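/- Let q ≥ 3 be a prime power and let G = Sp_4(F_q), the symplectic group of 4×4 matrices over the field with q elements preserving a nondegenerate alternating bilinear form. Then for every odd prime p and every irreducible complex character χ of G with p ∤ χ(1), Property 1.3 holds for (G, χ, p). -/

import Mathlib

open CategoryTheory

/-- `Qcyc N` is the `N`-th cyclotomic field `ℚ(ζ_N)`, realised as the subfield of `ℂ`
generated by all `N`-th roots of unity. -/
noncomputable def Qcyc (N : ℕ) : IntermediateField ℚ ℂ :=
  IntermediateField.adjoin ℚ {z : ℂ | z ^ N = 1}

/-- `Qadj c` is the subfield `ℚ(c)` of `ℂ` generated by a complex number `c`. -/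
noncomputable def Qadj (c : ℂ) : IntermediateField ℚ ℂ :=
  IntermediateField.adjoin ℚ {c}

/-- `f` is the conductor of the complex number `c`: the least positive integer `N`
with `c ∈ ℚ(ζ_N)`. -/
def IsConductorOf (c : ℂ) (f : ℕ) : Prop :=
  IsLeast {N : ℕ | 0 < N ∧ c ∈ Qcyc N} f

/-- `f` is the conductor of the character `χ`: the least positive integer `N` such that all
values of `χ` lie in `ℚ(ζ_N)`. -/
def IsCharConductor {G : Type*} [Monoid G] (χ : G → ℂ) (f : ℕ) : Prop :=
  IsLeast {N : ℕ | 0 < N ∧ ∀ g, χ g ∈ Qcyc N} f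

/-- Property 1.3 of Navarro–Tiep for `(G, χ, p)`: writing the conductor of `χ` as
`f = p ^ a * m` with `p ∤ m` (so that `p ^ a = p ^ (f.factorization p)` is the `p`-part of `f`),
there is a `p`-element `g ∈ G` such that `p ∤ [ℚ(ζ_{p^a}) : ℚ(χ(g))]`. -/
def Property13 {G : Type*} [Group G] (χ : G → ℂ) (p : ℕ) : Prop :=
  ∀ f : ℕ, IsCharConductor χ f →
    ∃ g : G, (∃ j : ℕ, orderOf g = p ^ j) ∧
      ¬ p ∣ (Qadj (χ g)).relfinrank (Qcyc (p ^ f.factorization p))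

set_option linter.all false
open ComplexConjugate

/-! ### Part 1: characters of finite groups -/

open Representation in
/-- the set of irreducible characters -/
def Irr0 (L : Type) [Group L] (φ : L → ℂ) : Prop :=
  ∃ (V : Type) (_ : AddCommGroup V) (_ : Module ℂ V) (_ : FiniteDimensional ℂ V)
    (ρ : Representation ℂ L V), IsIrreducible ρ ∧ φ = ρ.character

def IsChar {L : Type} [Group L] (f : L → ℂ) : Prop :=
  ∃ (n : ℕ) (ρ : L →* Matrix (Fin n) (Fin n) ℂ), ∀ g, f g = (ρ g).trace

noncomputable def bil {L : Type} [Group L] [Fintype L] (f g : L → ℂ) : ℂ :=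
  (Nat.card L : ℂ)⁻¹ * ∑ x, f x * g x⁻¹

section
variable {L : Type} [Group L]

theorem isChar_of_rep {V : Type} [AddCommGroup V] [Module ℂ V] [FiniteDimensional ℂ V]
    (ρ : Representation ℂ L V) : IsChar ρ.character := by
  let b := Module.finBasis ℂ V
  refine ⟨_, (LinearMap.toMatrixAlgEquiv b).toRingEquiv.toRingHom.toMonoidHom.comp ρ, ?_⟩
  intro g
  simp only [Representation.character]
  rw [LinearMap.trace_eq_matrix_trace ℂ b]
  rfl

theorem IsChar.exists_rep {f : L → ℂ} (h : IsChar f) : ∃ (n : ℕ)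
    (ρ : Representation ℂ L (Fin n → ℂ)), f = ρ.character := by
  obtain ⟨n, ρ, h⟩ := h
  refine ⟨n, (Matrix.toLinAlgEquiv' (R := ℂ) (n := Fin n)).toRingEquiv.toRingHom.toMonoidHom.comp ρ, ?_⟩
  funext g
  rw [h]
  simp only [Representation.character]
  have := (Matrix.trace_toLin'_eq (ρ g)).symm
  exact this

theorem Irr0.isChar {φ : L → ℂ} (h : Irr0 L φ) : IsChar φ := by
  obtain ⟨V, _, _, _, ρ, _, rfl⟩ := h
  exact isChar_of_rep ρ

theorem IsChar.conj {f : L → ℂ} (h : IsChar f) (x g : L) : f (x * g * x⁻¹) = f g := by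
  obtain ⟨n, ρ, rfl⟩ := h.exists_rep
  exact ρ.char_conj g x

theorem IsChar.comp {f : L → ℂ} (h : IsChar f) {T : Type} [Group T] (i : T →* L) :
    IsChar (f ∘ i) := by
  obtain ⟨n, ρ, h⟩ := h
  exact ⟨n, ρ.comp i, fun g => h _⟩

theorem IsChar.one {f : L → ℂ} (h : IsChar f) : ∃ n : ℕ, f 1 = n := by
  obtain ⟨n, ρ, h⟩ := h
  exact ⟨n, by simp [h]⟩

end

section
variable {L : Type} [Group L] [Fintype L]

theorem bil_isChar {f g : L → ℂ} (hf : IsChar f) (hg : IsChar g) : ∃ n : ℕ, bil f g = n := by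
  obtain ⟨n, ρ, rfl⟩ := hf.exists_rep
  obtain ⟨m, σ, rfl⟩ := hg.exists_rep
  have : Invertible (Nat.card L : ℂ) := invertibleOfNonzero (by simp)
  exact ⟨_, Representation.card_inv_mul_sum_char_mul_char_eq_finrank σ ρ⟩

theorem bil_irr0 {f g : L → ℂ} (hf : Irr0 L f) (hg : Irr0 L g) :
    bil f g = if f = g then 1 else 0 := by
  obtain ⟨V, _, _, _, ρ, _, rfl⟩ := hf
  obtain ⟨W, _, _, _, σ, _, rfl⟩ := hg
  have : Invertible (Nat.card L : ℂ) := invertibleOfNonzero (by simp)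
  have h1 : bil ρ.character σ.character = _ := ρ.char_orthonormal σ
  by_cases h : Nonempty (σ.Equiv ρ)
  · rw [h1, if_pos h, if_pos]
    exact (Representation.char_iso h.some).symm
  · rw [h1, if_neg h, if_neg]
    intro he
    have h2 : bil ρ.character ρ.character = _ := ρ.char_orthonormal ρ
    rw [if_pos ⟨Representation.Equiv.refl _⟩] at h2
    rw [if_neg h, ← he, h2] at h1
    simp at h1

open Representation in
theorem asAlgebraHom_eq_zero (F : L → ℂ) (hF : ∀ x g, F (x * g * x⁻¹) = F g)
    {V : Type} [AddCommGroup V] [Module ℂ V] [FiniteDimensional ℂ V]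
    (ρ : Representation ℂ L V) [IsIrreducible ρ] (h : bil F ρ.character = 0) :
    ∑ x, F x⁻¹ • ρ x = 0 := by
  set f : V →ₗ[ℂ] V := ∑ x, F x⁻¹ • ρ x with hf
  have hfint : ∀ g v, f (ρ g v) = ρ g (f v) := by
    intro g v
    simp only [hf, LinearMap.sum_apply, LinearMap.smul_apply, map_sum, map_smul]
    refine Fintype.sum_equiv (MulAut.conj g⁻¹).toEquiv _ _ ?_
    intro x
    have : F ((MulAut.conj g⁻¹).toEquiv x)⁻¹ = F x⁻¹ := by
      rw [← hF g⁻¹ x⁻¹]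
      congr 1
      simp [mul_assoc]
    rw [this, ← Module.End.mul_apply, ← Module.End.mul_apply, ← map_mul, ← map_mul]
    simp
  obtain ⟨c, hc⟩ := (IsIrreducible.algebraMap_intertwiningMap_bijective_of_isAlgClosed
    (ρ := ρ)).2 (f.intertwiningMap_of_isIntertwiningMap ρ ρ hfint)
  have hfc : f = c • LinearMap.id := by
    ext v
    have := congrArg (fun u : IntertwiningMap ρ ρ => u v) hc
    exact this.symm
  have htr : LinearMap.trace ℂ V f = 0 := by
    have h2 : LinearMap.trace ℂ V f = ∑ x, F x⁻¹ * ρ.character x := by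
      simp [hf, Representation.character]
    rw [h2]
    have : bil F ρ.character = (Nat.card L : ℂ)⁻¹ * ∑ x, F x⁻¹ * ρ.character x := by
      unfold bil
      congr 1
      refine Fintype.sum_equiv (Equiv.inv L) _ _ ?_
      intro x
      simp
    rw [this] at h
    rcases mul_eq_zero.1 h with h | h
    · simp at h
    · exact h
  have hne : (Module.finrank ℂ V : ℂ) ≠ 0 := by
    have : Nontrivial V := by
      have := IsSimpleModule.nontrivial (MonoidAlgebra ℂ L) ρ.asModule
      exact this
    exact_mod_cast (Module.finrank_pos (R := ℂ) (M := V)).ne'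
  rw [hfc] at htr
  simp [hne] at htr
  rw [hfc, htr, zero_smul]

theorem smul_eq_zero_of_simple (F : L → ℂ) (hF : ∀ x g, F (x * g * x⁻¹) = F g)
    (h : ∀ φ, Irr0 L φ → bil F φ = 0) (M : Type) [AddCommGroup M] [Module ℂ M]
    [Module (MonoidAlgebra ℂ L) M] [IsScalarTower ℂ (MonoidAlgebra ℂ L) M]
    [FiniteDimensional ℂ M] [hS : IsSimpleModule (MonoidAlgebra ℂ L) M] (v : M) :
    (∑ x, MonoidAlgebra.single x (F x⁻¹) : MonoidAlgebra ℂ L) • v = 0 := by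
  let σ : Representation ℂ L M := Representation.ofModule' M
  have hσ : ∀ a : MonoidAlgebra ℂ L, ∀ v : M, σ.asAlgebraHom a v = a • v := by
    intro a v
    have : σ.asAlgebraHom = Algebra.lsmul ℂ ℂ M := by
      simp [σ, Representation.ofModule', Representation.asAlgebraHom]
    rw [this]; rfl
  let e : σ.asModule ≃ₗ[MonoidAlgebra ℂ L] M :=
    { σ.asModuleEquiv.toAddEquiv with
      map_smul' := fun r x => by
        change σ.asModuleEquiv (r • x) = _
        rw [Representation.asModuleEquiv_map_smul, hσ]; rfl }
  have hirr : Representation.IsIrreducible σ := by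
    rw [Representation.irreducible_iff_isSimpleModule_asModule]
    exact IsSimpleModule.congr e
  have h0 := asAlgebraHom_eq_zero F hF σ (h _ ⟨_, _, _, inferInstance, σ, hirr, rfl⟩)
  have h1 : σ.asAlgebraHom (∑ x, MonoidAlgebra.single x (F x⁻¹)) = 0 := by
    rw [← h0]
    simp only [map_sum, Representation.asAlgebraHom_single]
  rw [← hσ, h1]; rfl

/-- completeness -/
theorem eq_zero_of_bil (F : L → ℂ) (hF : ∀ x g, F (x * g * x⁻¹) = F g)
    (h : ∀ φ, Irr0 L φ → bil F φ = 0) : F = 0 := by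
  classical
  let a : MonoidAlgebra ℂ L := ∑ x, MonoidAlgebra.single x (F x⁻¹)
  have key : ∀ S : Submodule (MonoidAlgebra ℂ L) (MonoidAlgebra ℂ L),
      IsSimpleModule (MonoidAlgebra ℂ L) S → ∀ v ∈ S, a * v = 0 := by
    intro S hS v hv
    have := smul_eq_zero_of_simple F hF h S ⟨v, hv⟩
    exact congrArg Subtype.val this
  have : a = 0 := by
    have h1 : ∀ v : MonoidAlgebra ℂ L, a * v = 0 := by
      intro v
      have hv : v ∈ sSup { m : Submodule (MonoidAlgebra ℂ L) (MonoidAlgebra ℂ L) |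
          IsSimpleModule (MonoidAlgebra ℂ L) m } := by
        rw [IsSemisimpleModule.sSup_simples_eq_top]; trivial
      rw [sSup_eq_iSup'] at hv
      refine Submodule.iSup_induction _ (motive := fun v => a * v = 0) hv ?_ ?_ ?_
      · intro S v hv
        exact key S.1 S.2 v hv
      · simp
      · intro x y hx hy
        rw [mul_add, hx, hy, add_zero]
    simpa using h1 1
  funext x
  have h3 := congrArg (fun b : MonoidAlgebra ℂ L => b.coeff x⁻¹) this
  simpa [a, Finsupp.finsetSum_apply, MonoidAlgebra.coeff_sum,
    Finsupp.single_apply] using h3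
end

/-! ### Part 2: Galois automorphisms of ℂ -/

theorem ext_hom {R S M : Type} [CommRing R] [IsDomain R] [Field S] [Algebra R S]
    [Algebra.IsAlgebraic R S] [Module.IsTorsionFree R S] [Field M] [IsAlgClosed M]
    (f : R →+* M) (hf : Function.Injective f) :
    ∃ τ : S →+* M, ∀ r, τ (algebraMap R S r) = f r := by
  letI := f.toAlgebra
  haveI : FaithfulSMul R M := (faithfulSMul_iff_algebraMap_injective R M).2 hf
  exact ⟨(IsAlgClosed.lift (R := R) (S := S) (M := M)).toRingHom, fun r => by
    simp; rfl⟩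

theorem exists_galois_aux (n : ℕ) (hn : 0 < n) (s : ℕ) (hs : Nat.Coprime s n)
    (K : Type) [Field K] [Algebra ℚ K] [IsCyclotomicExtension {n} ℚ K] (i : K →+* ℂ) :
    ∃ τ : ℂ →+* ℂ, ∀ z : ℂ, z ^ n = 1 → τ z = z ^ s := by
  haveI : NeZero n := ⟨hn.ne'⟩
  letI : Algebra K ℂ := i.toAlgebra
  have hz := IsCyclotomicExtension.zeta_spec n ℚ K
  set ζ := IsCyclotomicExtension.zeta n ℚ K with hζ
  have hirr : Irreducible (Polynomial.cyclotomic n ℚ) := Polynomial.cyclotomic.irreducible_rat hn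
  obtain ⟨γ, hγ⟩ : ∃ γ : K ≃ₐ[ℚ] K, γ ζ = ζ ^ s :=
    ⟨IsCyclotomicExtension.fromZetaAut (hz.pow_of_coprime s hs) hirr,
      IsCyclotomicExtension.fromZetaAut_spec (hz.pow_of_coprime s hs) hirr⟩
  obtain ⟨v, hv⟩ := exists_isTranscendenceBasis K ℂ
  let e := hv.1.aevalEquiv
  let A := Algebra.adjoin K (Set.range ((↑) : v → ℂ))
  let f : A →+* ℂ := (MvPolynomial.aeval (R := K) ((↑) : v → ℂ)).toRingHom.comp
    ((MvPolynomial.map (γ : K →+* K)).comp (e.symm : A →+* MvPolynomial v K))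
  haveI : Algebra.IsAlgebraic A ℂ := hv.isAlgebraic
  have hf : Function.Injective f := by
    have h1 : Function.Injective (MvPolynomial.aeval (R := K) ((↑) : v → ℂ)) := hv.1
    intro a b hab
    exact e.symm.injective (MvPolynomial.map_injective (γ : K →+* K) γ.injective (h1 hab))
  obtain ⟨τ, hτ⟩ := ext_hom (S := ℂ) f hf
  have hK : ∀ k : K, τ (i k) = i (γ k) := by
    intro k
    have := hτ (algebraMap K A k)
    have h2 : e.symm (algebraMap K A k) = MvPolynomial.C k := by
      rw [AlgEquiv.commutes]; rfl
    have h3 : f (algebraMap K A k) = i (γ k) := by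
      change (MvPolynomial.aeval (R := K) ((↑) : v → ℂ)) (MvPolynomial.map (γ : K →+* K) (e.symm (algebraMap K A k))) = _
      rw [h2]; simp; rfl
    rw [h3] at this
    exact this
  refine ⟨τ, fun z hz1 => ?_⟩
  have hz' : IsPrimitiveRoot (i ζ) n := hz.map_of_injective i.injective
  obtain ⟨k, -, rfl⟩ := hz'.eq_pow_of_pow_eq_one hz1
  rw [map_pow, hK, hγ, map_pow, ← pow_mul, ← pow_mul, mul_comm]

theorem exists_galois (n : ℕ) (hn : 0 < n) (s : ℕ) (hs : Nat.Coprime s n) :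
    ∃ τ : ℂ →+* ℂ, ∀ z : ℂ, z ^ n = 1 → τ z = z ^ s :=
  haveI : NeZero (n : ℚ) := ⟨by exact_mod_cast hn.ne'⟩
  haveI : NeZero n := ⟨hn.ne'⟩
  @exists_galois_aux n hn s hs (CyclotomicField n ℚ) _ (CyclotomicField.algebra n ℚ)
    (CyclotomicField.isCyclotomicExtension n ℚ)
    (IsAlgClosed.lift (R := ℚ) (S := CyclotomicField n ℚ) (M := ℂ)).toRingHom

/-! ### Part 3: abelian duals, inner products -/

open ComplexConjugate

noncomputable def ip {L : Type} [Fintype L] (f g : L → ℂ) : ℂ :=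
  (Fintype.card L : ℂ)⁻¹ * ∑ x, f x * conj (g x)

noncomputable def nsq {L : Type} [Fintype L] (f : L → ℂ) : ℝ :=
  (Fintype.card L : ℝ)⁻¹ * ∑ x, Complex.normSq (f x)

theorem ip_self {L : Type} [Fintype L] (f : L → ℂ) : ip f f = nsq f := by
  simp [ip, nsq, Complex.mul_conj]

theorem nsq_nonneg {L : Type} [Fintype L] (f : L → ℂ) : 0 ≤ nsq f := by
  unfold nsq
  have : 0 ≤ ∑ x, Complex.normSq (f x) := Finset.sum_nonneg fun _ _ => Complex.normSq_nonneg _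
  positivity

theorem nsq_eq_zero {L : Type} [Fintype L] {f : L → ℂ} (h : nsq f = 0) (x : L) : f x = 0 := by
  unfold nsq at h
  have hne : (Fintype.card L : ℝ)⁻¹ ≠ 0 := by
    have : 0 < Fintype.card L := Fintype.card_pos_iff.2 ⟨x⟩
    positivity
  have h2 := (mul_eq_zero.1 h).resolve_left hne
  rw [Finset.sum_eq_zero_iff_of_nonneg fun _ _ => Complex.normSq_nonneg _] at h2
  exact Complex.normSq_eq_zero.1 (h2 x (Finset.mem_univ _))

theorem ip_add_left {L : Type} [Fintype L] (f f' g : L → ℂ) : ip (fun x => f x + f' x) g = ip f g + ip f' g := by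
  simp [ip, add_mul, Finset.sum_add_distrib, mul_add]

theorem ip_sub_left {L : Type} [Fintype L] (f f' g : L → ℂ) : ip (fun x => f x - f' x) g = ip f g - ip f' g := by
  simp [ip, sub_mul, Finset.sum_sub_distrib, mul_sub]

theorem ip_smul_left {L : Type} [Fintype L] (c : ℂ) (f g : L → ℂ) : ip (fun x => c * f x) g = c * ip f g := by
  simp only [ip, mul_assoc, ← Finset.mul_sum]; ring

theorem ip_sum_left {L ι : Type} [Fintype L] (s : Finset ι) (f : ι → L → ℂ) (g : L → ℂ) :
    ip (fun x => ∑ i ∈ s, f i x) g = ∑ i ∈ s, ip (f i) g := by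
  simp only [ip, Finset.sum_mul]
  rw [Finset.sum_comm, Finset.mul_sum]

theorem ip_conj {L : Type} [Fintype L] (f g : L → ℂ) : conj (ip f g) = ip g f := by
  simp [ip, mul_comm]

abbrev Hat (T : Type) [CommGroup T] := T →* ℂˣ

section
variable {T : Type} [CommGroup T] [Fintype T]

theorem hat_natcard : Nat.card (Hat T) = Nat.card T := by
  have : NeZero (Monoid.exponent T) := ⟨Monoid.exponent_ne_zero_of_finite⟩
  exact CommGroup.card_monoidHom_of_hasEnoughRootsOfUnity T ℂ

noncomputable instance : Fintype (Hat T) := by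
  have : Finite (Hat T) := Nat.finite_of_card_ne_zero (by rw [hat_natcard]; simp)
  exact Fintype.ofFinite _

theorem hat_card : Fintype.card (Hat T) = Fintype.card T := by
  rw [← Nat.card_eq_fintype_card, hat_natcard, Nat.card_eq_fintype_card]

theorem hat_pow_card (μ : Hat T) (t : T) : (μ t : ℂ) ^ Fintype.card T = 1 := by
  rw [← Units.val_pow_eq_pow_val, ← map_pow, pow_card_eq_one]; simp

theorem hat_conj (μ : Hat T) (t : T) : conj (μ t : ℂ) = (μ t⁻¹ : ℂ) := by
  rw [map_inv, Units.val_inv_eq_inv_val]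
  exact (Complex.inv_eq_conj (Complex.norm_eq_one_of_pow_eq_one (hat_pow_card μ t) Fintype.card_ne_zero)).symm

theorem hat_sum {μ : Hat T} (h : μ ≠ 1) : ∑ t, (μ t : ℂ) = 0 := by
  have := sum_hom_units_eq_zero ((Units.coeHom ℂ).comp μ) (by
    intro h2; apply h; ext t; exact congrArg (fun f => f t) h2)
  exact this

theorem hat_sum' {t : T} (h : t ≠ 1) : ∑ μ : Hat T, (μ t : ℂ) = 0 := by
  have : NeZero (Monoid.exponent T) := ⟨Monoid.exponent_ne_zero_of_finite⟩
  obtain ⟨φ, hφ⟩ := CommGroup.exists_apply_ne_one_of_hasEnoughRootsOfUnity T ℂ h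
  have h2 : ∑ μ : Hat T, (μ t : ℂ) = (φ t : ℂ) * ∑ μ : Hat T, (μ t : ℂ) := by
    rw [Finset.mul_sum]
    refine (Fintype.sum_equiv (Equiv.mulLeft φ) _ _ ?_).symm
    intro μ; simp
  have h3 : (φ t : ℂ) - 1 ≠ 0 := by
    intro h; apply hφ; ext; simpa [sub_eq_zero] using h
  have h4 : ((φ t : ℂ) - 1) * ∑ μ : Hat T, (μ t : ℂ) = 0 := by
    rw [sub_mul, one_mul, ← h2, sub_self]
  exact (mul_eq_zero.1 h4).resolve_left h3

noncomputable def co (f : T → ℂ) (μ : Hat T) : ℂ := ip f (fun t => (μ t : ℂ))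

theorem co_inv (f : T → ℂ) (t : T) : f t = ∑ μ : Hat T, co f μ * (μ t : ℂ) := by
  classical
  have : ∑ μ : Hat T, co f μ * (μ t : ℂ) =
      (Fintype.card T : ℂ)⁻¹ * ∑ x, f x * ∑ μ : Hat T, (μ (x⁻¹ * t) : ℂ) := by
    simp only [co, ip, Finset.mul_sum, Finset.sum_mul]
    rw [Finset.sum_comm]
    refine Finset.sum_congr rfl fun x _ => Finset.sum_congr rfl fun μ _ => ?_
    rw [hat_conj]; simp; ring
  rw [this, Finset.sum_eq_single t]
  · have h0 : (Fintype.card T : ℂ) ≠ 0 := by simp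
    simp [hat_card]
    field_simp
  · intro x _ hx
    rw [hat_sum', mul_zero]
    intro h
    exact hx (inv_mul_eq_one.1 h)
  · simp

theorem hat_orth [DecidableEq (Hat T)] (μ ν : Hat T) : co (fun t => (μ t : ℂ)) ν = if μ = ν then 1 else 0 := by
  have h0 : (Fintype.card T : ℂ) ≠ 0 := by simp
  have h1 : co (fun t => (μ t : ℂ)) ν = (Fintype.card T : ℂ)⁻¹ * ∑ x, ((μ * ν⁻¹) x : ℂ) := by
    simp [co, ip, hat_conj]
  rw [h1]
  split_ifs with h
  · subst h; simp
  · rw [hat_sum, mul_zero]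
    intro h2; exact h (mul_inv_eq_one.1 h2)

theorem co_sum (a : Hat T → ℂ) (ν : Hat T) :
    co (fun t => ∑ μ : Hat T, a μ * (μ t : ℂ)) ν = a ν := by
  classical
  have : ∀ μ : Hat T, ip (fun t => a μ * (μ t : ℂ)) (fun t => (ν t : ℂ)) = if μ = ν then a μ else 0 := by
    intro μ
    rw [ip_smul_left]
    have := hat_orth μ ν
    unfold co at this
    rw [this]; simp
  unfold co
  rw [ip_sum_left]
  simp [this]

theorem ip_eq_co (f g : T → ℂ) : ip f g = ∑ μ : Hat T, co f μ * conj (co g μ) := by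
  conv_lhs => rw [show f = fun t => ∑ μ : Hat T, co f μ * (μ t : ℂ) from funext (co_inv f)]
  rw [ip_sum_left]
  refine Finset.sum_congr rfl fun μ _ => ?_
  rw [ip_smul_left, co, co, ip_conj]

theorem nsq_eq_co (f : T → ℂ) : nsq f = ∑ μ : Hat T, Complex.normSq (co f μ) := by
  have := ip_eq_co f f
  simp only [ip_self, Complex.mul_conj] at this
  exact_mod_cast this

theorem hat_isChar (μ : Hat T) : IsChar (fun t => (μ t : ℂ)) := by
  refine ⟨1, (Matrix.scalar (Fin 1)).toMonoidHom.comp ((Units.coeHom ℂ).comp μ), fun g => ?_⟩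
  simp [Matrix.trace]

theorem co_eq_bil (f : T → ℂ) (μ : Hat T) : co f μ = bil f (fun t => (μ t : ℂ)) := by
  simp [co, ip, bil, hat_conj]

theorem co_nat {f : T → ℂ} (hf : IsChar f) (μ : Hat T) : ∃ n : ℕ, co f μ = n := by
  rw [co_eq_bil]
  exact bil_isChar hf (hat_isChar μ)

theorem IsChar.pow_exp_comm {f : T → ℂ} (hf : IsChar f) (t : T) :
    ∃ (ι : Type) (_ : Fintype ι) (α : ι → ℂ), (∀ i, α i ^ Fintype.card T = 1) ∧
      ∀ k : ℕ, f (t ^ k) = ∑ i, α i ^ k := by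
  choose n hn using co_nat hf
  refine ⟨Σ μ : Hat T, Fin (n μ), inferInstance, fun i => (i.1 t : ℂ), fun i => hat_pow_card _ _, fun k => ?_⟩
  rw [co_inv f (t ^ k), Fintype.sum_sigma]
  simp [hn]
end

section
variable {L : Type} [Group L] [Fintype L]

theorem IsChar.pow_exp {f : L → ℂ} (hf : IsChar f) (g : L) :
    ∃ (ι : Type) (_ : Fintype ι) (α : ι → ℂ), (∀ i, α i ^ Fintype.card L = 1) ∧
      ∀ k : ℕ, f (g ^ k) = ∑ i, α i ^ k := by
  letI : CommGroup (Subgroup.zpowers g) :=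
    { (inferInstance : Group (Subgroup.zpowers g)) with
      mul_comm := by
        rintro ⟨a, i, rfl⟩ ⟨b, j, rfl⟩
        exact Subtype.ext ((Commute.refl g).zpow_zpow i j) }
  letI : Fintype (Subgroup.zpowers g) := Fintype.ofFinite _
  obtain ⟨ι, _, α, h1, h2⟩ := (hf.comp (Subgroup.zpowers g).subtype).pow_exp_comm
    ⟨g, Subgroup.mem_zpowers g⟩
  refine ⟨ι, inferInstance, α, fun i => ?_, fun k => ?_⟩
  · have : Fintype.card (Subgroup.zpowers g) ∣ Fintype.card L := by
      rw [← Nat.card_eq_fintype_card, ← Nat.card_eq_fintype_card]; exact Subgroup.card_subgroup_dvd_card _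
    obtain ⟨c, hc⟩ := this
    rw [hc, pow_mul, h1, one_pow]
  · rw [← h2]; rfl

theorem IsChar.inv {f : L → ℂ} (hf : IsChar f) (g : L) : f g⁻¹ = conj (f g) := by
  obtain ⟨ι, _, α, h1, h2⟩ := hf.pow_exp g
  have hpos : 0 < Fintype.card L := Fintype.card_pos
  have h3 : g⁻¹ = g ^ (Fintype.card L - 1) := by
    rw [inv_eq_iff_mul_eq_one, mul_pow_sub_one hpos.ne', pow_card_eq_one]
  rw [h3, h2, ← pow_one g, h2, map_sum]
  refine Finset.sum_congr rfl fun i _ => ?_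
  rw [pow_one, ← Complex.inv_eq_conj (Complex.norm_eq_one_of_pow_eq_one (h1 i) hpos.ne')]
  symm
  apply inv_eq_of_mul_eq_one_right
  rw [mul_pow_sub_one hpos.ne', h1]

theorem bil_eq_ip (f : L → ℂ) {g : L → ℂ} (hg : IsChar g) : bil f g = ip f g := by
  simp [bil, ip, hg.inv]

/-- values of the twist of a character by a ring endomorphism -/
theorem IsChar.map {f : L → ℂ} (hf : IsChar f) (τ : ℂ →+* ℂ) : IsChar (fun g => τ (f g)) := by
  obtain ⟨n, ρ, h⟩ := hf
  refine ⟨n, (τ.mapMatrix (m := Fin n)).toMonoidHom.comp ρ, fun g => ?_⟩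
  simp [h, Matrix.trace]

theorem IsChar.galois {f : L → ℂ} (hf : IsChar f) {s : ℕ} {τ : ℂ →+* ℂ}
    (hτ : ∀ z : ℂ, z ^ Fintype.card L = 1 → τ z = z ^ s) (g : L) : τ (f g) = f (g ^ s) := by
  obtain ⟨ι, _, α, h1, h2⟩ := hf.pow_exp g
  rw [h2, ← pow_one g, h2, map_sum]
  exact Finset.sum_congr rfl fun i _ => by rw [pow_one, hτ _ (h1 i)]

theorem IsChar.pow {f : L → ℂ} (hf : IsChar f) {s : ℕ} (hs : s.Coprime (Fintype.card L)) :
    IsChar (fun g => f (g ^ s)) := by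
  obtain ⟨τ, hτ⟩ := exists_galois _ Fintype.card_pos s hs
  have := hf.map τ
  simpa only [hf.galois hτ] using this

def IsClass (F : L → ℂ) : Prop := ∀ x g, F (x * g * x⁻¹) = F g

theorem IsChar.isClass {f : L → ℂ} (hf : IsChar f) : IsClass f := fun x g => hf.conj x g

variable (L) in
theorem irr_finite : {φ : L → ℂ | Irr0 L φ}.Finite := by
  have : LinearIndependent ℂ (fun φ : {φ : L → ℂ | Irr0 L φ} => (φ : L → ℂ)) := by
    classical
    rw [linearIndependent_iff']
    intro s c hc i hi
    have h1 : bil (∑ j ∈ s, c j • (j : L → ℂ)) i = ∑ j ∈ s, c j * bil (j : L → ℂ) i := by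
      simp only [bil, Finset.sum_apply, Pi.smul_apply, smul_eq_mul, Finset.sum_mul]
      rw [Finset.sum_comm, Finset.mul_sum]
      refine Finset.sum_congr rfl fun j _ => ?_
      simp only [Finset.mul_sum]
      refine Finset.sum_congr rfl fun j _ => ?_
      ring
    rw [hc, Finset.sum_eq_single i] at h1
    · rw [bil_irr0 i.2 i.2] at h1
      simpa [bil] using h1.symm
    · intro j _ hj
      rw [bil_irr0 j.2 i.2, if_neg, mul_zero]
      intro h; exact hj (Subtype.ext h)
    · intro h; exact absurd hi h
  exact this.setFinite

variable (L) in
noncomputable def irr : Finset (L → ℂ) := (irr_finite L).toFinset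

theorem mem_irr {φ : L → ℂ} : φ ∈ irr L ↔ Irr0 L φ := by simp [irr]

theorem irr_isChar {φ : L → ℂ} (h : φ ∈ irr L) : IsChar φ := (mem_irr.1 h).isChar

theorem irr_orth {φ ψ : L → ℂ} [Decidable (φ = ψ)] (h : φ ∈ irr L) (h' : ψ ∈ irr L) :
    ip φ ψ = if φ = ψ then 1 else 0 := by
  rw [← bil_eq_ip _ (irr_isChar h'), bil_irr0 (mem_irr.1 h) (mem_irr.1 h')]
  congr

theorem irr_expand {F : L → ℂ} (hF : IsClass F) (g : L) : F g = ∑ φ ∈ irr L, ip F φ * φ g := by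
  classical
  have : (fun g => F g - ∑ φ ∈ irr L, ip F φ * φ g) = 0 := by
    apply eq_zero_of_bil
    · intro x g
      simp only [hF x g]
      congr 1
      exact Finset.sum_congr rfl fun φ hφ => by rw [(irr_isChar hφ).conj]
    · intro ψ hψ
      rw [bil_eq_ip _ hψ.isChar, ip_sub_left, ip_sum_left]
      rw [Finset.sum_eq_single ψ]
      · rw [ip_smul_left, irr_orth (mem_irr.2 hψ) (mem_irr.2 hψ)]; simp
      · intro φ hφ hne
        rw [ip_smul_left, irr_orth hφ (mem_irr.2 hψ), if_neg hne, mul_zero]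
      · intro h; exact absurd (mem_irr.2 hψ) h
  have h2 := congrFun this g
  exact sub_eq_zero.1 h2

theorem ip_eq_irr {F : L → ℂ} (hF : IsClass F) (H : L → ℂ) :
    ip F H = ∑ φ ∈ irr L, ip F φ * conj (ip H φ) := by
  conv_lhs => rw [show F = fun t => ∑ φ ∈ irr L, ip F φ * φ t from funext (irr_expand hF)]
  rw [ip_sum_left]
  refine Finset.sum_congr rfl fun μ _ => ?_
  rw [ip_smul_left, ip_conj]

theorem nsq_eq_irr {F : L → ℂ} (hF : IsClass F) : nsq F = ∑ φ ∈ irr L, Complex.normSq (ip F φ) := by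
  have := ip_eq_irr hF F
  simp only [ip_self, Complex.mul_conj] at this
  exact_mod_cast this

theorem ip_nat {f g : L → ℂ} (hf : IsChar f) (hg : IsChar g) : ∃ n : ℕ, ip f g = n := by
  rw [← bil_eq_ip _ hg]; exact bil_isChar hf hg

theorem irr_of_nsq {f : L → ℂ} (hf : IsChar f) (h : ip f f = 1) : f ∈ irr L := by
  classical
  have h0 : ∀ φ : L → ℂ, ∃ n : ℕ, φ ∈ irr L → ip f φ = n := by
    intro φ
    by_cases h : φ ∈ irr L
    · obtain ⟨n, hn⟩ := ip_nat hf (irr_isChar h)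
      exact ⟨n, fun _ => hn⟩
    · exact ⟨0, fun h' => absurd h' h⟩
  choose n hn using h0
  rw [ip_eq_irr hf.isClass] at h
  have h1 : ∑ φ ∈ irr L, n φ * n φ = 1 := by
    have : ((∑ φ ∈ irr L, n φ * n φ : ℕ) : ℂ) = 1 := by
      rw [← h]; push_cast
      exact Finset.sum_congr rfl fun φ hφ => by rw [hn φ hφ]; simp
    exact_mod_cast this
  obtain ⟨ψ, hψ, hne⟩ : ∃ ψ ∈ irr L, n ψ ≠ 0 := by
    by_contra hcon
    push Not at hcon
    rw [Finset.sum_eq_zero] at h1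
    · simp at h1
    · intro φ hφ; simp [hcon φ hφ]
  rw [← Finset.add_sum_erase _ _ hψ] at h1
  have hge : 1 ≤ n ψ := Nat.one_le_iff_ne_zero.2 hne
  have h3 : n ψ = 1 := by nlinarith [Nat.zero_le (∑ φ ∈ (irr L).erase ψ, n φ * n φ)]
  have h4 : ∑ φ ∈ (irr L).erase ψ, n φ * n φ = 0 := by rw [h3] at h1; omega
  rw [Finset.sum_eq_zero_iff] at h4
  have : f = ψ := by
    funext g
    rw [irr_expand hf.isClass g, Finset.sum_eq_single ψ]
    · rw [hn ψ hψ, h3]; simp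
    · intro φ hφ hne
      have := h4 φ (Finset.mem_erase.2 ⟨hne, hφ⟩)
      rw [hn φ hφ, mul_self_eq_zero.1 this]; simp
    · intro h; exact absurd hψ h
  rw [this]; exact hψ

theorem irr_nsq {φ : L → ℂ} (h : φ ∈ irr L) : nsq φ = 1 := by
  classical
  have := irr_orth h h
  rw [ip_self, if_pos rfl] at this
  exact_mod_cast this

theorem irr_one {φ : L → ℂ} (h : φ ∈ irr L) : ∃ n : ℕ, 0 < n ∧ φ 1 = n := by
  obtain ⟨n, ρ, hρ⟩ := irr_isChar h
  refine ⟨n, ?_, by simp [hρ]⟩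
  rcases Nat.eq_zero_or_pos n with rfl | hn
  · have : φ = 0 := by funext g; simp [hρ]
    have h2 := irr_nsq h
    simp [this, nsq] at h2
  · exact hn

theorem irr_comp {φ : L → ℂ} (h : φ ∈ irr L) (e : L ≃ L) (hc : IsChar (fun g => φ (e g))) :
    (fun g => φ (e g)) ∈ irr L := by
  classical
  apply irr_of_nsq hc
  have h1 := irr_orth h h
  rw [if_pos rfl] at h1
  rw [← h1, ip, ip]
  congr 1
  exact Fintype.sum_equiv e _ _ fun x => rfl

theorem irr_aut {φ : L → ℂ} (h : φ ∈ irr L) (e : L ≃* L) : (fun g => φ (e g)) ∈ irr L :=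
  irr_comp h e.toEquiv ((irr_isChar h).comp e.toMonoidHom)

theorem irr_pow {φ : L → ℂ} (h : φ ∈ irr L) {s : ℕ} (hs : s.Coprime (Fintype.card L)) :
    (fun g => φ (g ^ s)) ∈ irr L :=
  irr_comp h (powCoprime (by rw [Nat.card_eq_fintype_card]; exact hs.symm)) ((irr_isChar h).pow hs)

theorem irr_central {φ : L → ℂ} (h : φ ∈ irr L) {z : L} (hz : ∀ g, z * g = g * z) :
    ∃ ω : ℂ, ∀ g, φ (z * g) = ω * φ g := by
  obtain ⟨V, _, _, _, ρ, hirr, rfl⟩ := mem_irr.1 h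
  obtain ⟨c, hc⟩ := (Representation.IsIrreducible.algebraMap_intertwiningMap_bijective_of_isAlgClosed
    (ρ := ρ)).2 ((ρ z).intertwiningMap_of_isIntertwiningMap ρ ρ (by
      intro g v
      rw [← Module.End.mul_apply, ← Module.End.mul_apply, ← map_mul, ← map_mul, hz]))
  refine ⟨c, fun g => ?_⟩
  have hfc : ρ z = c • LinearMap.id := by
    ext v
    have := congrArg (fun u : Representation.IntertwiningMap ρ ρ => u v) hc
    exact this.symm
  rw [Representation.character, map_mul, hfc]
  have : (c • LinearMap.id) * ρ g = c • ρ g := by ext; simp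
  rw [this, map_smul]; rfl
end

open CategoryTheory

/-! ### Part 4: the Galois theoretic reduction -/

theorem pow_modEq {A : Type*} [Monoid A] {z : A} {n s t : ℕ} (hz : z ^ n = 1) (h : s ≡ t [MOD n]) :
    z ^ s = z ^ t := by
  have key : ∀ s, z ^ s = z ^ (s % n) := by
    intro s
    conv_lhs => rw [← Nat.div_add_mod s n, pow_add, pow_mul, hz, one_pow, one_mul]
  rw [key s, key t, h]

theorem Qcyc_agree {M s : ℕ} {τ τ' : ℂ →+* ℂ} (h1 : ∀ z : ℂ, z ^ M = 1 → τ z = τ' z)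
    {x : ℂ} (hx : x ∈ Qcyc M) : τ x = τ' x := by
  induction hx using IntermediateField.adjoin_induction with
  | mem x hx => exact h1 x hx
  | algebraMap x => simp
  | add x y _ _ h h' => simp [h, h']
  | inv x _ h => simp [h]
  | mul x y _ _ h h' => simp [h, h']

theorem Qcyc_fix {M s : ℕ} {τ : ℂ →+* ℂ} (h1 : ∀ z : ℂ, z ^ M = 1 → τ z = z)
    {x : ℂ} (hx : x ∈ Qcyc M) : τ x = x :=
  Qcyc_agree (s := s) (τ' := RingHom.id ℂ) h1 hx

theorem Qcyc_mono {d M : ℕ} (h : d ∣ M) : Qcyc d ≤ Qcyc M := by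
  apply IntermediateField.adjoin.mono
  intro z hz
  obtain ⟨c, rfl⟩ := h
  simp only [Set.mem_setOf_eq] at hz ⊢
  rw [pow_mul, hz, one_pow]

open IntermediateField in
theorem Qcyc_isSplitting {M : ℕ} (hM : 0 < M) {K : IntermediateField ℚ ℂ} (hK : K ≤ Qcyc M) :
    Polynomial.IsSplittingField K (extendScalars hK) (Polynomial.X ^ M - 1 : Polynomial K) := by
  have hr : ∀ z : ℂ, z ∈ (Polynomial.X ^ M - 1 : Polynomial K).rootSet ℂ ↔ z ^ M = 1 := by
    intro z
    have h0 : (Polynomial.X ^ M - 1 : Polynomial K) ≠ 0 := by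
      simpa using Polynomial.X_pow_sub_C_ne_zero hM (1 : K)
    rw [Polynomial.mem_rootSet_of_ne h0]
    simp [sub_eq_zero]
  have hE : extendScalars hK = adjoin K ((Polynomial.X ^ M - 1 : Polynomial K).rootSet ℂ) := by
    apply le_antisymm
    · intro x hx
      have hx2 : x ∈ Qcyc M := hx
      clear hx
      unfold Qcyc at hx2
      induction hx2 using IntermediateField.adjoin_induction with
      | mem x hx => exact subset_adjoin _ _ ((hr x).2 hx)
      | algebraMap x => exact IntermediateField.algebraMap_mem _ (algebraMap ℚ K x)
      | add x y _ _ h h' => exact add_mem h h'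
      | inv x _ h => exact inv_mem h
      | mul x y _ _ h h' => exact mul_mem h h'
    · rw [adjoin_le_iff]
      intro x hx
      exact subset_adjoin ℚ _ ((hr x).1 hx)
  rw [isSplittingField_iff]
  refine ⟨?_, hE⟩
  apply splits_of_splits
  · exact IsAlgClosed.splits _
  · intro x hx
    exact subset_adjoin ℚ _ ((hr x).1 hx)

theorem Qcyc_aut {M : ℕ} (hM : 0 < M) {K : IntermediateField ℚ ℂ} (hK : K ≤ Qcyc M)
    (γ : IntermediateField.extendScalars hK ≃ₐ[K] IntermediateField.extendScalars hK) :
    ∃ s : ℕ, s.Coprime M ∧ ∀ τ : ℂ →+* ℂ, (∀ z : ℂ, z ^ M = 1 → τ z = z ^ s) →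
      ∀ x : IntermediateField.extendScalars hK, τ x = γ x := by
  have hζ := Complex.isPrimitiveRoot_exp M hM.ne'
  have : NeZero M := ⟨hM.ne'⟩
  set ζ := Complex.exp (2 * Real.pi * Complex.I / M)
  have hmem : ∀ z : ℂ, z ^ M = 1 → z ∈ Qcyc M := fun z hz => IntermediateField.subset_adjoin ℚ _ hz
  let ζ' : IntermediateField.extendScalars hK := ⟨ζ, hmem ζ hζ.pow_eq_one⟩
  have hζ' : IsPrimitiveRoot ζ' M :=
    IsPrimitiveRoot.of_map_of_injective (f := algebraMap (IntermediateField.extendScalars hK) ℂ) hζ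
      (algebraMap (IntermediateField.extendScalars hK) ℂ).injective
  have h2 : IsPrimitiveRoot ((γ ζ' : IntermediateField.extendScalars hK) : ℂ) M :=
    (hζ'.map_of_injective γ.injective).map_of_injective (f := algebraMap (IntermediateField.extendScalars hK) ℂ)
      (algebraMap (IntermediateField.extendScalars hK) ℂ).injective
  obtain ⟨s, -, hs⟩ := hζ.eq_pow_of_pow_eq_one h2.pow_eq_one
  have hs' : s.Coprime M := by
    rw [← hs] at h2
    exact (hζ.pow_iff_coprime hM s).1 h2
  refine ⟨s, hs', fun τ hτ ⟨x, hx⟩ => ?_⟩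
  have hx' : x ∈ Qcyc M := hx
  unfold Qcyc at hx'
  have key : ∀ x ∈ IntermediateField.adjoin ℚ {z : ℂ | z ^ M = 1}, ∀ hx : x ∈ IntermediateField.extendScalars hK,
      τ x = γ ⟨x, hx⟩ := by
    intro x hx
    induction hx using IntermediateField.adjoin_induction with
    | mem x hx =>
      intro hx'
      obtain ⟨k, -, rfl⟩ := hζ.eq_pow_of_pow_eq_one hx
      have : (⟨ζ ^ k, hx'⟩ : IntermediateField.extendScalars hK) = ζ' ^ k := rfl
      rw [this, map_pow, map_pow, hτ _ hζ.pow_eq_one]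
      push_cast
      rw [← hs]
    | algebraMap x =>
      intro hx'
      have : (⟨algebraMap ℚ ℂ x, hx'⟩ : IntermediateField.extendScalars hK) = (x : IntermediateField.extendScalars hK) := by
        ext; simp
      rw [this]; simp
    | add x y h1 h2 h h' =>
      intro hx'
      have : (⟨x + y, hx'⟩ : IntermediateField.extendScalars hK) = ⟨x, h1⟩ + ⟨y, h2⟩ := rfl
      rw [this, map_add, map_add, h h1, h' h2]; rfl
    | inv x h1 h =>
      intro hx'
      have : (⟨x⁻¹, hx'⟩ : IntermediateField.extendScalars hK) = (⟨x, h1⟩)⁻¹ := rfl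
      rw [this, map_inv₀, map_inv₀, h h1]; rfl
    | mul x y h1 h2 h h' =>
      intro hx'
      have : (⟨x * y, hx'⟩ : IntermediateField.extendScalars hK) = ⟨x, h1⟩ * ⟨y, h2⟩ := rfl
      rw [this, map_mul, map_mul, h h1, h' h2]; rfl
  exact key x hx' hx

theorem Qcyc_galois {M : ℕ} (hM : 0 < M) {K : IntermediateField ℚ ℂ} (hK : K ≤ Qcyc M) :
    IsGalois K (IntermediateField.extendScalars hK) ∧
      FiniteDimensional K (IntermediateField.extendScalars hK) := by
  have := Qcyc_isSplitting hM hK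
  refine ⟨IsGalois.of_separable_splitting_field (p := Polynomial.X ^ M - 1) ?_,
    Polynomial.IsSplittingField.finiteDimensional _ (Polynomial.X ^ M - 1 : Polynomial K)⟩
  rw [Polynomial.X_pow_sub_one_separable_iff]
  exact_mod_cast hM.ne'

theorem mem_of_fixed {M : ℕ} (hM : 0 < M) {K : IntermediateField ℚ ℂ} (hK : K ≤ Qcyc M)
    {x : ℂ} (hx : x ∈ Qcyc M)
    (hfix : ∀ s : ℕ, s.Coprime M → ∀ τ : ℂ →+* ℂ, (∀ z : ℂ, z ^ M = 1 → τ z = z ^ s) →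
      (∀ k ∈ K, τ k = k) → τ x = x) : x ∈ K := by
  obtain ⟨h1, h2⟩ := Qcyc_galois hM hK
  have h3 := (IsGalois.mem_bot_iff_fixed (F := K) (E := IntermediateField.extendScalars hK) ⟨x, hx⟩).2 (by
    intro γ
    obtain ⟨s, hs, h⟩ := Qcyc_aut hM hK γ
    obtain ⟨τ, hτ⟩ := exists_galois M hM s hs
    apply Subtype.ext
    rw [← h τ hτ]
    refine hfix s hs τ hτ ?_
    intro k hk
    have := h τ hτ (algebraMap K _ ⟨k, hk⟩)
    rw [γ.commutes] at this
    exact this)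
  obtain ⟨y, hy⟩ := h3
  have : (y : ℂ) = x := congrArg Subtype.val hy
  rw [← this]; exact y.2

theorem mem_Qcyc_of_fixed {M d : ℕ} (hM : 0 < M) (hd : d ∣ M) {x : ℂ} (hx : x ∈ Qcyc M)
    (hfix : ∀ s : ℕ, s.Coprime M → s ≡ 1 [MOD d] → ∀ τ : ℂ →+* ℂ,
      (∀ z : ℂ, z ^ M = 1 → τ z = z ^ s) → τ x = x) : x ∈ Qcyc d := by
  refine mem_of_fixed hM (Qcyc_mono hd) hx ?_
  intro s hs τ hτ hk
  refine hfix s hs ?_ τ hτ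
  have hd0 : d ≠ 0 := by rintro rfl; simp at hd; omega
  have hζ := Complex.isPrimitiveRoot_exp d hd0
  have h1 := hk _ (IntermediateField.subset_adjoin ℚ _ hζ.pow_eq_one)
  rw [hτ _ (by obtain ⟨c, rfl⟩ := hd; rw [pow_mul, hζ.pow_eq_one, one_pow])] at h1
  have h2 := h1.trans (pow_one _).symm
  have h3 := hζ.pow_inj (Nat.mod_lt s (Nat.pos_of_ne_zero hd0)) (Nat.mod_lt 1 (Nat.pos_of_ne_zero hd0)) (by
    rw [pow_modEq hζ.pow_eq_one (Nat.mod_modEq s d), pow_modEq hζ.pow_eq_one (Nat.mod_modEq 1 d), h2])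
  exact h3

theorem Qcyc_inter {a b : ℕ} (ha : 0 < a) (hb : 0 < b) {x : ℂ} (hxa : x ∈ Qcyc a) (hxb : x ∈ Qcyc b) :
    x ∈ Qcyc (Nat.gcd a b) := by
  refine mem_Qcyc_of_fixed ha (Nat.gcd_dvd_left a b) hxa ?_
  intro s hs hs1 τ hτ
  have hl : 0 < Nat.lcm a b := Nat.lcm_pos ha hb
  -- s1 ≡ s mod a, s1 ≡ 1 mod b
  obtain ⟨s1, h1, h2⟩ := Nat.chineseRemainder' hs1
  have hc : s1.Coprime (Nat.lcm a b) := by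
    have h3 : s1.Coprime a := by
      rw [Nat.Coprime, h1.gcd_eq]; exact hs
    have h4 : s1.Coprime b := by
      rw [Nat.Coprime, h2.gcd_eq]; simp
    exact Nat.Coprime.of_dvd_right (Nat.lcm_dvd_mul a b) (h3.mul_right h4)
  obtain ⟨τ1, hτ1⟩ := exists_galois _ hl s1 hc
  have h5 : τ x = τ1 x := by
    refine Qcyc_agree (s := 0) (M := a) ?_ hxa
    intro z hz
    rw [hτ z hz, hτ1 z (by obtain ⟨c, hc⟩ := Nat.dvd_lcm_left a b; rw [hc, pow_mul, hz, one_pow])]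
    exact pow_modEq hz h1.symm
  rw [h5]
  refine Qcyc_fix (s := 0) (M := b) ?_ hxb
  intro z hz
  rw [hτ1 z (by obtain ⟨c, hc⟩ := Nat.dvd_lcm_right a b; rw [hc, pow_mul, hz, one_pow])]
  conv_rhs => rw [← pow_one z]
  exact pow_modEq hz h2

theorem pow_p_modEq {p k s : ℕ} (hk : 1 ≤ k) (hs : s ≡ 1 [MOD p ^ k]) :
    s ^ p ≡ 1 [MOD p ^ (k + 1)] := by
  have h1 : ((p ^ k : ℕ) : ℤ) ∣ (s : ℤ) - 1 := by
    have := (Nat.modEq_iff_dvd.1 hs.symm)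
    simpa using this
  apply Nat.ModEq.symm
  rw [Nat.modEq_iff_dvd]
  push_cast
  rw [← geom_sum_mul, pow_succ, mul_comm]
  apply mul_dvd_mul _ (by exact_mod_cast h1)
  have h2 : (s : ℤ) ≡ 1 [ZMOD p] := by
    apply Int.ModEq.symm
    rw [Int.modEq_iff_dvd]
    refine dvd_trans ?_ h1
    exact_mod_cast dvd_pow_self p (by omega)
  rw [← Int.modEq_zero_iff_dvd]
  have h3 : ∑ i ∈ Finset.range p, (s : ℤ) ^ i ≡ ∑ i ∈ Finset.range p, (1 : ℤ) [ZMOD p] := by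
    rw [← ZMod.intCast_eq_intCast_iff] at h2 ⊢
    push_cast at h2 ⊢
    simp [h2]
  refine h3.trans ?_
  simp [Int.modEq_zero_iff_dvd]

theorem cyc_pow {p k : ℕ} (hp : p.Prime) (hp2 : p ≠ 2) (u v : (ZMod (p ^ (k + 1)))ˣ)
    (hu : u ^ p = 1) (hu1 : u ≠ 1) (hv : v ^ p = 1) : ∃ j : ℕ, v = u ^ j := by
  classical
  have : NeZero (p ^ (k + 1)) := ⟨pow_ne_zero _ hp.ne_zero⟩
  have hc := ZMod.isCyclic_units_of_prime_pow p hp hp2 (k + 1)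
  have h1 := IsCyclic.card_pow_eq_one_le (α := (ZMod (p ^ (k + 1)))ˣ) (n := p) hp.pos
  have hfp : Fact p.Prime := ⟨hp⟩
  have ho : orderOf u = p := orderOf_eq_prime hu hu1
  have h2 : (Finset.range p).image (fun j => u ^ j) ⊆ Finset.univ.filter fun a : (ZMod (p ^ (k + 1)))ˣ => a ^ p = 1 := by
    intro x hx
    obtain ⟨j, -, rfl⟩ := Finset.mem_image.1 hx
    simp only [Finset.mem_filter, Finset.mem_univ, true_and]
    rw [← pow_mul, mul_comm, pow_mul, hu, one_pow]
  have h3 : ((Finset.range p).image (fun j => u ^ j)).card = p := by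
    rw [Finset.card_image_of_injOn, Finset.card_range]
    intro i hi j hj hij
    simp only [Finset.coe_range, Set.mem_Iio] at hi hj
    exact pow_injOn_Iio_orderOf (by rw [ho]; exact hi) (by rw [ho]; exact hj) hij
  have h4 := Finset.eq_of_subset_of_card_le h2 (by rw [h3]; exact h1)
  have : v ∈ (Finset.range p).image (fun j => u ^ j) := by
    rw [h4]; simp [hv]
  obtain ⟨j, -, rfl⟩ := Finset.mem_image.1 this
  exact ⟨j, rfl⟩

theorem not_dvd_relfinrank {p k : ℕ} (hp : p.Prime) (hp2 : p ≠ 2) (hk : 1 ≤ k) {c : ℂ}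
    (hc : c ∈ Qcyc (p ^ (k + 1))) (hc' : c ∉ Qcyc (p ^ k)) :
    ¬ p ∣ (Qadj c).relfinrank (Qcyc (p ^ (k + 1))) := by
  intro hdvd
  apply hc'
  set M := p ^ (k + 1) with hMdef
  have hM : 0 < M := pow_pos hp.pos _
  have hK : Qadj c ≤ Qcyc M := by
    unfold Qadj
    rw [IntermediateField.adjoin_le_iff]
    simpa using hc
  rw [IntermediateField.relfinrank_eq_finrank_of_le hK] at hdvd
  obtain ⟨hG, hfd⟩ := Qcyc_galois hM hK
  rw [← IsGalois.card_aut_eq_finrank] at hdvd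
  have : Fact p.Prime := ⟨hp⟩
  obtain ⟨γ, hγ⟩ := exists_prime_orderOf_dvd_card' p hdvd
  obtain ⟨r, hr, hγr⟩ := Qcyc_aut hM hK γ
  obtain ⟨τ, hτ⟩ := exists_galois M hM r hr
  have hγτ := hγr τ hτ
  have hit : ∀ n : ℕ, ∀ x : IntermediateField.extendScalars hK, (τ^[n]) x = ((γ ^ n : _) x : IntermediateField.extendScalars hK) := by
    intro n
    induction n with
    | zero => intro x; simp
    | succ n ih =>
      intro x
      rw [Function.iterate_succ_apply', ih, hγτ, pow_succ']; rfl
  have hit2 : ∀ n : ℕ, ∀ z : ℂ, z ^ M = 1 → (τ^[n]) z = z ^ (r ^ n) := by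
    intro n
    induction n with
    | zero => intro z _; simp
    | succ n ih =>
      intro z hz
      rw [Function.iterate_succ_apply', ih z hz, map_pow, hτ z hz, ← pow_mul, pow_succ, mul_comm]
  have hζ := Complex.isPrimitiveRoot_exp M hM.ne'
  set ζ := Complex.exp (2 * Real.pi * Complex.I / M)
  have hmem : ∀ z : ℂ, z ^ M = 1 → z ∈ Qcyc M := fun z hz => IntermediateField.subset_adjoin ℚ _ hz
  have hcz : ∀ s t : ℕ, ζ ^ s = ζ ^ t → s ≡ t [MOD M] := by
    intro s t h
    exact hζ.pow_inj (Nat.mod_lt s hM) (Nat.mod_lt t hM) (by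
      rw [pow_modEq hζ.pow_eq_one (Nat.mod_modEq s M), pow_modEq hζ.pow_eq_one (Nat.mod_modEq t M), h])
  let u := ZMod.unitOfCoprime r hr
  have hup : u ^ p = 1 := by
    have h1 := hit p ⟨ζ, hmem ζ hζ.pow_eq_one⟩
    rw [← hγ, pow_orderOf_eq_one, hit2 _ _ hζ.pow_eq_one] at h1
    have h2 := hcz _ 1 (h1.trans (pow_one _).symm)
    rw [hγ] at h2
    ext
    have h3 := (ZMod.natCast_eq_natCast_iff _ _ _).2 h2
    simpa [u] using h3
  have hu1 : u ≠ 1 := by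
    intro h
    have h2 : (r : ZMod M) = (1 : ℕ) := by
      have := congrArg Units.val h
      simpa [u] using this
    rw [ZMod.natCast_eq_natCast_iff] at h2
    have h3 : γ = 1 := by
      ext x
      rw [← hγτ]
      refine Qcyc_fix (s := 0) (M := M) ?_ x.2
      intro z hz
      rw [hτ z hz, pow_modEq hz h2, pow_one]
    rw [h3, orderOf_one] at hγ
    exact hp.one_lt.ne hγ
  have hτc : τ c = c := by
    have hcK : c ∈ Qadj c := IntermediateField.subset_adjoin ℚ _ rfl
    have := hγτ (algebraMap (Qadj c) _ ⟨c, hcK⟩)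
    rw [γ.commutes] at this
    exact this
  refine mem_Qcyc_of_fixed hM (pow_dvd_pow p (by omega)) hc ?_
  intro s hs hs1 τ' hτ'
  let v := ZMod.unitOfCoprime s hs
  have hv : v ^ p = 1 := by
    ext
    have h3 := (ZMod.natCast_eq_natCast_iff _ _ _).2 (pow_p_modEq hk hs1)
    simpa [v] using h3
  obtain ⟨j, hj⟩ := cyc_pow hp hp2 u v hup hu1 hv
  have hj2 : s ≡ r ^ j [MOD M] := by
    rw [← ZMod.natCast_eq_natCast_iff]
    have := congrArg Units.val hj
    simpa [u, v] using this
  have h6 : τ' c = (τ ^ j) c := by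
    refine Qcyc_agree (s := 0) (M := M) ?_ hc
    intro z hz
    rw [hτ' z hz, RingHom.coe_pow, hit2 j z hz]
    exact pow_modEq hz hj2
  rw [h6, RingHom.coe_pow]
  exact Function.iterate_fixed hτc j

theorem property13_of_main {G : Type} [Group G] [Fintype G] {χ : G → ℂ} (hχ : IsChar χ) {p : ℕ}
    (hp : p.Prime) (hp2 : p ≠ 2) {b m : ℕ} (hcard : Fintype.card G = p ^ b * m) (hpm : ¬ p ∣ m)
    (hmain : ∀ s : ℕ, s ≡ 1 [MOD p * m] → (∀ t : G, (∃ j, orderOf t = p ^ j) → χ (t ^ s) = χ t) →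
      ∀ g, χ (g ^ s) = χ g) : Property13 χ p := by
  intro f hf
  obtain ⟨⟨hf0, hfmem⟩, hmin⟩ := hf
  set a := f.factorization p with ha
  have hE0 : 0 < Fintype.card G := Fintype.card_pos
  have hroot : ∀ M : ℕ, ∀ z : ℂ, z ^ M = 1 → z ∈ Qcyc M := fun M z hz => IntermediateField.subset_adjoin ℚ _ hz
  have hval : ∀ t : G, ∀ n : ℕ, t ^ n = 1 → 0 < n → χ t ∈ Qcyc n := by
    intro t n ht hn
    have h1 : χ t ∈ Qcyc (Fintype.card G) := by
      obtain ⟨ι, _, α, h1, h2⟩ := hχ.pow_exp t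
      rw [← pow_one t, h2]
      exact sum_mem fun i _ => pow_mem (hroot _ _ (h1 i)) _
    have h2 : χ t ∈ Qcyc (Nat.gcd (Fintype.card G) n) := by
      refine mem_Qcyc_of_fixed hE0 (Nat.gcd_dvd_left _ _) h1 ?_
      intro s hs hs1 τ hτ
      rw [hχ.galois hτ]
      have : t ^ (Nat.gcd (Fintype.card G) n) = 1 := by
        rw [pow_gcd_eq_one, ]
        exact ⟨pow_card_eq_one, ht⟩
      rw [pow_modEq this hs1, pow_one]
    exact Qcyc_mono (Nat.gcd_dvd_right _ _) h2
  by_cases ha1 : a ≤ 1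
  · refine ⟨1, ⟨0, by simp⟩, ?_⟩
    have hK : Qadj (χ 1) ≤ Qcyc (p ^ a) := by
      unfold Qadj
      rw [IntermediateField.adjoin_le_iff]
      obtain ⟨n, hn⟩ := hχ.one
      intro x hx
      simp only [Set.mem_singleton_iff] at hx
      rw [hx, hn]
      exact natCast_mem _ n
    have hpa : 0 < p ^ a := pow_pos hp.pos a
    rw [IntermediateField.relfinrank_eq_finrank_of_le hK]
    obtain ⟨hG, hfd⟩ := Qcyc_galois hpa hK
    rw [← IsGalois.card_aut_eq_finrank]
    intro hdvd
    have : Fact p.Prime := ⟨hp⟩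
    obtain ⟨γ, hγ⟩ := exists_prime_orderOf_dvd_card' p hdvd
    obtain ⟨r, hr, hγr⟩ := Qcyc_aut hpa hK γ
    obtain ⟨τ, hτ⟩ := exists_galois _ hpa r hr
    have hγτ := hγr τ hτ
    -- γ ^ (p - 1) = 1
    have h1 : γ ^ (p - 1) = 1 := by
      have hit : ∀ n : ℕ, ∀ x : IntermediateField.extendScalars hK, (τ^[n]) x = ((γ ^ n : _) x : IntermediateField.extendScalars hK) := by
        intro n
        induction n with
        | zero => intro x; simp
        | succ n ih =>
          intro x
          rw [Function.iterate_succ_apply', ih, hγτ, pow_succ']; rfl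
      have hit2 : ∀ n : ℕ, ∀ z : ℂ, z ^ (p ^ a) = 1 → (τ^[n]) z = z ^ (r ^ n) := by
        intro n
        induction n with
        | zero => intro z _; simp
        | succ n ih =>
          intro z hz
          rw [Function.iterate_succ_apply', ih z hz, map_pow, hτ z hz, ← pow_mul, pow_succ, mul_comm]
      ext x
      rw [← hit, ← RingHom.coe_pow]
      refine Qcyc_fix (s := 0) (M := p ^ a) ?_ x.2
      intro z hz
      rw [RingHom.coe_pow, hit2 _ z hz]
      interval_cases a
      · simp at hz; simp [hz]
      · rw [pow_one] at hr hz
        have h3 : r ^ (p - 1) ≡ 1 [MOD p] := by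
          have := Nat.ModEq.pow_totient hr
          rwa [Nat.totient_prime hp] at this
        rw [pow_modEq hz h3, pow_one]
    have h2 := orderOf_dvd_of_pow_eq_one h1
    rw [hγ] at h2
    have := Nat.le_of_dvd (by have := hp.two_le; omega) h2
    have := hp.two_le
    omega
  · push Not at ha1
    obtain ⟨k, hk⟩ : ∃ k, a = k + 1 := ⟨a - 1, by omega⟩
    have hfa : f = p ^ a * (f / p ^ a) := (Nat.ordProj_mul_ordCompl_eq_self f p).symm
    set f' := f / p ^ a with hf'
    have hpf' : ¬ p ∣ f' := Nat.not_dvd_ordCompl hp hf0.ne'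
    have hm0 : 0 < m := Nat.pos_of_ne_zero (by rintro rfl; simp at hpm)
    -- p-elements
    have hpel : ∀ t : G, (∃ j, orderOf t = p ^ j) → χ t ∈ Qcyc (p ^ a) := by
      rintro t ⟨j, hj⟩
      have h1 := hval t (p ^ j) (by rw [← hj, pow_orderOf_eq_one]) (pow_pos hp.pos j)
      have h2 := Qcyc_inter (pow_pos hp.pos j) hf0 h1 (hfmem t)
      refine Qcyc_mono ?_ h2
      obtain ⟨i, -, hi⟩ := (Nat.dvd_prime_pow hp).1 (Nat.gcd_dvd_left (p ^ j) f)
      rw [hi]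
      apply pow_dvd_pow
      rw [ha]
      rw [← hp.pow_dvd_iff_le_factorization hf0.ne', ← hi]
      exact Nat.gcd_dvd_right _ _
    by_contra hcon
    push Not at hcon
    have hpel2 : ∀ t : G, (∃ j, orderOf t = p ^ j) → χ t ∈ Qcyc (p ^ k) := by
      intro t ht
      by_contra h
      have := hcon t ht
      rw [hk] at this
      refine not_dvd_relfinrank hp hp2 (by omega) ?_ h this
      rw [← hk]; exact hpel t ht
    -- values in Qcyc (p^k * m')
    have hgk : f ∣ Fintype.card G * f := Dvd.intro_left _ rfl
    have hall : ∀ g, χ g ∈ Qcyc (p ^ k * m) := by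
      intro g
      have hkm : 0 < p ^ k * m := Nat.mul_pos (pow_pos hp.pos k) hm0
      have hM : 0 < p ^ (b + k) * m := Nat.mul_pos (pow_pos hp.pos _) hm0
      have h1 : χ g ∈ Qcyc (p ^ (b + k) * m) :=
        hval g _ (by rw [pow_add, mul_comm (p ^ b), mul_assoc, ← hcard, mul_comm, pow_mul, pow_card_eq_one, one_pow]) hM
      refine mem_Qcyc_of_fixed hM (Nat.mul_dvd_mul_right (pow_dvd_pow p (by omega)) m) h1 ?_
      intro s hs hs1 τ hτ
      have hτ2 : ∀ z : ℂ, z ^ Fintype.card G = 1 → τ z = z ^ s := by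
        intro z hz
        apply hτ
        rw [pow_add, mul_comm (p ^ b), mul_assoc, ← hcard, mul_comm, pow_mul, hz, one_pow]
      rw [hχ.galois hτ2]
      refine hmain s (hs1.of_dvd (Nat.mul_dvd_mul_right (dvd_pow_self p (by omega)) m)) ?_ g
      intro t ht
      rw [← hχ.galois hτ2]
      refine Qcyc_fix (s := 0) (M := p ^ k) ?_ (hpel2 t ht)
      intro z hz
      rw [hτ z (by rw [pow_add, mul_comm (p ^ b), mul_assoc, pow_mul, hz, one_pow]),
        pow_modEq hz (hs1.of_dvd (Nat.dvd_mul_right _ _)), pow_one]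
    have hle := hmin (a := Nat.gcd f (p ^ k * m)) ⟨Nat.gcd_pos_of_pos_left _ hf0, fun g =>
      Qcyc_inter hf0 (Nat.mul_pos (pow_pos hp.pos k) hm0) (hfmem g) (hall g)⟩
    have heq : Nat.gcd f (p ^ k * m) = f :=
      le_antisymm (Nat.le_of_dvd hf0 (Nat.gcd_dvd_left _ _)) hle
    have hdv : f ∣ p ^ k * m := by rw [← heq]; exact Nat.gcd_dvd_right _ _
    have h9 : p ^ a ∣ p ^ k * m := dvd_trans (Dvd.intro _ hfa.symm) hdv
    rw [hk, pow_succ] at h9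
    exact hpm (Nat.dvd_of_mul_dvd_mul_left (pow_pos hp.pos k) h9)

/-! ### Part 5: exponents, weights, the abelian centraliser case -/

structure Ex (p b m e e' s : ℕ) : Prop where
  hp : p.Prime
  hp2 : p ≠ 2
  hpm : ¬ p ∣ m
  he1 : e ≡ 1 [MOD p ^ b]
  he0 : m ∣ e
  he'1 : e' ≡ 1 [MOD m]
  he'0 : p ^ b ∣ e'
  hs : s ≡ 1 [MOD p * m]

theorem Ex.exists {p b m s : ℕ} (hp : p.Prime) (hp2 : p ≠ 2) (hpm : ¬ p ∣ m)
    (hs : s ≡ 1 [MOD p * m]) : ∃ e e', Ex p b m e e' s := by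
  have hc : Nat.Coprime (p ^ b) m := Nat.Coprime.pow_left _ ((Nat.Prime.coprime_iff_not_dvd hp).2 hpm)
  obtain ⟨e, h1, h2⟩ := Nat.chineseRemainder hc 1 0
  obtain ⟨e', h3, h4⟩ := Nat.chineseRemainder hc 0 1
  exact ⟨e, e', hp, hp2, hpm, h1, (Nat.modEq_zero_iff_dvd.1 h2), h4, Nat.modEq_zero_iff_dvd.1 h3, hs⟩

theorem pow_modEq' {M : Type*} [Monoid M] {n a c : ℕ} {g : M} (hg : g ^ n = 1) (h : a ≡ c [MOD n]) :
    g ^ a = g ^ c := by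
  rw [← Nat.mod_add_div a n, ← Nat.mod_add_div c n, pow_add, pow_add, pow_mul, pow_mul, hg, h]
  simp

namespace Ex
variable {p b m e e' s : ℕ}

theorem cop (E : Ex p b m e e' s) : Nat.Coprime (p ^ b) m := Nat.Coprime.pow_left _ ((Nat.Prime.coprime_iff_not_dvd E.hp).2 E.hpm)

theorem s_m (E : Ex p b m e e' s) : s ≡ 1 [MOD m] := E.hs.of_mul_left p
theorem s_p (E : Ex p b m e e' s) : s ≡ 1 [MOD p] := E.hs.of_mul_right m

theorem modEq_of (E : Ex p b m e e' s) {a c : ℕ} (h1 : a ≡ c [MOD p ^ b]) (h2 : a ≡ c [MOD m]) : a ≡ c [MOD p ^ b * m] :=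
  (Nat.modEq_and_modEq_iff_modEq_mul E.cop).1 ⟨h1, h2⟩

theorem coprime_s (E : Ex p b m e e' s) : s.Coprime (p ^ b * m) := by
  apply Nat.Coprime.mul_right
  · apply Nat.Coprime.pow_right
    rw [Nat.Coprime, E.s_p.gcd_eq]; simp
  · rw [Nat.Coprime, E.s_m.gcd_eq]; simp

variable {M : Type*} [Monoid M] {g : M}

theorem mul_parts (E : Ex p b m e e' s) (hg : g ^ (p ^ b * m) = 1) : g ^ e * g ^ e' = g := by
  rw [← pow_add]
  conv_rhs => rw [← pow_one g]
  apply pow_modEq' hg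
  apply E.modEq_of
  · simpa using E.he1.add (Nat.modEq_zero_iff_dvd.2 E.he'0)
  · simpa using (Nat.modEq_zero_iff_dvd.2 E.he0).add E.he'1

theorem pp_pow (E : Ex p b m e e' s) (hg : g ^ (p ^ b * m) = 1) : (g ^ e) ^ (p ^ b) = 1 := by
  obtain ⟨c, rfl⟩ := E.he0
  rw [← pow_mul, show m * c * p ^ b = p ^ b * m * c by ring, pow_mul, hg, one_pow]

theorem qq_pow (E : Ex p b m e e' s) (hg : g ^ (p ^ b * m) = 1) : (g ^ e') ^ m = 1 := by
  obtain ⟨c, hc⟩ := E.he'0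
  rw [hc, ← pow_mul, show p ^ b * c * m = p ^ b * m * c by ring, pow_mul, hg, one_pow]

theorem pp_of_p (E : Ex p b m e e' s) (hg : g ^ (p ^ b) = 1) : g ^ e = g := by
  conv_rhs => rw [← pow_one g]
  exact pow_modEq' hg E.he1

theorem pp_of_p' (E : Ex p b m e e' s) (hg : g ^ m = 1) : g ^ e = 1 := by
  obtain ⟨c, rfl⟩ := E.he0
  rw [pow_mul, hg, one_pow]

theorem qq_of_p (E : Ex p b m e e' s) (hg : g ^ (p ^ b) = 1) : g ^ e' = 1 := by
  obtain ⟨c, hc⟩ := E.he'0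
  rw [hc, pow_mul, hg, one_pow]

theorem qq_of_p' (E : Ex p b m e e' s) (hg : g ^ m = 1) : g ^ e' = g := by
  conv_rhs => rw [← pow_one g]
  exact pow_modEq' hg E.he'1

theorem pp_pp (E : Ex p b m e e' s) (hg : g ^ (p ^ b * m) = 1) : (g ^ e) ^ e = g ^ e := E.pp_of_p (E.pp_pow hg)
theorem pp_qq (E : Ex p b m e e' s) (hg : g ^ (p ^ b * m) = 1) : (g ^ e') ^ e = 1 := E.pp_of_p' (E.qq_pow hg)

theorem qq_s (E : Ex p b m e e' s) (hg : g ^ (p ^ b * m) = 1) : (g ^ e') ^ s = g ^ e' := by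
  conv_rhs => rw [← pow_one (g ^ e')]
  exact pow_modEq' (E.qq_pow hg) E.s_m

theorem pow_s (E : Ex p b m e e' s) (hg : g ^ (p ^ b * m) = 1) : g ^ s = (g ^ e) ^ s * g ^ e' := by
  conv_lhs => rw [← E.mul_parts hg]
  rw [((Commute.refl g).pow_pow e e').mul_pow, E.qq_s hg]

theorem pow_s_eq (E : Ex p b m e e' s) (hg : g ^ (p ^ b * m) = 1) (h : (g ^ e) ^ s = g ^ e) : g ^ s = g := by
  rw [E.pow_s hg, h, E.mul_parts hg]

theorem pow_s_of_pp (E : Ex p b m e e' s) (hg : g ^ (p ^ b * m) = 1) (h : g ^ e = 1) : g ^ s = g := by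
  apply E.pow_s_eq hg; rw [h, one_pow]

theorem pow_si (E : Ex p b m e e' s) (hg : g ^ (p ^ b * m) = 1) (i : ℕ) (h : (g ^ e) ^ (s ^ i) = g ^ e) : g ^ (s ^ i) = g := by
  conv_rhs => rw [← E.mul_parts hg]
  conv_lhs => rw [← E.mul_parts hg]
  rw [((Commute.refl g).pow_pow e e').mul_pow, h]
  congr 1
  clear h
  induction i with
  | zero => simp
  | succ i ih => rw [pow_succ, pow_mul, ih, E.qq_s hg]

/-- `u ≡ 1 mod p`, `p ∤ k`, `z ^ (u ^ k) = z` implies `z ^ u = z` for `p`-power order `z`. -/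
theorem root (E : Ex p b m e e' s) {G : Type*} [Group G] {z : G} (hz : z ^ (p ^ b) = 1) {u k : ℕ} (hu : u ≡ 1 [MOD p]) (hk : ¬ p ∣ k)
    (h : z ^ (u ^ k) = z) : z ^ u = z := by
  have h1 : z ^ ((u : ℤ) ^ k - 1) = 1 := by
    rw [zpow_sub, zpow_one, mul_inv_eq_one]; exact_mod_cast h
  rw [← geom_sum_mul, zpow_mul] at h1
  set S := ∑ i ∈ Finset.range k, (u : ℤ) ^ i with hS
  have h2 : S ≡ k [ZMOD p] := by
    have h3 : (u : ℤ) ≡ 1 [ZMOD p] := by exact_mod_cast (Int.natCast_modEq_iff.2 hu)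
    rw [← ZMod.intCast_eq_intCast_iff] at h3 ⊢
    rw [hS]; push_cast at h3 ⊢; simp [h3]
  have h4 : IsCoprime S ((p ^ b : ℕ) : ℤ) := by
    push_cast
    apply IsCoprime.pow_right
    rw [isCoprime_comm, Prime.coprime_iff_not_dvd (Nat.prime_iff_prime_int.1 E.hp)]
    intro hd
    apply hk
    have := (Int.ModEq.dvd h2)
    have := (Int.dvd_add hd this)
    simp at this
    exact_mod_cast this
  obtain ⟨x, y, hxy⟩ := h4
  have h5 : z ^ ((u : ℤ) - 1) = 1 := by
    have : z ^ ((u : ℤ) - 1) = (z ^ ((u : ℤ) - 1)) ^ (x * S + y * ((p ^ b : ℕ) : ℤ)) := by rw [hxy, zpow_one]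
    rw [this, ← zpow_mul, show ((u : ℤ) - 1) * (x * S + y * ((p ^ b : ℕ) : ℤ)) =
      (S * (u - 1)) * x + ((p ^ b : ℕ) : ℤ) * ((u - 1) * y) by ring, zpow_add, zpow_mul, zpow_mul z S, h1,
      zpow_mul, zpow_natCast, hz]
    simp
  rw [zpow_sub, zpow_one, mul_inv_eq_one] at h5
  exact_mod_cast h5

end Ex

theorem sum_weight {G : Type} [Group G] [Fintype G] {F w : G → ℝ} (hF : ∀ g, 0 ≤ F g)
    (hc : ∀ h g, F (h * g * h⁻¹) = F g) (hw : ∀ g, F g ≠ 0 → ∑ h, w (h * g * h⁻¹) ≤ 1) :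
    (Fintype.card G) * ∑ g, w g * F g ≤ ∑ g, F g := by
  have h1 : ∀ h : G, ∑ g, w g * F g = ∑ g, w (h * g * h⁻¹) * F g := by
    intro h
    refine (Fintype.sum_equiv (MulAut.conj h).toEquiv _ _ ?_).symm
    intro g
    simp [hc]
  have h2 : (Fintype.card G) * ∑ g, w g * F g = ∑ h : G, ∑ g, w (h * g * h⁻¹) * F g := by
    rw [← Finset.sum_congr rfl fun h _ => h1 h]
    simp
  rw [h2, Finset.sum_comm]
  apply Finset.sum_le_sum
  intro g _
  rw [← Finset.sum_mul]
  by_cases h : F g = 0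
  · simp [h]
  · have := hw g h
    have := hF g
    nlinarith

/-- if `a (μ^s) = M (μ^s) - M μ` and `a μ ≠ 0` there is another orbit element in the support -/
theorem orb_exists {H : Type} [CommGroup H] {n s : ℕ} (hn : 0 < n) (hH : ∀ μ : H, μ ^ n = 1) (hs : s.Coprime n)
    {a M : H → ℤ} (ha : ∀ μ, a (μ ^ s) = M (μ ^ s) - M μ) {μ : H} (hμ : a μ ≠ 0) :
    ∃ i : ℕ, a (μ ^ (s ^ i)) ≠ 0 ∧ μ ^ (s ^ i) ≠ μ := by
  by_contra hcon
  push Not at hcon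
  set N := Nat.totient n
  have hN : 0 < N := Nat.totient_pos.2 hn
  have hsN : μ ^ (s ^ N) = μ := by
    have := Nat.ModEq.pow_totient hs
    conv_rhs => rw [← pow_one μ]
    exact pow_modEq' (hH μ) this
  have h1 : ∑ i ∈ Finset.range N, a (μ ^ (s ^ (i + 1))) = 0 := by
    have : ∀ i, a (μ ^ (s ^ (i + 1))) = M (μ ^ (s ^ (i + 1))) - M (μ ^ (s ^ i)) := by
      intro i; rw [pow_succ, pow_mul, ha]
    rw [Finset.sum_congr rfl fun i _ => this i, Finset.sum_range_sub (fun i => M (μ ^ (s ^ i)))]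
    simp [hsN]
  have h2 : ∀ i, a (μ ^ (s ^ i)) = 0 ∨ a (μ ^ (s ^ i)) = a μ := by
    intro i
    by_cases h : a (μ ^ (s ^ i)) = 0
    · exact Or.inl h
    · right; rw [hcon i h]
  obtain ⟨k, hk⟩ : ∃ k, N = k + 1 := ⟨N - 1, by omega⟩
  rw [hk, Finset.sum_range_succ, ← hk, hsN] at h1
  have h3 : 0 ≤ (∑ i ∈ Finset.range k, a (μ ^ (s ^ (i + 1)))) * a μ := by
    rw [Finset.sum_mul]
    apply Finset.sum_nonneg
    intro i _
    rcases h2 (i + 1) with h | h <;> rw [h]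
    · simp
    · exact mul_self_nonneg _
  have h4 : 0 < a μ * a μ := mul_self_pos.2 hμ
  have h5 : (∑ x ∈ Finset.range k, a (μ ^ s ^ (x + 1))) = - a μ := by linarith
  rw [h5] at h3
  linarith

theorem hat_pow {T : Type} [CommGroup T] [Fintype T] (μ : Hat T) {n : ℕ} (h : Fintype.card T ∣ n) : μ ^ n = 1 := by
  obtain ⟨c, rfl⟩ := h
  ext t
  rw [MonoidHom.pow_apply, ← map_pow, pow_mul, pow_card_eq_one]
  simp

theorem co_pow {T : Type} [CommGroup T] [Fintype T] (f : T → ℂ) {s : ℕ} (hs : s.Coprime (Fintype.card T)) (μ : Hat T) :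
    co (fun t => f (t ^ s)) (μ ^ s) = co f μ := by
  unfold co ip
  congr 1
  refine Fintype.sum_equiv (powCoprime (G := T) (n := s) (by rw [Nat.card_eq_fintype_card]; exact hs.symm)) _ _ ?_
  intro t
  simp

theorem co_equiv {T : Type} [CommGroup T] [Fintype T] (f : T → ℂ) (c : T ≃* T) (μ : Hat T) :
    co (fun t => f (c t)) (μ.comp c.toMonoidHom) = co f μ := by
  unfold co ip
  congr 1
  exact Fintype.sum_equiv c.toEquiv _ _ fun t => by simp

/-- linear independence: the fibre sums of the coefficients vanish -/
theorem fibre_sum {T : Type} [CommGroup T] [Fintype T] [DecidableEq (Hat T)] (f : T → ℂ) (e : ℕ) (hf : ∀ t, f (t ^ e) = 0) (ν : Hat T) :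
    ∑ μ with μ ^ e = ν, co f μ = 0 := by
  have h1 : (fun t => ∑ ν : Hat T, (∑ μ with μ ^ e = ν, co f μ) * (ν t : ℂ)) = fun t => 0 := by
    funext t
    rw [← hf t, co_inv f (t ^ e)]
    rw [← Finset.sum_fiberwise (s := Finset.univ) (g := fun μ : Hat T => μ ^ e) (f := fun μ => co f μ * (μ (t ^ e) : ℂ))]
    refine Finset.sum_congr rfl fun ν _ => ?_
    rw [Finset.sum_mul]
    refine Finset.sum_congr rfl fun μ hμ => ?_
    rw [← (Finset.mem_filter.1 hμ).2]; simp
  have h2 := co_sum (fun ν => ∑ μ with μ ^ e = ν, co f μ) ν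
  rw [← h2, h1]
  simp [co, ip]

theorem delta_nsq {G : Type} [Group G] [Fintype G] {χ : G → ℂ} (hχ : χ ∈ irr G) {s : ℕ}
    (hs : s.Coprime (Fintype.card G)) : nsq (fun g => χ g - χ (g ^ s)) ≤ 2 := by
  classical
  have h1 := irr_pow hχ hs
  by_cases h : χ = fun g => χ (g ^ s)
  · have : (fun g => χ g - χ (g ^ s)) = fun g => 0 := by
      funext g; rw [sub_eq_zero]; exact congrFun h g
    rw [this]; simp [nsq]
  · have h2 : ip (fun g => χ g - χ (g ^ s)) (fun g => χ g - χ (g ^ s)) = 2 := by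
      rw [ip_sub_left, ← ip_conj _ χ, ← ip_conj _ (fun g => χ (g ^ s)), ip_sub_left, ip_sub_left]
      rw [irr_orth hχ hχ, irr_orth h1 h1, irr_orth h1 hχ, irr_orth hχ h1]
      simp [h, Ne.symm h]; norm_num
    rw [ip_self] at h2
    have h3 : nsq (fun g => χ g - χ (g ^ s)) = 2 := by exact_mod_cast h2
    rw [h3]

theorem exists_cj {G T : Type} [Group G] [Group T] [Finite T] {ι : T →* G} (hι : Function.Injective ι) (g : G)
    (hg : ∀ t, ∃ t', ι t' = g * ι t * g⁻¹) : ∃ c : T ≃* T, ∀ t, ι (c t) = g * ι t * g⁻¹ := by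
  choose f hf using hg
  let F : T →* T := MonoidHom.mk' f (by intro a b; apply hι; rw [map_mul, hf, hf, hf, map_mul]; group)
  have hF : Function.Injective F := by
    intro a b hab
    have : g * ι a * g⁻¹ = g * ι b * g⁻¹ := by rw [← hf, ← hf]; exact congrArg ι hab
    exact hι (by simpa using this)
  exact ⟨MulEquiv.ofBijective F ⟨hF, Finite.injective_iff_surjective.1 hF⟩, hf⟩

theorem main_CI {G T : Type} [Group G] [Fintype G] [CommGroup T] [Fintype T] {ι : T →* G}
    (hι : Function.Injective ι) {p b m e e' s : ℕ} (E : Ex p b m e e' s)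
    (hG : Fintype.card G = p ^ b * m) (hT : p ^ b ∣ Fintype.card T)
    (hcent : ∀ t : T, t ^ e ≠ 1 → ∀ g, g * ι (t ^ e) = ι (t ^ e) * g → ∃ t', ι t' = g)
    (hconj : ∀ g : G, g ^ e ≠ 1 → ∃ h t, h * g * h⁻¹ = ι t)
    {χ : G → ℂ} (hχ : χ ∈ irr G) (hpel : ∀ t, t ^ (p ^ b) = 1 → χ (t ^ s) = χ t) (g : G) :
    χ (g ^ s) = χ g := by
  classical
  have hG1 : ∀ g : G, g ^ (p ^ b * m) = 1 := fun g => by rw [← hG, pow_card_eq_one]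
  have hTG : Fintype.card T ∣ p ^ b * m := by
    rw [← hG, ← Nat.card_eq_fintype_card, ← Nat.card_eq_fintype_card]
    exact Subgroup.card_dvd_of_injective ι hι
  have hT1 : ∀ t : T, t ^ (p ^ b * m) = 1 := fun g => by
    obtain ⟨c, hc⟩ := hTG
    rw [hc, pow_mul, pow_card_eq_one, one_pow]
  have hH1 : ∀ μ : Hat T, μ ^ (p ^ b * m) = 1 := fun μ => hat_pow μ hTG
  have hsG : s.Coprime (Fintype.card G) := by rw [hG]; exact E.coprime_s
  have hsT : s.Coprime (Fintype.card T) := Nat.Coprime.of_dvd_right hTG E.coprime_s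
  have hχc := irr_isChar hχ
  set δ : G → ℂ := fun g => χ g - χ (g ^ s) with hδ
  have hδc : ∀ h g, δ (h * g * h⁻¹) = δ g := by
    intro h g
    simp only [hδ]
    rw [conj_pow, hχc.conj, hχc.conj]
  have hδ0 : ∀ g, g ^ e = 1 → δ g = 0 := by
    intro g hg
    simp only [hδ]; rw [E.pow_s_of_pp (hG1 g) hg, sub_self]
  by_contra hne
  -- coefficients
  choose M hM using (co_nat (hχc.comp ι) : ∀ μ, ∃ n : ℕ, co (fun t => χ (ι t)) μ = n)
  choose M' hM' using (co_nat ((hχc.pow hsG).comp ι) : ∀ μ, ∃ n : ℕ, co (fun t => χ (ι t ^ s)) μ = n)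
  have hMM : ∀ μ, M' (μ ^ s) = M μ := by
    intro μ
    have := co_pow (fun t => χ (ι t)) hsT μ
    rw [hM μ] at this
    have h2 := hM' (μ ^ s)
    simp only [map_pow] at this
    rw [this] at h2
    exact_mod_cast h2.symm
  let a : Hat T → ℤ := fun μ => (M μ : ℤ) - M' μ
  have ha : ∀ μ, co (fun t => δ (ι t)) μ = a μ := by
    intro μ
    simp only [hδ, co]
    rw [ip_sub_left]
    simp only [a]; push_cast
    rw [← hM, ← hM']; simp only [co]
  have has : ∀ μ, a (μ ^ s) = M (μ ^ s) - M μ := by intro μ; simp only [a, hMM]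
  -- support nonempty
  have hsupp : ∃ μ, a μ ≠ 0 := by
    by_contra hcon
    push Not at hcon
    have h0 : ∀ t, δ (ι t) = 0 := by
      intro t
      have := co_inv (fun t => δ (ι t)) t
      rw [this]
      exact Finset.sum_eq_zero fun μ _ => by rw [ha, hcon]; simp
    apply hne
    by_cases hg : g ^ e = 1
    · rw [E.pow_s_of_pp (hG1 g) hg]
    · obtain ⟨h, t, hht⟩ := hconj g hg
      have := hδc h g
      rw [hht, h0] at this
      simp only [hδ] at this
      exact (sub_eq_zero.1 this.symm).symm
  obtain ⟨μ, hμ⟩ := hsupp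
  -- normaliser
  let N : Subgroup G := Subgroup.normalizer (ι.range : Set G)
  have hN : ∀ g : N, ∀ t, ∃ t', ι t' = (g : G) * ι t * (g : G)⁻¹ := by
    intro g t
    have := (Subgroup.mem_normalizer_iff.1 g.2 (ι t)).1 ⟨t, rfl⟩
    exact this
  choose c hc using fun g : N => exists_cj hι (g : G) (hN g)
  have hmemN : ∀ g : G, (∀ t, ∃ t', ι t' = g * ι t * g⁻¹) → g ∈ N := by
    intro g hg
    obtain ⟨d, hd⟩ := exists_cj hι g hg
    rw [Subgroup.mem_normalizer_iff]
    intro y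
    constructor
    · rintro ⟨t, rfl⟩; exact ⟨d t, hd t⟩
    · rintro ⟨t, ht⟩
      refine ⟨d.symm t, ?_⟩
      have := hd (d.symm t)
      rw [d.apply_symm_apply, ht] at this
      simpa using this.symm
  letI : Fintype N := Fintype.ofFinite _
  -- the TI property
  have hTI : ∀ g : G, ∀ t t' : T, t ^ e ≠ 1 → g * ι t * g⁻¹ = ι t' → g ∈ N := by
    intro g t t' ht h
    apply hmemN
    intro r
    apply hcent t' _
    · rw [map_pow, ← h, conj_pow]
      have : ι r * ι t = ι t * ι r := by rw [← map_mul, mul_comm, map_mul]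
      have h2 : ι r * (ι t) ^ e = (ι t) ^ e * ι r := Commute.pow_right this e
      calc g * ι r * g⁻¹ * (g * ι t ^ e * g⁻¹) = g * (ι r * ι t ^ e) * g⁻¹ := by group
        _ = _ := by rw [h2]; group
    · intro h3
      apply ht
      apply hι
      have : (g * ι t * g⁻¹) ^ e = 1 := by rw [h, ← map_pow, h3, map_one]
      rw [conj_pow] at this
      have h4 : ι t ^ e = 1 := by simpa using this
      rw [map_pow, h4, map_one]
  -- norm inequality
  have hnorm : (∑ t : T, Complex.normSq (δ (ι t))) ≤ 2 * Fintype.card N := by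
    have hNpos : (0 : ℝ) < Fintype.card N := by exact_mod_cast Fintype.card_pos
    have hGpos : (0 : ℝ) < Fintype.card G := by exact_mod_cast Fintype.card_pos
    let w : G → ℝ := fun g => if (g ∈ ι.range ∧ g ^ e ≠ 1) then (Fintype.card N : ℝ)⁻¹ else 0
    have h1 := sum_weight (F := fun g => Complex.normSq (δ g)) (w := w) (fun g => Complex.normSq_nonneg _)
      (fun h g => by simp only [hδc]) (by
        intro g _
        simp only [w]
        rw [← Finset.sum_filter, Finset.sum_const, nsmul_eq_mul, mul_inv_le_iff₀ hNpos, one_mul]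
        norm_cast
        by_cases hem : (Finset.univ.filter fun h : G => h * g * h⁻¹ ∈ ι.range ∧ (h * g * h⁻¹) ^ e ≠ 1) = ∅
        · rw [hem]; simp
        · obtain ⟨h0, hh0⟩ := Finset.nonempty_iff_ne_empty.2 hem
          simp only [Finset.mem_filter, Finset.mem_univ, true_and] at hh0
          obtain ⟨⟨t0, ht0⟩, hne0⟩ := hh0
          have hinj : ∀ h ∈ (Finset.univ.filter fun h : G => h * g * h⁻¹ ∈ ι.range ∧ (h * g * h⁻¹) ^ e ≠ 1),
              h * h0⁻¹ ∈ N := by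
            intro h hh
            simp only [Finset.mem_filter, Finset.mem_univ, true_and] at hh
            obtain ⟨⟨t1, ht1⟩, hne1⟩ := hh
            apply hTI _ t0 t1
            · intro h3; apply hne0; rw [← ht0, ← map_pow, h3, map_one]
            · rw [ht0, ht1]; group
          rw [← Finset.card_attach, ← Finset.card_univ (α := N)]
          refine Finset.card_le_card_of_injOn (fun h => ⟨h.1 * h0⁻¹, hinj h.1 h.2⟩) (by simp) ?_
          intro x _ y _ hxy
          simp only [Subtype.mk.injEq, mul_left_inj] at hxy
          exact Subtype.ext hxy)
    have h2 := delta_nsq hχ hsG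
    unfold nsq at h2
    rw [inv_mul_le_iff₀ hGpos] at h2
    have h3 : (Fintype.card G : ℝ) * ∑ g, w g * Complex.normSq (δ g) ≤ Fintype.card G * 2 := h1.trans h2
    have h4 := le_of_mul_le_mul_left h3 hGpos
    have h5 : ∑ g, w g * Complex.normSq (δ g) = (Fintype.card N : ℝ)⁻¹ * ∑ t : T, Complex.normSq (δ (ι t)) := by
      rw [Finset.mul_sum, ← Finset.sum_subset (Finset.subset_univ (Finset.univ.image ι)), Finset.sum_image (fun a _ b _ h => hι h)]
      · refine Finset.sum_congr rfl fun t _ => ?_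
        by_cases ht : (ι t) ^ e = 1
        · rw [hδ0 _ ht]; simp
        · simp only [w]; rw [if_pos ⟨⟨t, rfl⟩, ht⟩]
      · intro x _ hx
        simp only [w]
        rw [if_neg, zero_mul]
        rintro ⟨⟨t, rfl⟩, -⟩
        exact hx (Finset.mem_image_of_mem _ (Finset.mem_univ _))
    rw [h5, inv_mul_le_iff₀ hNpos] at h4
    linarith
  -- coefficient counts
  have hTpos : (0 : ℝ) < Fintype.card T := by exact_mod_cast Fintype.card_pos
  have hsum : (Fintype.card T : ℤ) * ∑ μ, a μ ^ 2 ≤ 2 * Fintype.card N := by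
    have h1 := nsq_eq_co (fun t => δ (ι t))
    simp only [ha, nsq] at h1
    have h2 : ∑ t : T, Complex.normSq (δ (ι t)) = Fintype.card T * ∑ μ, Complex.normSq (a μ : ℂ) := by
      rw [← h1]; field_simp
    rw [h2] at hnorm
    have h3 : ∀ μ, Complex.normSq (a μ : ℂ) = ((a μ ^ 2 : ℤ) : ℝ) := by
      intro μ
      have := Complex.normSq_ofReal ((a μ : ℤ) : ℝ)
      push_cast at this ⊢
      rw [this]; ring
    simp only [h3] at hnorm
    exact_mod_cast hnorm
  set S : Finset (Hat T) := Finset.univ.filter fun μ => a μ ≠ 0 with hS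
  have hScard : (S.card : ℤ) ≤ ∑ μ, a μ ^ 2 := by
    rw [Finset.card_eq_sum_ones]
    push_cast
    rw [hS, Finset.sum_filter]
    apply Finset.sum_le_sum
    intro μ _
    split_ifs with h
    · have : 0 < a μ ^ 2 := by positivity
      linarith
    · positivity
  set Ms := S.image (fun μ => μ ^ e) with hMs
  have hMcard : 2 * Ms.card ≤ S.card := by
    apply Finset.mul_card_image_le_card
    intro ν hν
    obtain ⟨κ, hκ, rfl⟩ := Finset.mem_image.1 hν
    have h1 := fibre_sum (fun t => δ (ι t)) e (by
      intro t
      simp only [hδ]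
      rw [hpel, sub_self]
      rw [← map_pow, E.pp_pow (hT1 t), map_one]) (κ ^ e)
    simp only [ha] at h1
    have h2 : ∑ μ with μ ^ e = κ ^ e, a μ = 0 := by exact_mod_cast h1
    by_contra hlt
    have hκS : κ ∈ S.filter fun x => x ^ e = κ ^ e := by simp [hκ]
    have h3 : S.filter (fun x => x ^ e = κ ^ e) = {κ} := by
      apply Finset.eq_singleton_iff_unique_mem.2 ⟨hκS, ?_⟩
      intro y hy
      by_contra hyk
      apply hlt
      have : ({y, κ} : Finset (Hat T)) ⊆ S.filter fun x => x ^ e = κ ^ e := by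
        intro z hz
        simp only [Finset.mem_insert, Finset.mem_singleton] at hz
        rcases hz with rfl | rfl
        · exact hy
        · exact hκS
      calc 2 = ({y, κ} : Finset (Hat T)).card := (Finset.card_pair hyk).symm
        _ ≤ _ := Finset.card_le_card this
    have h4 : ∑ μ with μ ^ e = κ ^ e, a μ = a κ := by
      rw [Finset.sum_eq_single κ]
      · intro y hy hyk
        by_contra hay
        have : y ∈ S.filter (fun x => x ^ e = κ ^ e) := by
          simp only [Finset.mem_filter, Finset.mem_univ, true_and] at hy
          simp [hS, hay, hy]
        rw [h3, Finset.mem_singleton] at this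
        exact hyk this
      · intro h; simp at h
    rw [h4] at h2
    rw [hS, Finset.mem_filter] at hκ
    exact hκ.2 h2
  set lam : Hat T := μ ^ e with hlam
  have hlam1 : lam ≠ 1 := by
    intro h
    apply hμ
    have h1 := E.pow_s_of_pp (M := Hat T) (g := μ) (hH1 μ) (hlam.symm.trans h)
    have := has μ
    rw [h1, sub_self] at this
    exact this
  -- stabiliser
  have hstab : ∀ g : N, (∀ t, lam (c g t) = lam t) → ∃ t, ι t = (g : G) := by
    intro g hg
    by_contra hcon
    apply hlam1
    -- the commutator map on T
    let K : T →* T := MonoidHom.mk' (fun t => c g t * t⁻¹) (by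
      intro x y; rw [map_mul, mul_inv]; exact mul_mul_mul_comm _ _ _ _)
    let P : Subgroup T := (powMonoidHom (p ^ b) : T →* T).ker
    have hP : ∀ t, t ∈ P ↔ t ^ (p ^ b) = 1 := fun t => by simp [P, MonoidHom.mem_ker]
    have hKP : ∀ t : P, K t ∈ P := by
      intro t
      rw [hP, ← map_pow, (hP _).1 t.2, map_one]
    let K' : P → P := fun t => ⟨K t, hKP t⟩
    have hinj : Function.Injective K' := by
      intro x y hxy
      have h1 : K x = K y := congrArg Subtype.val hxy
      have h2 : K ((x : T) * (y : T)⁻¹) = 1 := by rw [map_mul, map_inv, h1, mul_inv_cancel]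
      set z : T := (x : T) * (y : T)⁻¹ with hz
      have hzP : z ∈ P := P.mul_mem x.2 (P.inv_mem y.2)
      have h3 : c g z = z := by
        have : c g z * z⁻¹ = 1 := h2
        exact mul_inv_eq_one.1 this
      by_contra hxy'
      apply hcon
      have hze : z ^ e = z := E.pp_of_p ((hP _).1 hzP)
      apply hcent z
      · rw [hze]
        intro h
        apply hxy'
        exact Subtype.ext (mul_inv_eq_one.1 h)
      · rw [hze]
        have := hc g z
        rw [h3] at this
        rw [eq_mul_inv_iff_mul_eq] at this
        exact this.symm
    have hsurj := Finite.injective_iff_surjective.1 hinj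
    ext t
    obtain ⟨⟨y, hy⟩, hyt⟩ := hsurj ⟨t ^ e, (hP _).2 (E.pp_pow (hT1 t))⟩
    have h1 : c g y * y⁻¹ = t ^ e := congrArg Subtype.val hyt
    have h2 : lam t = lam (t ^ e) := by
      rw [hlam, MonoidHom.pow_apply, MonoidHom.pow_apply, ← map_pow, ← map_pow, E.pp_pp (hT1 t)]
    rw [h2, ← h1, map_mul, hg, ← map_mul, mul_inv_cancel, map_one]; rfl
  set O : Finset (Hat T) := (Finset.univ : Finset N).image (fun g => lam.comp (c g).toMonoidHom) with hO
  have hcc : ∀ g : N, ∀ κ : Hat T, a (κ.comp (c g).toMonoidHom) = a κ := by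
    intro g κ
    have h1 := co_equiv (fun t => δ (ι t)) (c g) κ
    have h2 : (fun t => δ (ι (c g t))) = fun t => δ (ι t) := by
      funext t; rw [hc, hδc]
    rw [h2, ha, ha] at h1
    exact_mod_cast h1
  have hOM : O ⊆ Ms := by
    intro ν hν
    obtain ⟨g, -, rfl⟩ := Finset.mem_image.1 hν
    refine Finset.mem_image.2 ⟨μ.comp (c g).toMonoidHom, ?_, ?_⟩
    · rw [hS, Finset.mem_filter]
      exact ⟨Finset.mem_univ _, by rw [hcc]; exact hμ⟩
    · ext t; simp [hlam]
  have hOcard : Fintype.card N ≤ Fintype.card T * O.card := by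
    rw [← Finset.card_univ (α := N)]
    apply Finset.card_le_mul_card_image
    intro ν hν
    obtain ⟨g0, -, rfl⟩ := Finset.mem_image.1 hν
    have hst : ∀ g : N, lam.comp (c g).toMonoidHom = lam.comp (c g0).toMonoidHom → ∃ t, ι t = ((g * g0⁻¹ : N) : G) := by
      intro g hg
      apply hstab
      intro t
      have h1 : ∀ t, lam (c g t) = lam (c g0 t) := fun t => by
        have := congrArg (fun f : Hat T => f t) hg
        exact this
      have h2 : c (g * g0⁻¹) t = c g ((c g0).symm t) := by
        apply hι
        have h3 := hc g0 ((c g0).symm t)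
        rw [(c g0).apply_symm_apply] at h3
        rw [hc, hc, h3]
        simp
        group
      rw [h2, h1, (c g0).apply_symm_apply]
    rw [← Finset.card_univ (α := T)]
    choose! f hf using hst
    refine Finset.card_le_card_of_injOn f (by simp) ?_
    intro x hx y hy hxy
    have hx' := hf x (Finset.mem_filter.1 (Finset.mem_coe.1 hx)).2
    have hy' := hf y (Finset.mem_filter.1 (Finset.mem_coe.1 hy)).2
    rw [hxy, hy'] at hx'
    have := Subtype.ext (a1 := (y * g0⁻¹ : N)) (a2 := x * g0⁻¹) hx'
    exact (mul_right_cancel this).symm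
  have hOeq : O = Ms := by
    apply Finset.eq_of_subset_of_card_le hOM
    have h1 : Fintype.card T * (2 * Ms.card) ≤ 2 * (Fintype.card T * O.card) := by
      have h2 : (Fintype.card T : ℤ) * (2 * Ms.card) ≤ 2 * Fintype.card N := by
        refine le_trans ?_ hsum
        apply mul_le_mul_of_nonneg_left _ (by positivity)
        refine le_trans ?_ hScard
        exact_mod_cast hMcard
      have h3 : Fintype.card T * (2 * Ms.card) ≤ 2 * Fintype.card N := by exact_mod_cast h2
      omega
    have hpos : 0 < Fintype.card T := Fintype.card_pos
    nlinarith
  obtain ⟨i, hi1, hi2⟩ := orb_exists (H := Hat T) (M := fun μ => (M μ : ℤ)) (n := p ^ b * m) (by rw [← hG]; exact Fintype.card_pos) hH1 E.coprime_s has hμ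
  apply hi2
  apply E.pow_si (hH1 μ)
  have hmem : lam ^ (s ^ i) ∈ O := by
    rw [hOeq]
    refine Finset.mem_image.2 ⟨μ ^ (s ^ i), by simp [hS, hi1], ?_⟩
    ext t
    simp only [hlam, MonoidHom.pow_apply, ← pow_mul, mul_comm]
  obtain ⟨g, -, hg⟩ := Finset.mem_image.1 hmem
  -- index
  let R : Subgroup N := ι.range.subgroupOf N
  have hRn : R.Normal := Subgroup.normal_in_normalizer
  have hle : ι.range ≤ N := Subgroup.le_normalizer
  have hRcard : Nat.card R = Fintype.card T := by
    have h1 : Nat.card R = Nat.card ι.range := Nat.card_congr (Subgroup.subgroupOfEquivOfLe hle).toEquiv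
    rw [h1, ← Nat.card_eq_fintype_card]
    exact (Nat.card_congr (MonoidHom.ofInjective hι).toEquiv).symm
  have hgk : g ^ R.index ∈ R := Subgroup.pow_index_mem R g
  have hk : ¬ p ∣ R.index := by
    intro hd
    have h1 := R.card_mul_index
    have h2 : Nat.card N ∣ p ^ b * m := by
      rw [← hG, ← Nat.card_eq_fintype_card]; exact Subgroup.card_subgroup_dvd_card N
    rw [← h1, hRcard] at h2
    have h3 : p ^ b * p ∣ p ^ b * m := (mul_dvd_mul hT hd).trans h2
    exact E.hpm (Nat.dvd_of_mul_dvd_mul_left (pow_pos E.hp.pos b) h3)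
  apply E.root (k := R.index) (E.pp_pow (hH1 μ)) _ hk
  · have hgl : ∀ t, lam (c g t) = lam t ^ (s ^ i) := by
      intro t
      have := congrArg (fun f : Hat T => f t) hg
      simpa using this
    have hit : ∀ n : ℕ, ∀ t, lam (c (g ^ n) t) = lam t ^ ((s ^ i) ^ n) := by
      intro n
      induction n with
      | zero =>
        intro t
        have : c (g ^ 0) t = t := by apply hι; rw [hc]; simp
        rw [this]; simp
      | succ n ih =>
        intro t
        have : c (g ^ (n + 1)) t = c (g ^ n) (c g t) := by
          apply hι; rw [hc, hc, hc, pow_succ]; simp [mul_assoc]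
        rw [this, ih, hgl, ← pow_mul, pow_succ, mul_comm]
    obtain ⟨r, hr⟩ : ∃ r, ι r = ((g ^ R.index : N) : G) := by
      have := Subgroup.mem_subgroupOf.1 hgk
      exact this
    ext t
    have h1 := hit R.index t
    have h2 : c (g ^ R.index) t = t := by
      apply hι; rw [hc, ← hr, ← map_mul, mul_comm r t, map_mul, mul_inv_cancel_right]
    rw [h2] at h1
    rw [MonoidHom.pow_apply, ← h1]
  · have := E.s_p.pow i
    simpa using this

theorem main_C {G : Type} [Group G] [Fintype G] {p b m e e' s : ℕ} (E : Ex p b m e e' s)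
    (hG : Fintype.card G = p ^ b * m)
    (hab : ∀ t : G, t ≠ 1 → t ^ (p ^ b) = 1 → ∀ x y, x * t = t * x → y * t = t * y → x * y = y * x)
    {χ : G → ℂ} (hχ : χ ∈ irr G) (hpel : ∀ t, t ^ (p ^ b) = 1 → χ (t ^ s) = χ t) (g : G) :
    χ (g ^ s) = χ g := by
  classical
  have hG1 : ∀ g : G, g ^ (p ^ b * m) = 1 := fun g => by rw [← hG, pow_card_eq_one]
  have hfp : Fact p.Prime := ⟨E.hp⟩
  rcases Nat.eq_zero_or_pos b with rfl | hb
  · have h1 := E.pp_pow (hG1 g)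
    rw [pow_zero, pow_one] at h1
    rw [E.pow_s_of_pp (hG1 g) h1]
  let P : Sylow p G := default
  have hPc : Nat.card P = p ^ b := by
    rw [P.card_eq_multiplicity, Nat.card_eq_fintype_card, hG]
    congr 1
    have hm0 : m ≠ 0 := by rintro rfl; exact E.hpm (dvd_zero p)
    rw [Nat.factorization_mul (pow_ne_zero _ E.hp.ne_zero) hm0, E.hp.factorization_pow]
    simp [Nat.factorization_eq_zero_of_not_dvd E.hpm]
  have hPn : Nontrivial P := by
    rw [← Finite.one_lt_card_iff_nontrivial]
    have : Nat.card (P : Subgroup G) = p ^ b := hPc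
    rw [this]; exact Nat.one_lt_pow hb.ne' E.hp.one_lt
  have hcn : Nontrivial (Subgroup.center P) := P.2.center_nontrivial
  obtain ⟨⟨⟨z, hzP⟩, hzc⟩, hz1⟩ := exists_ne (1 : Subgroup.center P)
  have hz1' : z ≠ 1 := by
    intro h; apply hz1; ext; exact h
  have hzcomm : ∀ y ∈ P, y * z = z * y := by
    intro y hy
    have := Subgroup.mem_center_iff.1 hzc ⟨y, hy⟩
    exact congrArg Subtype.val this
  have hPp : ∀ y ∈ P, y ^ (p ^ b) = 1 := by
    intro y hy
    have : (⟨y, hy⟩ : P) ^ Nat.card P = 1 := pow_card_eq_one'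
    rw [hPc] at this
    exact congrArg Subtype.val this
  let T := Subgroup.centralizer ({z} : Set G)
  have hTm : ∀ y, y ∈ T ↔ y * z = z * y := by
    intro y; rw [Subgroup.mem_centralizer_singleton_iff]; 
  have hTc : ∀ x ∈ T, ∀ y ∈ T, x * y = y * x := by
    intro x hx y hy
    exact hab z hz1' (hPp z hzP) x y ((hTm x).1 hx) ((hTm y).1 hy)
  letI : CommGroup T := { (inferInstance : Group T) with
    mul_comm := fun x y => Subtype.ext (hTc x x.2 y y.2) }
  letI : Fintype T := Fintype.ofFinite _
  have hcen : ∀ t : G, t ≠ 1 → t ^ (p ^ b) = 1 → t ∈ T → ∀ g, g * t = t * g → g ∈ T := by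
    intro t ht htp htT g hg
    rw [hTm]
    exact hab t ht htp g z hg ((hTm t).1 htT).symm
  refine main_CI (ι := T.subtype) (Subtype.val_injective) E hG ?_ ?_ ?_ hχ hpel g
  · rw [← hPc, ← Nat.card_eq_fintype_card]
    apply Subgroup.card_dvd_of_le
    intro y hy
    rw [hTm]; exact hzcomm y hy
  · intro t ht g hg
    refine ⟨⟨g, ?_⟩, rfl⟩
    refine hcen (T.subtype (t ^ e)) ?_ ?_ (t ^ e : T).2 g hg
    · intro h; apply ht; exact Subtype.ext h
    · rw [map_pow]; exact E.pp_pow (hG1 _)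
  · intro g hg
    have hpg : IsPGroup p (Subgroup.zpowers (g ^ e)) := by
      apply IsPGroup.of_card (n := (Nat.card (Subgroup.zpowers (g ^ e))).factorization p)
      have h1 : orderOf (g ^ e) ∣ p ^ b := orderOf_dvd_of_pow_eq_one (E.pp_pow (hG1 g))
      rw [Nat.card_zpowers]
      obtain ⟨k, -, hk⟩ := (Nat.dvd_prime_pow E.hp).1 h1
      rw [hk, E.hp.factorization_pow]; simp
    obtain ⟨Q, hQ⟩ := hpg.exists_le_sylow
    obtain ⟨h, hh⟩ := MulAction.exists_smul_eq G Q P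
    have h1 : h * (g ^ e) * h⁻¹ ∈ P := by
      rw [← hh]
      have : g ^ e ∈ (Q : Subgroup G) := hQ (Subgroup.mem_zpowers _)
      have h2 := Subgroup.smul_mem_pointwise_smul _ (MulAut.conj h) _ this
      exact h2
    refine ⟨h, ⟨h * g * h⁻¹, ?_⟩, rfl⟩
    apply hcen (h * g ^ e * h⁻¹) _ (hPp _ h1) ((hTm _).2 (hzcomm _ h1))
    · have := ((Commute.refl g).pow_right e).eq
      calc h * g * h⁻¹ * (h * g ^ e * h⁻¹) = h * (g * g ^ e) * h⁻¹ := by group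
        _ = _ := by rw [this]; group
    · intro h3; apply hg; simpa using h3

/-! ### Part 7: restriction to a torus with a reflection -/

/-- combinatorial lemmas on integer families close to their mean -/
theorem comb_sq {α : Type} (C : Finset α) (m : α → ℤ) (hC : 0 < C.card) (v : ℝ) :
    ∑ i ∈ C, ((m i : ℝ) - v) ^ 2 =
      ∑ i ∈ C, ((m i : ℝ) - (C.card : ℝ)⁻¹ * ∑ j ∈ C, (m j : ℝ)) ^ 2 +
        (C.card : ℝ)⁻¹ * (∑ i ∈ C, ((m i : ℝ) - v)) ^ 2 := by
  have hn : (C.card : ℝ) ≠ 0 := by positivity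
  set S := ∑ j ∈ C, (m j : ℝ)
  have h1 : ∀ c : ℝ, ∑ i ∈ C, ((m i : ℝ) - c) ^ 2 = ∑ i ∈ C, (m i : ℝ) ^ 2 - 2 * c * S + C.card * c ^ 2 := by
    intro c
    simp only [sub_sq, Finset.sum_add_distrib, Finset.sum_sub_distrib, Finset.sum_const, nsmul_eq_mul]
    simp only [S, Finset.mul_sum]
    congr 2
    exact Finset.sum_congr rfl fun i _ => by ring
  rw [h1, h1, Finset.sum_sub_distrib]
  simp only [Finset.sum_const, nsmul_eq_mul]
  change _ = _ + (C.card : ℝ)⁻¹ * (S - _) ^ 2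
  field_simp
  ring

theorem comb_exists {α : Type} (C : Finset α) (m : α → ℤ) (hC : 0 < C.card)
    (hQ : ∑ i ∈ C, ((m i : ℝ) - (C.card : ℝ)⁻¹ * ∑ j ∈ C, (m j : ℝ)) ^ 2 < 2) :
    ∃ v : ℤ, (C.filter fun i => m i ≠ v).card ≤ 3 := by
  classical
  have hn : (C.card : ℝ) ≠ 0 := by positivity
  have hn0 : (0 : ℝ) < C.card := by positivity
  set Q := ∑ i ∈ C, ((m i : ℝ) - (C.card : ℝ)⁻¹ * ∑ j ∈ C, (m j : ℝ)) ^ 2 with hQd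
  have h1 : ∑ j ∈ C, ∑ i ∈ C, ((m i : ℝ) - m j) ^ 2 = 2 * C.card * Q := by
    rw [Finset.sum_congr rfl fun j _ => comb_sq C m hC (m j)]
    rw [Finset.sum_add_distrib, Finset.sum_const, nsmul_eq_mul]
    have : ∑ j ∈ C, (C.card : ℝ)⁻¹ * (∑ i ∈ C, ((m i : ℝ) - m j)) ^ 2 = C.card * Q := by
      rw [hQd, Finset.mul_sum]
      refine Finset.sum_congr rfl fun j _ => ?_
      rw [Finset.sum_sub_distrib, Finset.sum_const, nsmul_eq_mul]
      field_simp
      ring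
    rw [this]; ring
  obtain ⟨j, hj, hlt⟩ : ∃ j ∈ C, ∑ i ∈ C, (m i - m j) ^ 2 ≤ 3 := by
    by_contra hcon
    push Not at hcon
    have h2 : ∑ j ∈ C, (4 : ℝ) ≤ ∑ j ∈ C, ∑ i ∈ C, ((m i : ℝ) - m j) ^ 2 := by
      apply Finset.sum_le_sum
      intro j hj
      have := hcon j hj
      have h3 : (4 : ℤ) ≤ ∑ i ∈ C, (m i - m j) ^ 2 := by omega
      exact_mod_cast h3
    rw [h1, Finset.sum_const, nsmul_eq_mul] at h2
    nlinarith
  refine ⟨m j, ?_⟩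
  have h4 : ((C.filter fun i => m i ≠ m j).card : ℤ) ≤ ∑ i ∈ C, (m i - m j) ^ 2 := by
    rw [Finset.card_eq_sum_ones, Finset.sum_filter]
    push_cast
    apply Finset.sum_le_sum
    intro i _
    split_ifs with h
    · have : m i - m j ≠ 0 := sub_ne_zero.2 h
      have : 0 < (m i - m j) ^ 2 := by positivity
      omega
    · positivity
  have := h4.trans hlt
  exact_mod_cast this

theorem comb_bound {α : Type} (C : Finset α) (m : α → ℤ) (hC : 9 ≤ C.card) (v : ℤ)
    (hv : (C.filter fun i => m i ≠ v).card ≤ 3) :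
    (2 : ℝ) * ∑ i ∈ C, ((m i : ℝ) - v) ^ 2 ≤ 3 * ∑ i ∈ C, ((m i : ℝ) - (C.card : ℝ)⁻¹ * ∑ j ∈ C, (m j : ℝ)) ^ 2 := by
  classical
  have h1 := comb_sq C m (by omega) v
  set Q := ∑ i ∈ C, ((m i : ℝ) - (C.card : ℝ)⁻¹ * ∑ j ∈ C, (m j : ℝ)) ^ 2
  have h2 : (∑ i ∈ C, ((m i : ℝ) - v)) ^ 2 ≤ 3 * ∑ i ∈ C, ((m i : ℝ) - v) ^ 2 := by
    have h3 : ∑ i ∈ C, ((m i : ℝ) - v) = ∑ i ∈ C.filter (fun i => m i ≠ v), ((m i : ℝ) - v) := by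
      rw [Finset.sum_filter_of_ne]
      intro i _ h h'
      apply h; rw [h']; simp
    have h4 : ∑ i ∈ C, ((m i : ℝ) - v) ^ 2 = ∑ i ∈ C.filter (fun i => m i ≠ v), ((m i : ℝ) - v) ^ 2 := by
      rw [Finset.sum_filter_of_ne]
      intro i _ h h'
      apply h; rw [h']; simp
    rw [h3, h4]
    refine (sq_sum_le_card_mul_sum_sq).trans ?_
    apply mul_le_mul_of_nonneg_right
    · exact_mod_cast hv
    · exact Finset.sum_nonneg fun i _ => by positivity
  have h5 : (C.card : ℝ)⁻¹ ≤ 9⁻¹ := by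
    apply inv_anti₀ (by norm_num); exact_mod_cast hC
  have h6 : (C.card : ℝ)⁻¹ * (∑ i ∈ C, ((m i : ℝ) - v)) ^ 2 ≤ 9⁻¹ * (3 * ∑ i ∈ C, ((m i : ℝ) - v) ^ 2) := by
    apply mul_le_mul h5 h2 (by positivity) (by norm_num)
  linarith

section
variable {T : Type} [CommGroup T] [Fintype T] (Y : Subgroup T)

def ceq (μ ν : Hat T) : Prop := ∀ y ∈ Y, μ y = ν y

open Classical in
noncomputable def cos (μ : Hat T) : Finset (Hat T) := Finset.univ.filter fun ν => ceq Y μ ν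

variable {Y}
theorem mem_cos {μ ν : Hat T} : ν ∈ cos Y μ ↔ ceq Y μ ν := by simp [cos]
theorem ceq.symm {μ ν : Hat T} (h : ceq Y μ ν) : ceq Y ν μ := fun y hy => (h y hy).symm
theorem ceq.refl (μ : Hat T) : ceq Y μ μ := fun y hy => rfl
theorem ceq.trans {μ ν κ : Hat T} (h : ceq Y μ ν) (h' : ceq Y ν κ) : ceq Y μ κ := fun y hy => (h y hy).trans (h' y hy)
theorem cos_eq {μ ν : Hat T} (h : ceq Y μ ν) : cos Y μ = cos Y ν := by
  ext κ; rw [mem_cos, mem_cos]; exact ⟨fun h' => h.symm.trans h', fun h' => h.trans h'⟩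

theorem cos_exists (Y : Subgroup T) (μ : Hat T) : ∃ (Q : Type) (_ : CommGroup Q) (_ : Fintype Q) (π : T →* Q),
    Fintype.card Q = Y.index ∧ (∀ t, π t = 1 ↔ t ∈ Y) ∧ Function.Injective (fun κ : Hat Q => μ * κ.comp π) ∧
    ∀ ν, ν ∈ cos Y μ ↔ ∃ κ : Hat Q, μ * κ.comp π = ν := by
  letI : Fintype (T ⧸ Y) := Fintype.ofFinite _
  refine ⟨T ⧸ Y, inferInstance, inferInstance, QuotientGroup.mk' Y, ?_, ?_, ?_, ?_⟩
  · rw [← Nat.card_eq_fintype_card]; rfl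
  · intro t; simp
  · intro κ κ' h
    have h2 := mul_left_cancel h
    ext q
    exact congrArg (fun f : Hat T => ((f q : ℂˣ) : ℂ)) h2
  · intro ν
    rw [mem_cos]
    constructor
    · intro h
      refine ⟨QuotientGroup.lift Y (μ⁻¹ * ν) ?_, ?_⟩
      · intro y hy
        simp [h y hy]
      · ext t; simp
    · rintro ⟨κ, rfl⟩ y hy
      simp [(QuotientGroup.eq_one_iff y).2 hy]

theorem cos_card (Y : Subgroup T) (μ : Hat T) : (cos Y μ).card = Y.index := by
  classical
  obtain ⟨Q, _, _, π, h1, h2, h3, h4⟩ := cos_exists Y μ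
  rw [← h1, ← hat_card, ← Finset.card_univ, ← Finset.card_image_of_injective _ h3]
  congr 1
  ext ν
  rw [h4]; simp

theorem cos_sum (Y : Subgroup T) (μ : Hat T) (t : T) [Decidable (t ∈ Y)] :
    ∑ ν ∈ cos Y μ, (ν t : ℂ) = if t ∈ Y then (Y.index : ℂ) * (μ t : ℂ) else 0 := by
  classical
  obtain ⟨Q, _, _, π, h1, h2, h3, h4⟩ := cos_exists Y μ
  have : cos Y μ = Finset.univ.image (fun κ : Hat Q => μ * κ.comp π) := by
    ext ν
    rw [h4]; simp
  rw [this, Finset.sum_image (fun a _ b _ h => h3 h)]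
  simp only [MonoidHom.mul_apply, Units.val_mul, MonoidHom.comp_apply]
  rw [← Finset.mul_sum]
  split_ifs with h
  · rw [(h2 t).2 h]
    simp [hat_card, h1, mul_comm]
  · rw [hat_sum' (fun h' => h ((h2 t).1 h')), mul_zero]

theorem index_ne (Y : Subgroup T) : (Y.index : ℂ) ≠ 0 := by
  have : Y.index ≠ 0 := Subgroup.index_ne_zero_of_finite
  exact_mod_cast this

open Classical in
theorem co_restrict (Y : Subgroup T) (f : T → ℂ) (μ : Hat T) :
    co (fun t => if t ∈ Y then f t else 0) μ = (Y.index : ℂ)⁻¹ * ∑ ν ∈ cos Y μ, co f ν := by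
  have hN := index_ne Y
  simp only [co, ip]
  rw [← Finset.mul_sum, Finset.sum_comm, ← mul_assoc, mul_comm (Y.index : ℂ)⁻¹, mul_assoc]
  congr 1
  rw [Finset.mul_sum]
  refine Finset.sum_congr rfl fun t _ => ?_
  rw [← Finset.mul_sum]
  simp only [hat_conj]
  rw [cos_sum]
  have : t⁻¹ ∈ Y ↔ t ∈ Y := Y.inv_mem_iff
  simp only [this]
  split_ifs
  · field_simp
  · simp

open Classical in
theorem nsq_off (Y : Subgroup T) (f : T → ℂ) :
    ∑ μ, Complex.normSq (co f μ - (Y.index : ℂ)⁻¹ * ∑ ν ∈ cos Y μ, co f ν) =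
      (Fintype.card T : ℝ)⁻¹ * ∑ t with t ∉ Y, Complex.normSq (f t) := by
  have h1 := nsq_eq_co (fun t => f t - if t ∈ Y then f t else 0)
  have h2 : ∀ μ, co (fun t => f t - if t ∈ Y then f t else 0) μ = co f μ - (Y.index : ℂ)⁻¹ * ∑ ν ∈ cos Y μ, co f ν := by
    intro μ
    rw [← co_restrict]; simp only [co]
    rw [ip_sub_left]
  simp only [h2] at h1
  rw [← h1, nsq, Finset.sum_filter]
  congr 1
  refine Finset.sum_congr rfl fun t _ => ?_
  split_ifs <;> simp_all

open Classical in
noncomputable def majC (C : Finset (Hat T)) (M : Hat T → ℤ) : ℤ :=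
  if h : ∃ v : ℤ, (C.filter fun ν => M ν ≠ v).card ≤ 3 then h.choose else 0

variable (Y) in
noncomputable def maj (M : Hat T → ℤ) (μ : Hat T) : ℤ := majC (cos Y μ) M

theorem maj_unique (hN : 9 ≤ Y.index) {M : Hat T → ℤ} {μ : Hat T} {v v' : ℤ}
    (hv : ((cos Y μ).filter fun ν => M ν ≠ v).card ≤ 3) (hv' : ((cos Y μ).filter fun ν => M ν ≠ v').card ≤ 3) : v = v' := by
  classical
  by_contra hne
  have h1 : cos Y μ ⊆ ((cos Y μ).filter fun ν => M ν ≠ v) ∪ ((cos Y μ).filter fun ν => M ν ≠ v') := by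
    intro ν hν
    rw [Finset.mem_union, Finset.mem_filter, Finset.mem_filter]
    by_cases h : M ν = v
    · right; exact ⟨hν, by rw [h]; exact hne⟩
    · left; exact ⟨hν, h⟩
  have h2 := (Finset.card_le_card h1).trans (Finset.card_union_le _ _)
  rw [cos_card] at h2
  omega

theorem maj_eq (hN : 9 ≤ Y.index) {M : Hat T → ℤ} {μ : Hat T} {v : ℤ}
    (hv : ((cos Y μ).filter fun ν => M ν ≠ v).card ≤ 3) : maj Y M μ = v := by
  unfold maj majC
  have h : ∃ v : ℤ, ((cos Y μ).filter fun ν => M ν ≠ v).card ≤ 3 := ⟨v, hv⟩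
  rw [dif_pos (by convert h)]
  exact maj_unique hN (by convert h.choose_spec) hv

theorem maj_spec (hN : 9 ≤ Y.index) {M : Hat T → ℤ} {μ : Hat T} (h : ∃ v : ℤ, ((cos Y μ).filter fun ν => M ν ≠ v).card ≤ 3) :
    ((cos Y μ).filter fun ν => M ν ≠ maj Y M μ).card ≤ 3 := by
  obtain ⟨v, hv⟩ := h
  rw [maj_eq hN hv]; exact hv

theorem maj_congr {M : Hat T → ℤ} {μ ν : Hat T} (h : ceq Y μ ν) : maj Y M μ = maj Y M ν := by
  unfold maj; rw [cos_eq h]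

/-- naturality of the majority value -/
theorem maj_nat (hN : 9 ≤ Y.index) {M M' : Hat T → ℤ} {f : Hat T → Hat T} (hf : Function.Injective f)
    (hfc : ∀ μ ν, ceq Y μ ν → ceq Y (f μ) (f ν)) (hM : ∀ μ, M' (f μ) = M μ)
    {μ : Hat T} (h : ∃ v : ℤ, ((cos Y μ).filter fun ν => M ν ≠ v).card ≤ 3) : maj Y M' (f μ) = maj Y M μ := by
  classical
  obtain ⟨v, hv⟩ := h
  rw [maj_eq hN hv]
  apply maj_eq hN
  have h1 : cos Y (f μ) = (cos Y μ).image f := by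
    symm
    apply Finset.eq_of_subset_of_card_le
    · intro ν hν
      obtain ⟨κ, hκ, rfl⟩ := Finset.mem_image.1 hν
      exact mem_cos.2 (hfc _ _ (mem_cos.1 hκ))
    · rw [Finset.card_image_of_injective _ hf, cos_card, cos_card]
  rw [h1, Finset.filter_image, Finset.card_image_of_injective _ hf]
  simpa only [hM] using hv
end

structure LD {L T : Type} [Group L] [CommGroup T] (ι : T →* L) (w : L) (r : T ≃* T) (Y : Subgroup T) : Prop where
  inj : Function.Injective ι
  hw : ∀ t, ι (r t) = w * ι t * w⁻¹
  rr : ∀ t, r (r t) = t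
  rY : ∀ t, r t * t ∈ Y
  TI : ∀ t, t ∉ Y → ∀ g t', g * ι t * g⁻¹ = ι t' → (∃ u, g = ι u) ∨ ∃ u, g = ι u * w
  odd : Odd Y.index
  nine : 9 ≤ Y.index

section
variable {L T : Type} [Group L] [Fintype L] [CommGroup T] [Fintype T]

noncomputable def mm (ι : T →* L) (φ : L → ℂ) (μ : Hat T) : ℤ := ⌊(co (fun t => φ (ι t)) μ).re⌋

theorem mm_eq (ι : T →* L) {φ : L → ℂ} (hφ : IsChar φ) (μ : Hat T) : co (fun t => φ (ι t)) μ = (mm ι φ μ : ℂ) := by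
  obtain ⟨n, hn⟩ := co_nat (hφ.comp ι) μ
  have hn' : co (fun t => φ (ι t)) μ = n := hn
  simp [mm, hn']

noncomputable def dd (ι : T →* L) (Y : Subgroup T) (φ : L → ℂ) (μ : Hat T) : ℤ := mm ι φ μ - maj Y (mm ι φ) μ

def rm (r : T ≃* T) (μ : Hat T) : Hat T := μ.comp r.toMonoidHom

theorem rm_apply (r : T ≃* T) (μ : Hat T) (t : T) : rm r μ t = μ (r t) := rfl

noncomputable def IndT (ι : T →* L) (u : T → ℂ) (g : L) : ℂ :=
  (Fintype.card T : ℂ)⁻¹ * ∑ h : L, Function.extend ι u 0 (h * g * h⁻¹)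

theorem IndT_class (ι : T →* L) (u : T → ℂ) : IsClass (IndT ι u) := by
  intro x g
  unfold IndT
  congr 1
  refine Fintype.sum_equiv (Equiv.mulRight x) _ _ fun h => ?_
  simp [mul_assoc]

theorem IndT_ip {ι : T →* L} (hι : Function.Injective ι) (u : T → ℂ) {φ : L → ℂ} (hφ : IsClass φ) :
    ip (IndT ι u) φ = ip u (fun t => φ (ι t)) := by
  classical
  have hL : (Fintype.card L : ℂ) ≠ 0 := by simp
  have h1 : ∀ h : L, ∑ g, Function.extend ι u 0 (h * g * h⁻¹) * conj (φ g) =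
      ∑ t, u t * conj (φ (ι t)) := by
    intro h
    have h2 : ∑ g, Function.extend ι u 0 (h * g * h⁻¹) * conj (φ g) = ∑ g, Function.extend ι u 0 g * conj (φ g) := by
      refine Fintype.sum_equiv (MulAut.conj h).toEquiv _ _ fun g => ?_
      simp [hφ h g]
    rw [h2, ← Finset.sum_subset (Finset.subset_univ (Finset.univ.image ι)), Finset.sum_image (fun a _ b _ h => hι h)]
    · refine Finset.sum_congr rfl fun t _ => ?_
      rw [hι.extend_apply]
    · intro x _ hx
      rw [Function.extend_apply', Pi.zero_apply, zero_mul]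
      rintro ⟨t, rfl⟩
      exact hx (Finset.mem_image_of_mem _ (Finset.mem_univ _))
  have h0 : ∀ g, IndT ι u g * conj (φ g) = (Fintype.card T : ℂ)⁻¹ * ∑ h, Function.extend ι u 0 (h * g * h⁻¹) * conj (φ g) := by
    intro g; rw [IndT, mul_assoc, Finset.sum_mul]
  simp only [ip, h0]
  rw [← Finset.mul_sum, Finset.sum_comm, Finset.sum_congr rfl fun h _ => h1 h]
  simp
  field_simp

theorem IndT_off {ι : T →* L} (hι : Function.Injective ι) {u : T → ℂ} {g : L} (h : ∀ x t, x * g * x⁻¹ = ι t → u t = 0) :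
    IndT ι u g = 0 := by
  unfold IndT
  rw [Finset.sum_eq_zero, mul_zero]
  intro x _
  by_cases hx : ∃ t, ι t = x * g * x⁻¹
  · obtain ⟨t, ht⟩ := hx
    rw [← ht, hι.extend_apply]
    exact h x t ht.symm
  · rw [Function.extend_apply' _ _ _ hx]; rfl

namespace LD
variable {ι : T →* L} {w : L} {r : T ≃* T} {Y : Subgroup T}

theorem r_mem (D : LD ι w r Y) (t : T) : r t ∈ Y ↔ t ∈ Y := by
  constructor
  · intro h; exact (Subgroup.mul_mem_cancel_left Y h).1 (D.rY t)
  · intro h; exact (Subgroup.mul_mem_cancel_right Y h).1 (D.rY t)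

theorem w_not (D : LD ι w r Y) (u : T) : ι u ≠ w := by
  intro h
  have h1 : ∀ t, r t = t := by
    intro t
    apply D.inj
    rw [D.hw, ← h, ← map_inv, ← map_mul, ← map_mul, mul_comm u t, mul_inv_cancel_right]
  have h2 : ∀ t : T, t ∈ Y := by
    intro t
    have h3 : t ^ 2 ∈ Y := by have := D.rY t; rw [h1] at this; rwa [sq]
    have h4 : t ^ Y.index ∈ Y := Subgroup.pow_index_mem Y t
    obtain ⟨k, hk⟩ := D.odd
    rw [hk, pow_succ, pow_mul] at h4
    exact (Subgroup.mul_mem_cancel_left Y (Y.pow_mem h3 k)).1 h4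
  have h3 : Y = ⊤ := by ext t; simp [h2 t]
  have := D.nine
  rw [h3] at this
  simp at this

theorem sum_two (D : LD ι w r Y) {M : Type} [AddCommMonoid M] (H : L → M)
    (hH : ∀ g, H g ≠ 0 → (∃ u, g = ι u) ∨ ∃ u, g = ι u * w) :
    ∑ g, H g = ∑ u, H (ι u) + ∑ u, H (ι u * w) := by
  classical
  have h1 : Function.Injective (Sum.elim (fun u : T => ι u) (fun u : T => ι u * w)) := by
    apply Function.Injective.sumElim D.inj
    · intro a b h; exact D.inj (mul_right_cancel h)
    · intro a b h
      apply D.w_not (b⁻¹ * a)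
      rw [map_mul, h, map_inv]; simp
  rw [← Finset.sum_subset (Finset.subset_univ (Finset.univ.image (Sum.elim (fun u : T => ι u) (fun u : T => ι u * w)))),
    Finset.sum_image (fun a _ b _ h => h1 h), Fintype.sum_sum_type]
  · rfl
  · intro g _ hg
    by_contra h
    apply hg
    rcases hH g h with ⟨u, rfl⟩ | ⟨u, rfl⟩
    · exact Finset.mem_image.2 ⟨Sum.inl u, Finset.mem_univ _, rfl⟩
    · exact Finset.mem_image.2 ⟨Sum.inr u, Finset.mem_univ _, rfl⟩

theorem conj_u (D : LD ι w r Y) (u t : T) : ι u * ι t * (ι u)⁻¹ = ι t := by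
  rw [← map_mul, mul_comm, map_mul, mul_inv_cancel_right]

theorem conj_uw (D : LD ι w r Y) (u t : T) : (ι u * w) * ι t * (ι u * w)⁻¹ = ι (r t) := by
  have : (ι u * w) * ι t * (ι u * w)⁻¹ = ι u * (w * ι t * w⁻¹) * (ι u)⁻¹ := by group
  rw [this, ← D.hw, D.conj_u]

theorem IndT_on (D : LD ι w r Y) {u : T → ℂ} (hu : ∀ y ∈ Y, u y = 0) (t : T) : IndT ι u (ι t) = u t + u (r t) := by
  by_cases ht : t ∈ Y
  · rw [hu t ht, hu _ ((D.r_mem t).2 ht), add_zero]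
    apply IndT_off D.inj
    intro x t' h
    apply hu
    by_contra ht'
    have h2 : x⁻¹ * ι t' * (x⁻¹)⁻¹ = ι t := by rw [← h]; group
    rcases D.TI t' ht' _ _ h2 with ⟨v, hv⟩ | ⟨v, hv⟩
    · rw [hv, D.conj_u] at h2
      exact ht' (D.inj h2 ▸ ht)
    · rw [hv, D.conj_uw] at h2
      exact ht' ((D.r_mem t').1 (D.inj h2 ▸ ht))
  · unfold IndT
    rw [D.sum_two]
    · simp only [D.conj_u, D.conj_uw, D.inj.extend_apply]
      have : (Fintype.card T : ℂ) ≠ 0 := by simp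
      simp; field_simp
    · intro g hg
      by_cases hx : ∃ t', ι t' = g * ι t * g⁻¹
      · obtain ⟨t', h'⟩ := hx
        exact D.TI t ht g t' h'.symm
      · exact absurd (by rw [Function.extend_apply' _ _ _ hx]; rfl) hg

open Classical in
theorem count (D : LD ι w r Y) (g : L) :
    ∑ h : L, (if ∃ t, t ∉ Y ∧ ι t = h * g * h⁻¹ then (2 * Fintype.card T : ℝ)⁻¹ else 0) ≤ 1 := by
  have hT : (0 : ℝ) < Fintype.card T := by exact_mod_cast Fintype.card_pos
  by_cases hex : ∃ h0 t0, t0 ∉ Y ∧ ι t0 = h0 * g * h0⁻¹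
  · obtain ⟨h0, t0, ht0, he⟩ := hex
    have h1 : ∑ h : L, (if ∃ t, t ∉ Y ∧ ι t = h * g * h⁻¹ then (2 * Fintype.card T : ℝ)⁻¹ else 0) =
        ∑ h : L, (if ∃ t, t ∉ Y ∧ ι t = h * ι t0 * h⁻¹ then (2 * Fintype.card T : ℝ)⁻¹ else 0) := by
      refine (Fintype.sum_equiv (Equiv.mulRight h0) _ _ fun h => ?_).symm
      have : (Equiv.mulRight h0) h * g * ((Equiv.mulRight h0) h)⁻¹ = h * ι t0 * h⁻¹ := by
        rw [he]; simp [mul_assoc]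
      rw [this]
    rw [h1, D.sum_two]
    · have h2 : ∀ f : T → L, ∑ u : T, (if ∃ t, t ∉ Y ∧ ι t = f u * ι t0 * (f u)⁻¹ then (2 * Fintype.card T : ℝ)⁻¹ else 0) ≤ 2⁻¹ := by
        intro f
        calc _ ≤ ∑ u : T, (2 * Fintype.card T : ℝ)⁻¹ := by
              apply Finset.sum_le_sum
              intro u _
              split_ifs
              · exact le_refl _
              · positivity
          _ = 2⁻¹ := by simp
      have h3 := h2 (fun u => ι u)
      have h4 := h2 (fun u => ι u * w)
      linarith
    · intro h hh
      split_ifs at hh with hc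
      · obtain ⟨t, ht, hte⟩ := hc
        exact D.TI t0 ht0 h t hte.symm
      · exact absurd rfl hh
  · rw [Finset.sum_eq_zero]
    · norm_num
    · intro h _
      rw [if_neg]
      rintro ⟨t, ht⟩
      exact hex ⟨h, t, ht⟩

open Classical in
theorem sum_bound (D : LD ι w r Y) {φ : L → ℂ} (hφ : φ ∈ irr L) :
    (Fintype.card T : ℝ)⁻¹ * ∑ t with t ∉ Y, Complex.normSq (φ (ι t)) < 2 := by
  have hT : (0 : ℝ) < Fintype.card T := by exact_mod_cast Fintype.card_pos
  have hL : (0 : ℝ) < Fintype.card L := by exact_mod_cast Fintype.card_pos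
  have h1 := sum_weight (F := fun g : L => if g = 1 then 0 else Complex.normSq (φ g))
    (w := fun g => if ∃ t, t ∉ Y ∧ ι t = g then (2 * Fintype.card T : ℝ)⁻¹ else 0)
    (fun g => by split_ifs; exact le_refl _; exact Complex.normSq_nonneg _)
    (fun h g => by simp only [(irr_isChar hφ).conj]; simp)
    (fun g _ => D.count g)
  have h2 : ∑ g : L, (if g = 1 then 0 else Complex.normSq (φ g)) < Fintype.card L := by
    have h3 := irr_nsq hφ
    unfold nsq at h3
    have h4 : ∑ x, Complex.normSq (φ x) = Fintype.card L := by
      field_simp at h3; exact h3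
    rw [← h4]
    apply Finset.sum_lt_sum
    · intro g _; split_ifs
      · exact Complex.normSq_nonneg _
      · exact le_refl _
    · refine ⟨1, Finset.mem_univ _, ?_⟩
      rw [if_pos rfl]
      obtain ⟨n, hn, h⟩ := irr_one hφ
      rw [h, Complex.normSq_pos]
      exact_mod_cast hn.ne'
  have h3 : ∑ g : L, (if ∃ t, t ∉ Y ∧ ι t = g then (2 * Fintype.card T : ℝ)⁻¹ else 0) * (if g = 1 then 0 else Complex.normSq (φ g))
      = (2 * Fintype.card T : ℝ)⁻¹ * ∑ t with t ∉ Y, Complex.normSq (φ (ι t)) := by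
    rw [← Finset.sum_subset (Finset.subset_univ (Finset.univ.image ι)), Finset.sum_image (fun a _ b _ h => D.inj h), Finset.mul_sum,
      Finset.sum_filter]
    · refine Finset.sum_congr rfl fun t _ => ?_
      by_cases ht : t ∈ Y
      · rw [if_neg, if_neg (not_not.2 ht), zero_mul]
        rintro ⟨t', ht', h⟩
        exact ht' (D.inj h ▸ ht)
      · rw [if_pos ⟨t, ht, rfl⟩, if_pos ht, if_neg]
        intro h
        rw [← map_one ι] at h
        exact ht (D.inj h ▸ Y.one_mem)
    · intro g _ hg
      rw [if_neg, zero_mul]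
      rintro ⟨t, -, rfl⟩
      exact hg (Finset.mem_image_of_mem _ (Finset.mem_univ _))
  rw [h3] at h1
  have h4 := lt_of_le_of_lt h1 h2
  have h5 : (2 * Fintype.card T : ℝ)⁻¹ * ∑ t with t ∉ Y, Complex.normSq (φ (ι t)) < 1 := by
    by_contra hcon
    push Not at hcon
    nlinarith
  rw [mul_inv, mul_assoc] at h5
  linarith

theorem mean_bound (D : LD ι w r Y) {φ : L → ℂ} (hφ : φ ∈ irr L) :
    ∑ μ, ((mm ι φ μ : ℝ) - ((cos Y μ).card : ℝ)⁻¹ * ∑ ν ∈ cos Y μ, (mm ι φ ν : ℝ)) ^ 2 < 2 := by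
  classical
  have h1 := D.sum_bound hφ
  rw [← nsq_off Y (fun t => φ (ι t))] at h1
  simp only [mm_eq ι (irr_isChar hφ)] at h1
  convert h1 using 2 with μ
  have : ((mm ι φ μ : ℂ) - (Y.index : ℂ)⁻¹ * ∑ ν ∈ cos Y μ, (mm ι φ ν : ℂ)) =
    (((mm ι φ μ : ℝ) - ((cos Y μ).card : ℝ)⁻¹ * ∑ ν ∈ cos Y μ, (mm ι φ ν : ℝ) : ℝ) : ℂ) := by
    rw [cos_card]; push_cast; rfl
  rw [this, Complex.normSq_ofReal, sq]

theorem has_maj (D : LD ι w r Y) {φ : L → ℂ} (hφ : φ ∈ irr L) (μ : Hat T) :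
    ∃ v : ℤ, ((cos Y μ).filter fun ν => mm ι φ ν ≠ v).card ≤ 3 := by
  apply comb_exists
  · rw [cos_card]; have := D.nine; omega
  · refine lt_of_le_of_lt ?_ (D.mean_bound hφ)
    calc _ = ∑ ν ∈ cos Y μ, ((mm ι φ ν : ℝ) - ((cos Y ν).card : ℝ)⁻¹ * ∑ κ ∈ cos Y ν, (mm ι φ κ : ℝ)) ^ 2 := by
          refine Finset.sum_congr rfl fun ν hν => ?_
          rw [cos_eq (mem_cos.1 hν)]
      _ ≤ _ := Finset.sum_le_sum_of_subset_of_nonneg (Finset.subset_univ _) fun _ _ _ => sq_nonneg _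

theorem cos_double (Y : Subgroup T) (g : Hat T → ℝ) : ∑ μ, ∑ ν ∈ cos Y μ, g ν = Y.index * ∑ ν, g ν := by
  classical
  simp only [cos, Finset.sum_filter]
  rw [Finset.sum_comm, Finset.mul_sum]
  refine Finset.sum_congr rfl fun ν _ => ?_
  rw [← Finset.sum_filter, Finset.sum_const, nsmul_eq_mul, ← cos_card Y ν]
  congr 3
  ext μ
  simp only [Finset.mem_filter, Finset.mem_univ, true_and, mem_cos]
  exact ⟨ceq.symm, ceq.symm⟩

theorem dd_sq (D : LD ι w r Y) {φ : L → ℂ} (hφ : φ ∈ irr L) : ∑ μ, dd ι Y φ μ ^ 2 ≤ 2 := by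
  have h1 : ∀ μ, (2 : ℝ) * ∑ ν ∈ cos Y μ, ((dd ι Y φ ν : ℝ)) ^ 2 ≤
      3 * ∑ ν ∈ cos Y μ, ((mm ι φ ν : ℝ) - ((cos Y ν).card : ℝ)⁻¹ * ∑ κ ∈ cos Y ν, (mm ι φ κ : ℝ)) ^ 2 := by
    intro μ
    have := comb_bound (cos Y μ) (mm ι φ) (by rw [cos_card]; exact D.nine) _ (maj_spec D.nine (D.has_maj hφ μ))
    convert this using 2
    · refine Finset.sum_congr rfl fun ν hν => ?_
      rw [dd, maj_congr (mem_cos.1 hν)]; push_cast; rfl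
    · refine Finset.sum_congr rfl fun ν hν => ?_
      rw [cos_eq (mem_cos.1 hν)]
  have h2 := Finset.sum_le_sum fun μ (_ : μ ∈ Finset.univ) => h1 μ
  rw [← Finset.mul_sum, ← Finset.mul_sum, cos_double, cos_double] at h2
  have h3 := D.mean_bound hφ
  have hN : (0 : ℝ) < Y.index := by have := D.nine; exact_mod_cast (by omega : 0 < Y.index)
  have h4 : (∑ μ, (dd ι Y φ μ : ℝ) ^ 2) < 3 := by
    by_contra hcon
    push Not at hcon
    nlinarith
  have h5 : ∑ μ, dd ι Y φ μ ^ 2 < 3 := by exact_mod_cast h4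
  omega

theorem dd_diff {φ : L → ℂ} {μ ν : Hat T} (h : ceq Y μ ν) : dd ι Y φ μ - dd ι Y φ ν = mm ι φ μ - mm ι φ ν := by
  unfold dd; rw [maj_congr h]; ring

theorem rm_rm (D : LD ι w r Y) (μ : Hat T) : rm r (rm r μ) = μ := by
  ext t; simp [rm_apply, D.rr]

theorem rm_ceq (D : LD ι w r Y) {μ ν : Hat T} (h : ceq Y μ ν) : ceq Y (rm r μ) (rm r ν) := by
  intro y hy; rw [rm_apply, rm_apply]; exact h _ ((D.r_mem y).2 hy)

theorem mm_rm (D : LD ι w r Y) {φ : L → ℂ} (hφ : φ ∈ irr L) (μ : Hat T) : mm ι φ (rm r μ) = mm ι φ μ := by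
  have h1 := co_equiv (fun t => φ (ι t)) r μ
  have h2 : (fun t => φ (ι (r t))) = fun t => φ (ι t) := by
    funext t; rw [D.hw, (irr_isChar hφ).conj]
  rw [h2] at h1
  simp only [mm]; rw [← h1]; rfl

theorem dd_rm (D : LD ι w r Y) {φ : L → ℂ} (hφ : φ ∈ irr L) (μ : Hat T) : dd ι Y φ (rm r μ) = dd ι Y φ μ := by
  unfold dd
  rw [D.mm_rm hφ, maj_nat D.nine (f := rm r) (M := mm ι φ) ?_ (fun _ _ => D.rm_ceq) (D.mm_rm hφ) (D.has_maj hφ μ)]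
  intro a b h
  rw [← D.rm_rm a, h, D.rm_rm]

theorem dd_excl (D : LD ι w r Y) {φ : L → ℂ} (hφ : φ ∈ irr L) {μ κ : Hat T} (h1 : rm r μ ≠ μ) (h2 : κ ≠ μ) (h3 : κ ≠ rm r μ) :
    dd ι Y φ μ * dd ι Y φ κ = 0 := by
  classical
  by_contra hne
  obtain ⟨ha, hb⟩ := mul_ne_zero_iff.1 hne
  have h4 : ∑ ν ∈ ({κ, rm r μ, μ} : Finset (Hat T)), dd ι Y φ ν ^ 2 ≤ 2 :=
    (Finset.sum_le_sum_of_subset_of_nonneg (Finset.subset_univ _) fun _ _ _ => sq_nonneg _).trans (D.dd_sq hφ)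
  rw [Finset.sum_insert (by simp [h2, h3]), Finset.sum_pair h1, D.dd_rm hφ] at h4
  have : 0 < dd ι Y φ μ ^ 2 := by positivity
  have : 0 < dd ι Y φ κ ^ 2 := by positivity
  omega

theorem fixed_unique (D : LD ι w r Y) {μ ν : Hat T} (h : ceq Y μ ν) (h1 : rm r μ = μ) (h2 : rm r ν = ν) : μ = ν := by
  have h3 : ∀ t, (μ * ν⁻¹) t = 1 := by
    intro t
    have hy : ∀ y ∈ Y, (μ * ν⁻¹) y = 1 := fun y hy => by simp [h y hy]
    have hr : (μ * ν⁻¹) (r t) = (μ * ν⁻¹) t := by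
      have e1 : μ (r t) = μ t := by rw [← rm_apply, h1]
      have e2 : ν (r t) = ν t := by rw [← rm_apply, h2]
      simp [e1, e2]
    have h4 : ((μ * ν⁻¹) t) ^ 2 = 1 := by
      have := hy _ (D.rY t)
      rw [map_mul, hr] at this
      rw [sq]; exact this
    have h5 : ((μ * ν⁻¹) t) ^ Y.index = 1 := by
      rw [← map_pow]; exact hy _ (Subgroup.pow_index_mem Y t)
    obtain ⟨k, hk⟩ := D.odd
    rw [hk, pow_succ, pow_mul, h4, one_pow, one_mul] at h5
    exact h5
  ext t
  have := h3 t
  rw [MonoidHom.mul_apply, MonoidHom.inv_apply, mul_inv_eq_one] at this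
  rw [this]

theorem pick (D : LD ι w r Y) (κ : Hat T) (S : Finset (Hat T)) (hS : S.card ≤ 7) :
    ∃ κ', ceq Y κ κ' ∧ κ' ∉ S ∧ rm r κ' ≠ κ' := by
  classical
  by_contra hcon
  push Not at hcon
  have h1 : cos Y κ ⊆ S ∪ (cos Y κ).filter fun ν => rm r ν = ν := by
    intro ν hν
    rw [Finset.mem_union, Finset.mem_filter]
    by_cases h : ν ∈ S
    · exact Or.inl h
    · exact Or.inr ⟨hν, hcon ν (mem_cos.1 hν) h⟩
  have h2 : ((cos Y κ).filter fun ν => rm r ν = ν).card ≤ 1 := by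
    rw [Finset.card_le_one]
    intro a ha b hb
    rw [Finset.mem_filter, mem_cos] at ha hb
    exact D.fixed_unique (ha.1.symm.trans hb.1) ha.2 hb.2
  have h3 := (Finset.card_le_card h1).trans (Finset.card_union_le _ _)
  rw [cos_card] at h3
  have := D.nine
  omega

end LD
end

section
variable {L T : Type} [Group L] [Fintype L] [CommGroup T] [Fintype T]

theorem ip_sub_right {L : Type} [Fintype L] (f g g' : L → ℂ) : ip f (fun x => g x - g' x) = ip f g - ip f g' := by
  rw [← ip_conj, ip_sub_left, map_sub, ip_conj, ip_conj]

theorem ip_add_right {L : Type} [Fintype L] (f g g' : L → ℂ) : ip f (fun x => g x + g' x) = ip f g + ip f g' := by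
  rw [← ip_conj, ip_add_left, map_add, ip_conj, ip_conj]

theorem ip_hat_mm (ι : T →* L) {φ : L → ℂ} (hφ : IsChar φ) (μ : Hat T) :
    ip (fun t => (μ t : ℂ)) (fun t => φ (ι t)) = (mm ι φ μ : ℂ) := by
  rw [← ip_conj]
  have := mm_eq ι hφ μ
  unfold co at this
  rw [this]; simp

theorem hat_ip [DecidableEq (Hat T)] (μ ν : Hat T) : ip (fun t => (μ t : ℂ)) (fun t => (ν t : ℂ)) = if μ = ν then 1 else 0 := hat_orth μ ν

noncomputable def DD (ι : T →* L) (Y : Subgroup T) (F : L → ℂ) (μ : Hat T) : ℂ := ∑ φ ∈ irr L, ip F φ * (dd ι Y φ μ : ℂ)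

theorem DD_sub (ι : T →* L) (Y : Subgroup T) (F H : L → ℂ) (μ : Hat T) :
    DD ι Y (fun g => F g - H g) μ = DD ι Y F μ - DD ι Y H μ := by
  simp only [DD, ip_sub_left, sub_mul, Finset.sum_sub_distrib]

theorem DD_smul (ι : T →* L) (Y : Subgroup T) (c : ℂ) (F : L → ℂ) (μ : Hat T) :
    DD ι Y (fun g => c * F g) μ = c * DD ι Y F μ := by
  simp only [DD, ip_smul_left, mul_assoc, Finset.mul_sum]

theorem co_class (ι : T →* L) {F : L → ℂ} (hF : IsClass F) (μ : Hat T) :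
    co (fun t => F (ι t)) μ = ∑ φ ∈ irr L, ip F φ * (mm ι φ μ : ℂ) := by
  have : (fun t => F (ι t)) = fun t => ∑ φ ∈ irr L, ip F φ * φ (ι t) := by
    funext t; exact irr_expand hF _
  rw [this, co, ip_sum_left]
  refine Finset.sum_congr rfl fun φ hφ => ?_
  rw [ip_smul_left]
  congr 1
  exact mm_eq ι (irr_isChar hφ) μ

theorem DD_const (ι : T →* L) (Y : Subgroup T) {F : L → ℂ} (hF : IsClass F) {μ ν : Hat T} (h : ceq Y μ ν) :
    co (fun t => F (ι t)) μ - DD ι Y F μ = co (fun t => F (ι t)) ν - DD ι Y F ν := by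
  rw [co_class ι hF, co_class ι hF, DD, DD, ← Finset.sum_sub_distrib, ← Finset.sum_sub_distrib]
  refine Finset.sum_congr rfl fun φ hφ => ?_
  have := LD.dd_diff (ι := ι) (φ := φ) h
  have h2 : (dd ι Y φ μ : ℂ) - dd ι Y φ ν = mm ι φ μ - mm ι φ ν := by exact_mod_cast this
  linear_combination (-ip F φ) * h2

theorem cos_doubleC (Y : Subgroup T) (g : Hat T → ℂ) : ∑ μ, ∑ ν ∈ cos Y μ, g ν = Y.index * ∑ ν, g ν := by
  classical
  simp only [cos, Finset.sum_filter]
  rw [Finset.sum_comm, Finset.mul_sum]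
  refine Finset.sum_congr rfl fun ν _ => ?_
  rw [← Finset.sum_filter, Finset.sum_const, nsmul_eq_mul, ← cos_card Y ν]
  congr 3
  ext μ
  simp only [Finset.mem_filter, Finset.mem_univ, true_and, mem_cos]
  exact ⟨ceq.symm, ceq.symm⟩

namespace LD
variable {ι : T →* L} {w : L} {r : T ≃* T} {Y : Subgroup T}

theorem DD_rm (D : LD ι w r Y) (F : L → ℂ) (μ : Hat T) : DD ι Y F (rm r μ) = DD ι Y F μ := by
  unfold DD
  refine Finset.sum_congr rfl fun φ hφ => ?_
  rw [D.dd_rm hφ]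

theorem diff_id [DecidableEq (Hat T)] (D : LD ι w r Y) {μ μ' κ κ' : Hat T} (h : ceq Y μ μ') (h' : ceq Y κ κ') :
    ∑ φ ∈ irr L, (mm ι φ μ - mm ι φ μ') * (mm ι φ κ - mm ι φ κ') =
      ((if μ = κ then 1 else 0) - (if μ' = κ then 1 else 0) - (if μ = κ' then 1 else 0) + (if μ' = κ' then 1 else 0))
      + ((if rm r μ = κ then 1 else 0) - (if rm r μ' = κ then 1 else 0) - (if rm r μ = κ' then 1 else 0) + (if rm r μ' = κ' then 1 else 0) : ℤ) := by
  set u : T → ℂ := fun t => (μ t : ℂ) - (μ' t : ℂ) with hu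
  set v : T → ℂ := fun t => (κ t : ℂ) - (κ' t : ℂ) with hv
  have hu0 : ∀ y ∈ Y, u y = 0 := fun y hy => by simp [hu, h y hy]
  have hv0 : ∀ y ∈ Y, v y = 0 := fun y hy => by simp [hv, h' y hy]
  have h1 : ip (IndT ι u) (IndT ι v) = ∑ φ ∈ irr L, ip (IndT ι u) φ * conj (ip (IndT ι v) φ) := by
    rw [ip_eq_irr (IndT_class ι u)]
  have h2 : ip (IndT ι u) (IndT ι v) = ip u (fun t => v t + v (r t)) := by
    rw [IndT_ip D.inj u (IndT_class ι v)]
    congr 1; funext t; exact D.IndT_on hv0 t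
  rw [h1] at h2
  have hr : ∀ a b : Hat T, ip (fun t => (a t : ℂ)) (fun t => (b (r t) : ℂ)) = if rm r a = b then 1 else 0 := by
    intro a b
    have := hat_ip a (rm r b)
    simp only [rm_apply] at this
    rw [this]
    have hiff : a = rm r b ↔ rm r a = b := ⟨fun e => by rw [e, D.rm_rm], fun e => by rw [← e, D.rm_rm]⟩
    simp [hiff]
  have h3 : ip u (fun t => v t + v (r t)) = ((((if μ = κ then 1 else 0) - (if μ' = κ then 1 else 0) - (if μ = κ' then 1 else 0) + (if μ' = κ' then 1 else 0))
      + ((if rm r μ = κ then 1 else 0) - (if rm r μ' = κ then 1 else 0) - (if rm r μ = κ' then 1 else 0) + (if rm r μ' = κ' then 1 else 0) : ℤ) : ℤ) : ℂ) := by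
    rw [ip_add_right]
    simp only [hu, hv]
    rw [ip_sub_left, ip_sub_left, ip_sub_right, ip_sub_right, ip_sub_right, ip_sub_right, hat_ip, hat_ip, hat_ip, hat_ip, hr, hr, hr, hr]
    push_cast
    ring
  rw [h3] at h2
  have h4 : ∀ φ ∈ irr L, ip (IndT ι u) φ * conj (ip (IndT ι v) φ) =
      (((mm ι φ μ - mm ι φ μ') * (mm ι φ κ - mm ι φ κ') : ℤ) : ℂ) := by
    intro φ hφ
    have hc := irr_isChar hφ
    rw [IndT_ip D.inj u hc.isClass, IndT_ip D.inj v hc.isClass]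
    simp only [hu, hv]
    rw [ip_sub_left, ip_sub_left, ip_hat_mm ι hc, ip_hat_mm ι hc, ip_hat_mm ι hc, ip_hat_mm ι hc]
    push_cast
    simp
  rw [Finset.sum_congr rfl h4] at h2
  exact_mod_cast h2

theorem gram [DecidableEq (Hat T)] (D : LD ι w r Y) (μ κ : Hat T) :
    ∑ φ ∈ irr L, dd ι Y φ μ * dd ι Y φ κ = (if μ = κ then 1 else 0) + (if rm r μ = κ then 1 else 0) := by
  obtain ⟨κ', hk1, hk2, hk3⟩ := D.pick κ {μ, rm r μ} ((Finset.card_insert_le _ _).trans (by simp))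
  obtain ⟨μ', hm1, hm2, hm3⟩ := D.pick μ {κ, rm r κ, κ', rm r κ'} (by
    refine (Finset.card_insert_le _ _).trans ?_
    have h1 := Finset.card_insert_le (rm r κ) {κ', rm r κ'}
    have h2 := Finset.card_insert_le κ' {rm r κ'}
    simp at h2 ⊢; omega)
  simp only [Finset.mem_insert, Finset.mem_singleton, not_or] at hk2 hm2
  have sw : ∀ a b : Hat T, rm r a = b → a = rm r b := fun a b e => by rw [← e, D.rm_rm]
  have h1 := D.diff_id hm1 hk1
  have h2 : ∀ φ ∈ irr L, (mm ι φ μ - mm ι φ μ') * (mm ι φ κ - mm ι φ κ') = dd ι Y φ μ * dd ι Y φ κ := by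
    intro φ hφ
    rw [← dd_diff hm1, ← dd_diff hk1]
    have e1 := D.dd_excl hφ (μ := μ') (κ := κ) hm3 (Ne.symm hm2.1) (fun e => hm2.2.1 (sw _ _ e.symm))
    have e2 := D.dd_excl hφ (μ := μ') (κ := κ') hm3 (Ne.symm hm2.2.2.1) (fun e => hm2.2.2.2 (sw _ _ e.symm))
    have e3 := D.dd_excl hφ (μ := κ') (κ := μ) hk3 (Ne.symm hk2.1) (fun e => hk2.2 (sw _ _ e.symm))
    linear_combination -e1 + e2 - e3
  rw [Finset.sum_congr rfl h2] at h1
  rw [h1, if_neg hm2.1, if_neg (Ne.symm hk2.1), if_neg hm2.2.2.1, if_neg (fun e => hm2.2.1 (sw _ _ e)),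
    if_neg (c := rm r μ = κ') (fun e => hk2.2 e.symm), if_neg (fun e => hm2.2.2.2 (sw _ _ e))]
  ring

theorem DD_sq (D : LD ι w r Y) {F : L → ℂ} (hF : IsClass F) (c : (L → ℂ) → ℤ) (hc : ∀ φ ∈ irr L, ip F φ = c φ) :
    ∑ μ, Complex.normSq (DD ι Y F μ) ≤ 2 * nsq F := by
  classical
  set d : Hat T → ℤ := fun μ => ∑ φ ∈ irr L, c φ * dd ι Y φ μ with hd
  have h1 : ∀ μ, DD ι Y F μ = (d μ : ℂ) := by
    intro μ
    simp only [DD, hd]; push_cast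
    exact Finset.sum_congr rfl fun φ hφ => by rw [hc φ hφ]
  have h2 : nsq F = ((∑ φ ∈ irr L, c φ ^ 2 : ℤ) : ℝ) := by
    rw [nsq_eq_irr hF]; push_cast
    refine Finset.sum_congr rfl fun φ hφ => ?_
    rw [hc φ hφ, Complex.normSq_intCast, sq]
  have h3 : ∑ μ, Complex.normSq (DD ι Y F μ) = ((∑ μ, d μ ^ 2 : ℤ) : ℝ) := by
    push_cast
    refine Finset.sum_congr rfl fun μ _ => ?_
    rw [h1, Complex.normSq_intCast, sq]
  rw [h2, h3]
  have hdr : ∀ μ, d (rm r μ) = d μ := fun μ => by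
    simp only [hd]; exact Finset.sum_congr rfl fun φ hφ => by rw [D.dd_rm hφ]
  have h4 : (0 : ℤ) ≤ ∑ φ ∈ irr L, (2 * c φ - ∑ μ, d μ * dd ι Y φ μ) ^ 2 := Finset.sum_nonneg fun _ _ => sq_nonneg _
  have h5 : ∑ φ ∈ irr L, (2 * c φ - ∑ μ, d μ * dd ι Y φ μ) ^ 2 =
      4 * ∑ φ ∈ irr L, c φ ^ 2 - 4 * ∑ φ ∈ irr L, c φ * ∑ μ, d μ * dd ι Y φ μ + ∑ φ ∈ irr L, (∑ μ, d μ * dd ι Y φ μ) ^ 2 := by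
    rw [Finset.mul_sum, Finset.mul_sum, ← Finset.sum_sub_distrib, ← Finset.sum_add_distrib]
    exact Finset.sum_congr rfl fun φ hφ => by ring
  have h6 : ∑ φ ∈ irr L, c φ * ∑ μ, d μ * dd ι Y φ μ = ∑ μ, d μ ^ 2 := by
    simp only [Finset.mul_sum]
    rw [Finset.sum_comm]
    refine Finset.sum_congr rfl fun μ _ => ?_
    rw [sq]; nth_rewrite 3 [hd]
    rw [Finset.mul_sum]
    exact Finset.sum_congr rfl fun φ hφ => by ring
  have h7 : ∑ φ ∈ irr L, (∑ μ, d μ * dd ι Y φ μ) ^ 2 = 2 * ∑ μ, d μ ^ 2 := by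
    simp only [sq, Finset.sum_mul_sum]
    rw [Finset.sum_comm, Finset.mul_sum]
    refine Finset.sum_congr rfl fun μ _ => ?_
    rw [Finset.sum_comm]
    have : ∀ κ, ∑ φ ∈ irr L, d μ * dd ι Y φ μ * (d κ * dd ι Y φ κ) = d μ * d κ * ((if μ = κ then 1 else 0) + (if rm r μ = κ then 1 else 0)) := by
      intro κ
      rw [← D.gram, Finset.mul_sum]
      exact Finset.sum_congr rfl fun φ hφ => by ring
    simp only [this, mul_add, Finset.sum_add_distrib, mul_ite, mul_one, mul_zero, Finset.sum_ite_eq, Finset.mem_univ, if_true, hdr]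
    ring
  rw [h5, h6, h7] at h4
  have : ∑ μ, d μ ^ 2 ≤ 2 * ∑ φ ∈ irr L, c φ ^ 2 := by linarith
  exact_mod_cast this

theorem co_rm (D : LD ι w r Y) {k : T → ℂ} (hk : ∀ t, k (r t) = k t) (μ : Hat T) : co k (rm r μ) = co k μ := by
  have := co_equiv k r μ
  rw [show (fun t => k (r t)) = k from funext hk] at this
  exact this

theorem IndT_coef (D : LD ι w r Y) (k : T → ℂ) {φ : L → ℂ} (hφ : φ ∈ irr L) :
    ip (IndT ι k) φ = ∑ μ, co k μ * (mm ι φ μ : ℂ) := by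
  rw [IndT_ip D.inj k (irr_isChar hφ).isClass]
  have : k = fun t => ∑ μ : Hat T, co k μ * (μ t : ℂ) := funext fun t => co_inv k t
  nth_rewrite 1 [this]
  rw [ip_sum_left]
  exact Finset.sum_congr rfl fun μ _ => by rw [ip_smul_left, ip_hat_mm ι (irr_isChar hφ)]

theorem DD_IndT (D : LD ι w r Y) {k : T → ℂ} (hk : ∀ t, k (r t) = k t) (hY : ∀ y ∈ Y, k y = 0) (μ : Hat T) :
    DD ι Y (IndT ι k) μ = 2 * co k μ := by
  classical
  have hz : ∀ ν, ∑ κ ∈ cos Y ν, co k κ = 0 := by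
    intro ν
    have h := co_restrict Y k ν
    have h0 : (fun t => if t ∈ Y then k t else 0) = fun _ => 0 := by
      funext t; split_ifs with ht
      · exact hY t ht
      · rfl
    rw [h0] at h
    have h1 : co (fun _ : T => (0 : ℂ)) ν = 0 := by simp [co, ip]
    rw [h1] at h
    exact (mul_eq_zero.1 h.symm).resolve_left (inv_ne_zero (index_ne Y))
  have hm : ∀ φ, ∑ κ, co k κ * (maj Y (mm ι φ) κ : ℂ) = 0 := by
    intro φ
    have h1 := cos_doubleC Y (fun κ => co k κ * (maj Y (mm ι φ) κ : ℂ))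
    have h2 : ∀ ν, ∑ κ ∈ cos Y ν, co k κ * (maj Y (mm ι φ) κ : ℂ) = 0 := by
      intro ν
      have : ∀ κ ∈ cos Y ν, co k κ * (maj Y (mm ι φ) κ : ℂ) = co k κ * (maj Y (mm ι φ) ν : ℂ) := by
        intro κ hκ
        rw [maj_congr (mem_cos.1 hκ)]
      rw [Finset.sum_congr rfl this, ← Finset.sum_mul, hz, zero_mul]
    simp only [h2, Finset.sum_const_zero] at h1
    exact (mul_eq_zero.1 h1.symm).resolve_left (index_ne Y)
  have hc : ∀ φ ∈ irr L, ip (IndT ι k) φ * (dd ι Y φ μ : ℂ) = ∑ κ, co k κ * ((dd ι Y φ κ : ℂ) * dd ι Y φ μ) := by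
    intro φ hφ
    have h1 : ip (IndT ι k) φ = ∑ κ, co k κ * (dd ι Y φ κ : ℂ) := by
      rw [D.IndT_coef k hφ, ← sub_zero (∑ κ, co k κ * (mm ι φ κ : ℂ)), ← hm φ, ← Finset.sum_sub_distrib]
      refine Finset.sum_congr rfl fun κ _ => ?_
      unfold dd; push_cast; ring
    rw [h1, Finset.sum_mul]
    exact Finset.sum_congr rfl fun κ _ => by ring
  rw [DD, Finset.sum_congr rfl hc, Finset.sum_comm]
  have hg : ∀ κ, ∑ φ ∈ irr L, co k κ * ((dd ι Y φ κ : ℂ) * dd ι Y φ μ) = co k κ * ((if κ = μ then 1 else 0) + (if κ = rm r μ then 1 else 0)) := by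
    intro κ
    have h1 := D.gram κ μ
    have h2 : ∑ φ ∈ irr L, ((dd ι Y φ κ : ℂ) * dd ι Y φ μ) = (if κ = μ then 1 else 0) + (if rm r κ = μ then 1 else 0) := by
      exact_mod_cast h1
    have hiff : rm r κ = μ ↔ κ = rm r μ := ⟨fun e => by rw [← e, D.rm_rm], fun e => by rw [e, D.rm_rm]⟩
    rw [← Finset.mul_sum, h2]
    simp only [hiff]
  simp only [hg, mul_add, Finset.sum_add_distrib, mul_ite, mul_one, mul_zero, Finset.sum_ite_eq', Finset.mem_univ, if_true, D.co_rm hk]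
  ring

/-- naturality of `DD` -/
theorem DD_nat (D : LD ι w r Y) (f : Hat T → Hat T) (hf : Function.Injective f)
    (hfc : ∀ μ ν, ceq Y μ ν → ceq Y (f μ) (f ν)) (Φ : (L → ℂ) → (L → ℂ)) (hΦ : Function.Injective Φ)
    (hΦi : ∀ φ ∈ irr L, Φ φ ∈ irr L) (hM : ∀ φ ∈ irr L, ∀ μ, mm ι (Φ φ) (f μ) = mm ι φ μ)
    {F F' : L → ℂ} (hip : ∀ φ ∈ irr L, ip F' (Φ φ) = ip F φ) (μ : Hat T) : DD ι Y F' (f μ) = DD ι Y F μ := by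
  classical
  have h1 : irr L = (irr L).image Φ := by
    symm
    apply Finset.eq_of_subset_of_card_le
    · intro ψ hψ
      obtain ⟨φ, hφ, rfl⟩ := Finset.mem_image.1 hψ
      exact hΦi φ hφ
    · rw [Finset.card_image_of_injective _ hΦ]
  unfold DD
  rw [h1, Finset.sum_image (fun a _ b _ h => hΦ h), ← h1]
  refine Finset.sum_congr rfl fun φ hφ => ?_
  rw [hip φ hφ]
  unfold dd
  rw [hM φ hφ, maj_nat D.nine hf hfc (hM φ hφ) (D.has_maj hφ μ)]

theorem DD_pow (D : LD ι w r Y) {s : ℕ} (hs : s.Coprime (Fintype.card L)) (hsT : s.Coprime (Fintype.card T)) {n : ℕ} (hn : (Fintype.card T) ∣ n) {s' : ℕ}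
    (hss : s * s' ≡ 1 [MOD n]) (F : L → ℂ) (μ : Hat T) :
    DD ι Y (fun g => F (g ^ s)) (μ ^ s) = DD ι Y F μ := by
  have hb : Function.Bijective (fun g : L => g ^ s) := (powCoprime (by rw [Nat.card_eq_fintype_card]; exact hs.symm)).bijective
  refine D.DD_nat (fun μ => μ ^ s) ?_ ?_ (fun φ g => φ (g ^ s)) ?_ ?_ ?_ ?_ μ
  · intro a b h
    have h2 : ∀ a : Hat T, (a ^ s) ^ s' = a := by
      intro a
      ext t
      have h3 : (a t) ^ n = 1 := by rw [← MonoidHom.pow_apply, hat_pow a hn]; rfl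
      have h4 := pow_modEq' h3 hss
      rw [pow_mul, pow_one] at h4
      rw [MonoidHom.pow_apply, MonoidHom.pow_apply, h4]
    have h' : a ^ s = b ^ s := h
    rw [← h2 a, h', h2]
  · intro a b h y hy
    show (a y) ^ s = (b y) ^ s
    rw [h y hy]
  · intro a b h
    funext g
    obtain ⟨g', rfl⟩ := hb.2 g
    exact congrFun h g'
  · intro φ hφ; exact irr_pow hφ hs
  · intro φ hφ μ
    have := co_pow (fun t => φ (ι t)) hsT μ
    simp only [mm, ← map_pow]
    rw [← this]
  · intro φ hφ
    simp only [ip]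
    congr 1
    exact Fintype.sum_bijective _ hb _ _ fun g => rfl

theorem DD_aut (D : LD ι w r Y) (θ : L ≃* L) (θ' : T ≃* T) (hθ : ∀ t, θ (ι t) = ι (θ' t)) (hY : ∀ t ∈ Y, θ' t ∈ Y) (F : L → ℂ) (μ : Hat T) :
    DD ι Y (fun g => F (θ g)) (rm θ' μ) = DD ι Y F μ := by
  refine D.DD_nat (rm θ') ?_ ?_ (fun φ g => φ (θ g)) ?_ ?_ ?_ ?_ μ
  · intro a b h
    ext t
    have := congrArg (fun c : Hat T => c (θ'.symm t)) h
    simp only [rm_apply, MulEquiv.apply_symm_apply] at this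
    rw [this]
  · intro a b h y hy
    exact h _ (hY y hy)
  · intro a b h
    funext g
    have := congrFun h (θ.symm g)
    simpa using this
  · intro φ hφ; exact irr_aut hφ θ
  · intro φ hφ μ
    have := co_equiv (fun t => φ (ι t)) θ' μ
    simp only [mm, hθ]
    rw [← this]; rfl
  · intro φ hφ
    simp only [ip]
    congr 1
    exact Fintype.sum_bijective _ θ.bijective _ _ fun g => rfl

/-- central characters -/
theorem DD_central (D : LD ι w r Y) {z : T} (hz : z ∈ Y) (hzc : ∀ g, ι z * g = g * ι z) {F : L → ℂ} {μ : Hat T} (h : DD ι Y F μ ≠ 0) :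
    ∃ φ ∈ irr L, ip F φ ≠ 0 ∧ ∀ g, φ (ι z * g) = μ z * φ g := by
  classical
  obtain ⟨φ, hφ, hne⟩ := Finset.exists_ne_zero_of_sum_ne_zero h
  obtain ⟨h1, h2⟩ := mul_ne_zero_iff.1 hne
  refine ⟨φ, hφ, h1, ?_⟩
  obtain ⟨ω, hω⟩ := irr_central hφ hzc
  by_contra hcon
  have hωμ : ω ≠ μ z := by
    intro e; apply hcon; intro g; rw [hω, e]
  have h3 : ∀ ν, ceq Y μ ν → mm ι φ ν = 0 := by
    intro ν hν
    have e1 : (ν z : ℂ) * co (fun t => φ (ι t)) ν = ω * co (fun t => φ (ι t)) ν := by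
      simp only [co]
      rw [← ip_smul_left ω]
      have e2 : (fun t => ω * φ (ι t)) = fun t => φ (ι (z * t)) := by
        funext t; rw [map_mul, hω]
      rw [e2]
      simp only [ip, Finset.mul_sum]
      symm
      refine Fintype.sum_equiv (Equiv.mulLeft z) _ _ fun t => ?_
      simp only [Equiv.coe_mulLeft, hat_conj, mul_inv_rev, map_mul, Units.val_mul]
      have : (ν z : ℂ) * (ν z⁻¹ : ℂ) = 1 := by rw [← Units.val_mul, ← map_mul]; simp
      linear_combination (-(Fintype.card T : ℂ)⁻¹ * φ (ι z * ι t) * (ν t⁻¹ : ℂ)) * this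
    rw [mm_eq ι (irr_isChar hφ), ← hν z hz] at e1
    have e3 : ((μ z : ℂ) - ω) * (mm ι φ ν : ℂ) = 0 := by linear_combination e1
    rcases mul_eq_zero.1 e3 with e | e
    · exact absurd (sub_eq_zero.1 e).symm hωμ
    · exact_mod_cast e
  apply h2
  have h4 : maj Y (mm ι φ) μ = 0 := by
    apply maj_eq D.nine
    rw [Finset.filter_eq_empty_iff.2]
    · simp
    · intro ν hν; rw [h3 ν (mem_cos.1 hν)]; simp
  rw [dd, h4, h3 μ (ceq.refl μ)]; simp

theorem even_sum (D : LD ι w r Y) (K : Hat T → ℤ) (hK : ∀ μ, K (rm r μ) = K μ) (hf : ∀ μ, rm r μ = μ → Even (K μ)) {φ : L → ℂ} (hφ : φ ∈ irr L) :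
    Even (∑ μ, K μ * mm ι φ μ) := by
  rw [← ZMod.intCast_eq_zero_iff_even]
  push_cast
  refine Finset.sum_involution (fun μ _ => rm r μ) ?_ ?_ (fun _ _ => Finset.mem_univ _) (fun μ _ => D.rm_rm μ)
  · intro μ _
    rw [hK, D.mm_rm hφ, ← two_mul, show (2 : ZMod 2) = 0 from rfl, zero_mul]
  · intro μ _ hne he
    apply hne
    rw [(ZMod.intCast_eq_zero_iff_even).2 (hf μ he), zero_mul]

end LD
end

theorem orb_existsC {H : Type} [CommGroup H] {n s : ℕ} (hn : 0 < n) (hH : ∀ μ : H, μ ^ n = 1) (hs : s.Coprime n)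
    {a M : H → ℂ} (ha : ∀ μ, a (μ ^ s) = M (μ ^ s) - M μ) {μ : H} (hμ : a μ ≠ 0) :
    ∃ i : ℕ, a (μ ^ (s ^ i)) ≠ 0 ∧ μ ^ (s ^ i) ≠ μ := by
  by_contra hcon
  push Not at hcon
  set N := Nat.totient n
  have hN : 0 < N := Nat.totient_pos.2 hn
  have hsN : μ ^ (s ^ N) = μ := by
    have := Nat.ModEq.pow_totient hs
    conv_rhs => rw [← pow_one μ]
    exact pow_modEq' (hH μ) this
  have h1 : ∑ i ∈ Finset.range N, a (μ ^ (s ^ (i + 1))) = 0 := by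
    have : ∀ i, a (μ ^ (s ^ (i + 1))) = M (μ ^ (s ^ (i + 1))) - M (μ ^ (s ^ i)) := by
      intro i; rw [pow_succ, pow_mul, ha]
    rw [Finset.sum_congr rfl fun i _ => this i, Finset.sum_range_sub (fun i => M (μ ^ (s ^ i)))]
    simp [hsN]
  have h2 : ∀ i, a (μ ^ (s ^ i)) = (if a (μ ^ (s ^ i)) = 0 then 0 else 1 : ℕ) * a μ := by
    intro i
    by_cases h : a (μ ^ (s ^ i)) = 0
    · rw [if_pos h, h]; simp
    · rw [if_neg h, hcon i h]; simp
  rw [Finset.sum_congr rfl fun i _ => h2 (i + 1), ← Finset.sum_mul, ← Nat.cast_sum] at h1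
  rcases mul_eq_zero.1 h1 with h | h
  · obtain ⟨k, hk⟩ : ∃ k, N = k + 1 := ⟨N - 1, by omega⟩
    have h3 : ∑ i ∈ Finset.range N, (if a (μ ^ s ^ (i + 1)) = 0 then 0 else 1 : ℕ) = 0 := by exact_mod_cast h
    rw [hk, Finset.sum_range_succ, ← hk, hsN, if_neg hμ] at h3
    omega
  · exact hμ h

structure R2 {G T : Type} [Group G] [CommGroup T] (ι : T →* G) (x y : T) (w1 w3 : G) (r1 r3 : T ≃* T) (q N : ℕ) : Prop where
  inj : Function.Injective ι
  hN : N ∣ q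
  N9 : 9 ≤ N
  odd : Odd N
  xN : x ^ N = 1
  yN : y ^ N = 1
  ind : ∀ i j : ℤ, x ^ i * y ^ j = 1 → (N : ℤ) ∣ i ∧ (N : ℤ) ∣ j
  hr1 : ∀ t, ι (r1 t) = w1 * ι t * w1⁻¹
  hr3 : ∀ t, ι (r3 t) = w3 * ι t * w3⁻¹
  r1x : r1 x = x
  r1y : r1 y = y⁻¹
  r3x : r3 x = y
  r3y : r3 y = x
  cen : ∀ g, g * ι x = ι x * g → g * ι y = ι y * g → ∃ t, g = ι t
  fus : ∀ g (i j i' j' : ℤ), g * ι (x ^ i * y ^ j) * g⁻¹ = ι (x ^ i' * y ^ j') →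
    ∃ a c : ℤ, (a = 1 ∨ a = -1) ∧ (c = 1 ∨ c = -1) ∧
      (((N : ℤ) ∣ i' - a * i ∧ (N : ℤ) ∣ j' - c * j) ∨ ((N : ℤ) ∣ i' - a * j ∧ (N : ℤ) ∣ j' - c * i))
  cx : ∀ i : ℤ, ¬ (N : ℤ) ∣ i → ∀ g, g * ι (x ^ i) = ι (x ^ i) * g → g * ι x = ι x * g
  cxy : ∀ i : ℤ, ¬ (N : ℤ) ∣ i → ∀ g, g * ι ((x * y) ^ i) = ι ((x * y) ^ i) * g → g * ι (x * y) = ι (x * y) * g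
  creg : ∀ i j : ℤ, ¬ (N : ℤ) ∣ i → ¬ (N : ℤ) ∣ j → ¬ (N : ℤ) ∣ i + j → ¬ (N : ℤ) ∣ i - j →
    ∀ g, g * ι (x ^ i * y ^ j) = ι (x ^ i * y ^ j) * g → ∃ t, g = ι t
  pT : ∀ t, t ^ q = 1 → ∃ i j : ℤ, t = x ^ i * y ^ j
  syl : ∀ a c : G, a ^ q = 1 → c ^ q = 1 → a * c = c * a → ∃ (h : G) (i j k l : ℤ),
    h * a * h⁻¹ = ι (x ^ i * y ^ j) ∧ h * c * h⁻¹ = ι (x ^ k * y ^ l)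

namespace R2
variable {G T : Type} [Group G] [CommGroup T] {ι : T →* G} {x y : T} {w1 w3 : G} {r1 r3 : T ≃* T} {q N : ℕ}

theorem zx (R : R2 ι x y w1 w3 r1 r3 q N) {i : ℤ} (h : (N : ℤ) ∣ i) : x ^ i = 1 := by
  obtain ⟨k, rfl⟩ := h
  rw [zpow_mul, zpow_natCast, R.xN, one_zpow]

theorem zy (R : R2 ι x y w1 w3 r1 r3 q N) {i : ℤ} (h : (N : ℤ) ∣ i) : y ^ i = 1 := by
  obtain ⟨k, rfl⟩ := h
  rw [zpow_mul, zpow_natCast, R.yN, one_zpow]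

theorem eqx (R : R2 ι x y w1 w3 r1 r3 q N) {i j : ℤ} (h : (N : ℤ) ∣ i - j) : x ^ i = x ^ j := by
  have := R.zx h
  rwa [zpow_sub, mul_inv_eq_one] at this

theorem eqy (R : R2 ι x y w1 w3 r1 r3 q N) {i j : ℤ} (h : (N : ℤ) ∣ i - j) : y ^ i = y ^ j := by
  have := R.zy h
  rwa [zpow_sub, mul_inv_eq_one] at this

theorem half (R : R2 ι x y w1 w3 r1 r3 q N) {i : ℤ} (h : (N : ℤ) ∣ 2 * i) : (N : ℤ) ∣ i := by
  have h1 : IsCoprime (N : ℤ) 2 := by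
    obtain ⟨k, hk⟩ := R.odd
    exact ⟨1, -k, by rw [hk]; push_cast; ring⟩
  exact h1.dvd_of_dvd_mul_left h

/-- a conjugation fixing x and y is trivial on T -/
theorem triv (R : R2 ι x y w1 w3 r1 r3 q N) {r : T ≃* T} {g : G} (hr : ∀ t, ι (r t) = g * ι t * g⁻¹) (hx : r x = x) (hy : r y = y) (t : T) :
    r t = t := by
  have h1 := hr x
  have h2 := hr y
  rw [hx, eq_mul_inv_iff_mul_eq] at h1
  rw [hy, eq_mul_inv_iff_mul_eq] at h2
  obtain ⟨u, hu⟩ := R.cen g h1.symm h2.symm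
  apply R.inj
  rw [hr, hu, ← map_inv, ← map_mul, ← map_mul, mul_comm u t, mul_inv_cancel_right]

theorem rr1 (R : R2 ι x y w1 w3 r1 r3 q N) (t : T) : r1 (r1 t) = t := by
  refine R.triv (r := r1.trans r1) (g := w1 * w1) (fun t => ?_) ?_ ?_ t
  · simp only [MulEquiv.trans_apply]; rw [R.hr1, R.hr1]; group
  · simp [R.r1x]
  · simp [R.r1y]

theorem rr3 (R : R2 ι x y w1 w3 r1 r3 q N) (t : T) : r3 (r3 t) = t := by
  refine R.triv (r := r3.trans r3) (g := w3 * w3) (fun t => ?_) ?_ ?_ t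
  · simp only [MulEquiv.trans_apply]; rw [R.hr3, R.hr3]; group
  · simp [R.r3x, R.r3y]
  · simp [R.r3x, R.r3y]

theorem dual (R : R2 ι x y w1 w3 r1 r3 q N) : R2 ι (x * y) (x * y⁻¹) w3 w1 r3 r1 q N := by
  have key : ∀ i j : ℤ, (x * y) ^ i * (x * y⁻¹) ^ j = x ^ (i + j) * y ^ (i - j) := by
    intro i j
    rw [mul_zpow, mul_zpow, inv_zpow, zpow_add, zpow_sub]
    exact mul_mul_mul_comm _ _ _ _
  have d2 : ∀ {i j : ℤ}, (N : ℤ) ∣ i → (N : ℤ) ∣ j → (N : ℤ) ∣ i + j ∧ (N : ℤ) ∣ i - j := fun h h' => ⟨dvd_add h h', dvd_sub h h'⟩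
  have hsum : ∀ {i j : ℤ}, (N : ℤ) ∣ i + j → (N : ℤ) ∣ i - j → (N : ℤ) ∣ i ∧ (N : ℤ) ∣ j := by
    intro i j h h'
    constructor
    · apply R.half; have := dvd_add h h'; ring_nf at this ⊢; exact this
    · apply R.half; have := dvd_sub h h'; ring_nf at this ⊢; exact this
  have comx : ∀ g, g * ι (x * y) = ι (x * y) * g → g * ι (x * y⁻¹) = ι (x * y⁻¹) * g → g * ι x = ι x * g ∧ g * ι y = ι y * g := by
    intro g h1 h2
    obtain ⟨k, hk⟩ := R.odd
    have hx : x = ((x * y) * (x * y⁻¹)) ^ (k + 1) := by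
      rw [show (x * y) * (x * y⁻¹) = x ^ 2 by rw [sq]; rw [mul_mul_mul_comm]; simp, ← pow_mul, show 2 * (k + 1) = N + 1 by omega, pow_succ, R.xN, one_mul]
    have hc1 : Commute g (ι x) := by
      rw [hx, map_pow, map_mul]
      exact Commute.pow_right (Commute.mul_right h1 h2) _
    refine ⟨hc1, ?_⟩
    have hy : y = x⁻¹ * (x * y) := by simp
    rw [hy, map_mul, map_inv]
    exact Commute.mul_right hc1.inv_right h1
  refine ⟨R.inj, R.hN, R.N9, R.odd, ?_, ?_, ?_, R.hr3, R.hr1, ?_, ?_, ?_, ?_, ?_, ?_, R.cxy, ?_, ?_, ?_, ?_⟩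
  · rw [mul_pow, R.xN, R.yN, one_mul]
  · rw [mul_pow, inv_pow, R.xN, R.yN]; simp
  · intro i j h
    rw [key] at h
    obtain ⟨h1, h2⟩ := R.ind _ _ h
    exact hsum h1 h2
  · rw [map_mul, R.r3x, R.r3y, mul_comm]
  · rw [map_mul, map_inv, R.r3x, R.r3y]; simp
  · rw [map_mul, R.r1x, R.r1y]
  · rw [map_mul, map_inv, R.r1x, R.r1y, inv_inv]
  · intro g h1 h2
    obtain ⟨h3, h4⟩ := comx g h1 h2
    exact R.cen g h3 h4
  · intro g i j i' j' h
    rw [key, key] at h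
    obtain ⟨a, c, ha, hc, h⟩ := R.fus _ _ _ _ _ h
    rcases h with ⟨h1, h2⟩ | ⟨h1, h2⟩
    · obtain ⟨e1, e2⟩ := d2 h1 h2
      rcases ha with rfl | rfl <;> rcases hc with rfl | rfl
      · refine ⟨1, 1, by simp, by simp, Or.inl ⟨R.half ?_, R.half ?_⟩⟩ <;> ring_nf at e1 e2 ⊢ <;> assumption
      · refine ⟨1, 1, by simp, by simp, Or.inr ⟨R.half ?_, R.half ?_⟩⟩ <;> ring_nf at e1 e2 ⊢ <;> assumption
      · refine ⟨-1, -1, by simp, by simp, Or.inr ⟨R.half ?_, R.half ?_⟩⟩ <;> ring_nf at e1 e2 ⊢ <;> assumption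
      · refine ⟨-1, -1, by simp, by simp, Or.inl ⟨R.half ?_, R.half ?_⟩⟩ <;> ring_nf at e1 e2 ⊢ <;> assumption
    · obtain ⟨e1, e2⟩ := d2 h1 h2
      rcases ha with rfl | rfl <;> rcases hc with rfl | rfl
      · refine ⟨1, -1, by simp, by simp, Or.inl ⟨R.half ?_, R.half ?_⟩⟩ <;> ring_nf at e1 e2 ⊢ <;> assumption
      · refine ⟨-1, 1, by simp, by simp, Or.inr ⟨R.half ?_, R.half ?_⟩⟩ <;> ring_nf at e1 e2 ⊢ <;> assumption
      · refine ⟨1, -1, by simp, by simp, Or.inr ⟨R.half ?_, R.half ?_⟩⟩ <;> ring_nf at e1 e2 ⊢ <;> assumption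
      · refine ⟨-1, 1, by simp, by simp, Or.inl ⟨R.half ?_, R.half ?_⟩⟩ <;> ring_nf at e1 e2 ⊢ <;> assumption
  · intro i hi g h
    have e : (x * y) * (x * y⁻¹) = x ^ (2 : ℤ) := by rw [mul_mul_mul_comm, mul_inv_cancel, mul_one, zpow_two]
    rw [e] at h ⊢
    rw [← zpow_mul] at h
    have h2 := R.cx _ (fun h' => hi (R.half h')) g h
    have h3 : Commute g (ι x) := h2
    rw [map_zpow]
    exact h3.zpow_right 2
  · intro i j h1 h2 h3 h4 g h
    rw [key] at h
    refine R.creg _ _ h3 h4 ?_ ?_ g h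
    · intro h5; apply h1; apply R.half; ring_nf at h5 ⊢; exact h5
    · intro h5; apply h2; apply R.half; ring_nf at h5 ⊢; exact h5
  · intro t ht
    obtain ⟨i, j, rfl⟩ := R.pT t ht
    obtain ⟨k, hk⟩ := R.odd
    refine ⟨(i + j) * (k + 1), (i - j) * (k + 1), ?_⟩
    rw [key]
    congr 1
    · apply R.eqx; refine ⟨-i, ?_⟩; rw [hk]; push_cast; ring
    · apply R.eqy; refine ⟨-j, ?_⟩; rw [hk]; push_cast; ring
  · intro a c ha hc hac
    obtain ⟨h, i, j, i', j', e1, e2⟩ := R.syl a c ha hc hac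
    obtain ⟨k, hk⟩ := R.odd
    have key2 : ∀ i j : ℤ, x ^ i * y ^ j = (x * y) ^ ((i + j) * (k + 1)) * (x * y⁻¹) ^ ((i - j) * (k + 1)) := by
      intro i j
      rw [key]
      congr 1
      · apply R.eqx; refine ⟨-i, ?_⟩; rw [hk]; push_cast; ring
      · apply R.eqy; refine ⟨-j, ?_⟩; rw [hk]; push_cast; ring
    exact ⟨h, _, _, _, _, by rw [e1, key2], by rw [e2, key2]⟩

/-- the subgroup of T of elements with p-part in ⟨x⟩ -/
def YY (x : T) (e : ℕ) : Subgroup T := (Subgroup.zpowers x).comap (powMonoidHom e)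

theorem mem_YY {t : T} {e : ℕ} : t ∈ YY x e ↔ ∃ i : ℤ, x ^ i = t ^ e := by
  simp [YY, Subgroup.mem_comap, Subgroup.mem_zpowers_iff]

/-- the inclusion of T in the centralizer of x -/
def iL (ι : T →* G) (x : T) : T →* Subgroup.centralizer ({ι x} : Set G) :=
  ι.codRestrict _ (fun t => by
    rw [Subgroup.mem_centralizer_singleton_iff]
    rw [← map_mul, ← map_mul, mul_comm])

theorem iL_coe (t : T) : ((iL ι x t : Subgroup.centralizer ({ι x} : Set G)) : G) = ι t := rfl

theorem memL {g : G} : g ∈ Subgroup.centralizer ({ι x} : Set G) ↔ g * ι x = ι x * g := by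
  rw [Subgroup.mem_centralizer_singleton_iff]

theorem yfix (R : R2 ι x y w1 w3 r1 r3 q N) : R2 ι y x (w3 * w1 * w3⁻¹) w3 ((r3.trans r1).trans r3) r3 q N := by
  refine ⟨R.inj, R.hN, R.N9, R.odd, R.yN, R.xN, ?_, ?_, R.hr3, ?_, ?_, R.r3y, R.r3x, fun g h h' => R.cen g h' h, ?_, ?_, ?_, ?_, ?_, ?_⟩
  · intro i j h; rw [mul_comm] at h; exact (R.ind _ _ h).symm
  · intro t
    simp only [MulEquiv.trans_apply]
    rw [R.hr3, R.hr1, R.hr3]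
    have : w3⁻¹ * ι t * w3 = w3 * ι t * w3⁻¹ := by
      rw [← R.hr3]
      have h2 := R.hr3 (r3 t)
      rw [R.rr3] at h2
      rw [h2]; group
    rw [← this]; group
  · simp [R.r3x, R.r3y, R.r1x]
  · simp [R.r3x, R.r3y, R.r1y]
  · intro g i j i' j' h
    rw [mul_comm (y ^ i), mul_comm (y ^ i')] at h
    obtain ⟨a, c, ha, hc, h⟩ := R.fus _ _ _ _ _ h
    exact ⟨c, a, hc, ha, h.imp And.symm And.symm⟩
  · intro i hi g h
    have e1 : ∀ t, ι t = w3 * ι (r3 t) * w3⁻¹ := by intro t; rw [← R.hr3, R.rr3]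
    have cj : ∀ t, g * ι t = ι t * g ↔ (w3⁻¹ * g * w3) * ι (r3 t) = ι (r3 t) * (w3⁻¹ * g * w3) := by
      intro t
      rw [e1 t]
      constructor
      · intro h
        calc _ = w3⁻¹ * (g * (w3 * ι (r3 t) * w3⁻¹)) * w3 := by group
          _ = _ := by rw [h]; group
      · intro h
        calc _ = w3 * (w3⁻¹ * g * w3 * ι (r3 t)) * w3⁻¹ := by group
          _ = _ := by rw [h]; group
    rw [cj, R.r3y]
    rw [cj, map_zpow, R.r3y] at h
    exact R.cx i hi _ h
  · intro i hi g h; rw [mul_comm] at h ⊢; exact R.cxy i hi g h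
  · intro i j h1 h2 h3 h4 g h
    rw [mul_comm (y ^ i)] at h
    refine R.creg j i h2 h1 (by rwa [add_comm]) (fun h' => h4 ?_) g h
    rw [← neg_sub]; exact h'.neg_right
  · intro t ht
    obtain ⟨i, j, h⟩ := R.pT t ht
    exact ⟨j, i, by rw [h, mul_comm]⟩
  · intro a c ha hc hac
    obtain ⟨h, i, j, i', j', e1, e2⟩ := R.syl a c ha hc hac
    exact ⟨h, j, i, j', i', by rw [e1, mul_comm], by rw [e2, mul_comm]⟩

end R2

namespace R2
variable {G T : Type} [Group G] [CommGroup T] {ι : T →* G} {x y : T} {w1 w3 : G} {r1 r3 : T ≃* T} {N : ℕ}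
variable {p b m e e' s : ℕ}

theorem xq (R : R2 ι x y w1 w3 r1 r3 (p ^ b) N) (i : ℤ) : (x ^ i) ^ (p ^ b) = 1 := by
  obtain ⟨k, hk⟩ := R.hN
  rw [hk, ← zpow_natCast, ← zpow_mul]
  apply R.zx
  exact ⟨i * k, by push_cast; ring⟩

theorem yq (R : R2 ι x y w1 w3 r1 r3 (p ^ b) N) (i : ℤ) : (y ^ i) ^ (p ^ b) = 1 := by
  obtain ⟨k, hk⟩ := R.hN
  rw [hk, ← zpow_natCast, ← zpow_mul]
  apply R.zy
  exact ⟨i * k, by push_cast; ring⟩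

theorem xyq (R : R2 ι x y w1 w3 r1 r3 (p ^ b) N) (i j : ℤ) : (x ^ i * y ^ j) ^ (p ^ b) = 1 := by
  rw [mul_pow, R.xq, R.yq, one_mul]

theorem Tpow [Fintype G] (R : R2 ι x y w1 w3 r1 r3 (p ^ b) N) (hG : Fintype.card G = p ^ b * m) (t : T) : t ^ (p ^ b * m) = 1 := by
  apply R.inj
  rw [map_pow, ← hG, pow_card_eq_one, map_one]

theorem te [Fintype G] (R : R2 ι x y w1 w3 r1 r3 (p ^ b) N) (E : Ex p b m e e' s) (hG : Fintype.card G = p ^ b * m) (t : T) :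
    ∃ i j : ℤ, t ^ e = x ^ i * y ^ j := R.pT _ (E.pp_pow (R.Tpow hG t))

theorem xy_e (R : R2 ι x y w1 w3 r1 r3 (p ^ b) N) (E : Ex p b m e e' s) (i j : ℤ) : (x ^ i * y ^ j) ^ e = x ^ i * y ^ j :=
  E.pp_of_p (R.xyq i j)

theorem ind_eq (R : R2 ι x y w1 w3 r1 r3 (p ^ b) N) {i j i' j' : ℤ} (h : x ^ i * y ^ j = x ^ i' * y ^ j') :
    (N : ℤ) ∣ i - i' ∧ (N : ℤ) ∣ j - j' := by
  apply R.ind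
  rw [zpow_sub, zpow_sub, mul_mul_mul_comm, h, ← mul_inv, mul_inv_cancel]

theorem mem_YY_iff (R : R2 ι x y w1 w3 r1 r3 (p ^ b) N) {t : T} {i j : ℤ} (h : t ^ e = x ^ i * y ^ j) : t ∈ YY x e ↔ (N : ℤ) ∣ j := by
  rw [mem_YY, h]
  constructor
  · rintro ⟨k, hk⟩
    have : x ^ k * y ^ (0 : ℤ) = x ^ i * y ^ j := by rw [← hk]; simp
    have := (R.ind_eq this).2
    rw [zero_sub] at this
    exact (dvd_neg.1 this)
  · intro hj
    exact ⟨i, by rw [R.zy hj, mul_one]⟩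

theorem index_YY [Fintype G] (R : R2 ι x y w1 w3 r1 r3 (p ^ b) N) (E : Ex p b m e e' s) (hG : Fintype.card G = p ^ b * m) : (YY x e).index = N := by
  have hN : 0 < N := by have := R.N9; omega
  have h1 : Function.Bijective (fun j : Fin N => (QuotientGroup.mk (y ^ (j : ℤ)) : T ⧸ YY x e)) := by
    constructor
    · intro j j' h
      have h2 := QuotientGroup.eq.1 h
      have h3 : ((y ^ (j : ℤ))⁻¹ * y ^ (j' : ℤ)) ^ e = x ^ (0 : ℤ) * y ^ ((j' : ℤ) - j) := by
        rw [zpow_zero, one_mul, zpow_sub, mul_comm]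
        apply E.pp_of_p
        rw [← zpow_neg, ← zpow_add, R.yq]
      rw [R.mem_YY_iff h3] at h2
      have hj := j.2
      have hj' := j'.2
      have h4 : ((j' : ℤ) - j) = 0 := by
        apply Int.eq_zero_of_abs_lt_dvd h2
        rw [abs_lt]; constructor <;> omega
      ext; omega
    · intro z
      obtain ⟨t, rfl⟩ := QuotientGroup.mk_surjective z
      obtain ⟨i, j, h⟩ := R.te E hG t
      have hp : 0 ≤ j % N := Int.emod_nonneg _ (by omega)
      have hl : j % N < N := Int.emod_lt_of_pos _ (by omega)
      refine ⟨⟨(j % N).toNat, by omega⟩, ?_⟩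
      apply QuotientGroup.eq.2
      rw [mem_YY]
      refine ⟨i, ?_⟩
      rw [mul_pow, h]
      have e1 : ((y ^ (((j % N).toNat : ℕ) : ℤ))⁻¹) ^ e = y ^ (-j) := by
        rw [← zpow_neg, E.pp_of_p (R.yq _)]
        apply R.eqy
        rw [Int.toNat_of_nonneg hp]
        refine ⟨j / N, ?_⟩
        have := Int.emod_add_mul_ediv j N
        linear_combination -this
      rw [e1, zpow_neg, mul_comm (x ^ i), inv_mul_cancel_left]
  rw [Subgroup.index, ← Nat.card_eq_of_bijective _ h1, Nat.card_eq_fintype_card, Fintype.card_fin]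

theorem w1L (R : R2 ι x y w1 w3 r1 r3 (p ^ b) N) : w1 * ι x = ι x * w1 := by
  have := R.hr1 x
  rw [R.r1x, eq_mul_inv_iff_mul_eq] at this
  exact this.symm

theorem r1e [Fintype G] (R : R2 ι x y w1 w3 r1 r3 (p ^ b) N) {t : T} {i j : ℤ} (h : t ^ e = x ^ i * y ^ j) : (r1 t) ^ e = x ^ i * y ^ (-j) := by
  rw [← map_pow, h, map_mul, map_zpow, map_zpow, R.r1x, R.r1y, inv_zpow, zpow_neg]

theorem ld [Fintype G] (R : R2 ι x y w1 w3 r1 r3 (p ^ b) N) (E : Ex p b m e e' s) (hG : Fintype.card G = p ^ b * m) :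
    LD (iL ι x) ⟨w1, memL.2 R.w1L⟩ r1 (YY x e) := by
  refine ⟨?_, ?_, R.rr1, ?_, ?_, ?_, ?_⟩
  · intro a c h
    exact R.inj (congrArg Subtype.val h)
  · intro t
    exact Subtype.ext (R.hr1 t)
  · intro t
    obtain ⟨i, j, h⟩ := R.te E hG t
    rw [mem_YY]
    refine ⟨i + i, ?_⟩
    rw [mul_pow, R.r1e h, h, mul_mul_mul_comm, ← zpow_add, ← zpow_add]
    simp
  · intro t ht g t' h
    have h' : (g : G) * ι t * (g : G)⁻¹ = ι t' := congrArg Subtype.val h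
    have hgx := memL.1 g.2
    obtain ⟨i, j, hi⟩ := R.te E hG t
    obtain ⟨i', j', hi'⟩ := R.te E hG t'
    rw [R.mem_YY_iff hi] at ht
    have h2 : (g : G) * ι (x ^ i * y ^ j) * (g : G)⁻¹ = ι (x ^ i' * y ^ j') := by
      rw [← hi, ← hi', map_pow, map_pow, ← h', conj_pow]
    have hgi : Commute (g : G) (ι (x ^ i)) := by rw [map_zpow]; exact Commute.zpow_right hgx i
    have h3 : (g : G) * ι (x ^ (0 : ℤ) * y ^ j) * (g : G)⁻¹ = ι (x ^ (i' - i) * y ^ j') := by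
      have e1 : x ^ (i' - i) * y ^ j' = (x ^ i)⁻¹ * (x ^ i' * y ^ j') := by
        rw [zpow_sub, mul_comm (x ^ i'), mul_assoc]
      rw [e1, map_mul ι ((x ^ i)⁻¹), ← h2, map_mul ι (x ^ i), map_inv, zpow_zero, one_mul]
      have : ((ι (x ^ i))⁻¹ * (↑g * (ι (x ^ i) * ι (y ^ j)) * (↑g)⁻¹)) = (ι (x ^ i))⁻¹ * (↑g * ι (x ^ i)) * ι (y ^ j) * (↑g)⁻¹ := by group
      rw [this, hgi.eq]
      simp
    obtain ⟨a, c, ha, hc, hh⟩ := R.fus _ _ _ _ _ h3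
    rcases hh with ⟨h4, h5⟩ | ⟨h4, h5⟩
    · rw [mul_zero, sub_zero] at h4
      rw [R.zx h4, R.eqy h5, zpow_zero, one_mul] at h3
      rcases hc with rfl | rfl
      · left
        rw [one_mul, one_mul, mul_inv_eq_iff_eq_mul] at h3
        obtain ⟨u, hu⟩ := R.cen g hgx (R.yfix.cx j ht g h3)
        exact ⟨u, Subtype.ext hu⟩
      · right
        have h6 : (g * w1⁻¹ : G) * ι (y ^ j) * (g * w1⁻¹ : G)⁻¹ = ι (y ^ j) := by
          have e1 : ι (y ^ j) = w1 * ι (y ^ (-j)) * w1⁻¹ := by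
            rw [← R.hr1, map_zpow r1, R.r1y]; simp
          have e2 : w1⁻¹ * ι (y ^ j) * w1 = ι (y ^ (-j)) := by rw [e1]; group
          have e3 : (g : G) * ι (y ^ (-j)) * (g : G)⁻¹ = ι (y ^ j) := by
            rw [neg_one_mul, one_mul] at h3
            have := congrArg (fun z => z⁻¹) h3
            simp only [mul_inv_rev, inv_inv, ← map_inv, ← zpow_neg, neg_neg] at this
            rw [← this]; group
          calc _ = (g : G) * (w1⁻¹ * ι (y ^ j) * w1) * (g : G)⁻¹ := by group
            _ = _ := by rw [e2, e3]
        rw [mul_inv_eq_iff_eq_mul] at h6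
        have h7 : Commute (g * w1⁻¹ : G) (ι x) := Commute.mul_left hgx (Commute.inv_left R.w1L)
        obtain ⟨u, hu⟩ := R.cen _ h7 (R.yfix.cx j ht _ h6)
        refine ⟨u, Subtype.ext ?_⟩
        show (g : G) = ι u * w1
        rw [← hu]; group
    · rw [mul_zero, sub_zero] at h5
      exfalso
      rw [R.zy h5, R.eqx h4, zpow_zero, one_mul, mul_one] at h3
      have hgi : Commute (g : G) (ι (x ^ (a * j))) := by rw [map_zpow]; exact Commute.zpow_right hgx _
      rw [mul_inv_eq_iff_eq_mul, ← hgi.eq] at h3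
      have h6 : y ^ j = x ^ (a * j) := R.inj (mul_left_cancel h3)
      have h7 : x ^ (0 : ℤ) * y ^ j = x ^ (a * j) * y ^ (0 : ℤ) := by simp [h6]
      have := (R.ind_eq h7).2
      rw [sub_zero] at this
      exact ht this
  · rw [R.index_YY E hG]; exact R.odd
  · rw [R.index_YY E hG]; exact R.N9

/-- elements of L with p-part not in ⟨x⟩ are conjugate into T -/
theorem conjT [Fintype G] (R : R2 ι x y w1 w3 r1 r3 (p ^ b) N) (E : Ex p b m e e' s) (hG : Fintype.card G = p ^ b * m)
    (g : Subgroup.centralizer ({ι x} : Set G)) (hg : ∀ i : ℤ, (g : G) ^ e ≠ ι (x ^ i)) :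
    ∃ (h : Subgroup.centralizer ({ι x} : Set G)) (t : T), t ∉ YY x e ∧ h * g * h⁻¹ = iL ι x t := by
  have hgx := memL.1 g.2
  have hgG : (g : G) ^ (p ^ b * m) = 1 := by rw [← hG, pow_card_eq_one]
  have hxq : (ι x) ^ (p ^ b) = 1 := by
    have := R.xq 1
    rw [zpow_one] at this
    rw [← map_pow, this, map_one]
  obtain ⟨h, i, j, k, l, h1, h2⟩ := R.syl _ _ (E.pp_pow hgG) hxq (Commute.pow_left hgx e)
  -- adjust h to centralize x
  have hex : ∃ (v : G) (i' j' : ℤ), v * ι x * v⁻¹ = ι x ∧ v * (g : G) ^ e * v⁻¹ = ι (x ^ i' * y ^ j') := by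
    have h3 : h * ι (x ^ (1 : ℤ) * y ^ (0 : ℤ)) * h⁻¹ = ι (x ^ k * y ^ l) := by rw [← h2]; simp
    obtain ⟨a, c, ha, hc, hh⟩ := R.fus _ _ _ _ _ h3
    have c1 : ∀ i j : ℤ, w1 * ι (x ^ i * y ^ j) * w1⁻¹ = ι (x ^ i * y ^ (-j)) := by
      intro i j; rw [← R.hr1]; simp [R.r1x, R.r1y]
    have c3 : ∀ i j : ℤ, w3 * ι (x ^ i * y ^ j) * w3⁻¹ = ι (x ^ j * y ^ i) := by
      intro i j; rw [← R.hr3]; simp [R.r3x, R.r3y, mul_comm]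
    have step : ∀ v : G, (∃ i' j' : ℤ, v * ι (x ^ k * y ^ l) * v⁻¹ = ι x ∧ v * ι (x ^ i * y ^ j) * v⁻¹ = ι (x ^ i' * y ^ j')) →
        ∃ (v : G) (i' j' : ℤ), v * ι x * v⁻¹ = ι x ∧ v * (g : G) ^ e * v⁻¹ = ι (x ^ i' * y ^ j') := by
      rintro v ⟨i', j', e1, e2⟩
      refine ⟨v * h, i', j', ?_, ?_⟩
      · have : v * h * ι x * (v * h)⁻¹ = v * (h * ι x * h⁻¹) * v⁻¹ := by group
        rw [this, h2, e1]
      · have : v * h * (g : G) ^ e * (v * h)⁻¹ = v * (h * (g : G) ^ e * h⁻¹) * v⁻¹ := by simp only [mul_assoc, mul_inv_rev]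
        rw [this, h1, e2]
    have comp : ∀ (u v : G) (z : T), (u * v) * ι z * (u * v)⁻¹ = u * (v * ι z * v⁻¹) * u⁻¹ := by intros; group
    have fin : ∀ {i j : ℤ}, (N : ℤ) ∣ i - 1 → (N : ℤ) ∣ j → ι (x ^ i * y ^ j) = ι x := by
      intro i j h h'
      rw [R.eqx h, R.zy h']; simp
    rcases hh with ⟨e1, e2⟩ | ⟨e1, e2⟩
    · rw [mul_one] at e1; rw [mul_zero, sub_zero] at e2
      rcases ha with rfl | rfl
      · exact step 1 ⟨i, j, by rw [fin e1 e2]; group, by group⟩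
      · refine step (w3 * (w1 * w3)) ⟨-i, j, ?_, ?_⟩
        · rw [comp, comp, c3, c1, c3]
          apply fin _ e2
          have := e1.neg_right; ring_nf at this ⊢; exact this
        · rw [comp, comp, c3, c1, c3]
    · rw [mul_zero, sub_zero] at e1; rw [mul_one] at e2
      rcases hc with rfl | rfl
      · refine step w3 ⟨j, i, ?_, ?_⟩
        · rw [c3]; exact fin e2 e1
        · rw [c3]
      · refine step (w3 * w1) ⟨-j, i, ?_, ?_⟩
        · rw [comp, c1, c3]
          refine fin ?_ e1
          have := e2.neg_right; ring_nf at this ⊢; exact this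
        · rw [comp, c1, c3]
  obtain ⟨v, i, j, hv1, hv2⟩ := hex
  rw [mul_inv_eq_iff_eq_mul] at hv1
  have hj : ¬ (N : ℤ) ∣ j := by
    intro hj
    apply hg i
    rw [R.zy hj, mul_one] at hv2
    have hvi : Commute v (ι (x ^ i)) := by rw [map_zpow]; exact Commute.zpow_right hv1 i
    rw [mul_inv_eq_iff_eq_mul, ← hvi.eq] at hv2
    exact mul_left_cancel hv2
  set z : G := v * g * v⁻¹ with hz
  have hze : z ^ e = ι (x ^ i * y ^ j) := by rw [hz, conj_pow, hv2]
  have hzx : Commute z (ι x) := by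
    have h1 : Commute v (ι x) := hv1
    exact (h1.mul_left hgx).mul_left h1.inv_left
  have hzy : Commute z (ι (y ^ j)) := by
    have h1 : Commute z (z ^ e) := Commute.self_pow z e
    rw [hze] at h1
    have h2 : ι (y ^ j) = (ι x) ^ (-i) * ι (x ^ i * y ^ j) := by
      rw [← map_zpow, ← map_mul, ← mul_assoc, ← zpow_add]; simp
    rw [h2]
    exact (hzx.zpow_right _).mul_right h1
  obtain ⟨t, ht⟩ := R.cen z hzx (R.yfix.cx j hj z hzy)
  refine ⟨⟨v, memL.2 hv1⟩, t, ?_, Subtype.ext ht⟩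
  have hte : t ^ e = x ^ i * y ^ j := by
    apply R.inj
    rw [map_pow, ← ht, hze]
  rw [R.mem_YY_iff hte]; exact hj

end R2

/-- complementary data: the part of `χ` on `T` constant along cosets -/
structure KD {G T : Type} [Group G] [CommGroup T] [Fintype T] (ι : T →* G) (x : T) (r1 r3 : T ≃* T) (e s : ℕ)
    [Fintype (Subgroup.centralizer ({ι x} : Set G))] (χ : G → ℂ) (k : T → ℂ) : Prop where
  int : ∀ μ, ∃ n : ℤ, co k μ = n
  off : ∀ t, t ∉ R2.YY x e → k t = 0
  inv1 : ∀ t, k (r1 t) = k t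
  inv3 : ∀ t, k (r3 (r1 (r3 t))) = k t
  dd : ∀ μ, DD (R2.iL ι x) (R2.YY x e) (fun g => χ g - χ (g ^ s)) μ = co (fun t => χ (ι t) - χ (ι t ^ s) - k t) μ
  triv : ∀ μ : Hat T, μ x = 1 → co k μ = 0
  one : ∀ t, t ^ e = 1 → k t = 0
  orb : ∃ M : Hat T → ℤ, ∀ μ, co k (μ ^ s) = M (μ ^ s) - M μ

theorem co_sub {T : Type} [CommGroup T] [Fintype T] (f g : T → ℂ) (μ : Hat T) : co (fun t => f t - g t) μ = co f μ - co g μ := ip_sub_left _ _ _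
theorem co_add {T : Type} [CommGroup T] [Fintype T] (f g : T → ℂ) (μ : Hat T) : co (fun t => f t + g t) μ = co f μ + co g μ := ip_add_left _ _ _
theorem co_ext {T : Type} [CommGroup T] [Fintype T] {f g : T → ℂ} (h : ∀ μ, co f μ = co g μ) : f = g := by
  funext t; rw [co_inv f, co_inv g]; simp only [h]

namespace R2
variable {G T : Type} [Group G] [CommGroup T] {ι : T →* G} {x y : T} {w1 w3 : G} {r1 r3 : T ≃* T} {N : ℕ}
variable {p b m e e' s : ℕ}

/-- element conjugating x to its inverse -/
theorem v1x (R : R2 ι x y w1 w3 r1 r3 (p ^ b) N) : (w3 * w1 * w3⁻¹) * ι x * (w3 * w1 * w3⁻¹)⁻¹ = (ι x)⁻¹ := by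
  have := R.yfix.hr1 x
  rw [R.yfix.r1y, map_inv] at this
  exact this.symm

theorem expT [Fintype G] [Fintype T] (R : R2 ι x y w1 w3 r1 r3 (p ^ b) N) (hG : Fintype.card G = p ^ b * m) : Fintype.card T ∣ p ^ b * m := by
  rw [← hG, ← Nat.card_eq_fintype_card, ← Nat.card_eq_fintype_card]
  exact Subgroup.card_dvd_of_injective ι R.inj

theorem expL [Fintype G] [Fintype (Subgroup.centralizer ({ι x} : Set G))] (hG : Fintype.card G = p ^ b * m) : Fintype.card (Subgroup.centralizer ({ι x} : Set G)) ∣ p ^ b * m := by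
  rw [← hG, ← Nat.card_eq_fintype_card, ← Nat.card_eq_fintype_card]
  exact Subgroup.card_subgroup_dvd_card _

theorem exists_inv (E : Ex p b m e e' s) : ∃ s', s * s' ≡ 1 [MOD p ^ b * m] := by
  have h := E.coprime_s
  generalize p ^ b * m = n at h
  rcases Nat.lt_or_ge 1 n with h1 | h1
  · obtain ⟨k, _, hk⟩ := Nat.exists_mul_mod_eq_one_of_coprime h h1
    exact ⟨k, by rw [Nat.ModEq, hk, Nat.mod_eq_of_lt h1]⟩
  · interval_cases n
    · rw [Nat.coprime_zero_right] at h; exact ⟨1, by rw [h]⟩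
    · exact ⟨1, Nat.modEq_one⟩

theorem kd [Fintype G] [Fintype T] [Fintype (Subgroup.centralizer ({ι x} : Set G))] (R : R2 ι x y w1 w3 r1 r3 (p ^ b) N) (E : Ex p b m e e' s) (hG : Fintype.card G = p ^ b * m)
    {χ : G → ℂ} (hχ : χ ∈ irr G) : ∃ k : T → ℂ, KD ι x r1 r3 e s χ k := by
  have D := R.ld E hG
  have hc := irr_isChar hχ
  set Y := YY x e with hY
  set X : Hat T → ℂ := fun μ => co (fun t => χ (ι t)) μ - DD (iL ι x) Y (fun g => χ g) μ with hX
  set κ : T → ℂ := fun t => ∑ μ, X μ * (μ t : ℂ) with hκ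
  have coκ : ∀ μ, co κ μ = X μ := fun μ => co_sum X μ
  have hcL : IsChar (fun g : Subgroup.centralizer ({ι x} : Set G) => χ g) := IsChar.comp hc (Subgroup.subtype _)
  have hXc : ∀ {μ ν}, ceq Y μ ν → X μ = X ν := fun {μ ν} h => DD_const (iL ι x) Y hcL.isClass h
  have hXi : ∀ μ, ∃ n : ℤ, X μ = n := by
    intro μ
    obtain ⟨a, ha⟩ := co_nat (IsChar.comp hc ι) μ
    have h1 : ∀ φ, ∃ n : ℤ, φ ∈ irr (Subgroup.centralizer ({ι x} : Set G)) → ip (fun g : Subgroup.centralizer ({ι x} : Set G) => χ g) φ = n := by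
      intro φ
      by_cases hφ : φ ∈ irr (Subgroup.centralizer ({ι x} : Set G))
      · obtain ⟨n, hn⟩ := ip_nat hcL (irr_isChar hφ)
        exact ⟨n, fun _ => by rw [hn]; simp⟩
      · exact ⟨0, fun h => absurd h hφ⟩
    choose c hc using h1
    refine ⟨a - ∑ φ ∈ irr (Subgroup.centralizer ({ι x} : Set G)), c φ * _root_.dd (iL ι x) Y φ μ, ?_⟩
    have ha' : co (fun t => χ (ι t)) μ = a := ha
    simp only [hX, DD, ha']
    push_cast
    congr 1
    exact Finset.sum_congr rfl fun φ hφ => by rw [hc φ hφ]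
  choose Xi hXi using hXi
  have κoff : ∀ t, t ∉ Y → κ t = 0 := by
    classical
    have : κ = fun t => if t ∈ Y then κ t else 0 := by
      apply co_ext
      intro μ
      rw [co_restrict]
      rw [Finset.sum_congr rfl (g := fun _ => co κ μ) (fun ν hν => by rw [coκ, coκ, hXc (mem_cos.1 hν)]), Finset.sum_const, cos_card, nsmul_eq_mul, inv_mul_cancel_left₀ (index_ne Y)]
    intro t ht
    rw [this]; simp [ht]
  have rmκ : ∀ r : T ≃* T, (∀ t, r (r t) = t) → (∀ μ, X (rm r μ) = X μ) → ∀ t, κ (r t) = κ t := by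
    intro r hrr hr t
    have : (fun t => κ (r t)) = κ := by
      apply co_ext
      intro μ
      have h1 := co_equiv κ r (rm r μ)
      have h2 : (rm r μ).comp r.toMonoidHom = μ := by ext t; simp [rm, hrr]
      rw [h2] at h1
      rw [h1, coκ, coκ, hr]
    exact congrFun this t
  have κ1 : ∀ t, κ (r1 t) = κ t := by
    apply rmκ r1 R.rr1
    intro μ
    simp only [hX]
    rw [D.DD_rm, D.co_rm]
    intro t
    rw [R.hr1, hc.conj]
  have κ3 : ∀ t, κ (r3 (r1 (r3 t))) = κ t := by
    have hr := R.yfix.hr1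
    set r := (r3.trans r1).trans r3 with hrd
    apply rmκ r R.yfix.rr1
    intro μ
    simp only [hX]
    have h1 : co (fun t => χ (ι t)) (rm r μ) = co (fun t => χ (ι t)) μ := by
      have := co_equiv (fun t => χ (ι t)) r μ
      rw [← this]
      congr 1
      funext t
      rw [hr, hc.conj]
    rw [h1]
    congr 1
    -- conjugation by v1 on L
    set v : G := w3 * w1 * w3⁻¹ with hv
    have hvx := R.v1x
    have hvL : ∀ g, g ∈ Subgroup.centralizer ({ι x} : Set G) → v * g * v⁻¹ ∈ Subgroup.centralizer ({ι x} : Set G) := by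
      intro g hg
      rw [memL] at hg ⊢
      have h2 : Commute (v * g * v⁻¹) (v * ι x * v⁻¹) := by
        show (v * g * v⁻¹) * (v * ι x * v⁻¹) = (v * ι x * v⁻¹) * (v * g * v⁻¹)
        have a1 : (v * g * v⁻¹) * (v * ι x * v⁻¹) = v * (g * ι x) * v⁻¹ := by group
        have a2 : (v * ι x * v⁻¹) * (v * g * v⁻¹) = v * (ι x * g) * v⁻¹ := by group
        rw [a1, a2, hg]
      rw [hvx] at h2
      exact (Commute.inv_right_iff.1 h2)
    have hfin : Finite (Subgroup.centralizer ({ι x} : Set G)) := inferInstance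
    set θ0 : Subgroup.centralizer ({ι x} : Set G) →* Subgroup.centralizer ({ι x} : Set G) :=
      { toFun := fun g => ⟨v * g * v⁻¹, hvL g g.2⟩
        map_one' := by ext; simp
        map_mul' := by intro a c; ext; simp } with hθ0
    have hbij : Function.Bijective θ0 := by
      apply Finite.injective_iff_bijective.1
      intro a c h
      have := congrArg Subtype.val h
      simp only [hθ0, MonoidHom.coe_mk, OneHom.coe_mk] at this
      exact Subtype.ext (mul_left_cancel (mul_right_cancel this))
    have h3 := D.DD_aut (MulEquiv.ofBijective θ0 hbij) r ?_ ?_ (fun g => χ g) μ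
    · rw [← h3]
      congr 1
      funext g
      show χ g = χ (v * g * v⁻¹)
      rw [hc.conj]
    · intro t
      apply Subtype.ext
      exact (hr t).symm
    · intro t ht
      rw [mem_YY] at ht ⊢
      obtain ⟨i, hi⟩ := ht
      refine ⟨-i, ?_⟩
      rw [← map_pow, ← hi, map_zpow, R.yfix.r1y]; simp
  have hsT : s.Coprime (Fintype.card T) := E.coprime_s.coprime_dvd_right (R.expT hG)
  have hsL : s.Coprime (Fintype.card (Subgroup.centralizer ({ι x} : Set G))) := E.coprime_s.coprime_dvd_right (expL hG)
  obtain ⟨s', hs'⟩ := exists_inv E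
  have hss : ∀ μ : Hat T, (μ ^ s') ^ s = μ := by
    intro μ
    ext t
    have h1 : (μ t) ^ (p ^ b * m) = 1 := by rw [← map_pow, R.Tpow hG, map_one]
    simp only [MonoidHom.pow_apply]
    rw [← pow_mul, mul_comm, pow_modEq' h1 hs', pow_one]
  refine ⟨fun t => κ t - κ (t ^ s), ?_, ?_, ?_, ?_, ?_, ?_, ?_, ?_⟩
  · intro μ
    refine ⟨Xi μ - Xi (μ ^ s'), ?_⟩
    rw [co_sub, coκ, hXi]
    have := co_pow κ hsT (μ ^ s')
    rw [hss] at this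
    rw [this, coκ, hXi]; simp
  · intro t ht
    have : t ^ s ∉ Y := by
      intro h
      apply ht
      have h2 : t = (t ^ s) ^ s' := by
        rw [← pow_mul, pow_modEq' (R.Tpow hG t) hs', pow_one]
      rw [h2]
      exact Subgroup.pow_mem _ h _
    rw [κoff t ht, κoff _ this, sub_zero]
  · intro t
    rw [κ1, ← map_pow, κ1]
  · intro t
    rw [κ3, ← map_pow, ← map_pow, ← map_pow, κ3]
  · intro μ
    rw [DD_sub]
    have h1 := D.DD_pow hsL hsT (R.expT hG) hs' (fun g => χ g) (μ ^ s')
    have h2 := co_pow (fun t => χ (ι t)) hsT (μ ^ s')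
    have h3 := co_pow κ hsT (μ ^ s')
    rw [hss] at h1 h2 h3
    simp only [Subgroup.coe_pow] at h1
    rw [h1, co_sub, co_sub, co_sub, h3, coκ, coκ]
    simp only [map_pow] at h2
    rw [h2]
    simp only [hX]
    ring
  · intro μ hμ
    rw [co_sub, sub_eq_zero]
    simp only [co, ip]
    congr 1
    rw [← Equiv.sum_comp (powCoprime (G := T) (n := s) (by rw [Nat.card_eq_fintype_card]; exact hsT.symm))]
    apply Finset.sum_congr rfl
    intro t _
    simp only [powCoprime_apply]
    by_cases ht : t ^ s ∈ Y
    · congr 2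
      have h1 : t ∈ Y := by
        have h2 : t = (t ^ s) ^ s' := by
          rw [← pow_mul, pow_modEq' (R.Tpow hG t) hs', pow_one]
        rw [h2]
        exact Subgroup.pow_mem _ ht _
      rw [mem_YY] at h1
      obtain ⟨i, hi⟩ := h1
      have h3 : μ (t ^ e) = 1 := by rw [← hi, map_zpow, hμ, one_zpow]
      rw [E.pow_s (R.Tpow hG t), map_mul, map_pow, h3, one_pow, one_mul]
      have h4 : μ t = μ (t ^ e) * μ (t ^ e') := by rw [← map_mul, E.mul_parts (R.Tpow hG t)]
      rw [h4, h3, one_mul]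
    · rw [κoff _ ht]; simp
  · intro t ht
    rw [E.pow_s_of_pp (R.Tpow hG t) ht, sub_self]
  · refine ⟨Xi, fun μ => ?_⟩
    rw [co_sub, co_pow κ hsT μ, coκ, coκ, hXi, hXi]

end R2

section central
variable {L Z : Type} [Group L] [Fintype L] [CommGroup Z] [Fintype Z]

theorem cc_exists (ζ : Z →* L) (hζ : ∀ z g, ζ z * g = g * ζ z) {φ : L → ℂ} (hφ : φ ∈ irr L) :
    ∃ l : Hat Z, ∀ z g, φ (ζ z * g) = l z * φ g := by
  obtain ⟨n, hn, h1⟩ := irr_one hφ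
  have h0 : φ 1 ≠ 0 := by rw [h1]; exact_mod_cast hn.ne'
  choose ω hω using fun z => irr_central hφ (hζ z)
  have hm : ∀ z, ω z = φ (ζ z) / φ 1 := by
    intro z
    have := hω z 1
    rw [mul_one] at this
    rw [this, mul_div_cancel_right₀ _ h0]
  let f : Z →* ℂ :=
    { toFun := ω
      map_one' := by rw [hm, map_one, div_self h0]
      map_mul' := by
        intro a c
        have h2 := hω a (ζ c * 1)
        rw [hω c, ← mul_assoc, ← map_mul, hω (a * c)] at h2
        apply mul_right_cancel₀ h0
        rw [h2]; ring }
  exact ⟨f.toHomUnits, hω⟩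

theorem cc_unique (ζ : Z →* L) {φ : L → ℂ} (hφ : φ ∈ irr L) {l l' : Hat Z} (h : ∀ z g, φ (ζ z * g) = l z * φ g)
    (h' : ∀ z g, φ (ζ z * g) = l' z * φ g) : l = l' := by
  obtain ⟨n, hn, h1⟩ := irr_one hφ
  have h0 : φ 1 ≠ 0 := by rw [h1]; exact_mod_cast hn.ne'
  ext z
  exact mul_right_cancel₀ h0 ((h z 1).symm.trans (h' z 1))

theorem central_supp (ζ : Z →* L) (hζ : ∀ z g, ζ z * g = g * ζ z) {F : L → ℂ} (hF : IsClass F) (c : (L → ℂ) → ℤ)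
    (hc : ∀ φ ∈ irr L, ip F φ = c φ) (h0 : ∀ z, F (ζ z) = 0) :
    ∃ M : Finset (Hat Z), (2 * M.card : ℝ) ≤ nsq F ∧
      (∀ φ ∈ irr L, ip F φ ≠ 0 → ∀ l : Hat Z, (∀ z g, φ (ζ z * g) = l z * φ g) → l ∈ M) ∧
      ∀ (y : L) (l : Hat Z), co (fun z => F (ζ z * y)) l ≠ 0 → l ∈ M := by
  classical
  have : ∀ φ, ∃ l : Hat Z, φ ∈ irr L → ∀ z g, φ (ζ z * g) = l z * φ g := by
    intro φ
    by_cases hφ : φ ∈ irr L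
    · obtain ⟨l, hl⟩ := cc_exists ζ hζ hφ
      exact ⟨l, fun _ => hl⟩
    · exact ⟨1, fun h => absurd h hφ⟩
  choose lam hl using this
  have key : ∀ (y : L) (l : Hat Z), co (fun z => F (ζ z * y)) l = ∑ φ ∈ irr L with lam φ = l, ip F φ * φ y := by
    intro y l
    have h1 : (fun z => F (ζ z * y)) = fun z => ∑ φ ∈ irr L, (ip F φ * φ y) * (lam φ z : ℂ) := by
      funext z
      rw [irr_expand hF]
      apply Finset.sum_congr rfl
      intro φ hφ
      rw [hl φ hφ]; ring
    rw [h1, co, ip_sum_left, Finset.sum_filter]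
    apply Finset.sum_congr rfl
    intro φ hφ
    rw [ip_smul_left]
    have := hat_orth (lam φ) l
    rw [co] at this
    rw [this]
    split_ifs <;> simp
  set Sp := (irr L).filter fun φ => ip F φ ≠ 0 with hSp
  refine ⟨Sp.image lam, ?_, ?_, ?_⟩
  · rw [nsq_eq_irr hF]
    have h1 : ∑ φ ∈ irr L, Complex.normSq (ip F φ) = ∑ φ ∈ irr L, ((c φ) ^ 2 : ℝ) := by
      apply Finset.sum_congr rfl
      intro φ hφ
      rw [hc φ hφ]
      have : ((c φ : ℤ) : ℂ) = (((c φ : ℤ) : ℝ) : ℂ) := by simp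
      rw [this, Complex.normSq_ofReal]; ring
    rw [h1]
    have h2 : ∑ φ ∈ Sp, ((c φ) ^ 2 : ℝ) ≤ ∑ φ ∈ irr L, ((c φ) ^ 2 : ℝ) :=
      Finset.sum_le_sum_of_subset_of_nonneg (Finset.filter_subset _ _) (fun _ _ _ => sq_nonneg _)
    refine le_trans ?_ h2
    rw [← Finset.sum_fiberwise_of_maps_to (t := Sp.image lam) (g := lam) (fun φ hφ => Finset.mem_image_of_mem _ hφ)]
    rw [mul_comm, ← nsmul_eq_mul]
    apply Finset.card_nsmul_le_sum
    intro l hl'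
    obtain ⟨φ0, hφ0, rfl⟩ := Finset.mem_image.1 hl'
    -- a second constituent
    have h3 : ∑ φ ∈ irr L with lam φ = lam φ0, ip F φ * φ 1 = 0 := by
      rw [← key]
      have : (fun z => F (ζ z * 1)) = fun _ => 0 := by funext z; rw [mul_one, h0]
      rw [this]; simp [co, ip]
    have h4 : ∃ φ1 ∈ Sp, lam φ1 = lam φ0 ∧ φ1 ≠ φ0 := by
      by_contra hcon
      push Not at hcon
      have h5 := Finset.mem_filter.1 hφ0
      rw [Finset.sum_eq_single φ0] at h3
      · obtain ⟨n, hn, h6⟩ := irr_one h5.1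
        rw [h6] at h3
        rcases mul_eq_zero.1 h3 with h | h
        · exact h5.2 h
        · exact hn.ne' (by exact_mod_cast h)
      · intro φ hφ hne
        rw [Finset.mem_filter] at hφ
        by_contra h7
        have : ip F φ ≠ 0 := fun h => h7 (by rw [h, zero_mul])
        exact hne (hcon φ (Finset.mem_filter.2 ⟨hφ.1, this⟩) hφ.2)
      · intro h; exact (h (Finset.mem_filter.2 ⟨h5.1, rfl⟩)).elim
    obtain ⟨φ1, hφ1, hl1, hne⟩ := h4
    have one_le : ∀ φ ∈ Sp, (1 : ℝ) ≤ (c φ) ^ 2 := by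
      intro φ hφ
      rw [Finset.mem_filter] at hφ
      have : c φ ≠ 0 := by
        intro h; apply hφ.2; rw [hc φ hφ.1, h]; simp
      have h8 : 0 < (c φ) ^ 2 := by positivity
      exact_mod_cast h8
    calc (2 : ℝ) = 1 + 1 := by norm_num
      _ ≤ (c φ1 : ℝ) ^ 2 + (c φ0 : ℝ) ^ 2 := add_le_add (one_le _ hφ1) (one_le _ hφ0)
      _ = ∑ φ ∈ {φ1, φ0}, (c φ : ℝ) ^ 2 := (Finset.sum_pair (f := fun φ => (c φ : ℝ) ^ 2) hne).symm
      _ ≤ _ := by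
        apply Finset.sum_le_sum_of_subset_of_nonneg
        · intro φ hφ
          simp only [Finset.mem_insert, Finset.mem_singleton] at hφ
          rcases hφ with rfl | rfl
          · exact Finset.mem_filter.2 ⟨hφ1, hl1⟩
          · exact Finset.mem_filter.2 ⟨hφ0, rfl⟩
        · intros; positivity
  · intro φ hφ hne l h
    have := cc_unique ζ hφ h (hl φ hφ)
    rw [this]
    exact Finset.mem_image_of_mem _ (Finset.mem_filter.2 ⟨hφ, hne⟩)
  · intro y l h
    rw [key] at h
    obtain ⟨φ, hφ, hne⟩ := Finset.exists_ne_zero_of_sum_ne_zero h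
    rw [Finset.mem_filter] at hφ
    rw [← hφ.2]
    exact Finset.mem_image_of_mem _ (Finset.mem_filter.2 ⟨hφ.1, fun h => hne (by rw [h, zero_mul])⟩)

end central

/-- four characters from one -/
theorem four_le {H : Type} [CommGroup H] [DecidableEq H] {p b m e e' s : ℕ} (E : Ex p b m e e' s) {l : H} (hl : l ^ (p ^ b) = 1) {u : ℕ} (hu : u ≡ 1 [MOD p]) (h : l ^ u ≠ l)
    {M : Finset H} (h1 : l ∈ M) (h2 : l ^ u ∈ M) (h3 : l⁻¹ ∈ M) (h4 : (l ^ u)⁻¹ ∈ M) : 4 ≤ M.card := by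
  have hp := E.hp
  have triv : ∀ n : ℕ, n.Coprime p → l ^ n = 1 → False := by
    intro n hn h5
    have : l = 1 := by
      have h6 : orderOf l ∣ Nat.gcd n (p ^ b) := Nat.dvd_gcd (orderOf_dvd_of_pow_eq_one h5) (orderOf_dvd_of_pow_eq_one hl)
      rw [Nat.Coprime.gcd_eq_one (Nat.Coprime.pow_right b hn), Nat.dvd_one, orderOf_eq_one_iff] at h6
      exact h6
    exact h (by rw [this, one_pow])
  have c2 : Nat.Coprime 2 p := (Nat.coprime_primes Nat.prime_two hp).2 (Ne.symm E.hp2)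
  have cu : Nat.Coprime u p := by
    have := hu.gcd_eq
    simpa [Nat.Coprime] using this
  have cu1 : Nat.Coprime (u + 1) p := by
    have := (hu.add_right 1).gcd_eq
    rw [Nat.Coprime, this]; exact c2
  have n1 : l ≠ l⁻¹ := by
    intro h5
    apply triv 2 c2
    rw [sq]; nth_rewrite 2 [h5]; simp
  have n2 : l ≠ (l ^ u)⁻¹ := by
    intro h5
    apply triv (u + 1) cu1
    rw [pow_succ]; nth_rewrite 2 [h5]; simp
  have n3 : l ^ u ≠ l⁻¹ := by
    intro h5; exact n2 (by rw [h5, inv_inv])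
  have n4 : l ^ u ≠ (l ^ u)⁻¹ := by
    intro h5
    apply triv (u * 2) (Nat.Coprime.mul_left cu c2)
    rw [pow_mul, sq]; nth_rewrite 2 [h5]; simp
  have n5 : l⁻¹ ≠ (l ^ u)⁻¹ := by
    intro h5; exact h (inv_injective h5).symm
  have : ({l, l ^ u, l⁻¹, (l ^ u)⁻¹} : Finset H).card = 4 := by
    rw [Finset.card_insert_of_notMem, Finset.card_insert_of_notMem, Finset.card_insert_of_notMem, Finset.card_singleton]
    · simp [n5]
    · simp [n3, n4]
    · simp only [Finset.mem_insert, Finset.mem_singleton, not_or]; exact ⟨Ne.symm h, n1, n2⟩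
  rw [← this]
  apply Finset.card_le_card
  intro z hz
  simp only [Finset.mem_insert, Finset.mem_singleton] at hz
  rcases hz with rfl | rfl | rfl | rfl <;> assumption

namespace R2
variable {G T : Type} [Group G] [CommGroup T] {ι : T →* G} {x y : T} {w1 w3 : G} {r1 r3 : T ≃* T} {N : ℕ}
variable {p b m e e' s : ℕ}

theorem sec_F [Fintype G] [Fintype T] [Fintype (Subgroup.centralizer ({ι x} : Set G))] (R : R2 ι x y w1 w3 r1 r3 (p ^ b) N) (E : Ex p b m e e' s) (hG : Fintype.card G = p ^ b * m)
    {χ : G → ℂ} (hχ : χ ∈ irr G) {k J : T → ℂ} (K : KD ι x r1 r3 e s χ k)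
    (Jint : ∀ μ, ∃ n : ℤ, co J μ = n) (JY : ∀ t ∈ YY x e, J t = 0) (Jr : ∀ t, J (r1 t) = J t)
    (Jev : ∀ μ, rm r1 μ = μ → ∃ n : ℤ, co J μ = 2 * n) :
    ∃ (F : Subgroup.centralizer ({ι x} : Set G) → ℂ) (c : (Subgroup.centralizer ({ι x} : Set G) → ℂ) → ℤ),
      IsClass F ∧ (∀ φ ∈ irr (Subgroup.centralizer ({ι x} : Set G)), ip F φ = c φ) ∧
      (∀ μ, DD (iL ι x) (YY x e) F μ = co (fun t => χ (ι t) - χ (ι t ^ s) - k t - J t) μ) ∧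
      (∀ t, t ∉ YY x e → F (iL ι x t) = χ (ι t) - χ (ι t ^ s) - k t - J t) ∧
      ∀ g : Subgroup.centralizer ({ι x} : Set G), (∃ i : ℤ, (g : G) ^ e = ι (x ^ i)) → F g = χ g - χ (g ^ s) := by
  have D := R.ld E hG
  have hc := irr_isChar hχ
  have hsG : s.Coprime (Fintype.card G) := by rw [hG]; exact E.coprime_s
  have c1 : IsChar (fun g : Subgroup.centralizer ({ι x} : Set G) => χ g) := IsChar.comp hc (Subgroup.subtype _)
  have c2 : IsChar (fun g : Subgroup.centralizer ({ι x} : Set G) => χ (g ^ s)) := IsChar.comp (hc.pow hsG) (Subgroup.subtype _)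
  choose K0 hK0 using Jint
  have hrm : ∀ μ, K0 (rm r1 μ) = K0 μ := by
    intro μ
    have := D.co_rm Jr μ
    rw [hK0, hK0] at this
    exact_mod_cast this
  have hev : ∀ μ, rm r1 μ = μ → Even (K0 μ) := by
    intro μ h
    obtain ⟨n, hn⟩ := Jev μ h
    rw [hK0] at hn
    exact ⟨n, by have : K0 μ = 2 * n := by exact_mod_cast hn
                 omega⟩
  have hcoef : ∀ φ, ∃ n : ℤ, φ ∈ irr (Subgroup.centralizer ({ι x} : Set G)) →
      ip (fun g : Subgroup.centralizer ({ι x} : Set G) => (χ g - χ (g ^ s)) - (1 / 2 : ℂ) * IndT (iL ι x) J g) φ = n := by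
    intro φ
    by_cases hφ : φ ∈ irr (Subgroup.centralizer ({ι x} : Set G))
    · obtain ⟨n1, h1⟩ := ip_nat c1 (irr_isChar hφ)
      obtain ⟨n2, h2⟩ := ip_nat c2 (irr_isChar hφ)
      obtain ⟨n3, h3⟩ := D.even_sum K0 hrm hev hφ
      refine ⟨n1 - n2 - n3, fun _ => ?_⟩
      rw [ip_sub_left, ip_sub_left, ip_smul_left, h1, h2, D.IndT_coef J hφ]
      have h4 : ∑ μ, co J μ * (mm (iL ι x) φ μ : ℂ) = ((n3 + n3 : ℤ) : ℂ) := by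
        rw [← h3]; push_cast
        exact Finset.sum_congr rfl fun μ _ => by rw [hK0]
      rw [h4]; push_cast; ring
    · exact ⟨0, fun h => absurd h hφ⟩
  choose c hcoef using hcoef
  have hcl := IndT_class (iL ι x) J
  refine ⟨fun g => (χ g - χ (g ^ s)) - (1 / 2 : ℂ) * IndT (iL ι x) J g, c, ?_, fun φ hφ => hcoef φ hφ, ?_, ?_, ?_⟩
  · intro a g
    have h1 := c1.conj a g
    have h2 := c2.conj a g
    have h3 := hcl a g
    simp only [Subgroup.coe_mul, InvMemClass.coe_inv] at h1 h2 h3 ⊢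
    rw [h1, h2, h3]
  · intro μ
    rw [DD_sub, DD_smul, D.DD_IndT Jr JY, K.dd, co_sub]
    conv_rhs => rw [co_sub, co_sub]
    ring
  · intro t ht
    show χ (iL ι x t : Subgroup.centralizer ({ι x} : Set G)) - χ ((iL ι x t : Subgroup.centralizer ({ι x} : Set G)) ^ s) - (1 / 2 : ℂ) * IndT (iL ι x) J (iL ι x t) = _
    rw [D.IndT_on JY, Jr, K.off t ht, iL_coe]
    ring
  · rintro g ⟨i, hi⟩
    have : IndT (iL ι x) J g = 0 := by
      apply IndT_off D.inj
      intro a t h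
      apply JY
      rw [mem_YY]
      refine ⟨i, ?_⟩
      apply R.inj
      have h1 : ι t = a * (g : G) * (a : G)⁻¹ := (congrArg Subtype.val h).symm
      rw [map_pow, h1, conj_pow, hi]
      have h2 : Commute (a : G) (ι (x ^ i)) := by rw [map_zpow]; exact Commute.zpow_right (memL.1 a.2) i
      rw [h2.eq, mul_inv_cancel_right]
    simp only [this]; ring

open Classical in
theorem sec_bound [Fintype G] [Fintype T] [Fintype (Subgroup.centralizer ({ι x} : Set G))] (R : R2 ι x y w1 w3 r1 r3 (p ^ b) N) (E : Ex p b m e e' s) (hG : Fintype.card G = p ^ b * m)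
    {χ : G → ℂ} (hχ : χ ∈ irr G) {Δ : T → ℂ} {F : Subgroup.centralizer ({ι x} : Set G) → ℂ} (hF : IsClass F)
    (hon : ∀ t, t ∉ YY x e → F (iL ι x t) = Δ t)
    (hoff : ∀ g : Subgroup.centralizer ({ι x} : Set G), (∃ i : ℤ, (g : G) ^ e = ι (x ^ i)) → F g = χ g - χ (g ^ s)) :
    nsq F ≤ (Fintype.card (Subgroup.centralizer ({ι x} : Set G)) : ℝ)⁻¹ * ∑ g : G with (∃ i : ℤ, ¬ (N : ℤ) ∣ i ∧ g ^ e = ι (x ^ i)), Complex.normSq (χ g - χ (g ^ s))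
      + (2 * Fintype.card T : ℝ)⁻¹ * ∑ t with t ∉ YY x e, Complex.normSq (Δ t) := by
  have D := R.ld E hG
  set P : Subgroup.centralizer ({ι x} : Set G) → Prop := fun g => ∃ i : ℤ, (g : G) ^ e = ι (x ^ i) with hP
  have hTr : ∀ t, t ∉ YY x e → Δ (r1 t) = Δ t := by
    intro t ht
    have h1 : r1 t ∉ YY x e := by rw [D.r_mem]; exact ht
    rw [← hon _ h1, ← hon _ ht, D.hw, hF]
  set u : T → ℂ := fun t => if t ∉ YY x e then ((Complex.normSq (Δ t) : ℝ) : ℂ) else 0 with hu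
  have huY : ∀ t ∈ YY x e, u t = 0 := by intro t ht; simp [hu, ht]
  have hI : ∀ g : Subgroup.centralizer ({ι x} : Set G), IndT (iL ι x) u g = if P g then 0 else ((2 * Complex.normSq (F g) : ℝ) : ℂ) := by
    intro g
    split_ifs with h
    · apply IndT_off D.inj
      intro a t h1
      apply huY
      obtain ⟨i, hi⟩ := h
      rw [mem_YY]
      refine ⟨i, ?_⟩
      apply R.inj
      have h1 : ι t = a * (g : G) * (a : G)⁻¹ := (congrArg Subtype.val h1).symm
      rw [map_pow, h1, conj_pow, hi]
      have h2 : Commute (a : G) (ι (x ^ i)) := by rw [map_zpow]; exact Commute.zpow_right (memL.1 a.2) i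
      rw [h2.eq, mul_inv_cancel_right]
    · have h' : ∀ i : ℤ, (g : G) ^ e ≠ ι (x ^ i) := fun i hi => h ⟨i, hi⟩
      obtain ⟨a, t, ht, hh⟩ := R.conjT E hG g h'
      rw [← IndT_class (iL ι x) u a g, ← hF a g, hh, D.IndT_on huY, hon t ht]
      have h1 : r1 t ∉ YY x e := by rw [D.r_mem]; exact ht
      simp only [hu, ht, h1, not_false_eq_true, if_true, hTr t ht]
      push_cast; ring
  have hsum : (Fintype.card (Subgroup.centralizer ({ι x} : Set G)) : ℂ)⁻¹ * ∑ g, IndT (iL ι x) u g = (Fintype.card T : ℂ)⁻¹ * ∑ t, u t := by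
    have := IndT_ip D.inj u (φ := fun _ => 1) (fun _ _ => rfl)
    simpa [ip] using this
  have hsumR : (Fintype.card (Subgroup.centralizer ({ι x} : Set G)) : ℝ)⁻¹ * ∑ g : Subgroup.centralizer ({ι x} : Set G), (if P g then 0 else 2 * Complex.normSq (F g)) = (Fintype.card T : ℝ)⁻¹ * ∑ t with t ∉ YY x e, Complex.normSq (Δ t) := by
    have h1 : ∑ g, IndT (iL ι x) u g = ((∑ g : Subgroup.centralizer ({ι x} : Set G), (if P g then 0 else 2 * Complex.normSq (F g)) : ℝ) : ℂ) := by
      push_cast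
      apply Finset.sum_congr rfl
      intro g _
      rw [hI]; split_ifs <;> simp
    have h2 : ∑ t, u t = ((∑ t with t ∉ YY x e, Complex.normSq (Δ t) : ℝ) : ℂ) := by
      rw [Finset.sum_filter]
      push_cast
      apply Finset.sum_congr rfl
      intro t _
      simp only [hu]
      split_ifs <;> simp
    rw [h1, h2] at hsum
    apply Complex.ofReal_injective
    push_cast at hsum ⊢
    exact hsum
  have hPs : ∑ g : Subgroup.centralizer ({ι x} : Set G), (if P g then Complex.normSq (F g) else 0) ≤ ∑ g : G with (∃ i : ℤ, ¬ (N : ℤ) ∣ i ∧ g ^ e = ι (x ^ i)), Complex.normSq (χ g - χ (g ^ s)) := by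
    have h1 : ∑ g : Subgroup.centralizer ({ι x} : Set G), (if P g then Complex.normSq (F g) else 0) = ∑ g : Subgroup.centralizer ({ι x} : Set G) with ((P g) ∧ (g : G) ^ e ≠ 1), Complex.normSq (χ g - χ (g ^ s)) := by
      rw [Finset.sum_filter]
      apply Finset.sum_congr rfl
      intro g _
      by_cases h : P g
      · by_cases h' : (g : G) ^ e = 1
        · simp only [h, h', if_true, ne_eq, not_true_eq_false, and_false, if_false]
          rw [hoff g h, E.pow_s_of_pp (by rw [← hG, pow_card_eq_one]) h', sub_self, map_zero]
        · simp only [h, h', if_true, ne_eq, not_false_eq_true, and_true]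
          rw [hoff g h]
      · simp [h]
    rw [h1]
    refine le_trans (le_of_eq (Finset.sum_map (Finset.univ.filter fun g : Subgroup.centralizer ({ι x} : Set G) => (P g) ∧ (g : G) ^ e ≠ 1) (Function.Embedding.subtype _) (fun g : G => Complex.normSq (χ g - χ (g ^ s)))).symm) ?_
    apply Finset.sum_le_sum_of_subset_of_nonneg
    · intro g hg
      rw [Finset.mem_map] at hg
      obtain ⟨a, ha, rfl⟩ := hg
      simp only [Finset.mem_filter, Finset.mem_univ, true_and] at ha ⊢
      obtain ⟨⟨i, hi⟩, h⟩ := ha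
      refine ⟨i, fun hd => h ?_, hi⟩
      rw [hi, R.zx hd, map_one]
    · intros; exact Complex.normSq_nonneg _
  have hsplit : ∑ g : Subgroup.centralizer ({ι x} : Set G), Complex.normSq (F g) = ∑ g : Subgroup.centralizer ({ι x} : Set G), (if P g then Complex.normSq (F g) else 0) + (1 / 2) * ∑ g : Subgroup.centralizer ({ι x} : Set G), (if P g then 0 else 2 * Complex.normSq (F g)) := by
    rw [Finset.mul_sum, ← Finset.sum_add_distrib]
    apply Finset.sum_congr rfl
    intro g _
    split_ifs <;> ring
  have e1 : nsq F = (Fintype.card (Subgroup.centralizer ({ι x} : Set G)) : ℝ)⁻¹ * ∑ g : Subgroup.centralizer ({ι x} : Set G), Complex.normSq (F g) := rfl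
  rw [e1, hsplit, mul_add]
  have e2 : (Fintype.card (Subgroup.centralizer ({ι x} : Set G)) : ℝ)⁻¹ * (1 / 2 * ∑ g : Subgroup.centralizer ({ι x} : Set G), (if P g then 0 else 2 * Complex.normSq (F g))) = (2 * Fintype.card T : ℝ)⁻¹ * ∑ t with t ∉ YY x e, Complex.normSq (Δ t) := by
    rw [mul_left_comm, hsumR, mul_inv]; ring
  rw [e2]
  gcongr

end R2

namespace R2
variable {G T : Type} [Group G] [CommGroup T] {ι : T →* G} {x y : T} {w1 w3 : G} {r1 r3 : T ≃* T} {N : ℕ}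
variable {p b m e e' s : ℕ}

theorem s_pow_p (E : Ex p b m e e' s) (i : ℕ) : s ^ i ≡ 1 [MOD p] := by
  have := E.s_p.pow i
  rwa [one_pow] at this

open Classical in
theorem sec [Fintype G] [Fintype T] [Fintype (Subgroup.centralizer ({ι x} : Set G))] (R : R2 ι x y w1 w3 r1 r3 (p ^ b) N) (E : Ex p b m e e' s) (hG : Fintype.card G = p ^ b * m)
    {χ : G → ℂ} (hχ : χ ∈ irr G) (hpel : ∀ t : G, t ^ (p ^ b) = 1 → χ (t ^ s) = χ t) {k J : T → ℂ} (K : KD ι x r1 r3 e s χ k)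
    (Jint : ∀ μ, ∃ n : ℤ, co J μ = n) (JY : ∀ t ∈ YY x e, J t = 0) (Jr : ∀ t, J (r1 t) = J t)
    (Jev : ∀ μ, rm r1 μ = μ → ∃ n : ℤ, co J μ = 2 * n) {Δ : T → ℂ} (hΔ : Δ = fun t => χ (ι t) - χ (ι t ^ s) - k t - J t) :
    ∃ (S : ℝ) (M : Finset ℂˣ),
      S ≤ (Fintype.card (Subgroup.centralizer ({ι x} : Set G)) : ℝ)⁻¹ * ∑ g : G with (∃ i : ℤ, ¬ (N : ℤ) ∣ i ∧ g ^ e = ι (x ^ i)), Complex.normSq (χ g - χ (g ^ s))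
        + (2 * Fintype.card T : ℝ)⁻¹ * ∑ t with t ∉ YY x e, Complex.normSq (Δ t) ∧
      ∑ μ, Complex.normSq (co Δ μ) ≤ 2 * S ∧ (2 * M.card : ℝ) ≤ S ∧ (∀ μ, co Δ μ ≠ 0 → μ x ∈ M) ∧
      ∀ g0 : G, (∃ i : ℤ, g0 ^ e = ι (x ^ i)) → χ (g0 ^ s) ≠ χ g0 → 8 ≤ S := by
  have D := R.ld E hG
  have hc := irr_isChar hχ
  obtain ⟨F, c, hF, hcF, hDD, hon, hoff⟩ := R.sec_F E hG hχ K Jint JY Jr Jev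
  rw [← hΔ] at hDD
  have hon' : ∀ t, t ∉ YY x e → F (iL ι x t) = Δ t := by rw [hΔ]; exact hon
  have ex : ∀ g : G, g ^ (p ^ b * m) = 1 := fun g => by rw [← hG, pow_card_eq_one]
  have hxq : ∀ i : ℤ, (ι (x ^ i)) ^ (p ^ b) = 1 := by
    intro i
    rw [← map_pow, R.xq, map_one]
  have hZf : Fintype (Subgroup.zpowers x) := Fintype.ofFinite _
  set ζ : Subgroup.zpowers x →* Subgroup.centralizer ({ι x} : Set G) := (iL ι x).comp (Subgroup.subtype _) with hζ
  have ζco : ∀ z, ((ζ z : Subgroup.centralizer ({ι x} : Set G)) : G) = ι z := fun z => rfl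
  have hζc : ∀ z g, ζ z * g = g * ζ z := by
    rintro ⟨z, hz⟩ g
    obtain ⟨i, rfl⟩ := Subgroup.mem_zpowers_iff.1 hz
    apply Subtype.ext
    show ι (x ^ i) * (g : G) = (g : G) * ι (x ^ i)
    rw [map_zpow]
    exact (Commute.zpow_right (memL.1 g.2) i).symm.eq
  have h0 : ∀ z, F (ζ z) = 0 := by
    rintro ⟨z, hz⟩
    obtain ⟨i, rfl⟩ := Subgroup.mem_zpowers_iff.1 hz
    rw [hoff, ζco, hpel _ (hxq i), sub_self]
    exact ⟨i, by rw [ζco]; exact E.pp_of_p (hxq i)⟩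
  obtain ⟨MZ, hM1, hM2, hM3⟩ := central_supp ζ hζc hF c hcF h0
  set xz : Subgroup.zpowers x := ⟨x, Subgroup.mem_zpowers x⟩ with hxz
  refine ⟨nsq F, MZ.image (fun l => l xz), R.sec_bound E hG hχ hF hon' hoff, ?_, ?_, ?_, ?_⟩
  · have := D.DD_sq hF c hcF
    simp only [hDD] at this
    exact this
  · refine le_trans ?_ hM1
    have := Finset.card_image_le (s := MZ) (f := fun l => l xz)
    have h2 : ((MZ.image (fun l => l xz)).card : ℝ) ≤ MZ.card := by exact_mod_cast this
    linarith
  · intro μ hμ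
    rw [← hDD] at hμ
    have hxY : x ∈ YY x e := by
      rw [mem_YY]
      refine ⟨1, ?_⟩
      have := E.pp_of_p (R.xq 1)
      simp only [zpow_one] at this ⊢
      exact this.symm
    obtain ⟨φ, hφ, hne, h1⟩ := D.DD_central hxY (fun g => hζc xz g) hμ
    obtain ⟨l, hl⟩ := cc_exists ζ hζc hφ
    have h2 : l xz = μ x := by
      obtain ⟨n, hn, h3⟩ := irr_one hφ
      have h0 : φ 1 ≠ 0 := by rw [h3]; exact_mod_cast hn.ne'
      apply Units.ext
      exact mul_right_cancel₀ h0 ((hl xz 1).symm.trans (h1 1))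
    rw [← h2]
    exact Finset.mem_image_of_mem (fun l : Hat (Subgroup.zpowers x) => l xz) (hM2 φ hφ hne l hl)
  · rintro g0 ⟨i, hi⟩ hne
    have hiN : ¬ (N : ℤ) ∣ i := by
      intro h
      apply hne
      rw [R.zx h, map_one] at hi
      rw [E.pow_s_of_pp (ex g0) hi]
    -- the p'-part
    have hg0 : g0 ^ e * g0 ^ e' = g0 := E.mul_parts (ex g0)
    have hxc : ∀ g : G, g * ι (x ^ i) = ι (x ^ i) * g → g * ι x = ι x * g := R.cx i hiN
    have hyx : g0 ^ e' * ι x = ι x * g0 ^ e' := by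
      apply hxc
      rw [← hi, ← pow_add, ← pow_add, add_comm]
    have hym : (g0 ^ e') ^ m = 1 := E.qq_pow (ex g0)
    -- value of δ on x^j y
    have pe : ∀ (y' : G), y' * ι x = ι x * y' → y' ^ m = 1 → ∀ j : ℤ, (ι (x ^ j) * y') ^ e = ι (x ^ j) ∧ (ι (x ^ j) * y') ^ s = ι ((x ^ j) ^ s) * y' := by
      intro y' hy hm j
      have hcm : Commute (ι (x ^ j)) y' := by rw [map_zpow]; exact (Commute.zpow_right hy j).symm
      have hy's : y' ^ s = y' := by rw [pow_modEq' hm E.s_m, pow_one]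
      refine ⟨?_, ?_⟩
      · rw [hcm.mul_pow, E.pp_of_p (hxq j), E.pp_of_p' hm, mul_one]
      · rw [hcm.mul_pow, hy's, map_pow]
    have Fval : ∀ (y' : Subgroup.centralizer ({ι x} : Set G)), (y' : G) ^ m = 1 → (fun z => F (ζ z * y')) = fun z : Subgroup.zpowers x => χ (ι z * y') - χ (ι (z ^ s : Subgroup.zpowers x) * y') := by
      intro y' hm
      funext z
      obtain ⟨z, hz⟩ := z
      obtain ⟨j, rfl⟩ := Subgroup.mem_zpowers_iff.1 hz
      obtain ⟨h1, h2⟩ := pe y' (memL.1 y'.2) hm j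
      rw [hoff _ ⟨j, h1⟩]
      show χ (ι (x ^ j) * y') - χ ((ι (x ^ j) * y') ^ s) = _
      rw [h2]; rfl
    have hcardZ : Fintype.card (Subgroup.zpowers x) ∣ p ^ b * m := by
      refine dvd_trans ?_ (R.expT hG)
      rw [← Nat.card_eq_fintype_card, ← Nat.card_eq_fintype_card]
      exact Subgroup.card_subgroup_dvd_card _
    have hsZ : s.Coprime (Fintype.card (Subgroup.zpowers x)) := E.coprime_s.coprime_dvd_right hcardZ
    set y' : Subgroup.centralizer ({ι x} : Set G) := ⟨g0 ^ e', memL.2 hyx⟩ with hy'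
    set a : Hat (Subgroup.zpowers x) → ℂ := co (fun z => F (ζ z * y')) with ha
    have hgal : ∀ l : Hat (Subgroup.zpowers x), a (l ^ s) = co (fun z : Subgroup.zpowers x => χ (ι z * y')) (l ^ s) - co (fun z : Subgroup.zpowers x => χ (ι z * y')) l := by
      intro l
      rw [ha, Fval y' hym, co_sub, co_pow (fun z : Subgroup.zpowers x => χ (ι z * y')) hsZ l]
    have hnz : ∃ l, a l ≠ 0 := by
      by_contra hcon
      push Not at hcon
      have : (fun z => F (ζ z * y')) = fun _ => 0 := by
        apply co_ext
        intro l
        have h1 : co (fun z => F (ζ z * y')) l = 0 := hcon l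
        rw [h1]; simp [co, ip]
      rw [Fval y' hym] at this
      have h2 := congrFun this ⟨x ^ i, Subgroup.mem_zpowers_iff.2 ⟨i, rfl⟩⟩
      simp only at h2
      have h3 : χ (ι (x ^ i) * g0 ^ e') - χ (ι ((x ^ i) ^ s) * g0 ^ e') = 0 := h2
      rw [← (pe (g0 ^ e') hyx hym i).2, ← hi, hg0, sub_eq_zero] at h3
      exact hne h3.symm
    obtain ⟨l, hl⟩ := hnz
    have hpos : 0 < p ^ b * m := by rw [← hG]; exact Fintype.card_pos
    obtain ⟨n, hn1, hn2⟩ := orb_existsC hpos (fun l : Hat (Subgroup.zpowers x) => hat_pow l hcardZ) E.coprime_s hgal hl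
    -- inverses
    set v : G := w3 * w1 * w3⁻¹ with hv
    have hvx : v * ι x * v⁻¹ = (ι x)⁻¹ := R.v1x
    have hvy : (v * g0 ^ e' * v⁻¹) * ι x = ι x * (v * g0 ^ e' * v⁻¹) := by
      have h1 : (v * g0 ^ e' * v⁻¹) * (v * ι x * v⁻¹) = (v * ι x * v⁻¹) * (v * g0 ^ e' * v⁻¹) := by
        have a1 : (v * g0 ^ e' * v⁻¹) * (v * ι x * v⁻¹) = v * (g0 ^ e' * ι x) * v⁻¹ := by simp only [mul_assoc, inv_mul_cancel_left]
        have a2 : (v * ι x * v⁻¹) * (v * g0 ^ e' * v⁻¹) = v * (ι x * g0 ^ e') * v⁻¹ := by simp only [mul_assoc, inv_mul_cancel_left]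
        rw [a1, a2, hyx]
      rw [hvx] at h1
      exact (Commute.inv_right_iff.1 h1)
    set y'' : Subgroup.centralizer ({ι x} : Set G) := ⟨v * g0 ^ e' * v⁻¹, memL.2 hvy⟩ with hy''
    have hym'' : (y'' : G) ^ m = 1 := by
      show (v * g0 ^ e' * v⁻¹) ^ m = 1
      rw [conj_pow, hym]; simp
    have hinv : ∀ l : Hat (Subgroup.zpowers x), a l ≠ 0 → l⁻¹ ∈ MZ := by
      intro l hl
      apply hM3 y''
      have h1 : (fun z => F (ζ z * y'')) = fun z => F (ζ (MulEquiv.inv (Subgroup.zpowers x) z) * y') := by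
        rw [Fval y'' hym'']
        have h2 := Fval y' hym
        funext z
        rw [congrFun h2 (MulEquiv.inv (Subgroup.zpowers x) z)]
        have h3 : ∀ z : Subgroup.zpowers x, χ (ι z * y'') = χ (ι (z⁻¹ : Subgroup.zpowers x) * y') := by
          rintro ⟨z, hz⟩
          obtain ⟨j, rfl⟩ := Subgroup.mem_zpowers_iff.1 hz
          show χ (ι (x ^ j) * (v * g0 ^ e' * v⁻¹)) = χ (ι ((x ^ j)⁻¹) * g0 ^ e')
          rw [← hc.conj v (ι ((x ^ j)⁻¹) * g0 ^ e')]
          congr 1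
          have h4 : v * ι ((x ^ j)⁻¹) * v⁻¹ = ι (x ^ j) := by
            rw [map_inv, map_zpow, ← zpow_neg, ← conj_zpow, hvx]; simp
          rw [← h4]; simp only [mul_assoc, inv_mul_cancel_left]
        rw [h3, h3]
        simp [MulEquiv.inv_apply]
      rw [h1]
      have h2 := co_equiv (fun z => F (ζ z * y')) (MulEquiv.inv (Subgroup.zpowers x)) l
      have h3 : l.comp (MulEquiv.inv (Subgroup.zpowers x)).toMonoidHom = l⁻¹ := by
        ext z; simp
      rw [h3] at h2
      rw [h2]
      exact hl
    have h4 : 4 ≤ MZ.card := by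
      refine four_le E (l := l) ?_ (s_pow_p E n) hn2 (hM3 y' l hl) (hM3 y' _ hn1) (hinv l hl) (hinv _ hn1)
      ext z
      obtain ⟨z, hz⟩ := z
      obtain ⟨j, rfl⟩ := Subgroup.mem_zpowers_iff.1 hz
      have h5 : (⟨x ^ j, hz⟩ : Subgroup.zpowers x) ^ (p ^ b) = 1 := Subtype.ext (R.xq j)
      simp only [MonoidHom.pow_apply, MonoidHom.one_apply]
      rw [← map_pow, h5, map_one]
    have h5 : (4 : ℝ) ≤ MZ.card := by exact_mod_cast h4
    linarith

end R2

open Classical in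
theorem cnt_le {G : Type} [Group G] [Fintype G] {P : G → Prop} {C k : ℕ}
    (hP : ∀ z, P z → ∃ S : Finset G, S.card ≤ k ∧ ∀ h, P (h * z * h⁻¹) → h * z * h⁻¹ ∈ S)
    (hC : ∀ z, P z → (Finset.univ.filter fun h : G => h * z = z * h).card ≤ C) (g : G) :
    (Finset.univ.filter fun h : G => P (h * g * h⁻¹)).card ≤ C * k := by
  by_cases hex : ∃ h0, P (h0 * g * h0⁻¹)
  · obtain ⟨h0, h1⟩ := hex
    obtain ⟨S, hS, h2⟩ := hP _ h1
    refine le_trans (Finset.card_le_mul_card_image_of_maps_to (f := fun h => h * g * h⁻¹) (t := S) ?_ C ?_) (Nat.mul_le_mul_left _ hS)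
    · intro h hh
      have hh := (Finset.mem_filter.1 hh).2
      have e1 : h * g * h⁻¹ = (h * h0⁻¹) * (h0 * g * h0⁻¹) * (h * h0⁻¹)⁻¹ := by group
      show h * g * h⁻¹ ∈ S
      rw [e1]
      apply h2
      rw [← e1]; exact hh
    · intro c hc
      by_cases hne : (Finset.filter (fun h : G => h * g * h⁻¹ = c) (Finset.univ.filter fun h : G => P (h * g * h⁻¹))).Nonempty
      · obtain ⟨h3, hh3⟩ := hne
        rw [Finset.mem_filter, Finset.mem_filter] at hh3
        have h4 := hh3.1.2
        refine le_trans (Finset.card_le_card_of_injOn (fun h => h3 * h⁻¹) ?_ ?_) (hC _ h4)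
        · intro h hh
          have hh : h * g * h⁻¹ = c := (Finset.mem_filter.1 hh).2
          have e2 := hh.trans hh3.2.symm
          simp only [Finset.coe_filter, Finset.mem_univ, true_and, Set.mem_setOf_eq]
          rw [show h3 * h⁻¹ * (h3 * g * h3⁻¹) = h3 * h⁻¹ * (h * g * h⁻¹) by rw [e2]]
          group
        · intro a _ c _ hac
          simpa using hac
      · rw [Finset.not_nonempty_iff_eq_empty] at hne
        rw [hne]; simp
  · push Not at hex
    rw [Finset.filter_false_of_mem (fun h _ => hex h)]; simp

open Classical in
theorem card_cen {G : Type} [Group G] [Fintype G] (z : G) [Fintype (Subgroup.centralizer ({z} : Set G))] :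
    (Finset.univ.filter fun h : G => h * z = z * h).card = Fintype.card (Subgroup.centralizer ({z} : Set G)) := by
  rw [Fintype.card_of_subtype]
  intro h
  rw [Finset.mem_filter, Subgroup.mem_centralizer_singleton_iff]
  simp

namespace R2
variable {G T : Type} [Group G] [CommGroup T] {ι : T →* G} {x y : T} {w1 w3 : G} {r1 r3 : T ≃* T} {N : ℕ}
variable {p b m e e' s : ℕ}

def K1 (ι : T →* G) (x : T) (N : ℕ) (z : G) : Prop := ∃ i : ℤ, ¬ (N : ℤ) ∣ i ∧ z = ι (x ^ i)
def KR (ι : T →* G) (x y : T) (N : ℕ) (z : G) : Prop := ∃ i j : ℤ, ¬ (N : ℤ) ∣ i ∧ ¬ (N : ℤ) ∣ j ∧ ¬ (N : ℤ) ∣ i + j ∧ ¬ (N : ℤ) ∣ i - j ∧ z = ι (x ^ i * y ^ j)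

open Classical in
theorem cnt1 [Fintype G] [Fintype (Subgroup.centralizer ({ι x} : Set G))] (R : R2 ι x y w1 w3 r1 r3 (p ^ b) N) (g : G) :
    (Finset.univ.filter fun h : G => K1 ι x N (h * g * h⁻¹)).card ≤ Fintype.card (Subgroup.centralizer ({ι x} : Set G)) * 2 := by
  refine cnt_le ?_ ?_ g
  · rintro z ⟨i, hi, rfl⟩
    refine ⟨{ι (x ^ i), ι (x ^ (-i))}, Finset.card_le_two, ?_⟩
    rintro h ⟨i', hi', h1⟩
    obtain ⟨a, c, ha, hc, h2⟩ := R.fus h i 0 i' 0 (by simpa using h1)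
    rw [h1]
    have h3 : (N : ℤ) ∣ i' - a * i := by
      rcases h2 with h2 | h2
      · exact h2.1
      · exfalso; apply hi'; simpa using h2.1
    rw [R.eqx h3]
    rcases ha with rfl | rfl <;> simp
  · rintro z ⟨i, hi, rfl⟩
    rw [← card_cen]
    apply Finset.card_le_card
    intro h hh
    rw [Finset.mem_filter] at hh ⊢
    exact ⟨hh.1, R.cx i hi h hh.2⟩

open Classical in
theorem cntR [Fintype G] [Fintype T] (R : R2 ι x y w1 w3 r1 r3 (p ^ b) N) (g : G) :
    (Finset.univ.filter fun h : G => KR ι x y N (h * g * h⁻¹)).card ≤ Fintype.card T * 8 := by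
  refine cnt_le ?_ ?_ g
  · rintro z ⟨i, j, -, -, -, -, rfl⟩
    refine ⟨(({1, -1} : Finset ℤ) ×ˢ ({1, -1} : Finset ℤ)).image (fun a => ι (x ^ (a.1 * i) * y ^ (a.2 * j))) ∪
      (({1, -1} : Finset ℤ) ×ˢ ({1, -1} : Finset ℤ)).image (fun a => ι (x ^ (a.1 * j) * y ^ (a.2 * i))), ?_, ?_⟩
    · refine le_trans (Finset.card_union_le _ _) ?_
      exact Nat.add_le_add (b := 4) (d := 4) Finset.card_image_le Finset.card_image_le
    · rintro h ⟨i', j', -, -, -, -, h1⟩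
      obtain ⟨a, c, ha, hc, h2⟩ := R.fus h _ _ _ _ h1
      have hac : (a, c) ∈ (({1, -1} : Finset ℤ) ×ˢ ({1, -1} : Finset ℤ)) := by
        simp [ha, hc]
      rw [h1, Finset.mem_union]
      rcases h2 with h2 | h2
      · left; rw [R.eqx h2.1, R.eqy h2.2]; exact Finset.mem_image_of_mem _ hac
      · right; rw [R.eqx h2.1, R.eqy h2.2]; exact Finset.mem_image_of_mem _ hac
  · rintro z ⟨i, j, h1, h2, h3, h4, rfl⟩
    refine le_trans (Finset.card_le_card (t := Finset.univ.image ι) ?_) Finset.card_image_le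
    intro h hh
    rw [Finset.mem_filter] at hh
    obtain ⟨t, rfl⟩ := R.creg i j h1 h2 h3 h4 h hh.2
    exact Finset.mem_image_of_mem _ (Finset.mem_univ _)

theorem ex13 (R : R2 ι x y w1 w3 r1 r3 (p ^ b) N) {g h h' : G} (h1 : K1 ι x N (h * g * h⁻¹)) (h3 : K1 ι (x * y) N (h' * g * h'⁻¹)) : False := by
  obtain ⟨i, hi, h1⟩ := h1
  obtain ⟨k, hk, h3⟩ := h3
  have e1 : h' * g * h'⁻¹ = (h' * h⁻¹) * (h * g * h⁻¹) * (h' * h⁻¹)⁻¹ := by group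
  rw [e1, h1] at h3
  obtain ⟨a, c, ha, hc, h2⟩ := R.fus (h' * h⁻¹) i 0 k k (by rw [← mul_zpow]; simpa using h3)
  rcases h2 with h2 | h2
  · exact hk (by simpa using h2.2)
  · exact hk (by simpa using h2.1)

theorem ex1R (R : R2 ι x y w1 w3 r1 r3 (p ^ b) N) {g h h' : G} (h1 : K1 ι x N (h * g * h⁻¹)) (h3 : KR ι x y N (h' * g * h'⁻¹)) : False := by
  obtain ⟨i, hi, h1⟩ := h1
  obtain ⟨k, l, hk, hl, -, -, h3⟩ := h3
  have e1 : h' * g * h'⁻¹ = (h' * h⁻¹) * (h * g * h⁻¹) * (h' * h⁻¹)⁻¹ := by group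
  rw [e1, h1] at h3
  obtain ⟨a, c, ha, hc, h2⟩ := R.fus (h' * h⁻¹) i 0 k l (by simpa using h3)
  rcases h2 with h2 | h2
  · exact hl (by simpa using h2.2)
  · exact hk (by simpa using h2.1)

theorem ex3R (R : R2 ι x y w1 w3 r1 r3 (p ^ b) N) {g h h' : G} (h1 : K1 ι (x * y) N (h * g * h⁻¹)) (h3 : KR ι x y N (h' * g * h'⁻¹)) : False := by
  obtain ⟨i, hi, h1⟩ := h1
  obtain ⟨k, l, hk, hl, hp, hm, h3⟩ := h3
  have e1 : h' * g * h'⁻¹ = (h' * h⁻¹) * (h * g * h⁻¹) * (h' * h⁻¹)⁻¹ := by group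
  rw [e1, h1] at h3
  obtain ⟨a, c, ha, hc, h2⟩ := R.fus (h' * h⁻¹) i i k l (by rw [← mul_zpow]; exact h3)
  have h2 : (N : ℤ) ∣ k - a * i ∧ (N : ℤ) ∣ l - c * i := by
    rcases h2 with h2 | h2 <;> exact h2
  have h5 := dvd_sub h2.1 h2.2
  have h6 := dvd_add h2.1 h2.2
  rcases ha with rfl | rfl <;> rcases hc with rfl | rfl <;> ring_nf at h5 h6
  · exact hm h5
  · exact hp h6
  · exact hp h6
  · exact hm h5

theorem mem_YYy (R : R2 ι x y w1 w3 r1 r3 (p ^ b) N) {t : T} {i j : ℤ} (h : t ^ e = x ^ i * y ^ j) : t ∈ YY y e ↔ (N : ℤ) ∣ i := by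
  rw [mul_comm] at h
  exact R.yfix.mem_YY_iff h

theorem mem_YYxy (R : R2 ι x y w1 w3 r1 r3 (p ^ b) N) {t : T} {i j : ℤ} (h : t ^ e = x ^ i * y ^ j) : t ∈ YY (x * y) e ↔ (N : ℤ) ∣ i - j := by
  rw [mem_YY, h]
  constructor
  · rintro ⟨k, hk⟩
    rw [mul_zpow] at hk
    obtain ⟨h1, h2⟩ := R.ind_eq hk
    have := dvd_sub h2 h1
    ring_nf at this ⊢; exact this
  · intro h1
    exact ⟨i, by rw [mul_zpow, R.eqy h1]⟩

theorem mem_YYxy' (R : R2 ι x y w1 w3 r1 r3 (p ^ b) N) {t : T} {i j : ℤ} (h : t ^ e = x ^ i * y ^ j) : t ∈ YY (x * y⁻¹) e ↔ (N : ℤ) ∣ i + j := by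
  rw [mem_YY, h]
  constructor
  · rintro ⟨k, hk⟩
    rw [mul_zpow, inv_zpow, ← zpow_neg] at hk
    obtain ⟨h1, h2⟩ := R.ind_eq hk
    have := dvd_add h2 h1
    rw [← dvd_neg] at this
    ring_nf at this ⊢; exact this
  · intro h1
    refine ⟨i, ?_⟩
    rw [mul_zpow, inv_zpow, ← zpow_neg]
    congr 1
    apply R.eqy
    rw [← dvd_neg]; ring_nf at h1 ⊢; exact h1

def reg (x y : T) (e : ℕ) (t : T) : Prop := t ∉ YY x e ∧ t ∉ YY y e ∧ t ∉ YY (x * y) e ∧ t ∉ YY (x * y⁻¹) e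

open Classical in
theorem glob [Fintype G] [Fintype T] [Fintype (Subgroup.centralizer ({ι x} : Set G))] [Fintype (Subgroup.centralizer ({ι (x * y)} : Set G))]
    (R : R2 ι x y w1 w3 r1 r3 (p ^ b) N) (E : Ex p b m e e' s) (hG : Fintype.card G = p ^ b * m)
    {χ : G → ℂ} (hχ : χ ∈ irr G) :
    (Fintype.card (Subgroup.centralizer ({ι x} : Set G)) : ℝ)⁻¹ * ∑ g : G with (∃ i : ℤ, ¬ (N : ℤ) ∣ i ∧ g ^ e = ι (x ^ i)), Complex.normSq (χ g - χ (g ^ s))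
    + (Fintype.card (Subgroup.centralizer ({ι (x * y)} : Set G)) : ℝ)⁻¹ * ∑ g : G with (∃ i : ℤ, ¬ (N : ℤ) ∣ i ∧ g ^ e = ι ((x * y) ^ i)), Complex.normSq (χ g - χ (g ^ s))
    + (4 : ℝ)⁻¹ * ((Fintype.card T : ℝ)⁻¹ * ∑ t : T with reg x y e t, Complex.normSq (χ (ι t) - χ (ι t ^ s))) ≤ 4 := by
  set F : G → ℝ := fun g => Complex.normSq (χ g - χ (g ^ s)) with hF
  set c1 : ℝ := (Fintype.card (Subgroup.centralizer ({ι x} : Set G)) : ℝ) with hc1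
  set c3 : ℝ := (Fintype.card (Subgroup.centralizer ({ι (x * y)} : Set G)) : ℝ) with hc3
  set cT : ℝ := (Fintype.card T : ℝ) with hcT
  have p1 : 0 < c1 := by rw [hc1]; exact_mod_cast Fintype.card_pos
  have p3 : 0 < c3 := by rw [hc3]; exact_mod_cast Fintype.card_pos
  have pT : 0 < cT := by rw [hcT]; exact_mod_cast Fintype.card_pos
  set w : G → ℝ := fun g => (if K1 ι x N (g ^ e) then (c1 * 2)⁻¹ else 0) + (if K1 ι (x * y) N (g ^ e) then (c3 * 2)⁻¹ else 0)
    + (if KR ι x y N (g ^ e) then (cT * 8)⁻¹ else 0) with hw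
  have key := sum_weight (F := F) (w := w) (fun g => Complex.normSq_nonneg _) (fun h g => by
      have hc := (irr_isChar hχ)
      simp only [hF]
      rw [conj_pow, hc.conj, hc.conj]) (fun g _ => by
      simp only [hw, conj_pow]
      rw [Finset.sum_add_distrib, Finset.sum_add_distrib]
      simp only [← Finset.sum_filter, Finset.sum_const, nsmul_eq_mul]
      have q1 := R.cnt1 (g ^ e)
      have q3 := R.dual.cnt1 (g ^ e)
      have qR := R.cntR (g ^ e)
      have q1' : ((Finset.univ.filter fun h : G => K1 ι x N (h * g ^ e * h⁻¹)).card : ℝ) * (c1 * 2)⁻¹ ≤ 1 := by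
        rw [← div_eq_mul_inv, div_le_one (by positivity), hc1]; exact_mod_cast q1
      have q3' : ((Finset.univ.filter fun h : G => K1 ι (x * y) N (h * g ^ e * h⁻¹)).card : ℝ) * (c3 * 2)⁻¹ ≤ 1 := by
        rw [← div_eq_mul_inv, div_le_one (by positivity), hc3]; exact_mod_cast q3
      have qR' : ((Finset.univ.filter fun h : G => KR ι x y N (h * g ^ e * h⁻¹)).card : ℝ) * (cT * 8)⁻¹ ≤ 1 := by
        rw [← div_eq_mul_inv, div_le_one (by positivity), hcT]; exact_mod_cast qR
      by_cases a1 : ∃ h, K1 ι x N (h * g ^ e * h⁻¹)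
      · obtain ⟨h, a1⟩ := a1
        rw [Finset.filter_false_of_mem (p := fun h : G => K1 ι (x * y) N (h * g ^ e * h⁻¹)) (fun h' _ a => R.ex13 a1 a),
          Finset.filter_false_of_mem (p := fun h : G => KR ι x y N (h * g ^ e * h⁻¹)) (fun h' _ a => R.ex1R a1 a)]
        simpa using q1'
      · push Not at a1
        rw [Finset.filter_false_of_mem (p := fun h : G => K1 ι x N (h * g ^ e * h⁻¹)) (fun h' _ => a1 h')]
        by_cases a3 : ∃ h, K1 ι (x * y) N (h * g ^ e * h⁻¹)
        · obtain ⟨h, a3⟩ := a3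
          rw [Finset.filter_false_of_mem (p := fun h : G => KR ι x y N (h * g ^ e * h⁻¹)) (fun h' _ a => R.ex3R a3 a)]
          simpa using q3'
        · push Not at a3
          rw [Finset.filter_false_of_mem (p := fun h : G => K1 ι (x * y) N (h * g ^ e * h⁻¹)) (fun h' _ => a3 h')]
          simpa using qR')
  have hn := delta_nsq hχ (s := s) (by rw [hG]; exact E.coprime_s)
  have hn2 : ∑ g, F g ≤ 2 * Fintype.card G := by
    have hpos : (0 : ℝ) < Fintype.card G := by exact_mod_cast Fintype.card_pos
    have : nsq (fun g => χ g - χ (g ^ s)) = (Fintype.card G : ℝ)⁻¹ * ∑ g, F g := rfl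
    rw [this, inv_mul_le_iff₀ hpos] at hn
    linarith
  have hpos : (0 : ℝ) < Fintype.card G := by exact_mod_cast Fintype.card_pos
  have key2 : ∑ g, w g * F g ≤ 2 := by
    have := key.trans hn2
    rw [mul_comm 2] at this
    exact le_of_mul_le_mul_left this hpos
  have e1 : ∑ g, w g * F g = (c1 * 2)⁻¹ * ∑ g : G with K1 ι x N (g ^ e), F g + (c3 * 2)⁻¹ * ∑ g : G with K1 ι (x * y) N (g ^ e), F g
      + (cT * 8)⁻¹ * ∑ g : G with KR ι x y N (g ^ e), F g := by
    rw [Finset.mul_sum, Finset.mul_sum, Finset.mul_sum, Finset.sum_filter, Finset.sum_filter, Finset.sum_filter,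
      ← Finset.sum_add_distrib, ← Finset.sum_add_distrib]
    refine Finset.sum_congr rfl fun g _ => ?_
    simp only [hw]
    rw [add_mul, add_mul, ite_mul, ite_mul, ite_mul]
    simp only [zero_mul]
  have e2 : ∑ t : T with reg x y e t, Complex.normSq (χ (ι t) - χ (ι t ^ s)) ≤ ∑ g : G with KR ι x y N (g ^ e), F g := by
    rw [← Finset.sum_image (f := F) (s := Finset.univ.filter (reg x y e)) (g := ι) (fun a _ c _ h => R.inj h)]
    refine Finset.sum_le_sum_of_subset_of_nonneg ?_ (fun _ _ _ => Complex.normSq_nonneg _)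
    intro g hg
    obtain ⟨t, ht, rfl⟩ := Finset.mem_image.1 hg
    have ht := (Finset.mem_filter.1 ht).2
    obtain ⟨i, j, hij⟩ := R.te E hG t
    rw [Finset.mem_filter]
    refine ⟨Finset.mem_univ _, i, j, ?_, ?_, ?_, ?_, ?_⟩
    · rw [← R.mem_YYy hij]; exact ht.2.1
    · rw [← R.mem_YY_iff hij]; exact ht.1
    · rw [← R.mem_YYxy' hij]; exact ht.2.2.2
    · rw [← R.mem_YYxy hij]; exact ht.2.2.1
    · rw [← map_pow, hij]
  rw [e1, mul_inv, mul_inv, mul_inv] at key2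
  have e3 := mul_le_mul_of_nonneg_left e2 (inv_nonneg.2 pT.le)
  change c1⁻¹ * (∑ g : G with K1 ι x N (g ^ e), F g) + c3⁻¹ * (∑ g : G with K1 ι (x * y) N (g ^ e), F g) + (4 : ℝ)⁻¹ * (cT⁻¹ * _) ≤ 4
  linarith

end R2

theorem cop_one {H : Type} [Group H] {p b n : ℕ} {l : H} (hl : l ^ (p ^ b) = 1) (hn : n.Coprime p) (h : l ^ n = 1) : l = 1 := by
  have h6 : orderOf l ∣ Nat.gcd n (p ^ b) := Nat.dvd_gcd (orderOf_dvd_of_pow_eq_one h) (orderOf_dvd_of_pow_eq_one hl)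
  rw [Nat.Coprime.pow_right b hn, Nat.dvd_one, orderOf_eq_one_iff] at h6
  exact h6

theorem comb_final {H : Type} [CommGroup H] [DecidableEq H] {p b m e e' s : ℕ} (E : Ex p b m e e' s) {κ l : H} (hκ : κ ^ (p ^ b) = 1)
    {u : ℕ} (hu : u ≡ 1 [MOD p]) (hne : κ ^ u ≠ κ) {M1 M3 : Finset H} (c1 : M1.card ≤ 4) (c3 : M3.card ≤ 4)
    (h1 : κ ∈ M1) (h2 : κ ^ u ∈ M1) (h3 : κ⁻¹ ∈ M1) (h4 : (κ ^ u)⁻¹ ∈ M1) (h5 : l ∈ M1) (h6 : l ^ u ∈ M1)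
    (k1 : ∀ z, z = κ * l ∨ z = κ * l⁻¹ → z ∈ M3 ∧ z ^ u ∈ M3 ∧ z⁻¹ ∈ M3 ∧ (z ^ u)⁻¹ ∈ M3) : False := by
  have hp := E.hp
  have hp2 : ¬ p ∣ 2 := fun h => E.hp2 ((Nat.prime_dvd_prime_iff_eq hp Nat.prime_two).1 h)
  have cu : u.Coprime p := by rw [Nat.Coprime, hu.gcd_eq]; simp
  have c2 : Nat.Coprime 2 p := ((Nat.Prime.coprime_iff_not_dvd hp).2 hp2).symm
  have cop : ∀ {n : ℕ}, n ≡ 2 [MOD p] → n.Coprime p := by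
    intro n hn
    rw [Nat.Coprime, hn.gcd_eq]; exact c2
  have hpw : ∀ {z : H} (n : ℕ), z ^ (p ^ b) = 1 → (z ^ n) ^ (p ^ b) = 1 := by
    intro z n hz; rw [pow_right_comm, hz, one_pow]
  have full : ∀ {z : H} {M : Finset H}, z ^ (p ^ b) = 1 → z ^ u ≠ z → M.card ≤ 4 → z ∈ M → z ^ u ∈ M → z⁻¹ ∈ M → (z ^ u)⁻¹ ∈ M →
      M = {z, z ^ u, z⁻¹, (z ^ u)⁻¹} := by
    intro z M hz hzu hM a1 a2 a3 a4
    symm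
    apply Finset.eq_of_subset_of_card_le
    · intro w hw
      simp only [Finset.mem_insert, Finset.mem_singleton] at hw
      rcases hw with rfl | rfl | rfl | rfl <;> assumption
    · refine hM.trans (four_le E hz hu hzu ?_ ?_ ?_ ?_) <;> simp
  have hM1 := full hκ hne c1 h1 h2 h3 h4
  have hone : κ ≠ 1 := fun h => hne (by rw [h, one_pow])
  rw [hM1] at h5 h6
  simp only [Finset.mem_insert, Finset.mem_singleton] at h5 h6
  have caseA : l = κ ∨ l = κ⁻¹ → False := by
    intro hl
    have h7 : (κ ^ 2 = κ * l ∨ κ ^ 2 = κ * l⁻¹) ∧ (1 = κ * l ∨ 1 = κ * l⁻¹) := by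
      rcases hl with rfl | rfl
      · exact ⟨Or.inl (sq _), Or.inr (by simp)⟩
      · exact ⟨Or.inr (by simp [sq]), Or.inl (by simp)⟩
    obtain ⟨a1, a2, a3, a4⟩ := k1 _ h7.1
    have b1 := (k1 _ h7.2).1
    have n2 : (κ ^ 2) ^ u ≠ κ ^ 2 := by
      intro h
      apply hne
      have : (κ ^ u * κ⁻¹) ^ 2 = 1 := by
        rw [mul_pow, inv_pow, ← pow_mul, mul_comm u 2, pow_mul, h, mul_inv_cancel]
      have h8 := cop_one (p := p) (b := b) (n := 2) (l := κ ^ u * κ⁻¹) (by rw [mul_pow, hpw u hκ, inv_pow, hκ]; simp) c2 this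
      exact mul_inv_eq_one.1 h8
    rw [full (hpw 2 hκ) n2 c3 a1 a2 a3 a4] at b1
    simp only [Finset.mem_insert, Finset.mem_singleton] at b1
    have h9 : κ ^ 2 = 1 := by
      rcases b1 with h | h | h | h
      · exact h.symm
      · exact cop_one (hpw 2 hκ) cu h.symm
      · exact inv_eq_one.1 h.symm
      · exact cop_one (hpw 2 hκ) cu (inv_eq_one.1 h.symm)
    exact hone (cop_one hκ c2 h9)
  have caseB : ((κ ^ u) ^ u = κ ∨ (κ ^ u) ^ u = κ ^ u ∨ (κ ^ u) ^ u = κ⁻¹ ∨ (κ ^ u) ^ u = (κ ^ u)⁻¹) → False := by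
    rintro (h | h | h | h)
    · apply hne
      refine E.root hκ hu hp2 ?_
      rw [sq, pow_mul]; exact h
    · apply hne
      have : (κ ^ u * κ⁻¹) ^ u = 1 := by rw [mul_pow, h, inv_pow, mul_inv_cancel]
      have h8 := cop_one (p := p) (b := b) (n := u) (l := κ ^ u * κ⁻¹) (by rw [mul_pow, hpw u hκ, inv_pow, hκ]; simp) cu this
      exact mul_inv_eq_one.1 h8
    · have : κ ^ (u * u + 1) = 1 := by rw [pow_succ, pow_mul, h, inv_mul_cancel]
      refine hone (cop_one hκ (cop ?_) this)
      exact ((hu.mul hu).add_right 1)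
    · have : (κ ^ u) ^ (u + 1) = 1 := by rw [pow_succ, h, inv_mul_cancel]
      have h9 := cop_one (hpw u hκ) (cop (hu.add_right 1)) this
      exact hone (cop_one hκ cu h9)
  rcases h5 with h5 | h5 | h5 | h5
  · exact caseA (Or.inl h5)
  · rw [h5] at h6; exact caseB h6
  · exact caseA (Or.inr h5)
  · rw [h5, inv_pow] at h6
    apply caseB
    rcases h6 with h | h | h | h
    · right; right; left; exact inv_eq_iff_eq_inv.1 h
    · right; right; right; exact inv_eq_iff_eq_inv.1 h
    · left; exact inv_injective h
    · right; left; exact inv_injective h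

theorem co_twist {T : Type} [CommGroup T] [Fintype T] (k : T → ℂ) {r : T ≃* T} (hr : ∀ t, r (r t) = t) (μ : Hat T) :
    co (fun t => k (r t)) μ = co k (rm r μ) := by
  have := co_equiv k r (rm r μ)
  rw [show (rm r μ).comp r.toMonoidHom = μ from by ext t; simp [rm_apply, hr]] at this
  exact this

theorem rm_pow {T : Type} [CommGroup T] [Fintype T] (r : T ≃* T) (μ : Hat T) (s : ℕ) : rm r (μ ^ s) = (rm r μ) ^ s := by
  ext t; simp only [rm_apply, MonoidHom.pow_apply]

namespace R2
variable {G T : Type} [Group G] [CommGroup T] {ι : T →* G} {x y : T} {w1 w3 : G} {r1 r3 : T ≃* T} {N : ℕ}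
variable {p b m e e' s : ℕ}

theorem r3e (R : R2 ι x y w1 w3 r1 r3 (p ^ b) N) {t : T} {i j : ℤ} (h : t ^ e = x ^ i * y ^ j) : (r3 t) ^ e = x ^ j * y ^ i := by
  rw [← map_pow, h, map_mul, map_zpow, map_zpow, R.r3x, R.r3y, mul_comm]

open Classical in
theorem F_count [Fintype G] [Fintype T] (R : R2 ι x y w1 w3 r1 r3 (p ^ b) N) (E : Ex p b m e e' s) (hG : Fintype.card G = p ^ b * m)
    {F : T → ℝ} (hF : ∀ t, 0 ≤ F t) (h1 : ∀ t, F (r1 t) = F t) (h3 : ∀ t, F (r3 t) = F t) :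
    2 * (∑ t with t ∉ YY x e, F t + ∑ t with t ∉ YY (x * y) e, F t) ≤ 3 * ∑ t, F t + ∑ t with reg x y e t, F t := by
  have a1 : ∑ t with t ∉ YY x e, F t = ∑ t with t ∉ YY y e, F t := by
    rw [Finset.sum_filter, Finset.sum_filter]
    refine Fintype.sum_equiv r3.toEquiv _ _ fun t => ?_
    obtain ⟨i, j, hij⟩ := R.te E hG t
    simp only [MulEquiv.toEquiv_eq_coe, EquivLike.coe_coe, h3, R.mem_YY_iff hij, R.mem_YYy (R.r3e hij)]
  have a2 : ∑ t with t ∉ YY (x * y) e, F t = ∑ t with t ∉ YY (x * y⁻¹) e, F t := by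
    rw [Finset.sum_filter, Finset.sum_filter]
    refine Fintype.sum_equiv r1.toEquiv _ _ fun t => ?_
    obtain ⟨i, j, hij⟩ := R.te E hG t
    simp only [MulEquiv.toEquiv_eq_coe, EquivLike.coe_coe, h1, R.mem_YYxy hij, R.mem_YYxy' (R.r1e hij)]
    rw [sub_eq_add_neg]
  have a3 : 2 * (∑ t with t ∉ YY x e, F t + ∑ t with t ∉ YY (x * y) e, F t) = (∑ t with t ∉ YY x e, F t + ∑ t with t ∉ YY y e, F t) + (∑ t with t ∉ YY (x * y) e, F t + ∑ t with t ∉ YY (x * y⁻¹) e, F t) := by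
    rw [← a1, ← a2]; ring
  rw [a3]
  simp only [Finset.sum_filter, Finset.mul_sum, ← Finset.sum_add_distrib]
  refine Finset.sum_le_sum fun t _ => ?_
  have := hF t
  by_cases b1 : t ∈ YY x e <;> by_cases b2 : t ∈ YY y e <;> by_cases b3 : t ∈ YY (x * y) e <;> by_cases b4 : t ∈ YY (x * y⁻¹) e <;>
    simp [b1, b2, b3, b4, reg] <;> linarith

end R2

namespace R2
variable {G T : Type} [Group G] [CommGroup T] {ι : T →* G} {x y : T} {w1 w3 : G} {r1 r3 : T ≃* T} {N : ℕ}
variable {p b m e e' s : ℕ}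

/-- an element with trivial difference on all special parts -/
theorem finish [Fintype G] (R : R2 ι x y w1 w3 r1 r3 (p ^ b) N) (E : Ex p b m e e' s) (hG : Fintype.card G = p ^ b * m)
    {χ : G → ℂ} (hχ : χ ∈ irr G)
    (h1 : ∀ g0 : G, (∃ i : ℤ, g0 ^ e = ι (x ^ i)) → χ (g0 ^ s) = χ g0)
    (h3 : ∀ g0 : G, (∃ i : ℤ, g0 ^ e = ι ((x * y) ^ i)) → χ (g0 ^ s) = χ g0)
    (hr : ∀ t, reg x y e t → χ (ι t ^ s) = χ (ι t)) (g : G) : χ (g ^ s) = χ g := by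
  have hc := irr_isChar hχ
  have red : ∀ (h g : G), χ ((h * g * h⁻¹) ^ s) = χ (h * g * h⁻¹) → χ (g ^ s) = χ g := by
    intro h g hh
    rwa [conj_pow, hc.conj, hc.conj] at hh
  have ex : ∀ g : G, g ^ (p ^ b * m) = 1 := fun g => by rw [← hG, pow_card_eq_one]
  obtain ⟨h, i, j, k, l, hij, -⟩ := R.syl (g ^ e) 1 (E.pp_pow (ex g)) (one_pow _) (by simp)
  rw [← conj_pow] at hij
  apply red h
  generalize h * g * h⁻¹ = g at hij
  by_cases c1 : (N : ℤ) ∣ j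
  · exact h1 g ⟨i, by rw [hij, R.zy c1, mul_one]⟩
  by_cases c2 : (N : ℤ) ∣ i
  · apply red w3
    apply h1
    refine ⟨j, ?_⟩
    rw [conj_pow, hij, R.zx c2, one_mul, ← R.hr3, map_zpow, R.r3y]
  by_cases c3 : (N : ℤ) ∣ i - j
  · exact h3 g ⟨i, by rw [hij, mul_zpow, R.eqy c3]⟩
  by_cases c4 : (N : ℤ) ∣ i + j
  · apply red w1
    apply h3
    refine ⟨i, ?_⟩
    rw [conj_pow, hij, ← R.hr1, map_mul, map_zpow, map_zpow, R.r1x, R.r1y, mul_zpow, inv_zpow, ← zpow_neg]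
    rw [R.eqy (i := i) (j := -j) (by rwa [sub_neg_eq_add])]
  obtain ⟨t, rfl⟩ := R.creg i j c2 c1 c4 c3 g (by
    rw [← hij]; exact (Commute.self_pow g e).eq)
  apply hr
  have hij' : t ^ e = x ^ i * y ^ j := R.inj (by rw [map_pow, hij])
  refine ⟨?_, ?_, ?_, ?_⟩
  · rw [R.mem_YY_iff hij']; exact c1
  · rw [R.mem_YYy hij']; exact c2
  · rw [R.mem_YYxy hij']; exact c3
  · rw [R.mem_YYxy' hij']; exact c4

theorem fixed_one (E : Ex p b m e e' s) {H : Type} [Group H] {z : H} (hz : z ^ (p ^ b) = 1) (h : z⁻¹ = z) : z = 1 := by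
  have h2 : z ^ 2 = 1 := by rw [sq]; nth_rewrite 1 [← h]; exact inv_mul_cancel z
  refine cop_one hz ?_ h2
  rw [Nat.coprime_comm, Nat.Prime.coprime_iff_not_dvd E.hp]
  exact fun h => E.hp2 ((Nat.prime_dvd_prime_iff_eq E.hp Nat.prime_two).1 h)

theorem hat_ne [Fintype G] [Fintype T] (R : R2 ι x y w1 w3 r1 r3 (p ^ b) N) (E : Ex p b m e e' s) (hG : Fintype.card G = p ^ b * m)
    {μ : Hat T} {i : ℕ} (h : μ ^ (s ^ i) ≠ μ) : (μ x) ^ (s ^ i) ≠ μ x ∨ (μ y) ^ (s ^ i) ≠ μ y := by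
  by_contra hcon
  push Not at hcon
  apply h
  ext t
  congr 1
  rw [MonoidHom.pow_apply, ← map_pow]
  have h1 := E.mul_parts (R.Tpow hG t)
  have key : (μ (t ^ e)) ^ (s ^ i) = μ (t ^ e) := by
    obtain ⟨k, l, hkl⟩ := R.te E hG t
    rw [hkl, map_mul, map_zpow, map_zpow, mul_pow, ← zpow_natCast, ← zpow_natCast, zpow_comm, zpow_comm (μ y), zpow_natCast, zpow_natCast, hcon.1, hcon.2]
  have key2 : (t ^ e') ^ (s ^ i) = t ^ e' := by
    have hs : s ^ i ≡ 1 [MOD m] := by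
      have := E.s_m.pow i
      rwa [one_pow] at this
    have := pow_modEq' (E.qq_pow (R.Tpow hG t)) hs
    rwa [pow_one] at this
  rw [← h1, mul_pow, key2, map_mul, map_mul, map_pow, key]

open Classical in
theorem main_R [Fintype G] [Fintype T] (R : R2 ι x y w1 w3 r1 r3 (p ^ b) N) (E : Ex p b m e e' s) (hG : Fintype.card G = p ^ b * m)
    {χ : G → ℂ} (hχ : χ ∈ irr G) (hpel : ∀ t : G, t ^ (p ^ b) = 1 → χ (t ^ s) = χ t) (g : G) : χ (g ^ s) = χ g := by
  have hc := irr_isChar hχ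
  letI : Fintype (Subgroup.centralizer ({ι x} : Set G)) := Fintype.ofFinite _
  letI : Fintype (Subgroup.centralizer ({ι (x * y)} : Set G)) := Fintype.ofFinite _
  obtain ⟨k1, K1⟩ := R.kd E hG hχ
  obtain ⟨k3, K3⟩ := R.dual.kd E hG hχ
  have dd : ∀ {a c : ℤ}, (N : ℤ) ∣ a → (N : ℤ) ∣ c → (N : ℤ) ∣ a + c ∧ (N : ℤ) ∣ a - c := fun h h' => ⟨dvd_add h h', dvd_sub h h'⟩
  have e1 : ∀ {t : T} {i j : ℤ}, t ^ e = x ^ i * y ^ j → k1 t ≠ 0 → (N : ℤ) ∣ j ∧ ¬ (N : ℤ) ∣ i := by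
    intro t i j h hk
    have h1 : (N : ℤ) ∣ j := by
      rw [← R.mem_YY_iff h]; by_contra h2; exact hk (K1.off t h2)
    refine ⟨h1, fun h2 => hk (K1.one t ?_)⟩
    rw [h, R.zx h2, R.zy h1, one_mul]
  have e1' : ∀ {t : T} {i j : ℤ}, t ^ e = x ^ i * y ^ j → k1 (r3 t) ≠ 0 → (N : ℤ) ∣ i ∧ ¬ (N : ℤ) ∣ j := fun h hk => e1 (R.r3e h) hk
  have e3 : ∀ {t : T} {i j : ℤ}, t ^ e = x ^ i * y ^ j → k3 t ≠ 0 → (N : ℤ) ∣ i - j ∧ ¬ (N : ℤ) ∣ i + j := by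
    intro t i j h hk
    have h1 : (N : ℤ) ∣ i - j := by
      rw [← R.mem_YYxy h]; by_contra h2; exact hk (K3.off t h2)
    refine ⟨h1, fun h2 => hk (K3.one t ?_)⟩
    have h3 : (N : ℤ) ∣ i := by apply R.half; have := (dd h1 h2).1; ring_nf at this ⊢; exact this
    have h4 : (N : ℤ) ∣ j := by have := (dd h2 h3).2; simpa using this
    rw [h, R.zx h3, R.zy h4, one_mul]
  have e3' : ∀ {t : T} {i j : ℤ}, t ^ e = x ^ i * y ^ j → k3 (r1 t) ≠ 0 → (N : ℤ) ∣ i + j ∧ ¬ (N : ℤ) ∣ i - j := by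
    intro t i j h hk
    have := e3 (R.r1e h) hk
    rwa [sub_neg_eq_add, ← sub_eq_add_neg] at this
  have inv1' : ∀ t, k1 (r3 (r1 t)) = k1 (r3 t) := by
    intro t; have := K1.inv3 (r3 t); rwa [R.rr3] at this
  have inv3' : ∀ t, k3 (r1 (r3 t)) = k3 (r1 t) := by
    intro t; have := K3.inv3 (r1 t); rwa [R.rr1] at this
  set J1 : T → ℂ := fun t => k1 (r3 t) + k3 t + k3 (r1 t) with hJ1
  set J3 : T → ℂ := fun t => k3 (r1 t) + k1 t + k1 (r3 t) with hJ3
  set Δ : T → ℂ := fun t => χ (ι t) - χ (ι t ^ s) - k1 t - J1 t with hΔ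
  have hΔ3 : Δ = fun t => χ (ι t) - χ (ι t ^ s) - k3 t - J3 t := by
    funext t; simp only [hΔ, hJ1, hJ3]; ring
  have t1 : ∀ μ, co (fun t => k1 (r3 t)) μ = co k1 (rm r3 μ) := co_twist k1 R.rr3
  have t3 : ∀ μ, co (fun t => k3 (r1 t)) μ = co k3 (rm r1 μ) := co_twist k3 R.rr1
  have cJ1 : ∀ μ, co J1 μ = co k1 (rm r3 μ) + co k3 μ + co k3 (rm r1 μ) := by
    intro μ; rw [← t1, ← t3, ← co_add, ← co_add]
  have cJ3 : ∀ μ, co J3 μ = co k3 (rm r1 μ) + co k1 μ + co k1 (rm r3 μ) := by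
    intro μ; rw [← t1, ← t3, ← co_add, ← co_add]
  have iJ1 : ∀ μ, ∃ n : ℤ, co J1 μ = n := by
    intro μ
    obtain ⟨n1, h1⟩ := K1.int (rm r3 μ)
    obtain ⟨n2, h2⟩ := K3.int μ
    obtain ⟨n3, h3⟩ := K3.int (rm r1 μ)
    exact ⟨n1 + n2 + n3, by rw [cJ1, h1, h2, h3]; push_cast; ring⟩
  have iJ3 : ∀ μ, ∃ n : ℤ, co J3 μ = n := by
    intro μ
    obtain ⟨n1, h1⟩ := K3.int (rm r1 μ)
    obtain ⟨n2, h2⟩ := K1.int μ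
    obtain ⟨n3, h3⟩ := K1.int (rm r3 μ)
    exact ⟨n1 + n2 + n3, by rw [cJ3, h1, h2, h3]; push_cast; ring⟩
  have hpq : ∀ (μ : Hat T) {z : T}, z ^ (p ^ b) = 1 → (μ z) ^ (p ^ b) = 1 := by
    intro μ z hz; rw [← map_pow, hz, map_one]
  obtain ⟨S1, M1, b1, d1, m1, s1, f1⟩ := R.sec E hG hχ hpel K1 (J := J1) iJ1 (by
      intro t ht
      obtain ⟨i, j, hij⟩ := R.te E hG t
      rw [R.mem_YY_iff hij] at ht
      have a1 : k1 (r3 t) = 0 := by by_contra h; exact (e1' hij h).2 ht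
      have a2 : k3 t = 0 := by
        by_contra h; obtain ⟨h1, h2⟩ := e3 hij h
        apply h2; have := dd h1 (dvd_mul_of_dvd_right ht 2); have := this.1; ring_nf at this ⊢; exact this
      have a3 : k3 (r1 t) = 0 := by
        by_contra h; obtain ⟨h1, h2⟩ := e3' hij h
        apply h2; have := dd h1 (dvd_mul_of_dvd_right ht 2); have := this.2; ring_nf at this ⊢; exact this
      simp only [hJ1, a1, a2, a3, add_zero]) (by
      intro t
      simp only [hJ1, inv1', R.rr1]; ring) (by
      intro μ hμ
      have h1 : μ y = 1 := by
        refine fixed_one E (hpq μ (by simpa using R.yq 1)) ?_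
        conv_rhs => rw [← hμ]
        rw [rm_apply, R.r1y, map_inv]
      have h2 : co k1 (rm r3 μ) = 0 := K1.triv _ (by rw [rm_apply, R.r3x]; exact h1)
      obtain ⟨n, hn⟩ := K3.int μ
      exact ⟨n, by rw [cJ1, h2, hμ, hn]; ring⟩) hΔ
  obtain ⟨S3, M3, b3, d3, m3, s3, f3⟩ := R.dual.sec E hG hχ hpel K3 (J := J3) iJ3 (by
      intro t ht
      obtain ⟨i, j, hij⟩ := R.te E hG t
      rw [R.mem_YYxy hij] at ht
      have a1 : k3 (r1 t) = 0 := by by_contra h; exact (e3' hij h).2 ht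
      have a2 : k1 t = 0 := by
        by_contra h; obtain ⟨h1, h2⟩ := e1 hij h
        apply h2; have := (dd h1 ht).1; ring_nf at this; exact this
      have a3 : k1 (r3 t) = 0 := by
        by_contra h; obtain ⟨h1, h2⟩ := e1' hij h
        apply h2; have := (dd h1 ht).2; ring_nf at this; exact this
      simp only [hJ3, a1, a2, a3, add_zero]) (by
      intro t
      simp only [hJ3, inv3', R.rr3]; ring) (by
      intro μ hμ
      have h1 : μ (x * y⁻¹) = 1 := by
        refine fixed_one E (hpq μ (by simpa using R.dual.yq 1)) ?_
        conv_rhs => rw [← hμ]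
        rw [rm_apply, R.dual.r1y, map_inv]
      have h2 : co k3 (rm r1 μ) = 0 := K3.triv _ (by rw [rm_apply, R.dual.r3x]; exact h1)
      obtain ⟨n, hn⟩ := K1.int μ
      exact ⟨n, by rw [cJ3, h2, hμ, hn]; ring⟩) hΔ3
  have inv1 : ∀ t, Δ (r1 t) = Δ t := by
    intro t
    simp only [hΔ, hJ1]
    rw [R.hr1, conj_pow, hc.conj, hc.conj, K1.inv1, inv1', R.rr1]; ring
  have inv3 : ∀ t, Δ (r3 t) = Δ t := by
    intro t
    simp only [hΔ3, hJ3]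
    rw [R.hr3, conj_pow, hc.conj, hc.conj, K3.inv1, inv3', R.rr3]; ring
  have Δreg : ∀ t, reg x y e t → Δ t = χ (ι t) - χ (ι t ^ s) := by
    intro t ht
    obtain ⟨i, j, hij⟩ := R.te E hG t
    have n1 := mt (R.mem_YY_iff hij).2 ht.1
    have n2 := mt (R.mem_YYy hij).2 ht.2.1
    have n3 := mt (R.mem_YYxy hij).2 ht.2.2.1
    have n4 := mt (R.mem_YYxy' hij).2 ht.2.2.2
    have z1 : k1 t = 0 := by by_contra h; exact n1 (e1 hij h).1
    have z2 : k1 (r3 t) = 0 := by by_contra h; exact n2 (e1' hij h).1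
    have z3 : k3 t = 0 := by by_contra h; exact n3 (e3 hij h).1
    have z4 : k3 (r1 t) = 0 := by by_contra h; exact n4 (e3' hij h).1
    simp only [hΔ, hJ1, z1, z2, z3, z4]; ring
  have gl := R.glob E hG hχ
  have fc := R.F_count E hG (F := fun t => Complex.normSq (Δ t)) (fun t => Complex.normSq_nonneg _) (fun t => by rw [inv1]) (fun t => by rw [inv3])
  have hreg : ∑ t : T with reg x y e t, Complex.normSq (χ (ι t) - χ (ι t ^ s)) = ∑ t : T with reg x y e t, Complex.normSq (Δ t) :=
    Finset.sum_congr rfl fun t ht => by rw [Δreg t (Finset.mem_filter.1 ht).2]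
  rw [hreg] at gl
  set D : ℝ := ∑ μ, Complex.normSq (co Δ μ) with hD
  have hD2 : D = (Fintype.card T : ℝ)⁻¹ * ∑ t, Complex.normSq (Δ t) := (nsq_eq_co Δ).symm
  have pT : (0 : ℝ) < (Fintype.card T : ℝ) := by exact_mod_cast Fintype.card_pos
  have fc2 := mul_le_mul_of_nonneg_left fc (inv_nonneg.2 pT.le)
  have bound : S1 + S3 ≤ 4 + 3 / 4 * D := by
    rw [mul_inv] at b1 b3
    rw [hD2]
    nlinarith [b1, b3, gl, fc2]
  by_cases h0 : ∀ μ, co Δ μ = 0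
  · have hD0 : D = 0 := by rw [hD]; apply Finset.sum_eq_zero; intro μ _; rw [h0]; simp
    have hΔ0 : Δ = fun _ => 0 := by
      funext t; rw [co_inv Δ t]; apply Finset.sum_eq_zero; intro μ _; rw [h0]; simp
    refine R.finish E hG hχ ?_ ?_ ?_ g
    · intro g0 hg0; by_contra h; have := f1 g0 hg0 h; linarith
    · intro g0 hg0; by_contra h; have := f3 g0 hg0 h; linarith
    · intro t ht
      have := Δreg t ht
      rw [hΔ0] at this
      exact (sub_eq_zero.1 this.symm).symm
  · exfalso
    push Not at h0
    obtain ⟨μ, hμ⟩ := h0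
    have cM1 : M1.card ≤ 4 := by
      have : (M1.card : ℝ) ≤ 4 := by linarith
      exact_mod_cast this
    have cM3 : M3.card ≤ 4 := by
      have : (M3.card : ℝ) ≤ 4 := by linarith
      exact_mod_cast this
    have sy1 : ∀ μ, co Δ μ ≠ 0 → co Δ (rm r1 μ) ≠ 0 := by
      intro μ h
      rw [← co_twist Δ R.rr1, show (fun t => Δ (r1 t)) = Δ from funext inv1]; exact h
    have sy3 : ∀ μ, co Δ μ ≠ 0 → co Δ (rm r3 μ) ≠ 0 := by
      intro μ h
      rw [← co_twist Δ R.rr3, show (fun t => Δ (r3 t)) = Δ from funext inv3]; exact h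
    have mem : ∀ μ, co Δ μ ≠ 0 → μ x ∈ M1 ∧ (μ x)⁻¹ ∈ M1 ∧ μ y ∈ M1 ∧ ∀ z, z = μ x * μ y ∨ z = μ x * (μ y)⁻¹ → z ∈ M3 ∧ z⁻¹ ∈ M3 := by
      intro μ h
      have a1 := s1 _ h
      have a2 := s1 _ (sy3 _ h)
      have a3 := s1 _ (sy3 _ (sy1 _ (sy3 _ h)))
      have c1 := s3 _ h
      have c2 := s3 _ (sy1 _ h)
      have c3 := s3 _ (sy3 _ (sy1 _ (sy3 _ h)))
      have c4 := s3 _ (sy3 _ (sy1 _ (sy3 _ (sy1 _ h))))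
      simp only [rm_apply, R.r1x, R.r1y, R.r3x, R.r3y, map_mul, map_inv] at a1 a2 a3 c1 c2 c3 c4
      refine ⟨a1, a3, a2, ?_⟩
      rintro z (rfl | rfl)
      · refine ⟨c1, ?_⟩
        convert c4 using 1
        rw [mul_inv]
      · refine ⟨c2, ?_⟩
        convert c3 using 1
        rw [mul_inv, inv_inv]
    have claim : ∀ (μ : Hat T) (i : ℕ), co Δ μ ≠ 0 → co Δ (μ ^ (s ^ i)) ≠ 0 → (μ x) ^ (s ^ i) ≠ μ x → False := by
      intro μ i h h' hne
      obtain ⟨a1, a2, a3, a4⟩ := mem μ h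
      obtain ⟨c1, c2, c3, c4⟩ := mem _ h'
      simp only [MonoidHom.pow_apply] at c1 c2 c3 c4
      refine comb_final E (hpq μ (by simpa using R.xq 1)) (s_pow_p E i) hne cM1 cM3 a1 c1 a2 c2 a3 c3 ?_
      intro z hz
      have hz' : z ^ (s ^ i) = μ x ^ (s ^ i) * μ y ^ (s ^ i) ∨ z ^ (s ^ i) = μ x ^ (s ^ i) * (μ y ^ (s ^ i))⁻¹ := by
        rcases hz with rfl | rfl
        · left; rw [mul_pow]
        · right; rw [mul_pow, inv_pow]
      exact ⟨(a4 z hz).1, (c4 _ hz').1, (a4 z hz).2, (c4 _ hz').2⟩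
    have cT : s.Coprime (Fintype.card T) := E.coprime_s.coprime_dvd_right (R.expT hG)
    have hTχ : IsChar (fun t => χ (ι t)) := hc.comp ι
    choose A hA using co_nat hTχ
    have hA2 : ∀ μ, co (fun t => χ (ι t ^ s)) (μ ^ s) = A μ := by
      intro μ
      rw [← hA μ, ← co_pow (fun t => χ (ι t)) cT μ]
      simp only [map_pow]
    have hcoΔ : ∀ μ, co Δ μ = co (fun t => χ (ι t)) μ - co (fun t => χ (ι t ^ s)) μ - co k1 μ - co J1 μ := by
      intro μ; rw [← co_sub, ← co_sub, ← co_sub]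
    obtain ⟨O1, hO1⟩ := K1.orb
    obtain ⟨O3, hO3⟩ := K3.orb
    have spow : Function.Surjective (fun μ : Hat T => μ ^ s) := by
      intro μ
      obtain ⟨s', hs'⟩ := exists_inv E
      refine ⟨μ ^ s', ?_⟩
      ext t
      simp only [MonoidHom.pow_apply, ← pow_mul]
      have h1 : (μ t) ^ (p ^ b * m) = 1 := by rw [← map_pow, R.Tpow hG t, map_one]
      rw [mul_comm, pow_modEq' h1 hs', pow_one]
    have orbΔ : ∀ μ, co Δ (μ ^ s) = ((A (μ ^ s) - O1 (μ ^ s) - O1 (rm r3 (μ ^ s)) - O3 (μ ^ s) - O3 (rm r1 (μ ^ s)) : ℤ) : ℂ)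
        - ((A μ - O1 μ - O1 (rm r3 μ) - O3 μ - O3 (rm r1 μ) : ℤ) : ℂ) := by
      intro μ
      rw [hcoΔ, cJ1, hA, hA2, hO1, hO3, rm_pow, rm_pow, hO1, hO3]
      push_cast; ring
    set O : Hat T → ℤ := fun μ => A μ - O1 μ - O1 (rm r3 μ) - O3 μ - O3 (rm r1 μ) with hO
    have iΔ : ∀ μ, ∃ n : ℤ, co Δ μ = n := by
      intro μ
      obtain ⟨ν, rfl⟩ := spow μ
      exact ⟨O (ν ^ s) - O ν, by simp only; rw [orbΔ]; simp only [hO]; push_cast; ring⟩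
    choose a ha using iΔ
    obtain ⟨i, h1, h2⟩ := orb_exists (H := Hat T) (n := Fintype.card T) (a := a) (M := O) Fintype.card_pos (fun μ => hat_pow μ dvd_rfl) cT (by
      intro μ
      have := orbΔ μ
      rw [ha] at this
      exact_mod_cast this) (μ := μ) (by
      intro h; apply hμ; rw [ha, h]; simp)
    have h1' : co Δ (μ ^ (s ^ i)) ≠ 0 := by rw [ha]; exact_mod_cast h1
    rcases R.hat_ne E hG h2 with h | h
    · exact claim μ i hμ h1' h
    · refine claim (rm r3 μ) i (sy3 _ hμ) ?_ ?_
      · rw [← rm_pow]; exact sy3 _ h1'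
      · rw [rm_apply, R.r3x]; exact h

end R2

section SLtwo
variable {F : Type} [Field F]

/-- Cayley-Hamilton -/
theorem sl2_ch (Z : Matrix (Fin 2) (Fin 2) F) (h : Z.det = 1) : Z * Z = Z.trace • Z - 1 := by
  rw [Matrix.det_fin_two] at h
  ext i j
  fin_cases i <;> fin_cases j <;> simp [Matrix.mul_apply, Fin.sum_univ_two, Matrix.trace_fin_two] <;> first | ring1 | linear_combination -h

theorem sl2_inv (Z : Matrix.SpecialLinearGroup (Fin 2) F) : ((Z⁻¹ : Matrix.SpecialLinearGroup (Fin 2) F) : Matrix (Fin 2) (Fin 2) F) = (Z : Matrix (Fin 2) (Fin 2) F).trace • (1 : Matrix (Fin 2) (Fin 2) F) - (Z : Matrix (Fin 2) (Fin 2) F) := by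
  ext i j
  rw [Matrix.SpecialLinearGroup.coe_inv, Matrix.adjugate_fin_two]
  fin_cases i <;> fin_cases j <;> simp [Matrix.trace_fin_two]

theorem unip_one {R : Type} [Ring R] {n : ℕ} {z : R} (hn : ∀ r : R, (n : R) * r = 0 → r = 0) (hz : z ^ n = 1) (h : (z - 1) * (z - 1) = 0) : z = 1 := by
  have h1 : ∀ k : ℕ, z ^ k = 1 + (k : R) * (z - 1) := by
    intro k
    induction k with
    | zero => simp
    | succ k ih =>
      rw [pow_succ, ih]
      have : (1 + (k : R) * (z - 1)) * z = z + (k : R) * ((z - 1) * (z - 1)) + k * (z - 1) := by noncomm_ring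
      rw [this, h]; push_cast; noncomm_ring
  have h2 := h1 n
  rw [hz] at h2
  have h3 := hn (z - 1) (by simpa using h2.symm)
  exact sub_eq_zero.1 h3

/-- a nontrivial p-element has trace ≠ 2 -/
theorem sl2_tr {n : ℕ} (hn : (n : F) ≠ 0) {Z : Matrix.SpecialLinearGroup (Fin 2) F} (hZ : Z ^ n = 1) (hne : Z ≠ 1) : ((Z : Matrix (Fin 2) (Fin 2) F) - 1).det ≠ 0 := by
  intro h
  apply hne
  have h1 := Z.det_coe
  have ht : (Z : Matrix (Fin 2) (Fin 2) F).trace = 2 := by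
    rw [Matrix.det_fin_two] at h h1
    rw [Matrix.trace_fin_two]
    simp at h
    linear_combination h1 - h
  have hch := sl2_ch (Z : Matrix (Fin 2) (Fin 2) F) h1
  have hu : ((Z : Matrix (Fin 2) (Fin 2) F) - 1) * ((Z : Matrix (Fin 2) (Fin 2) F) - 1) = 0 := by
    rw [sub_mul, mul_sub, hch, ht, mul_one, one_mul, two_smul]; abel
  have h3 : (Z : Matrix (Fin 2) (Fin 2) F) = 1 := by
    refine unip_one (n := n) ?_ ?_ hu
    · intro r hr
      have : (n : F) • r = 0 := by rw [← hr, ← nsmul_eq_mul]; exact (Nat.cast_smul_eq_nsmul F n r)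
      exact (smul_eq_zero.1 this).resolve_left hn
    · rw [← Matrix.SpecialLinearGroup.coe_pow, hZ, Matrix.SpecialLinearGroup.coe_one]
  exact Matrix.SpecialLinearGroup.ext _ _ (fun i j => by rw [h3]; simp)

theorem sl2_left {n : ℕ} (hn : (n : F) ≠ 0) {Z : Matrix.SpecialLinearGroup (Fin 2) F} (hZ : Z ^ n = 1) (hne : Z ≠ 1) {a : Matrix (Fin 2) (Fin 2) F} (h : (Z : Matrix (Fin 2) (Fin 2) F) * a = a) : a = 0 := by
  have h1 := sl2_tr hn hZ hne
  have h2 : ((Z : Matrix (Fin 2) (Fin 2) F) - 1) * a = 0 := by rw [sub_mul, h, one_mul, sub_self]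
  have h3 : IsUnit ((Z : Matrix (Fin 2) (Fin 2) F) - 1).det := isUnit_iff_ne_zero.2 h1
  calc a = ((Z : Matrix (Fin 2) (Fin 2) F) - 1)⁻¹ * (((Z : Matrix (Fin 2) (Fin 2) F) - 1) * a) := by rw [Matrix.nonsing_inv_mul_cancel_left _ _ h3]
    _ = 0 := by rw [h2, mul_zero]

theorem sl2_right {n : ℕ} (hn : (n : F) ≠ 0) {Z : Matrix.SpecialLinearGroup (Fin 2) F} (hZ : Z ^ n = 1) (hne : Z ≠ 1) {a : Matrix (Fin 2) (Fin 2) F} (h : a * (Z : Matrix (Fin 2) (Fin 2) F) = a) : a = 0 := by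
  have h1 := sl2_tr hn hZ hne
  have h2 : a * ((Z : Matrix (Fin 2) (Fin 2) F) - 1) = 0 := by rw [mul_sub, h, mul_one, sub_self]
  have h3 : IsUnit ((Z : Matrix (Fin 2) (Fin 2) F) - 1).det := isUnit_iff_ne_zero.2 h1
  calc a = (a * ((Z : Matrix (Fin 2) (Fin 2) F) - 1)) * ((Z : Matrix (Fin 2) (Fin 2) F) - 1)⁻¹ := by rw [Matrix.mul_nonsing_inv_cancel_right _ _ h3]
    _ = 0 := by rw [h2, zero_mul]

/-- intertwiners preserve traces -/
theorem sl2_int {Z Z' : Matrix.SpecialLinearGroup (Fin 2) F} {a : Matrix (Fin 2) (Fin 2) F} (h : a * (Z : Matrix (Fin 2) (Fin 2) F) = (Z' : Matrix (Fin 2) (Fin 2) F) * a) (ha : a ≠ 0) : (Z : Matrix (Fin 2) (Fin 2) F).trace = (Z' : Matrix (Fin 2) (Fin 2) F).trace := by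
  have h1 := sl2_ch (Z : Matrix (Fin 2) (Fin 2) F) Z.det_coe
  have h2 := sl2_ch (Z' : Matrix (Fin 2) (Fin 2) F) Z'.det_coe
  have h3 : a * ((Z : Matrix (Fin 2) (Fin 2) F) * Z) = ((Z' : Matrix (Fin 2) (Fin 2) F) * Z') * a := by rw [← mul_assoc, h, mul_assoc, h, mul_assoc]
  rw [h1, h2, mul_sub, sub_mul, mul_smul_comm, h, smul_mul_assoc, mul_one, one_mul, sub_left_inj, ← sub_eq_zero, ← sub_smul, smul_eq_zero] at h3
  rcases h3 with h3 | h3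
  · exact sub_eq_zero.1 h3
  · exfalso; apply ha
    calc a = ((Z'⁻¹ : Matrix.SpecialLinearGroup (Fin 2) F) : Matrix (Fin 2) (Fin 2) F) * ((Z' : Matrix (Fin 2) (Fin 2) F) * a) := by
          rw [← mul_assoc, ← Matrix.SpecialLinearGroup.coe_mul, inv_mul_cancel]; simp
      _ = 0 := by rw [h3, mul_zero]

theorem sl2_eq {n : ℕ} (hn : (n : F) ≠ 0) {Z W : Matrix.SpecialLinearGroup (Fin 2) F} (hc : Z * W = W * Z) (hZ : Z ^ n = 1) (hW : W ^ n = 1) (h : (Z : Matrix (Fin 2) (Fin 2) F).trace = (W : Matrix (Fin 2) (Fin 2) F).trace) : Z = W ∨ Z = W⁻¹ := by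
  by_cases h0 : Z * W = 1
  · right; exact eq_inv_of_mul_eq_one_left h0
  · left
    have h1 : ((Z * W : Matrix.SpecialLinearGroup (Fin 2) F) ^ n = 1) := by rw [Commute.mul_pow hc, hZ, hW, one_mul]
    have e1 : (Z : Matrix (Fin 2) (Fin 2) F) + ((Z⁻¹ : Matrix.SpecialLinearGroup (Fin 2) F) : Matrix (Fin 2) (Fin 2) F) = (W : Matrix (Fin 2) (Fin 2) F) + ((W⁻¹ : Matrix.SpecialLinearGroup (Fin 2) F) : Matrix (Fin 2) (Fin 2) F) := by
      rw [sl2_inv, sl2_inv, h]; abel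
    have e2 : ((Z * W : Matrix.SpecialLinearGroup (Fin 2) F) : Matrix (Fin 2) (Fin 2) F) * (((Z : Matrix (Fin 2) (Fin 2) F) - W)) = ((Z : Matrix (Fin 2) (Fin 2) F) - W) := by
      have c1 : ((Z * W : Matrix.SpecialLinearGroup (Fin 2) F) : Matrix (Fin 2) (Fin 2) F) * ((Z⁻¹ : Matrix.SpecialLinearGroup (Fin 2) F) : Matrix (Fin 2) (Fin 2) F) = W := by
        rw [← Matrix.SpecialLinearGroup.coe_mul, hc]; simp
      have c2 : ((Z * W : Matrix.SpecialLinearGroup (Fin 2) F) : Matrix (Fin 2) (Fin 2) F) * ((W⁻¹ : Matrix.SpecialLinearGroup (Fin 2) F) : Matrix (Fin 2) (Fin 2) F) = Z := by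
        rw [← Matrix.SpecialLinearGroup.coe_mul]; simp
      have := congrArg (fun a => ((Z * W : Matrix.SpecialLinearGroup (Fin 2) F) : Matrix (Fin 2) (Fin 2) F) * a) e1
      simp only [mul_add, c1, c2] at this
      rw [mul_sub, sub_eq_sub_iff_add_eq_add, this, add_comm]
    have := sl2_left hn h1 h0 e2
    exact Matrix.SpecialLinearGroup.ext _ _ (fun i j => by rw [sub_eq_zero.1 this])

/-- commuting with a non-scalar matrix -/
theorem mat_key {Z a : Matrix (Fin 2) (Fin 2) F} (hZ : ∀ r : F, Z ≠ r • (1 : Matrix (Fin 2) (Fin 2) F)) (ha : a * Z = Z * a) : ∃ u v : F, a = u • (1 : Matrix (Fin 2) (Fin 2) F) + v • Z := by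
  have e00 := congrFun (congrFun ha 0) 0
  have e01 := congrFun (congrFun ha 0) 1
  have e10 := congrFun (congrFun ha 1) 0
  simp only [Matrix.mul_apply, Fin.sum_univ_two] at e00 e01 e10
  by_cases h1 : Z 0 1 = 0
  · by_cases h2 : Z 1 0 = 0
    · have h3 : Z 0 0 - Z 1 1 ≠ 0 := by
        intro h3
        apply hZ (Z 0 0)
        ext i j
        fin_cases i <;> fin_cases j <;> simp [h1, h2]
        exact (sub_eq_zero.1 h3).symm
      refine ⟨a 0 0 - (a 0 0 - a 1 1) / (Z 0 0 - Z 1 1) * Z 0 0, (a 0 0 - a 1 1) / (Z 0 0 - Z 1 1), ?_⟩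
      have k1 : a 0 1 = 0 := by
        rw [h1] at e01
        have : (Z 0 0 - Z 1 1) * a 0 1 = 0 := by linear_combination -e01
        exact (mul_eq_zero.1 this).resolve_left h3
      have k2 : a 1 0 = 0 := by
        rw [h2] at e10
        have : (Z 0 0 - Z 1 1) * a 1 0 = 0 := by linear_combination e10
        exact (mul_eq_zero.1 this).resolve_left h3
      ext i j
      fin_cases i <;> fin_cases j <;> simp [h1, h2, k1, k2]
      field_simp; ring
    · refine ⟨a 0 0 - a 1 0 / Z 1 0 * Z 0 0, a 1 0 / Z 1 0, ?_⟩
      ext i j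
      fin_cases i <;> fin_cases j <;> simp [h1, h2]
      · rw [h1] at e00
        have : Z 1 0 * a 0 1 = 0 := by linear_combination e00
        exact (mul_eq_zero.1 this).resolve_left h2
      · field_simp; linear_combination e10
  · refine ⟨a 0 0 - a 0 1 / Z 0 1 * Z 0 0, a 0 1 / Z 0 1, ?_⟩
    ext i j
    fin_cases i <;> fin_cases j <;> simp [h1]
    · field_simp; linear_combination -e00
    · field_simp; linear_combination -e01

theorem mat_comm {Z a c : Matrix (Fin 2) (Fin 2) F} (hZ : ∀ r : F, Z ≠ r • (1 : Matrix (Fin 2) (Fin 2) F)) (ha : a * Z = Z * a) (hc : c * Z = Z * c) : a * c = c * a := by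
  obtain ⟨u, v, rfl⟩ := mat_key hZ ha
  rw [add_mul, mul_add, smul_mul_assoc, mul_smul_comm, one_mul, mul_one, smul_mul_assoc, mul_smul_comm, hc]

theorem sl2_nonscalar {n : ℕ} (hodd : Odd n) {Z : Matrix.SpecialLinearGroup (Fin 2) F} (hZ : Z ^ n = 1) (hne : Z ≠ 1) (r : F) : (Z : Matrix (Fin 2) (Fin 2) F) ≠ r • (1 : Matrix (Fin 2) (Fin 2) F) := by
  intro h
  apply hne
  have h1 : r ^ 2 = 1 := by
    have := Z.det_coe
    rw [h] at this
    simpa [Matrix.det_smul] using this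
  have h2 : r ^ n = 1 := by
    have : ((Z ^ n : Matrix.SpecialLinearGroup (Fin 2) F) : Matrix (Fin 2) (Fin 2) F) = 1 := by rw [hZ]; simp
    rw [Matrix.SpecialLinearGroup.coe_pow, h, smul_pow, one_pow] at this
    have := congrFun (congrFun this 0) 0
    simpa using this
  obtain ⟨k, rfl⟩ := hodd
  rw [pow_succ, pow_mul, h1, one_pow, one_mul] at h2
  rw [h2, one_smul] at h
  exact Matrix.SpecialLinearGroup.ext _ _ (fun i j => by rw [h]; simp)

theorem quad_root [Fintype F] {c1 c0 : F} (h : c1 ^ 2 - 4 * c0 ≠ 0) : ∃ r s : F, r ^ 2 + c1 * r * s + c0 * s ^ 2 = -1 := by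
  classical
  by_cases h2 : (2 : F) = 0
  · refine ⟨1, 0, ?_⟩
    linear_combination h2
  · have hodd : Fintype.card F % 2 = 1 := FiniteField.odd_card_of_char_ne_two (by
      intro hh
      apply h2
      have := ringChar.Nat.cast_ringChar (R := F)
      rw [hh] at this; exact_mod_cast this)
    set k : F := c0 - c1 ^ 2 / 4 with hk
    have h4 : (4 : F) ≠ 0 := by
      have : (4 : F) = 2 * 2 := by norm_num
      rw [this]; exact mul_ne_zero h2 h2
    have hk0 : k ≠ 0 := by
      intro h5; apply h
      have : c1 ^ 2 - 4 * c0 = -4 * k := by rw [hk]; field_simp; ring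
      rw [this, h5, mul_zero]
    obtain ⟨a, c, hac⟩ := FiniteField.exists_root_sum_quadratic (R := F) (f := Polynomial.C 1 * Polynomial.X ^ 2 + Polynomial.C 0 * Polynomial.X + Polynomial.C 1)
      (g := Polynomial.C k * Polynomial.X ^ 2 + Polynomial.C 0 * Polynomial.X + Polynomial.C 0) (Polynomial.degree_quadratic one_ne_zero)
      (Polynomial.degree_quadratic hk0) hodd
    simp at hac
    refine ⟨a - c1 / 2 * c, c, ?_⟩
    have : (a - c1 / 2 * c) ^ 2 + c1 * (a - c1 / 2 * c) * c + c0 * c ^ 2 = a ^ 2 + k * c ^ 2 := by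
      rw [hk]; field_simp; ring
    rw [this]
    linear_combination hac

/-- an element of Matrix.SpecialLinearGroup (Fin 2) F inverting A -/
theorem sl2_w0 [Fintype F] {n : ℕ} (hn : (n : F) ≠ 0) (hodd : Odd n) {A : Matrix.SpecialLinearGroup (Fin 2) F} (hA : A ^ n = 1) (hne : A ≠ 1) : ∃ w : Matrix.SpecialLinearGroup (Fin 2) F, w * A = A⁻¹ * w := by
  have hns := sl2_nonscalar hodd hA hne
  have hdisc : ((A : Matrix (Fin 2) (Fin 2) F) 0 0 - (A : Matrix (Fin 2) (Fin 2) F) 1 1) ^ 2 + 4 * (A : Matrix (Fin 2) (Fin 2) F) 0 1 * (A : Matrix (Fin 2) (Fin 2) F) 1 0 ≠ 0 := by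
    intro h0
    have h1 := A.det_coe
    have hne1 := sl2_tr hn hA hne
    have hA2 : (A * A) ^ n = 1 := by rw [Commute.mul_pow rfl, hA, one_mul]
    have hne2 := sl2_tr hn hA2 (by
      intro h
      apply hne
      obtain ⟨k, rfl⟩ := hodd
      rw [pow_succ, pow_mul, sq, h, one_pow, one_mul] at hA
      exact hA)
    have hch := sl2_ch (A : Matrix (Fin 2) (Fin 2) F) h1
    rw [Matrix.SpecialLinearGroup.coe_mul, hch] at hne2
    rw [Matrix.det_fin_two] at hne2 h1 hne1
    simp [Matrix.trace_fin_two] at hne2 hne1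
    apply hne2
    set α := (A : Matrix (Fin 2) (Fin 2) F) 0 0
    set β := (A : Matrix (Fin 2) (Fin 2) F) 0 1
    set γ := (A : Matrix (Fin 2) (Fin 2) F) 1 0
    set δ := (A : Matrix (Fin 2) (Fin 2) F) 1 1
    have e2 : (α + δ) ^ 2 = 4 := by linear_combination h0 + 4 * h1
    linear_combination (α + δ) ^ 2 * h1 - e2
  obtain ⟨r, s, t, e1, e2⟩ : ∃ r s t : F, r * ((A : Matrix (Fin 2) (Fin 2) F) 0 0 - (A : Matrix (Fin 2) (Fin 2) F) 1 1) + s * (A : Matrix (Fin 2) (Fin 2) F) 1 0 + t * (A : Matrix (Fin 2) (Fin 2) F) 0 1 = 0 ∧ r ^ 2 + s * t = -1 := by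
    generalize (A : Matrix (Fin 2) (Fin 2) F) 0 1 = β at *
    generalize (A : Matrix (Fin 2) (Fin 2) F) 1 0 = γ at *
    generalize hd : (A : Matrix (Fin 2) (Fin 2) F) 0 0 - (A : Matrix (Fin 2) (Fin 2) F) 1 1 = d at *
    by_cases hβ : β = 0
    · by_cases hγ : γ = 0
      · refine ⟨0, 1, -1, by rw [hβ, hγ]; ring, by ring⟩
      · obtain ⟨r, t, h⟩ := quad_root (c1 := - d / γ) (c0 := - β / γ) (by
          intro h; apply hdisc; field_simp at h; linear_combination h)
        refine ⟨r, -(r * d + t * β) / γ, t, by field_simp; ring, ?_⟩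
        rw [← h]; field_simp; ring
    · obtain ⟨r, s, h⟩ := quad_root (c1 := - d / β) (c0 := - γ / β) (by
          intro h; apply hdisc; field_simp at h; linear_combination h)
      refine ⟨r, s, -(r * d + s * γ) / β, by field_simp; ring, ?_⟩
      rw [← h]; field_simp; ring
  obtain ⟨w, hw⟩ : ∃ w : Matrix.SpecialLinearGroup (Fin 2) F, (w : Matrix (Fin 2) (Fin 2) F) = !![r, s; t, -r] :=
    ⟨⟨!![r, s; t, -r], by rw [Matrix.det_fin_two]; simp; linear_combination -e2⟩, rfl⟩
  refine ⟨w, ?_⟩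
  apply Subtype.ext
  rw [Matrix.SpecialLinearGroup.coe_mul, Matrix.SpecialLinearGroup.coe_mul, sl2_inv, hw]
  ext i j
  fin_cases i <;> fin_cases j <;> simp [Matrix.mul_apply, Fin.sum_univ_two, Matrix.trace_fin_two]
  · linear_combination e1
  · ring
  · ring
  · linear_combination e1

end SLtwo

section SLgen
variable {F : Type} [Field F]

theorem sl2_gen [Fintype F] {n : ℕ} (hn : (n : F) ≠ 0) (hodd : Odd n) {Z0 : Matrix.SpecialLinearGroup (Fin 2) F} (hZ0 : Z0 ^ n = 1) (hne : Z0 ≠ 1) :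
    ∃ A : Matrix.SpecialLinearGroup (Fin 2) F, A ^ n = 1 ∧ A ≠ 1 ∧
      ∀ z : Matrix.SpecialLinearGroup (Fin 2) F, z * A = A * z → z ^ n = 1 → ∃ i : ℤ, z = A ^ i := by
  classical
  have hns := sl2_nonscalar hodd hZ0 hne
  have hcoe : ∀ z w : Matrix.SpecialLinearGroup (Fin 2) F, z * w = w * z ↔ (z : Matrix (Fin 2) (Fin 2) F) * w = w * (z : Matrix (Fin 2) (Fin 2) F) := by
    intro z w
    rw [← Matrix.SpecialLinearGroup.coe_mul, ← Matrix.SpecialLinearGroup.coe_mul]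
    exact ⟨fun h => by rw [h], fun h => Subtype.ext h⟩
  let P0 : Subgroup (Matrix.SpecialLinearGroup (Fin 2) F) :=
    { carrier := {z | z * Z0 = Z0 * z ∧ z ^ n = 1}
      mul_mem' := by
        rintro a c ⟨ha, ha'⟩ ⟨hc, hc'⟩
        have hac : a * c = c * a := (hcoe a c).2 (mat_comm hns ((hcoe _ _).1 ha) ((hcoe _ _).1 hc))
        refine ⟨?_, ?_⟩
        · rw [mul_assoc, hc, ← mul_assoc, ha, mul_assoc]
        · rw [Commute.mul_pow hac, ha', hc', one_mul]
      one_mem' := ⟨by simp, by simp⟩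
      inv_mem' := by
        rintro a ⟨ha, ha'⟩
        refine ⟨?_, by rw [inv_pow, ha', inv_one]⟩
        exact (Commute.inv_left (show Commute a Z0 from ha)) }
  let L := AlgebraicClosure F
  let φ := algebraMap F L
  have hφ : Function.Injective φ := φ.injective
  obtain ⟨c, hc⟩ : ∃ c : L, c ^ 2 - φ (Z0 : Matrix (Fin 2) (Fin 2) F).trace * c + 1 = 0 := by
    obtain ⟨c, hc⟩ := IsAlgClosed.exists_root (Polynomial.C 1 * Polynomial.X ^ 2 + Polynomial.C (- φ (Z0 : Matrix (Fin 2) (Fin 2) F).trace) * Polynomial.X + Polynomial.C 1 : Polynomial L) (by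
      rw [Polynomial.degree_quadratic one_ne_zero]; decide)
    refine ⟨c, ?_⟩
    simp [Polynomial.IsRoot] at hc
    linear_combination hc
  obtain ⟨v, hv0, hv⟩ : ∃ v : Fin 2 → L, v ≠ 0 ∧ ((Z0 : Matrix (Fin 2) (Fin 2) F).map φ - c • 1).mulVec v = 0 := by
    apply Matrix.exists_mulVec_eq_zero_iff.2
    have hd := congrArg φ (Z0.det_coe)
    rw [Matrix.det_fin_two] at hd
    rw [Matrix.trace_fin_two] at hc
    rw [Matrix.det_fin_two]
    simp at hd hc ⊢
    linear_combination hc + hd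
  have hv' : ((Z0 : Matrix (Fin 2) (Fin 2) F).map φ).mulVec v = c • v := by
    rw [Matrix.sub_mulVec, Matrix.smul_mulVec, Matrix.one_mulVec, sub_eq_zero] at hv
    exact hv
  have hex : ∀ z : P0, ∃ k : L, (((z : Matrix.SpecialLinearGroup (Fin 2) F) : Matrix (Fin 2) (Fin 2) F).map φ).mulVec v = k • v := by
    rintro ⟨z, hz, hz'⟩
    obtain ⟨u, w, h⟩ := mat_key hns ((hcoe _ _).1 hz)
    refine ⟨φ u + φ w * c, ?_⟩
    have : (z : Matrix (Fin 2) (Fin 2) F).map φ = φ u • (1 : Matrix (Fin 2) (Fin 2) L) + φ w • (Z0 : Matrix (Fin 2) (Fin 2) F).map φ := by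
      rw [h]
      ext i j
      fin_cases i <;> fin_cases j <;> simp
    show ((z : Matrix (Fin 2) (Fin 2) F).map φ).mulVec v = _
    rw [this, Matrix.add_mulVec, Matrix.smul_mulVec, Matrix.smul_mulVec, hv', Matrix.one_mulVec, smul_smul, ← add_smul]
  choose f hf using hex
  have hcan : ∀ k l : L, k • v = l • v → k = l := by
    intro k l h
    rw [← sub_eq_zero, ← sub_smul, smul_eq_zero] at h
    exact sub_eq_zero.1 (h.resolve_right hv0)
  let f' : P0 →* L :=
    { toFun := f
      map_one' := hcan _ _ (by rw [← hf]; simp [Matrix.map_one])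
      map_mul' := by
        intro a d
        apply hcan
        rw [← hf]
        simp only [Subgroup.coe_mul, Matrix.SpecialLinearGroup.coe_mul, Matrix.map_mul]
        rw [← Matrix.mulVec_mulVec, hf, Matrix.mulVec_smul, hf, smul_smul, mul_comm] }
  have hinj : Function.Injective f' := by
    rw [injective_iff_map_eq_one]
    intro z hz
    by_contra h
    have hz1 : (z : Matrix.SpecialLinearGroup (Fin 2) F) ≠ 1 := fun h' => h (Subtype.ext h')
    have h1 := sl2_tr hn z.2.2 hz1
    have h2 := hf z
    have hz' : f z = 1 := hz
    rw [hz', one_smul] at h2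
    have h3 : ((((z : Matrix.SpecialLinearGroup (Fin 2) F) : Matrix (Fin 2) (Fin 2) F) - 1).map φ).det = 0 := by
      apply Matrix.exists_mulVec_eq_zero_iff.1
      refine ⟨v, hv0, ?_⟩
      rw [Matrix.map_sub _ (fun a d => map_sub φ a d), Matrix.map_one _ (map_zero _) (map_one _), Matrix.sub_mulVec, h2, Matrix.one_mulVec, sub_self]
    apply h1
    apply hφ
    rw [map_zero, ← h3]
    exact RingHom.map_det φ _
  have hcyc : IsCyclic P0 := isCyclic_of_subgroup_isDomain f' hinj
  obtain ⟨A, hA⟩ := hcyc.exists_generator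
  have hgen : ∀ z ∈ P0, ∃ i : ℤ, z = (A : Matrix.SpecialLinearGroup (Fin 2) F) ^ i := by
    intro z hz
    obtain ⟨i, hi⟩ := hA ⟨z, hz⟩
    refine ⟨i, ?_⟩
    have := congrArg Subtype.val hi
    simpa using this.symm
  obtain ⟨k, hk⟩ := hgen Z0 ⟨rfl, hZ0⟩
  refine ⟨A, A.2.2, ?_, ?_⟩
  · intro h
    rw [h, one_zpow] at hk
    exact hne hk
  · intro z hz hz'
    apply hgen
    refine ⟨?_, hz'⟩
    rw [hk]
    exact (Commute.zpow_right (show Commute z _ from hz) k)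

end SLgen

/-- an abstract Sylow-type conjugation lemma -/
theorem syl_abs {G : Type} [Group G] [Finite G] {p : ℕ} (hp : p.Prime) (P : Subgroup G) (hP : IsPGroup p P)
    (h : ∀ g : G, (∀ z ∈ P, g * z * g⁻¹ ∈ P) → (∃ k : ℕ, g ^ (p ^ k) = 1) → g ∈ P)
    {b : ℕ} {a c : G} (ha : a ^ (p ^ b) = 1) (hc : c ^ (p ^ b) = 1) (hac : a * c = c * a) :
    ∃ k : G, k * a * k⁻¹ ∈ P ∧ k * c * k⁻¹ ∈ P := by
  haveI : Fact p.Prime := ⟨hp⟩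
  obtain ⟨S, hS⟩ := hP.exists_le_sylow
  have hPS : P = S := by
    by_contra hne
    have hlt : P.subgroupOf (S : Subgroup G) < ⊤ := by
      rw [lt_top_iff_ne_top]
      intro h'
      rw [Subgroup.subgroupOf_eq_top] at h'
      exact hne (le_antisymm hS h')
    haveI : Group.IsNilpotent (S : Subgroup G) := IsPGroup.isNilpotent S.isPGroup'
    have h2 := Group.normalizerCondition_of_isNilpotent (G := (S : Subgroup G)) _ hlt
    obtain ⟨g, hg1, hg2⟩ := SetLike.exists_of_lt h2
    apply hg2
    rw [Subgroup.mem_subgroupOf]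
    apply h
    · intro z hz
      have := (Subgroup.mem_normalizer_iff.1 hg1 ⟨z, hS hz⟩).1 (by rw [Subgroup.mem_subgroupOf]; exact hz)
      rw [Subgroup.mem_subgroupOf] at this
      simpa using this
    · obtain ⟨k, hk⟩ := S.isPGroup' g
      exact ⟨k, by simpa using congrArg Subtype.val hk⟩
  have pz : ∀ a : G, a ^ (p ^ b) = 1 → IsPGroup p (Subgroup.zpowers a) := by
    rintro a ha ⟨z, hz⟩
    obtain ⟨i, rfl⟩ := Subgroup.mem_zpowers_iff.1 hz
    refine ⟨b, Subtype.ext ?_⟩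
    simp only [SubgroupClass.coe_pow, OneMemClass.coe_one]
    rw [← zpow_natCast, ← zpow_mul, mul_comm, zpow_mul, zpow_natCast, ha, one_zpow]
  have hQ : IsPGroup p (Subgroup.zpowers a ⊔ Subgroup.zpowers c : Subgroup G) := by
    refine IsPGroup.to_sup_of_normal_right' (pz a ha) (pz c hc) ?_
    rw [Subgroup.zpowers_le]
    rw [Subgroup.mem_normalizer_iff]
    have hfix : ∀ z ∈ Subgroup.zpowers c, a * z * a⁻¹ = z := by
      intro z hz
      obtain ⟨i, rfl⟩ := Subgroup.mem_zpowers_iff.1 hz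
      rw [(Commute.zpow_right (show Commute a c from hac) i).eq, mul_inv_cancel_right]
    intro z
    constructor
    · intro hz; rw [hfix z hz]; exact hz
    · intro hz
      have := hfix _ hz
      have h5 : a * z * a⁻¹ = z := by
        have h6 := congrArg (fun w => a⁻¹ * w * a) this
        simpa [mul_assoc] using h6
      rwa [h5] at hz
  obtain ⟨Q, hQ'⟩ := hQ.exists_le_sylow
  obtain ⟨k, hk⟩ := MulAction.exists_smul_eq G Q S
  refine ⟨k, ?_, ?_⟩
  · rw [hPS, ← hk]
    have : a ∈ (Q : Subgroup G) := hQ' (Subgroup.mem_sup_left (Subgroup.mem_zpowers a))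
    exact Subgroup.smul_mem_pointwise_smul a (MulAut.conj k) _ this
  · rw [hPS, ← hk]
    have : c ∈ (Q : Subgroup G) := hQ' (Subgroup.mem_sup_right (Subgroup.mem_zpowers c))
    exact Subgroup.smul_mem_pointwise_smul c (MulAut.conj k) _ this

theorem perm4 {G : Type} [Group G] (φ : G ≃* G) {x y : G} (h1 : φ x = x ∨ φ x = x⁻¹ ∨ φ x = y ∨ φ x = y⁻¹)
    (h2 : φ y = x ∨ φ y = x⁻¹ ∨ φ y = y ∨ φ y = y⁻¹) : φ (φ (φ (φ x))) = x := by
  rcases h1 with h1 | h1 | h1 | h1 <;> rcases h2 with h2 | h2 | h2 | h2 <;> try (simp [h1, h2]; done)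
  · have := φ.injective (h1.trans h2.symm); rw [this, h2, h2, h2, h2]
  · have : x = y⁻¹ := φ.injective (by rw [map_inv, h1, h2, inv_inv])
    rw [this, map_inv, h2, inv_inv, h2, map_inv, h2, inv_inv, h2]
  · have : x = y⁻¹ := φ.injective (by rw [map_inv, h1, h2])
    rw [this, map_inv, h2, map_inv, h2, map_inv, h2, map_inv, h2]
  · have : x = y := φ.injective (by rw [h1, h2])
    rw [this, h2, map_inv, h2, inv_inv, h2, map_inv, h2, inv_inv]

structure SPD {F : Type} [Field F] {G : Type} [Group G] (ρ : G →* Matrix (Fin 2 ⊕ Fin 2) (Fin 2 ⊕ Fin 2) F)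
    (D : Matrix.SpecialLinearGroup (Fin 2) F × Matrix.SpecialLinearGroup (Fin 2) F →* G) (w3 : G) : Prop where
  inj : Function.Injective ρ
  hD : ∀ z, ρ (D z) = Matrix.fromBlocks (z.1 : Matrix (Fin 2) (Fin 2) F) 0 0 (z.2 : Matrix (Fin 2) (Fin 2) F)
  hw3 : ρ w3 = Matrix.fromBlocks 0 1 1 0
  det : ∀ g a d, ρ g = Matrix.fromBlocks a 0 0 d → a.det = 1 ∧ d.det = 1

structure SPA {F : Type} [Field F] (A w0 : Matrix.SpecialLinearGroup (Fin 2) F) (n N : ℕ) : Prop where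
  hn : (n : F) ≠ 0
  nodd : Odd n
  An : A ^ n = 1
  ne : A ≠ 1
  gen : ∀ z : Matrix.SpecialLinearGroup (Fin 2) F, z * A = A * z → z ^ n = 1 → ∃ i : ℤ, z = A ^ i
  ord : orderOf A = N
  hw0 : w0 * A = A⁻¹ * w0

namespace SPD
variable {F : Type} [Field F] {G : Type} [Group G] {ρ : G →* Matrix (Fin 2 ⊕ Fin 2) (Fin 2 ⊕ Fin 2) F}
    {D : Matrix.SpecialLinearGroup (Fin 2) F × Matrix.SpecialLinearGroup (Fin 2) F →* G} {w3 : G}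
    {A w0 : Matrix.SpecialLinearGroup (Fin 2) F} {n N : ℕ}

theorem blocks (S : SPD ρ D w3) {g : G} {z z' : Matrix.SpecialLinearGroup (Fin 2) F × Matrix.SpecialLinearGroup (Fin 2) F} :
    g * D z = D z' * g ↔
    (ρ g).toBlocks₁₁ * (z.1 : Matrix (Fin 2) (Fin 2) F) = (z'.1 : Matrix (Fin 2) (Fin 2) F) * (ρ g).toBlocks₁₁ ∧
    (ρ g).toBlocks₁₂ * (z.2 : Matrix (Fin 2) (Fin 2) F) = (z'.1 : Matrix (Fin 2) (Fin 2) F) * (ρ g).toBlocks₁₂ ∧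
    (ρ g).toBlocks₂₁ * (z.1 : Matrix (Fin 2) (Fin 2) F) = (z'.2 : Matrix (Fin 2) (Fin 2) F) * (ρ g).toBlocks₂₁ ∧
    (ρ g).toBlocks₂₂ * (z.2 : Matrix (Fin 2) (Fin 2) F) = (z'.2 : Matrix (Fin 2) (Fin 2) F) * (ρ g).toBlocks₂₂ := by
  rw [← S.inj.eq_iff, map_mul, map_mul, S.hD, S.hD]
  conv_lhs => rw [← Matrix.fromBlocks_toBlocks (ρ g), Matrix.fromBlocks_multiply, Matrix.fromBlocks_multiply, Matrix.fromBlocks_inj]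
  simp

theorem Dinj (S : SPD ρ D w3) : Function.Injective D := by
  intro z z' h
  have h1 := congrArg ρ h
  rw [S.hD, S.hD, Matrix.fromBlocks_inj] at h1
  exact Prod.ext (Subtype.ext h1.1) (Subtype.ext h1.2.2.2)

theorem nz (S : SPD ρ D w3) (g : G) : ((ρ g).toBlocks₁₁ ≠ 0 ∧ (ρ g).toBlocks₂₂ ≠ 0) ∨ ((ρ g).toBlocks₁₂ ≠ 0 ∧ (ρ g).toBlocks₂₁ ≠ 0) := by
  have h1 : ρ g * ρ g⁻¹ = 1 := by rw [← map_mul, mul_inv_cancel, map_one]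
  have h2 : ρ g⁻¹ * ρ g = 1 := by rw [← map_mul, inv_mul_cancel, map_one]
  rw [← Matrix.fromBlocks_toBlocks (ρ g), ← Matrix.fromBlocks_toBlocks (ρ g⁻¹), Matrix.fromBlocks_multiply, ← Matrix.fromBlocks_one, Matrix.fromBlocks_inj] at h1 h2
  by_contra hcon
  have h0 : (1 : Matrix (Fin 2) (Fin 2) F) ≠ 0 := one_ne_zero
  by_cases e1 : (ρ g).toBlocks₁₁ = 0 <;> by_cases e2 : (ρ g).toBlocks₂₂ = 0 <;> by_cases e3 : (ρ g).toBlocks₁₂ = 0 <;>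
    by_cases e4 : (ρ g).toBlocks₂₁ = 0 <;> simp_all

theorem Apow (H : SPA A w0 n N) {i : ℤ} : (A ^ i) ^ n = 1 := by
  rw [← zpow_natCast, ← zpow_mul, mul_comm, zpow_mul, zpow_natCast, H.An, one_zpow]

theorem Aone (H : SPA A w0 n N) {i : ℤ} : A ^ i = 1 ↔ (N : ℤ) ∣ i := by
  rw [← H.ord, orderOf_dvd_iff_zpow_eq_one]

theorem Apm (H : SPA A w0 n N) {i j : ℤ} (h : ((A ^ i : Matrix.SpecialLinearGroup (Fin 2) F) : Matrix (Fin 2) (Fin 2) F).trace = ((A ^ j : Matrix.SpecialLinearGroup (Fin 2) F) : Matrix (Fin 2) (Fin 2) F).trace) :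
    ∃ a : ℤ, (a = 1 ∨ a = -1) ∧ (N : ℤ) ∣ j - a * i := by
  rcases sl2_eq H.hn (Commute.zpow_zpow_self A i j) (Apow H) (Apow H) h with h | h
  · refine ⟨1, Or.inl rfl, ?_⟩
    rw [← Aone H, one_mul, zpow_sub, h, mul_inv_cancel]
  · refine ⟨-1, Or.inr rfl, ?_⟩
    rw [← Aone H, neg_one_mul, sub_neg_eq_add, zpow_add, h, mul_inv_cancel]

theorem cA (H : SPA A w0 n N) {i : ℤ} (hi : ¬ (N : ℤ) ∣ i) {a : Matrix (Fin 2) (Fin 2) F}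
    (h : a * ((A ^ i : Matrix.SpecialLinearGroup (Fin 2) F) : Matrix (Fin 2) (Fin 2) F) = ((A ^ i : Matrix.SpecialLinearGroup (Fin 2) F) : Matrix (Fin 2) (Fin 2) F) * a) :
    a * (A : Matrix (Fin 2) (Fin 2) F) = (A : Matrix (Fin 2) (Fin 2) F) * a := by
  refine mat_comm (sl2_nonscalar H.nodd (Apow H (i := i)) (fun h => hi ((Aone H).1 h))) h ?_
  rw [← Matrix.SpecialLinearGroup.coe_mul, ← Matrix.SpecialLinearGroup.coe_mul, (Commute.self_zpow A i).eq]

theorem xy (S : SPD ρ D w3) (A : Matrix.SpecialLinearGroup (Fin 2) F) (i j : ℤ) : (D (A, 1)) ^ i * (D (1, A)) ^ j = D (A ^ i, A ^ j) := by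
  rw [← map_zpow, ← map_zpow, ← map_mul]; simp

theorem fus (S : SPD ρ D w3) (H : SPA A w0 n N) {g : G} {i j i' j' : ℤ} (h : g * D (A ^ i, A ^ j) = D (A ^ i', A ^ j') * g) :
    ∃ a c : ℤ, (a = 1 ∨ a = -1) ∧ (c = 1 ∨ c = -1) ∧
      (((N : ℤ) ∣ i' - a * i ∧ (N : ℤ) ∣ j' - c * j) ∨ ((N : ℤ) ∣ i' - a * j ∧ (N : ℤ) ∣ j' - c * i)) := by
  obtain ⟨h1, h2, h3, h4⟩ := S.blocks.1 h
  rcases S.nz g with ⟨k1, k2⟩ | ⟨k1, k2⟩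
  · obtain ⟨a, ha, ha'⟩ := Apm H (sl2_int h1 k1)
    obtain ⟨c, hc, hc'⟩ := Apm H (sl2_int h4 k2)
    exact ⟨a, c, ha, hc, Or.inl ⟨ha', hc'⟩⟩
  · obtain ⟨a, ha, ha'⟩ := Apm H (sl2_int h2 k1)
    obtain ⟨c, hc, hc'⟩ := Apm H (sl2_int h3 k2)
    exact ⟨a, c, ha, hc, Or.inr ⟨ha', hc'⟩⟩

theorem cx (S : SPD ρ D w3) (H : SPA A w0 n N) {i : ℤ} (hi : ¬ (N : ℤ) ∣ i) {g : G} (h : g * D (A ^ i, 1) = D (A ^ i, 1) * g) :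
    (ρ g).toBlocks₁₂ = 0 ∧ (ρ g).toBlocks₂₁ = 0 ∧ g * D (A, 1) = D (A, 1) * g := by
  obtain ⟨h1, h2, h3, h4⟩ := S.blocks.1 h
  have hA : A ^ i ≠ 1 := fun h => hi ((Aone H).1 h)
  have k1 := cA H hi h1
  simp at h2 h3
  have k2 := sl2_left H.hn (Apow H (i := i)) hA h2.symm
  have k3 := sl2_right H.hn (Apow H (i := i)) hA h3
  refine ⟨k2, k3, S.blocks.2 ⟨k1, ?_, ?_, ?_⟩⟩
  · rw [k2]; simp
  · rw [k3]; simp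
  · simp

theorem cxy (S : SPD ρ D w3) (H : SPA A w0 n N) {i : ℤ} (hi : ¬ (N : ℤ) ∣ i) {g : G} (h : g * D (A ^ i, A ^ i) = D (A ^ i, A ^ i) * g) :
    g * D (A, A) = D (A, A) * g := by
  obtain ⟨h1, h2, h3, h4⟩ := S.blocks.1 h
  exact S.blocks.2 ⟨cA H hi h1, cA H hi h2, cA H hi h3, cA H hi h4⟩

theorem creg (S : SPD ρ D w3) (H : SPA A w0 n N) {i j : ℤ} (hi : ¬ (N : ℤ) ∣ i) (hj : ¬ (N : ℤ) ∣ j)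
    (hij : ¬ (N : ℤ) ∣ i + j) (hij' : ¬ (N : ℤ) ∣ i - j) {g : G} (h : g * D (A ^ i, A ^ j) = D (A ^ i, A ^ j) * g) :
    g * D (A, 1) = D (A, 1) * g ∧ g * D (1, A) = D (1, A) * g := by
  obtain ⟨h1, h2, h3, h4⟩ := S.blocks.1 h
  have no : ((A ^ i : Matrix.SpecialLinearGroup (Fin 2) F) : Matrix (Fin 2) (Fin 2) F).trace ≠ ((A ^ j : Matrix.SpecialLinearGroup (Fin 2) F) : Matrix (Fin 2) (Fin 2) F).trace := by
    intro h
    obtain ⟨a, ha, ha'⟩ := Apm H h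
    rcases ha with rfl | rfl
    · apply hij'; rw [one_mul] at ha'; rwa [← dvd_neg, neg_sub]
    · apply hij; have : j - -1 * i = i + j := by ring
      rwa [this] at ha'
  have k2 : (ρ g).toBlocks₁₂ = 0 := by
    by_contra hh; exact no (sl2_int h2 hh).symm
  have k3 : (ρ g).toBlocks₂₁ = 0 := by
    by_contra hh; exact no (sl2_int h3 hh)
  refine ⟨S.blocks.2 ⟨cA H hi h1, ?_, ?_, ?_⟩, S.blocks.2 ⟨?_, ?_, ?_, cA H hj h4⟩⟩ <;> simp [k2, k3]

theorem N1 (H : SPA A w0 n N) : ¬ (N : ℤ) ∣ 1 := by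
  intro h
  have := (Aone H).2 h
  rw [zpow_one] at this
  exact H.ne this

theorem pT (S : SPD ρ D w3) (H : SPA A w0 n N) {g : G} (h : g * D (A, 1) = D (A, 1) * g) (h' : g * D (1, A) = D (1, A) * g)
    (hg : g ^ n = 1) : ∃ i j : ℤ, g = D (A ^ i, A ^ j) := by
  obtain ⟨k2, k3, -⟩ := S.cx H (N1 H) (g := g) (by rw [zpow_one]; exact h)
  obtain ⟨h1, -, -, -⟩ := S.blocks.1 h
  obtain ⟨-, -, -, h4⟩ := S.blocks.1 h'
  have e := Matrix.fromBlocks_toBlocks (ρ g)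
  rw [k2, k3] at e
  obtain ⟨d1, d2⟩ := S.det g _ _ e.symm
  obtain ⟨a, ha⟩ : ∃ a : Matrix.SpecialLinearGroup (Fin 2) F, (a : Matrix (Fin 2) (Fin 2) F) = (ρ g).toBlocks₁₁ := ⟨⟨_, d1⟩, rfl⟩
  obtain ⟨d, hd⟩ : ∃ a : Matrix.SpecialLinearGroup (Fin 2) F, (a : Matrix (Fin 2) (Fin 2) F) = (ρ g).toBlocks₂₂ := ⟨⟨_, d2⟩, rfl⟩
  have hgD : g = D (a, d) := by
    apply S.inj
    rw [S.hD, ← e, ha, hd]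
  have hpow : D (a ^ n, d ^ n) = D (1, 1) := by
    have : D (a ^ n, d ^ n) = D (a, d) ^ n := by rw [← map_pow]; rfl
    rw [this, ← hgD, hg]; exact (map_one D).symm
  have hpow2 := S.Dinj hpow
  simp only [Prod.mk.injEq] at hpow2
  obtain ⟨i, hi⟩ := H.gen a (Subtype.ext (by
    rw [Matrix.SpecialLinearGroup.coe_mul, Matrix.SpecialLinearGroup.coe_mul, ha]; exact h1)) hpow2.1
  obtain ⟨j, hj⟩ := H.gen d (Subtype.ext (by
    rw [Matrix.SpecialLinearGroup.coe_mul, Matrix.SpecialLinearGroup.coe_mul, hd]; exact h4)) hpow2.2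
  exact ⟨i, j, by rw [hgD, hi, hj]⟩

end SPD

namespace SPD
variable {F : Type} [Field F] {G : Type} [Group G] {ρ : G →* Matrix (Fin 2 ⊕ Fin 2) (Fin 2 ⊕ Fin 2) F}
    {D : Matrix.SpecialLinearGroup (Fin 2) F × Matrix.SpecialLinearGroup (Fin 2) F →* G} {w3 : G}
    {A w0 : Matrix.SpecialLinearGroup (Fin 2) F} {n N p b m e e' s : ℕ}

theorem Aeq (H : SPA A w0 n N) {i j : ℤ} (h : (N : ℤ) ∣ i - j) : A ^ i = A ^ j := by
  have := (Aone H).2 h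
  rwa [zpow_sub, mul_inv_eq_one] at this

theorem fus1 (S : SPD ρ D w3) (H : SPA A w0 n N) {g : G} {i' j' : ℤ} (h : g * D (A, 1) * g⁻¹ = D (A ^ i', A ^ j')) :
    g * D (A, 1) * g⁻¹ = D (A, 1) ∨ g * D (A, 1) * g⁻¹ = (D (A, 1))⁻¹ ∨ g * D (A, 1) * g⁻¹ = D (1, A) ∨ g * D (A, 1) * g⁻¹ = (D (1, A))⁻¹ := by
  obtain ⟨a, c, ha, hc, hh⟩ := S.fus H (g := g) (i := 1) (j := 0) (i' := i') (j' := j') (by rw [← h]; simp)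
  rw [h, ← map_inv, ← map_inv]
  rcases hh with ⟨h1, h2⟩ | ⟨h1, h2⟩
  · rw [Aeq H h1, Aeq H h2]
    rcases ha with rfl | rfl <;> simp
  · rw [Aeq H h1, Aeq H h2]
    rcases hc with rfl | rfl <;> simp

theorem fus2 (S : SPD ρ D w3) (H : SPA A w0 n N) {g : G} {i' j' : ℤ} (h : g * D (1, A) * g⁻¹ = D (A ^ i', A ^ j')) :
    g * D (1, A) * g⁻¹ = D (A, 1) ∨ g * D (1, A) * g⁻¹ = (D (A, 1))⁻¹ ∨ g * D (1, A) * g⁻¹ = D (1, A) ∨ g * D (1, A) * g⁻¹ = (D (1, A))⁻¹ := by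
  obtain ⟨a, c, ha, hc, hh⟩ := S.fus H (g := g) (i := 0) (j := 1) (i' := i') (j' := j') (by rw [← h]; simp)
  rw [h, ← map_inv, ← map_inv]
  rcases hh with ⟨h1, h2⟩ | ⟨h1, h2⟩
  · rw [Aeq H h1, Aeq H h2]
    rcases hc with rfl | rfl <;> simp
  · rw [Aeq H h1, Aeq H h2]
    rcases ha with rfl | rfl <;> simp

theorem syl [Finite G] (hp : p.Prime) (hG : Nat.card G = p ^ b * m) (hpm : ¬ p ∣ m) (S : SPD ρ D w3) (H : SPA A w0 (p ^ b) N) {a c : G} (ha : a ^ (p ^ b) = 1) (hc : c ^ (p ^ b) = 1) (hac : a * c = c * a) :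
    ∃ (h : G) (i j k l : ℤ), h * a * h⁻¹ = D (A ^ i, A ^ j) ∧ h * c * h⁻¹ = D (A ^ k, A ^ l) := by
  let P : Subgroup G := Subgroup.map D ((Subgroup.zpowers A).prod (Subgroup.zpowers A))
  have memP : ∀ z, z ∈ P ↔ ∃ i j : ℤ, z = D (A ^ i, A ^ j) := by
    intro z
    constructor
    · rintro ⟨⟨u, v⟩, ⟨⟨i, hi⟩, ⟨j, hj⟩⟩, rfl⟩
      refine ⟨i, j, ?_⟩
      simp at hi hj
      rw [hi, hj]
    · rintro ⟨i, j, rfl⟩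
      exact ⟨(A ^ i, A ^ j), ⟨⟨i, rfl⟩, ⟨j, rfl⟩⟩, rfl⟩
  have hP : IsPGroup p P := by
    rintro ⟨z, hz⟩
    obtain ⟨i, j, rfl⟩ := (memP z).1 hz
    refine ⟨b, Subtype.ext ?_⟩
    show (D (A ^ i, A ^ j)) ^ p ^ b = 1
    rw [← map_pow]
    have : ((A ^ i, A ^ j) : Matrix.SpecialLinearGroup (Fin 2) F × Matrix.SpecialLinearGroup (Fin 2) F) ^ p ^ b = 1 :=
      Prod.ext (Apow H) (Apow H)
    rw [this, map_one]
  obtain ⟨k, hk1, hk2⟩ := syl_abs hp P hP (by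
    rintro g hg ⟨k, hk⟩
    obtain ⟨i1, j1, e1⟩ := (memP _).1 (hg (D (A, 1)) ((memP _).2 ⟨1, 0, by simp⟩))
    obtain ⟨i2, j2, e2⟩ := (memP _).1 (hg (D (1, A)) ((memP _).2 ⟨0, 1, by simp⟩))
    have f1 := S.fus1 H e1
    have f2 := S.fus2 H e2
    have c1 := perm4 (MulAut.conj g) (x := D (A, 1)) (y := D (1, A)) f1 f2
    have c2 := perm4 (MulAut.conj g) (x := D (1, A)) (y := D (A, 1)) (by tauto) (by tauto)
    have hodd : Odd (p ^ k) := Odd.pow (hp.odd_of_ne_two (by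
      rintro rfl
      have := H.nodd
      rcases Nat.eq_zero_or_pos b with rfl | hb
      · have h5 := H.An
        simp at h5
        exact H.ne h5
      · exact absurd this (by rw [Nat.not_odd_iff_even]; exact (even_two).pow_of_ne_zero (by omega))))
    have cc : ∀ z : G, (MulAut.conj g) ((MulAut.conj g) ((MulAut.conj g) ((MulAut.conj g) z))) = z → g * z = z * g := by
      intro z hz
      have h4 : Commute (g ^ 4) z := by
        simp only [MulAut.conj_apply] at hz
        show g ^ 4 * z = z * g ^ 4
        have : g ^ 4 * z * (g ^ 4)⁻¹ = z := by
          refine Eq.trans ?_ hz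
          rw [show g ^ 4 = g * g * g * g by simp only [pow_succ, pow_zero, one_mul]]
          simp only [mul_inv_rev, mul_assoc]
        exact mul_inv_eq_iff_eq_mul.1 this
      obtain ⟨r, hr⟩ := hodd
      have hgg : (g ^ 4) ^ ((r + 1) ^ 2) = g := by
        rw [← pow_mul, show 4 * (r + 1) ^ 2 = p ^ k * (p ^ k + 2) + 1 by rw [hr]; ring, pow_succ, pow_mul, hk, one_pow, one_mul]
      have := h4.pow_left ((r + 1) ^ 2)
      rw [hgg] at this
      exact this
    have hgn : g ^ (p ^ b) = 1 := by
      have h1 : orderOf g ∣ p ^ k := orderOf_dvd_of_pow_eq_one hk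
      have h2 : orderOf g ∣ p ^ b * m := by rw [← hG]; exact orderOf_dvd_natCard g
      exact orderOf_dvd_iff_pow_eq_one.1 ((Nat.Coprime.coprime_dvd_left h1 (Nat.Coprime.pow_left k ((Nat.Prime.coprime_iff_not_dvd hp).2 hpm))).dvd_of_dvd_mul_right h2)
    exact (memP _).2 (S.pT H (cc _ c1) (cc _ c2) hgn)) ha hc hac
  obtain ⟨i, j, h1⟩ := (memP _).1 hk1
  obtain ⟨i', j', h2⟩ := (memP _).1 hk2
  exact ⟨k, i, j, i', j', h1, h2⟩

theorem main [Fintype G] (S : SPD ρ D w3) (H : SPA A w0 (p ^ b) N) (E : Ex p b m e e' s) (hG : Fintype.card G = p ^ b * m)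
    {χ : G → ℂ} (hχ : χ ∈ irr G) (hpel : ∀ t : G, t ^ (p ^ b) = 1 → χ (t ^ s) = χ t) (g : G) : χ (g ^ s) = χ g := by
  classical
  have hG' : Nat.card G = p ^ b * m := by rw [Nat.card_eq_fintype_card, hG]
  have hNp : N ∣ p ^ b := by rw [← H.ord]; exact orderOf_dvd_of_pow_eq_one H.An
  obtain ⟨k, hkb, hk⟩ := (Nat.dvd_prime_pow E.hp).1 hNp
  have hAN : A ^ N = 1 := by rw [← H.ord]; exact pow_orderOf_eq_one A
  have hp3 : 3 ≤ p := by
    have := E.hp.two_le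
    have := E.hp2
    omega
  by_cases N9 : 9 ≤ N
  swap
  · have hk1 : k ≤ 1 := by
      by_contra h
      apply N9
      rw [hk]
      calc 9 = 3 ^ 2 := by norm_num
        _ ≤ p ^ 2 := Nat.pow_le_pow_left hp3 2
        _ ≤ p ^ k := Nat.pow_le_pow_right (by omega) (by omega)
    have hAp : A ^ p = 1 := by
      have : N ∣ p := by rw [hk]; calc p ^ k ∣ p ^ 1 := pow_dvd_pow p hk1
          _ = p := pow_one p
      obtain ⟨c, hc⟩ := this
      rw [hc, pow_mul, hAN, one_pow]
    have hgc : g ^ (p ^ b * m) = 1 := by rw [← hG]; exact pow_card_eq_one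
    rw [E.pow_s_eq hgc]
    obtain ⟨h, i, j, -, -, h1, -⟩ := syl E.hp hG' E.hpm S H (E.pp_pow hgc) (E.pp_pow hgc) rfl
    have hup : (g ^ e) ^ p = 1 := by
      have h2 : (h * g ^ e * h⁻¹) ^ p = 1 := by
        rw [h1, ← map_pow]
        have : ((A ^ i, A ^ j) : Matrix.SpecialLinearGroup (Fin 2) F × Matrix.SpecialLinearGroup (Fin 2) F) ^ p = 1 := by
          have hz : ∀ i : ℤ, (A ^ i) ^ p = 1 := by
            intro i
            rw [← zpow_natCast, ← zpow_mul, mul_comm, zpow_mul, zpow_natCast, hAp, one_zpow]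
          exact Prod.ext (hz i) (hz j)
        rw [this, map_one]
      rw [conj_pow] at h2
      have h3 := congrArg (fun w => h⁻¹ * w * h) h2
      simpa [mul_assoc] using h3
    conv_rhs => rw [← pow_one (g ^ e)]
    exact pow_modEq' hup E.s_p
  · let T : Subgroup G := Subgroup.centralizer {D (A, 1), D (1, A)}
    have memT : ∀ t, t ∈ T ↔ t * D (A, 1) = D (A, 1) * t ∧ t * D (1, A) = D (1, A) * t := by
      intro t
      simp [T, Subgroup.mem_centralizer_iff, eq_comm]
    have hns : ∀ r : F, (A : Matrix (Fin 2) (Fin 2) F) ≠ r • 1 := sl2_nonscalar H.nodd H.An H.ne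
    have hcomm : ∀ t u : T, t * u = u * t := by
      rintro ⟨t, ht⟩ ⟨u, hu⟩
      apply Subtype.ext
      show t * u = u * t
      rw [memT] at ht hu
      obtain ⟨k2, k3, -⟩ := S.cx H (N1 H) (g := t) (by rw [zpow_one]; exact ht.1)
      obtain ⟨k2', k3', -⟩ := S.cx H (N1 H) (g := u) (by rw [zpow_one]; exact hu.1)
      have h1 := (S.blocks.1 ht.1).1
      have h4 := (S.blocks.1 ht.2).2.2.2
      have h1' := (S.blocks.1 hu.1).1
      have h4' := (S.blocks.1 hu.2).2.2.2
      apply S.inj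
      rw [map_mul, map_mul, ← Matrix.fromBlocks_toBlocks (ρ t), ← Matrix.fromBlocks_toBlocks (ρ u), k2, k3, k2', k3', Matrix.fromBlocks_multiply, Matrix.fromBlocks_multiply]
      simp only [mul_zero, zero_mul, add_zero, zero_add]
      rw [mat_comm hns h1 h1', mat_comm hns h4 h4']
    letI : CommGroup T := { (inferInstance : Group T) with mul_comm := hcomm }
    letI : Fintype T := Fintype.ofFinite T
    have xT : D (A, 1) ∈ T := (memT _).2 ⟨rfl, by rw [← map_mul, ← map_mul]; simp⟩
    have yT : D (1, A) ∈ T := (memT _).2 ⟨by rw [← map_mul, ← map_mul]; simp, rfl⟩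
    have mkr : ∀ w : G, (∀ t, t ∈ T ↔ w * t * w⁻¹ ∈ T) → ∃ r : T ≃* T, ∀ t : T, ((r t : T) : G) = w * t * w⁻¹ := by
      intro w hw
      have hmap : T.map (MulAut.conj w).toMonoidHom = T := by
        ext t
        constructor
        · rintro ⟨u, hu, rfl⟩
          exact (hw u).1 hu
        · intro ht
          refine ⟨w⁻¹ * t * w, ?_, ?_⟩
          · rw [SetLike.mem_coe, hw]; simpa [mul_assoc] using ht
          · simp [mul_assoc]
      exact ⟨((MulAut.conj w).subgroupMap T).trans (MulEquiv.subgroupCongr hmap), fun t => rfl⟩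
    have w1x : D (1, w0) * D (A, 1) * (D (1, w0))⁻¹ = D (A, 1) := by
      rw [← map_inv, ← map_mul, ← map_mul]; simp
    have w1y : D (1, w0) * D (1, A) * (D (1, w0))⁻¹ = (D (1, A))⁻¹ := by
      rw [← map_inv, ← map_inv, ← map_mul, ← map_mul]
      simp only [Prod.mk_mul_mk, Prod.inv_mk, mul_one, one_mul, inv_one, H.hw0, mul_inv_cancel_right]
    have w3x : w3 * D (A, 1) * w3⁻¹ = D (1, A) := by
      rw [mul_inv_eq_iff_eq_mul]
      apply S.inj
      rw [map_mul, map_mul, S.hw3, S.hD, S.hD, Matrix.fromBlocks_multiply, Matrix.fromBlocks_multiply]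
      simp
    have w3y : w3 * D (1, A) * w3⁻¹ = D (A, 1) := by
      rw [mul_inv_eq_iff_eq_mul]
      apply S.inj
      rw [map_mul, map_mul, S.hw3, S.hD, S.hD, Matrix.fromBlocks_multiply, Matrix.fromBlocks_multiply]
      simp
    obtain ⟨r1, hr1⟩ := mkr (D (1, w0)) (by
      intro t
      rw [memT, memT]
      have e1 := Commute.conj_iff (a := t) (b := D (A, 1)) (D (1, w0))
      have e2 := Commute.conj_iff (a := t) (b := (D (1, A))) (D (1, w0))
      rw [w1x] at e1
      rw [w1y, Commute.inv_right_iff] at e2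
      exact (and_congr e1 e2).symm)
    obtain ⟨r3, hr3⟩ := mkr w3 (by
      intro t
      rw [memT, memT]
      have e1 := Commute.conj_iff (a := t) (b := D (A, 1)) w3
      have e2 := Commute.conj_iff (a := t) (b := (D (1, A))) w3
      rw [w3x] at e1
      rw [w3y] at e2
      exact ((and_congr e1 e2).symm.trans and_comm))
    have hxy : ∀ i j : ℤ, T.subtype ((⟨D (A, 1), xT⟩ : T) ^ i * (⟨D (1, A), yT⟩ : T) ^ j) = D (A ^ i, A ^ j) := by
      intro i j
      rw [← S.xy A i j]; rfl
    have R : R2 T.subtype ⟨D (A, 1), xT⟩ ⟨D (1, A), yT⟩ (D (1, w0)) w3 r1 r3 (p ^ b) N := by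
      refine ⟨T.subtype_injective, hNp, N9, H.nodd.of_dvd_nat hNp, ?_, ?_, ?_, hr1, hr3, ?_, ?_, ?_, ?_, ?_, ?_, ?_, ?_, ?_, ?_, ?_⟩
      · apply Subtype.ext
        show D (A, 1) ^ N = 1
        rw [← map_pow, Prod.pow_mk, hAN, one_pow]; exact map_one D
      · apply Subtype.ext
        show D (1, A) ^ N = 1
        rw [← map_pow, Prod.pow_mk, hAN, one_pow]; exact map_one D
      · intro i j h
        have := congrArg T.subtype h
        rw [hxy, map_one, ← map_one D] at this
        have := S.Dinj this
        rw [Prod.ext_iff] at this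
        exact ⟨(Aone H).1 this.1, (Aone H).1 this.2⟩
      · exact Subtype.ext ((hr1 _).trans w1x)
      · exact Subtype.ext ((hr1 _).trans w1y)
      · exact Subtype.ext ((hr3 _).trans w3x)
      · exact Subtype.ext ((hr3 _).trans w3y)
      · intro g h1 h2
        exact ⟨⟨g, (memT g).2 ⟨h1, h2⟩⟩, rfl⟩
      · intro g i j i' j' h
        rw [hxy, hxy, mul_inv_eq_iff_eq_mul] at h
        exact S.fus H h
      · intro i hi g h
        have h1 := hxy i 0
        rw [zpow_zero, mul_one, zpow_zero] at h1
        rw [h1] at h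
        exact (S.cx H hi h).2.2
      · intro i hi g h
        rw [mul_zpow, hxy] at h
        have h1 := hxy 1 1
        rw [zpow_one, zpow_one, zpow_one] at h1
        rw [h1]
        exact S.cxy H hi h
      · intro i j hi hj hij hij' g h
        rw [hxy] at h
        exact ⟨⟨g, (memT g).2 (S.creg H hi hj hij hij' h)⟩, rfl⟩
      · intro t ht
        obtain ⟨h1, h2⟩ := (memT _).1 t.2
        obtain ⟨i, j, h⟩ := S.pT H h1 h2 (by
          have := congrArg T.subtype ht
          rwa [map_pow, map_one] at this)
        refine ⟨i, j, Subtype.ext ?_⟩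
        rw [h]
        exact (hxy i j).symm
      · intro a c ha hc hac
        obtain ⟨h, i, j, k, l, h1, h2⟩ := syl E.hp hG' E.hpm S H ha hc hac
        exact ⟨h, i, j, k, l, by rw [hxy]; exact h1, by rw [hxy]; exact h2⟩
    exact R.main_R E hG hχ hpel g

end SPD

section SpFour
variable {F : Type} [Field F]

def sig4 : Fin 2 ⊕ Fin 2 ≃ Fin 2 ⊕ Fin 2 := Equiv.swap (Sum.inl 1) (Sum.inr 0)

def jj (F : Type) [Field F] : Matrix (Fin 2) (Fin 2) F := !![0, -1; 1, 0]

theorem sig4_sig4 : sig4 ∘ sig4 = id := by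
  funext i; simp [sig4]

theorem J_sig (F : Type) [Field F] : (Matrix.J (Fin 2) F) = (Matrix.fromBlocks (jj F) 0 0 (jj F)).submatrix sig4 sig4 := by
  ext i j
  rcases i with i | i <;> rcases j with j | j <;> fin_cases i <;> fin_cases j <;>
    simp [Matrix.J, sig4, Equiv.swap_apply_def, jj]

theorem jj_conj (a : Matrix (Fin 2) (Fin 2) F) : a * jj F * a.transpose = a.det • jj F := by
  ext i j
  fin_cases i <;> fin_cases j <;> simp [Matrix.mul_apply, Fin.sum_univ_two, jj, Matrix.det_fin_two] <;> ring

theorem sp_iff (X : Matrix (Fin 2 ⊕ Fin 2) (Fin 2 ⊕ Fin 2) F) :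
    X.submatrix sig4 sig4 ∈ Matrix.symplecticGroup (Fin 2) F ↔
      X * Matrix.fromBlocks (jj F) 0 0 (jj F) * X.transpose = Matrix.fromBlocks (jj F) 0 0 (jj F) := by
  rw [SymplecticGroup.mem_iff, J_sig, Matrix.transpose_submatrix, Matrix.submatrix_mul_equiv, Matrix.submatrix_mul_equiv]
  constructor
  · intro h
    have := congrArg (fun M => Matrix.submatrix M sig4 sig4) h
    simpa [Matrix.submatrix_submatrix, sig4_sig4] using this
  · intro h; rw [h]

/-- the reindexed representation -/
def spRho (F : Type) [Field F] : Matrix.symplecticGroup (Fin 2) F →* Matrix (Fin 2 ⊕ Fin 2) (Fin 2 ⊕ Fin 2) F where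
  toFun g := (g : Matrix (Fin 2 ⊕ Fin 2) (Fin 2 ⊕ Fin 2) F).submatrix sig4 sig4
  map_one' := by simp
  map_mul' g h := by
    rw [Matrix.submatrix_mul_equiv]; rfl

theorem spRho_mem (g : Matrix.symplecticGroup (Fin 2) F) : spRho F g * Matrix.fromBlocks (jj F) 0 0 (jj F) * (spRho F g).transpose = Matrix.fromBlocks (jj F) 0 0 (jj F) := by
  rw [← sp_iff]
  have : (spRho F g).submatrix sig4 sig4 = g := by
    simp [spRho, Matrix.submatrix_submatrix, sig4_sig4]
  rw [this]; exact g.2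

def spD (F : Type) [Field F] : Matrix.SpecialLinearGroup (Fin 2) F × Matrix.SpecialLinearGroup (Fin 2) F →* Matrix.symplecticGroup (Fin 2) F where
  toFun z := ⟨(Matrix.fromBlocks (z.1 : Matrix (Fin 2) (Fin 2) F) 0 0 (z.2 : Matrix (Fin 2) (Fin 2) F)).submatrix sig4 sig4, by
    rw [sp_iff, Matrix.fromBlocks_transpose, Matrix.fromBlocks_multiply, Matrix.fromBlocks_multiply]
    simp [jj_conj]⟩
  map_one' := by
    apply Subtype.ext
    simp
  map_mul' z w := by
    apply Subtype.ext
    show (Matrix.fromBlocks (((z * w).1 : Matrix.SpecialLinearGroup (Fin 2) F) : Matrix (Fin 2) (Fin 2) F) 0 0 (((z * w).2 : Matrix.SpecialLinearGroup (Fin 2) F) : Matrix (Fin 2) (Fin 2) F)).submatrix sig4 sig4 = Matrix.submatrix _ _ _ * Matrix.submatrix _ _ _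
    rw [Matrix.submatrix_mul_equiv, Matrix.fromBlocks_multiply]
    simp

def spW (F : Type) [Field F] : Matrix.symplecticGroup (Fin 2) F :=
  ⟨(Matrix.fromBlocks 0 1 1 0).submatrix sig4 sig4, by
    rw [sp_iff, Matrix.fromBlocks_transpose, Matrix.fromBlocks_multiply, Matrix.fromBlocks_multiply]
    simp⟩

theorem sp_data : SPD (spRho F) (spD F) (spW F) := by
  refine ⟨?_, ?_, ?_, ?_⟩
  · intro g h hh
    apply Subtype.ext
    have := congrArg (fun M => Matrix.submatrix M sig4 sig4) hh
    simpa [spRho, Matrix.submatrix_submatrix, sig4_sig4] using this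
  · intro z
    simp [spRho, spD, Matrix.submatrix_submatrix, sig4_sig4]
  · simp [spRho, spW, Matrix.submatrix_submatrix, sig4_sig4]
  · intro g a d h
    have h1 := spRho_mem g
    rw [h, Matrix.fromBlocks_transpose, Matrix.fromBlocks_multiply, Matrix.fromBlocks_multiply] at h1
    simp only [Matrix.fromBlocks_inj, mul_zero, zero_mul, add_zero, zero_add, Matrix.transpose_zero, jj_conj] at h1
    have e1 := congrFun (congrFun h1.1 1) 0
    have e2 := congrFun (congrFun h1.2.2.2 1) 0
    simp [jj] at e1 e2
    exact ⟨e1, e2⟩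

theorem caseA [Fintype F] [Fintype (Matrix.symplecticGroup (Fin 2) F)] {p b m e e' s : ℕ} (E : Ex p b m e e' s) (hG : Fintype.card (Matrix.symplecticGroup (Fin 2) F) = p ^ b * m)
    (hpF : (p : F) ≠ 0) {Z0 : Matrix.SpecialLinearGroup (Fin 2) F} (hZ0 : Z0 ^ (p ^ b) = 1) (hne : Z0 ≠ 1)
    {χ : Matrix.symplecticGroup (Fin 2) F → ℂ} (hχ : χ ∈ irr (Matrix.symplecticGroup (Fin 2) F))
    (hpel : ∀ t : Matrix.symplecticGroup (Fin 2) F, t ^ (p ^ b) = 1 → χ (t ^ s) = χ t) (g : Matrix.symplecticGroup (Fin 2) F) : χ (g ^ s) = χ g := by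
  have hn : ((p ^ b : ℕ) : F) ≠ 0 := by push_cast; exact pow_ne_zero b hpF
  have hodd : Odd (p ^ b) := (E.hp.odd_of_ne_two E.hp2).pow
  obtain ⟨A, hA1, hA2, hA3⟩ := sl2_gen hn hodd hZ0 hne
  obtain ⟨w0, hw0⟩ := sl2_w0 hn hodd hA1 hA2
  exact sp_data.main ⟨hn, hodd, hA1, hA2, hA3, rfl, hw0⟩ E hG hχ hpel g

end SpFour

section CaseB
variable {F : Type} [Field F]

theorem end_small {n : ℕ} (hs1 : ∀ c : F, c ^ n = 1 → c = 1) (hs : ∀ M : Matrix (Fin 2) (Fin 2) F, M ^ n = 1 → M = 1)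
    {W : Type*} [AddCommGroup W] [Module F W] [FiniteDimensional F W] (hW : Module.finrank F W ≤ 2) (f : Module.End F W) (hf : f ^ n = 1) : f = 1 := by
  have key : ∀ r : ℕ, Module.finrank F W = r → (∀ M : Matrix (Fin r) (Fin r) F, M ^ n = 1 → M = 1) → f = 1 := by
    intro r hr h
    let B := Module.finBasisOfFinrankEq F W hr
    have h1 := h (LinearMap.toMatrixAlgEquiv B f) (by rw [← map_pow, hf, map_one])
    exact (LinearMap.toMatrixAlgEquiv B).injective (by rw [h1, map_one])
  obtain h | h | h : Module.finrank F W = 0 ∨ Module.finrank F W = 1 ∨ Module.finrank F W = 2 := by omega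
  · exact key 0 h (fun M _ => Subsingleton.elim _ _)
  · refine key 1 h (fun M hM => ?_)
    have h1 := hs1 M.det (by rw [← Matrix.det_pow, hM, Matrix.det_one])
    rw [Matrix.det_fin_one] at h1
    ext i j
    rw [Subsingleton.elim i 0, Subsingleton.elim j 0, h1]; simp
  · exact key 2 h hs

theorem comm_aeval {V : Type*} [AddCommGroup V] [Module F V] {x T : Module.End F V} (h : Commute x T) (g : Polynomial F) : Commute x (Polynomial.aeval T g) := by
  rw [Polynomial.aeval_eq_sum_range]
  exact Commute.sum_right _ _ _ (fun i _ => (h.pow_right i).smul_right _)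

theorem irr_comm {n : ℕ} (hn : (n : F) ≠ 0) (hs1 : ∀ c : F, c ^ n = 1 → c = 1) (hs : ∀ M : Matrix (Fin 2) (Fin 2) F, M ^ n = 1 → M = 1)
    {V : Type*} [AddCommGroup V] [Module F V] [FiniteDimensional F V] (hV : Module.finrank F V = 4) (ω : V →ₗ[F] V →ₗ[F] F)
    (alt : ∀ u, ω u u = 0) (nd : ∀ u, (∀ w, ω u w = 0) → u = 0)
    {T : Module.End F V} (hT : T ^ n = 1) (hω : ∀ u w, ω (T u) (T w) = ω u w) (hne : T ≠ 1)
    {x y : Module.End F V} (hx : Commute x T) (hy : Commute y T) : x * y = y * x := by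
  let U := LinearMap.ker (T - 1)
  let I := LinearMap.range (T - 1)
  have memU : ∀ u, u ∈ U ↔ T u = u := by
    intro u
    simp [U, LinearMap.mem_ker, sub_eq_zero]
  have hUI : ∀ u, u ∈ U → u ∈ I → u = 0 := by
    rintro u hu ⟨w, hw⟩
    rw [memU] at hu
    have hw' : T w = w + u := by
      rw [← hw]; simp
    have hk : ∀ k : ℕ, (T ^ k) w = w + (k : F) • u := by
      intro k
      induction k with
      | zero => simp
      | succ k ih =>
        rw [pow_succ', Module.End.mul_apply, ih, map_add, map_smul, hu, hw']; push_cast; module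
    have := hk n
    rw [hT, Module.End.one_apply, left_eq_add, smul_eq_zero] at this
    exact this.resolve_left hn
  have hsum : Module.finrank F I + Module.finrank F U = 4 := by
    rw [← hV]; exact LinearMap.finrank_range_add_finrank_ker (T - 1)
  have small : ∀ W : Submodule F V, (∀ w ∈ W, T w ∈ W) → Module.finrank F W ≤ 2 → ∀ w ∈ W, T w = w := by
    intro W hW hd w hw
    have h1 : (T.restrict hW) ^ n = 1 := by
      rw [Module.End.pow_restrict]
      ext ⟨u, hu⟩
      simp [hT]
    have h2 := end_small hs1 hs hd (T.restrict hW) h1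
    have h3 := congrArg (fun f => ((f ⟨w, hw⟩ : W) : V)) h2
    simpa using h3
  have hIinv : ∀ w ∈ I, T w ∈ I := by
    rintro w ⟨v, rfl⟩
    exact ⟨T v, by simp⟩
  have hU0 : U = ⊥ := by
    by_contra hU
    have hUpos : Module.finrank F U ≠ 0 := fun h => hU (Submodule.finrank_eq_zero.1 h)
    by_cases h2 : 2 ≤ Module.finrank F U
    · have h3 := small I hIinv (by omega)
      apply hne
      ext v
      have h4 : (T - 1) v ∈ I := ⟨v, rfl⟩
      have h5 := hUI _ ((memU _).2 (h3 _ h4)) h4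
      simpa [sub_eq_zero] using h5
    · have h1 : Module.finrank F U = 1 := by omega
      obtain ⟨u, hu, hu0⟩ := Submodule.exists_mem_ne_zero_of_ne_bot hU
      apply hu0
      apply nd
      have hdis : Disjoint U I := by
        rw [Submodule.disjoint_def]; exact hUI
      have htop : U ⊔ I = ⊤ := Submodule.eq_top_of_disjoint U I (by omega) hdis
      intro w
      obtain ⟨a, ha, c, ⟨v, rfl⟩, rfl⟩ := Submodule.mem_sup.1 (show w ∈ U ⊔ I by rw [htop]; trivial)
      have e1 : ω u a = 0 := by
        obtain ⟨k, hk⟩ := (finrank_eq_one_iff_of_nonzero' (⟨u, hu⟩ : U) (by intro h; exact hu0 (congrArg Subtype.val h))).1 h1 ⟨a, ha⟩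
        have : a = k • u := (congrArg Subtype.val hk).symm
        rw [this, map_smul, alt, smul_zero]
      have e2 : ω u ((T - 1) v) = 0 := by
        rw [LinearMap.sub_apply, map_sub, Module.End.one_apply, sub_eq_zero]
        conv_lhs => rw [← (memU u).1 hu]
        exact hω u v
      rw [map_add, e1, e2, add_zero]
  have hIt : I = ⊤ := by
    apply Submodule.eq_top_of_finrank_eq
    rw [hU0, finrank_bot] at hsum
    omega
  have irred : ∀ W : Submodule F V, (∀ w ∈ W, T w ∈ W) → W ≠ ⊥ → W = ⊤ := by
    intro W hW hW0
    by_cases hd : Module.finrank F W ≤ 2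
    · exfalso
      apply hW0
      rw [eq_bot_iff, ← hU0]
      exact fun w hw => (memU w).2 (small W hW hd w hw)
    · have hq := Submodule.finrank_quotient_add_finrank W
      have h1 : (W.mapQ W T hW) ^ n = 1 := by
        rw [← Submodule.mapQ_pow, ]
        apply LinearMap.ext
        intro z
        obtain ⟨v, rfl⟩ := Submodule.mkQ_surjective W z
        simp [hT]
      have h2 := end_small hs1 hs (by omega) (W.mapQ W T hW) h1
      rw [eq_top_iff, ← hIt]
      rintro _ ⟨v, rfl⟩
      have h3 := congrArg (fun f => f (W.mkQ v)) h2
      simp at h3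
      rw [← sub_eq_zero, ← Submodule.Quotient.mk_sub, Submodule.Quotient.mk_eq_zero] at h3
      simpa using h3
  haveI : Nontrivial V := Module.nontrivial_of_finrank_pos (R := F) (by omega)
  obtain ⟨v, hv⟩ := exists_ne (0 : V)
  have cyc : ∀ w : V, ∃ g : Polynomial F, Polynomial.aeval T g v = w := by
    have := irred (LinearMap.range ((LinearMap.applyₗ v) ∘ₗ (Polynomial.aeval T).toLinearMap)) (by
      rintro _ ⟨g, rfl⟩
      exact ⟨Polynomial.X * g, by simp⟩) (by
      intro h
      apply hv
      have : v ∈ LinearMap.range ((LinearMap.applyₗ v) ∘ₗ (Polynomial.aeval T).toLinearMap) := ⟨1, by simp⟩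
      rw [h] at this
      simpa using this)
    intro w
    obtain ⟨g, hg⟩ : w ∈ LinearMap.range ((LinearMap.applyₗ v) ∘ₗ (Polynomial.aeval T).toLinearMap) := by rw [this]; trivial
    exact ⟨g, by simpa using hg⟩
  obtain ⟨f, hf⟩ := cyc (x v)
  have hxf : x = Polynomial.aeval T f := by
    ext w
    obtain ⟨g, rfl⟩ := cyc w
    have e1 := congrArg (fun φ => φ v) (comm_aeval hx g).eq
    simp only [Module.End.mul_apply] at e1
    rw [e1, ← hf, ← Module.End.mul_apply, ← map_mul, mul_comm, map_mul, Module.End.mul_apply]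
  rw [hxf]
  exact (comm_aeval hy f).symm.eq

theorem caseB_small {p : ℕ} (hp : p.Prime) (h0 : ∀ Z : Matrix.SpecialLinearGroup (Fin 2) F, Z ^ p = 1 → Z = 1) (b : ℕ) :
    (∀ c : F, c ^ (p ^ b) = 1 → c = 1) ∧ (∀ M : Matrix (Fin 2) (Fin 2) F, M ^ (p ^ b) = 1 → M = 1) := by
  have it : ∀ {R : Type} [Monoid R], (∀ z : R, z ^ p = 1 → z = 1) → ∀ z : R, z ^ (p ^ b) = 1 → z = 1 := by
    intro R _ h
    induction b with
    | zero => intro z hz; simpa using hz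
    | succ b ih => intro z hz; rw [pow_succ, pow_mul] at hz; exact ih _ (h _ hz)
  have h1 : ∀ c : F, c ^ p = 1 → c = 1 := by
    intro c hc
    have hc0 : c ≠ 0 := by
      rintro rfl
      rw [zero_pow hp.ne_zero] at hc
      exact zero_ne_one hc
    obtain ⟨Z, hZ⟩ : ∃ Z : Matrix.SpecialLinearGroup (Fin 2) F, (Z : Matrix (Fin 2) (Fin 2) F) = Matrix.diagonal ![c, c⁻¹] :=
      ⟨⟨Matrix.diagonal ![c, c⁻¹], by simp [Matrix.det_diagonal, hc0]⟩, rfl⟩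
    have hZ1 := h0 Z (Subtype.ext (by
      rw [Matrix.SpecialLinearGroup.coe_pow, hZ, Matrix.diagonal_pow]
      ext i j
      fin_cases i <;> fin_cases j <;> simp [hc]))
    rw [hZ1] at hZ
    have := congrFun (congrFun hZ 0) 0
    simpa using this.symm
  refine ⟨it h1, it ?_⟩
  intro M hM
  have hd := h1 M.det (by rw [← Matrix.det_pow, hM, Matrix.det_one])
  obtain ⟨Z, rfl⟩ : ∃ Z : Matrix.SpecialLinearGroup (Fin 2) F, (Z : Matrix (Fin 2) (Fin 2) F) = M := ⟨⟨M, hd⟩, rfl⟩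
  have := h0 Z (Subtype.ext (by rw [Matrix.SpecialLinearGroup.coe_pow]; exact hM))
  rw [this, Matrix.SpecialLinearGroup.coe_one]

theorem sp_form (F : Type) [Field F] : ∃ ω : (Fin 2 ⊕ Fin 2 → F) →ₗ[F] (Fin 2 ⊕ Fin 2 → F) →ₗ[F] F,
    (∀ u, ω u u = 0) ∧ (∀ u, (∀ w, ω u w = 0) → u = 0) ∧
    ∀ M : Matrix (Fin 2 ⊕ Fin 2) (Fin 2 ⊕ Fin 2) F, M ∈ Matrix.symplecticGroup (Fin 2) F ↔ ∀ u w, ω (M.mulVec u) (M.mulVec w) = ω u w := by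
  have hap : ∀ u w : Fin 2 ⊕ Fin 2 → F, Matrix.toLinearMap₂' F (Matrix.J (Fin 2) F) u w = u ⬝ᵥ (Matrix.J (Fin 2) F).mulVec w := by
    intro u w; rw [Matrix.toLinearMap₂'_apply']
  refine ⟨Matrix.toLinearMap₂' F (Matrix.J (Fin 2) F), ?_, ?_, ?_⟩
  · intro u
    rw [hap]
    simp [Matrix.J, dotProduct, Matrix.mulVec, Fintype.sum_sum_type, Fin.sum_univ_two, Matrix.one_apply]
    ring
  · intro u hu
    have h1 : Matrix.vecMul u (Matrix.J (Fin 2) F) = 0 := by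
      ext j
      have := hu (Pi.single j 1)
      rw [hap, Matrix.dotProduct_mulVec, dotProduct_single, mul_one] at this
      exact this
    have h2 : Matrix.vecMul (Matrix.vecMul u (Matrix.J (Fin 2) F)) (Matrix.J (Fin 2) F) = 0 := by rw [h1, Matrix.zero_vecMul]
    rw [Matrix.vecMul_vecMul, Matrix.J_squared, Matrix.vecMul_neg, Matrix.vecMul_one, neg_eq_zero] at h2
    exact h2
  · intro M
    rw [SymplecticGroup.mem_iff']
    have h3 : ∀ u w, (M.mulVec u) ⬝ᵥ (Matrix.J (Fin 2) F).mulVec (M.mulVec w) = u ⬝ᵥ (M.transpose * Matrix.J (Fin 2) F * M).mulVec w := by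
      intro u w
      rw [Matrix.mulVec_mulVec, Matrix.dotProduct_mulVec, ← Matrix.vecMul_transpose, Matrix.vecMul_vecMul, ← Matrix.dotProduct_mulVec, mul_assoc]
    constructor
    · intro h u w
      rw [hap, hap, h3, h]
    · intro h
      ext i j
      have := h (Pi.single i 1) (Pi.single j 1)
      rw [hap, hap, h3] at this
      simpa using this

theorem caseB [Fintype (Matrix.symplecticGroup (Fin 2) F)] {p b m e e' s : ℕ} (E : Ex p b m e e' s) (hG : Fintype.card (Matrix.symplecticGroup (Fin 2) F) = p ^ b * m)
    (hpF : (p : F) ≠ 0) (h0 : ∀ Z : Matrix.SpecialLinearGroup (Fin 2) F, Z ^ p = 1 → Z = 1)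
    {χ : Matrix.symplecticGroup (Fin 2) F → ℂ} (hχ : χ ∈ irr (Matrix.symplecticGroup (Fin 2) F))
    (hpel : ∀ t : Matrix.symplecticGroup (Fin 2) F, t ^ (p ^ b) = 1 → χ (t ^ s) = χ t) (g : Matrix.symplecticGroup (Fin 2) F) : χ (g ^ s) = χ g := by
  refine main_C E hG ?_ hχ hpel g
  intro t ht htn x y hx hy
  obtain ⟨hs1, hs⟩ := caseB_small E.hp h0 b
  obtain ⟨ω, alt, nd, hsp⟩ := sp_form F
  have hn : ((p ^ b : ℕ) : F) ≠ 0 := by push_cast; exact pow_ne_zero b hpF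
  let φ : Matrix.symplecticGroup (Fin 2) F →* Module.End F (Fin 2 ⊕ Fin 2 → F) :=
    (Matrix.toLinAlgEquiv' : Matrix (Fin 2 ⊕ Fin 2) (Fin 2 ⊕ Fin 2) F ≃ₐ[F] _).toMonoidHom.comp (Matrix.symplecticGroup (Fin 2) F).subtype
  have hφ : Function.Injective φ := by
    intro a c h
    exact Subtype.ext (Matrix.toLinAlgEquiv'.injective h)
  apply hφ
  rw [map_mul, map_mul]
  refine irr_comm hn hs1 hs (by simp) ω alt nd (T := φ t) ?_ ?_ ?_ ?_ ?_
  · rw [← map_pow, htn, map_one]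
  · exact (hsp _).1 t.2
  · intro h; rw [← map_one φ] at h; exact ht (hφ h)
  · show _ * _ = _ * _
    rw [← map_mul, hx, map_mul]
  · show _ * _ = _ * _
    rw [← map_mul, hy, map_mul]

end CaseB

section CaseC
variable {F : Type} [Field F]

theorem uni_nil {p : ℕ} (hp : p.Prime) [CharP F p] {V : Type} [AddCommGroup V] [Module F V] [FiniteDimensional F V] (hV : Module.finrank F V = 4)
    {U : Module.End F V} {b : ℕ} (hU : U ^ (p ^ b) = 1) : (U - 1) ^ 4 = 0 ∧ ∀ k : ℕ, U ^ (p ^ k) - 1 = (U - 1) ^ (p ^ k) := by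
  haveI : Fact p.Prime := ⟨hp⟩
  haveI : Nontrivial V := Module.nontrivial_of_finrank_pos (R := F) (by omega)
  haveI : CharP (Module.End F V) p := charP_of_injective_algebraMap (algebraMap F (Module.End F V)).injective p
  have h1 : ∀ k : ℕ, U ^ (p ^ k) - 1 = (U - 1) ^ (p ^ k) := by
    intro k
    rw [sub_pow_char_pow_of_commute _ _ (Commute.one_right U), one_pow]
  refine ⟨?_, h1⟩
  have h2 : (U - 1) ^ (p ^ b) = 0 := by rw [← h1, hU, sub_self]
  have h3 := Module.End.ker_pow_le_ker_pow_finrank (U - 1) (p ^ b)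
  rw [h2, LinearMap.ker_zero, hV, top_le_iff, LinearMap.ker_eq_top] at h3
  exact h3

theorem uni3 [CharP F 3] {V : Type} [AddCommGroup V] [Module F V] [FiniteDimensional F V] (hV : Module.finrank F V = 4)
    (ω : V →ₗ[F] V →ₗ[F] F) (alt : ∀ u, ω u u = 0) {U : Module.End F V} (hU4 : (U - 1) ^ 4 = 0) (hU3 : (U - 1) ^ 3 ≠ 0)
    (hω : ∀ u w, ω (U u) (U w) = ω u w) : ∃ h : Module.End F V, (∀ u w, ω (h u) (h w) = ω u w) ∧ h * U = U ^ 4 * h ∧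
      ∀ g : Module.End F V, Commute g U → ∃ c : F, g ^ 9 = algebraMap F (Module.End F V) c := by
  haveI : Fact (Nat.Prime 3) := ⟨Nat.prime_three⟩
  haveI : Nontrivial V := Module.nontrivial_of_finrank_pos (R := F) (by omega)
  haveI : CharP (Module.End F V) 3 := charP_of_injective_algebraMap (algebraMap F (Module.End F V)).injective 3
  have h30 : (3 : F) = 0 := by exact_mod_cast CharP.cast_eq_zero F 3
  obtain ⟨N, hN⟩ : ∃ N, N = U - 1 := ⟨_, rfl⟩
  have hUN : U = 1 + N := by rw [hN]; abel
  rw [← hN] at hU4 hU3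
  obtain ⟨v, hv⟩ : ∃ v, (N ^ 3) v ≠ 0 := by
    by_contra hcon
    push Not at hcon
    exact hU3 (LinearMap.ext hcon)
  have n4 : N (N (N (N v))) = 0 := by
    have := congrArg (fun f => f v) hU4
    simpa [pow_succ] using this
  have hv3 : N (N (N v)) ≠ 0 := by simpa [pow_succ] using hv
  obtain ⟨e0, he0⟩ : ∃ e, e = v := ⟨_, rfl⟩
  obtain ⟨e1, he1⟩ : ∃ e, e = N e0 := ⟨_, rfl⟩
  obtain ⟨e2, he2⟩ : ∃ e, e = N e1 := ⟨_, rfl⟩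
  obtain ⟨e3, he3⟩ : ∃ e, e = N e2 := ⟨_, rfl⟩
  have ne3 : N e3 = 0 := by rw [he3, he2, he1, he0, n4]
  have e3n : e3 ≠ 0 := by rw [he3, he2, he1, he0]; exact hv3
  have hli : LinearIndependent F ![e0, e1, e2, e3] := by
    rw [Fintype.linearIndependent_iff]
    intro a ha
    simp only [Fin.sum_univ_four, Matrix.cons_val] at ha
    have E1 := congrArg N ha
    simp only [map_add, map_smul, ← he1, ← he2, ← he3, ne3, smul_zero, add_zero, map_zero] at E1
    have E2 := congrArg N E1
    simp only [map_add, map_smul, ← he1, ← he2, ← he3, ne3, smul_zero, add_zero, map_zero] at E2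
    have E3 := congrArg N E2
    simp only [map_add, map_smul, ← he1, ← he2, ← he3, ne3, smul_zero, add_zero, map_zero] at E3
    have a0 : a 0 = 0 := (smul_eq_zero.1 E3).resolve_right e3n
    rw [a0] at E2 E1 ha
    simp only [zero_smul, zero_add] at E2 E1 ha
    have a1 : a 1 = 0 := (smul_eq_zero.1 E2).resolve_right e3n
    rw [a1] at E1 ha
    simp only [zero_smul, zero_add] at E1 ha
    have a2 : a 2 = 0 := (smul_eq_zero.1 E1).resolve_right e3n
    rw [a2] at ha
    simp only [zero_smul, zero_add] at ha
    have a3 : a 3 = 0 := (smul_eq_zero.1 ha).resolve_right e3n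
    intro i
    fin_cases i <;> assumption
  let B : Module.Basis (Fin 4) F V := basisOfLinearIndependentOfCardEqFinrank hli (by rw [hV]; rfl)
  have hB : ⇑B = ![e0, e1, e2, e3] := coe_basisOfLinearIndependentOfCardEqFinrank _ _
  have ext4 : ∀ {W : Type} [AddCommGroup W] [Module F W] (f g : V →ₗ[F] W), f e0 = g e0 → f e1 = g e1 → f e2 = g e2 → f e3 = g e3 → f = g := by
    intro W _ _ f g h0 h1 h2 h3
    refine B.ext (fun i => ?_)
    rw [hB]
    fin_cases i <;> assumption
  -- the form
  have anti : ∀ u w, ω u w = - ω w u := by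
    intro u w
    have := alt (u + w)
    simp only [map_add, LinearMap.add_apply, alt, zero_add, add_zero] at this
    linear_combination this
  have rel : ∀ u w, ω (N u) w + ω u (N w) + ω (N u) (N w) = 0 := by
    intro u w
    have := hω u w
    rw [hUN] at this
    simp only [LinearMap.add_apply, Module.End.one_apply, map_add] at this
    linear_combination this
  have r13 := rel e1 e3
  have r03 := rel e0 e3
  have r02 := rel e0 e2
  have r01 := rel e0 e1
  simp only [← he1, ← he2, ← he3, ne3, map_zero, alt, add_zero, zero_add, LinearMap.zero_apply] at r13 r03 r02 r01
  rw [r03, add_zero] at r02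
  have b12 : ω e1 e2 = - ω e0 e3 := by linear_combination r02
  have b02 : ω e0 e2 = ω e0 e3 := by linear_combination r01 - r02
  have b32 : ω e3 e2 = 0 := by rw [anti, r13, neg_zero]
  have b31 : ω e3 e1 = 0 := by rw [anti, r03, neg_zero]
  have b21 : ω e2 e1 = ω e0 e3 := by rw [anti, b12, neg_neg]
  have b20 : ω e2 e0 = - ω e0 e3 := by rw [anti, b02]
  have b30 : ω e3 e0 = - ω e0 e3 := by rw [anti]
  have b10 : ω e1 e0 = - ω e0 e1 := by rw [anti]
  obtain ⟨h, h0, h1, h2, h3⟩ : ∃ h : Module.End F V, h e0 = e0 + e2 ∧ h e1 = e1 - e3 ∧ h e2 = e2 ∧ h e3 = e3 := by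
    have hc := B.constr_basis F ![e0 + e2, e1 - e3, e2, e3]
    rw [hB] at hc
    exact ⟨B.constr F ![e0 + e2, e1 - e3, e2, e3], by simpa using hc 0, by simpa using hc 1, by simpa using hc 2, by simpa using hc 3⟩
  refine ⟨h, ?_, ?_, ?_⟩
  · have : (ω.compl₁₂ h h) = ω := by
      apply ext4 <;> apply ext4 <;> simp only [LinearMap.compl₁₂_apply, h0, h1, h2, h3, map_add, map_sub, LinearMap.add_apply, LinearMap.sub_apply, alt, r13, r03, b12, b02, b32, b31, b21, b20, b30, b10] <;> ring
    intro u w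
    conv_rhs => rw [← this]
    rfl
  · have hU4' : U ^ 4 = 1 + N + N ^ 3 := by
      have c3 : U ^ 3 = 1 + N ^ 3 := by
        have := add_pow_char_of_commute (R := Module.End F V) (p := 3) (x := 1) (y := N) (Commute.one_left N)
        rw [hUN, this, one_pow]
      rw [pow_succ, c3, hUN, add_mul, one_mul, mul_add, mul_one, ← pow_succ, hU4, add_zero]
    rw [hU4', hUN]
    have t2 : ∀ w : V, w + w + w = 0 := by
      intro w
      have : (3 : F) • w = 0 := by rw [h30, zero_smul]
      rw [← this]; module
    apply ext4 <;> simp [h0, h1, h2, h3, pow_succ, ← he1, ← he2, ← he3, ne3]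
    · rw [← sub_eq_zero]
      have := t2 e3
      rw [← neg_eq_zero.2 this]; abel
  · intro g hg
    have hgN : Commute g N := by rw [hN]; exact hg.sub_right (Commute.one_right g)
    have hgn : ∀ w, g (N w) = N (g w) := fun w => congrArg (fun f => f w) hgN.eq
    have hr := B.sum_repr (g e0)
    rw [hB] at hr
    simp only [Fin.sum_univ_four, Matrix.cons_val] at hr
    generalize (B.repr (g e0)) 0 = c0 at hr
    generalize (B.repr (g e0)) 1 = c1 at hr
    generalize (B.repr (g e0)) 2 = c2 at hr
    generalize (B.repr (g e0)) 3 = c3 at hr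
    have g1 : g e1 = N (g e0) := by rw [he1, hgn]
    have g2 : g e2 = N (N (g e0)) := by rw [he2, hgn, g1]
    have g3 : g e3 = N (N (N (g e0))) := by rw [he3, hgn, g2]
    have hgg : g = algebraMap F (Module.End F V) c0 + N * (algebraMap F (Module.End F V) c1 + c2 • N + c3 • N ^ 2) := by
      apply ext4 <;> simp [g1, g2, g3, ← hr, pow_succ, Module.algebraMap_end_apply, ← he1, ← he2, ← he3, ne3, add_assoc]
    refine ⟨c0 ^ 9, ?_⟩
    have k0 : Commute N (algebraMap F (Module.End F V) c1) := (Algebra.commutes c1 N).symm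
    have k1 : Commute N (algebraMap F (Module.End F V) c1 + c2 • N + c3 • N ^ 2) :=
      (k0.add_right ((Commute.refl N).smul_right c2)).add_right (((Commute.refl N).pow_right 2).smul_right c3)
    have k2 := add_pow_char_pow_of_commute (R := Module.End F V) (p := 3) (n := 2) (x := algebraMap F (Module.End F V) c0) (y := N * (algebraMap F (Module.End F V) c1 + c2 • N + c3 • N ^ 2)) (Algebra.commutes c0 _)
    rw [← hgg, k1.mul_pow, show 3 ^ 2 = 4 + 5 by norm_num, pow_add N, hU4, zero_mul, zero_mul, add_zero, ← map_pow] at k2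
    exact k2

end CaseC

section CaseC2
variable {F : Type} [Field F] [DecidableEq F]

theorem caseC [Fintype (Matrix.symplecticGroup (Fin 2) F)] {p b m e e' s : ℕ} (E : Ex p b m e e' s) (hG : Fintype.card (Matrix.symplecticGroup (Fin 2) F) = p ^ b * m)
    (hpF : (p : F) = 0)
    {χ : Matrix.symplecticGroup (Fin 2) F → ℂ} (hχ : χ ∈ irr (Matrix.symplecticGroup (Fin 2) F))
    (g : Matrix.symplecticGroup (Fin 2) F) : χ (g ^ s) = χ g := by
  haveI : CharP F p := by
    obtain ⟨r, hr⟩ := CharP.exists F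
    have h1 : r ∣ p := (CharP.cast_eq_zero_iff F r p).1 hpF
    rcases (Nat.dvd_prime E.hp).1 h1 with h2 | h2
    · exact absurd h2 (CharP.char_ne_one F r)
    · rw [← h2]; exact hr
  have hg : g ^ (p ^ b * m) = 1 := by rw [← hG]; exact pow_card_eq_one
  obtain ⟨ω, alt, nd, hsp⟩ := sp_form F
  let φ : Matrix.symplecticGroup (Fin 2) F →* Module.End F (Fin 2 ⊕ Fin 2 → F) :=
    (Matrix.toLinAlgEquiv' : Matrix (Fin 2 ⊕ Fin 2) (Fin 2 ⊕ Fin 2) F ≃ₐ[F] _).toMonoidHom.comp (Matrix.symplecticGroup (Fin 2) F).subtype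
  have hφ : Function.Injective φ := by
    intro a c h
    exact Subtype.ext (Matrix.toLinAlgEquiv'.injective h)
  have hVd : Module.finrank F (Fin 2 ⊕ Fin 2 → F) = 4 := by simp
  obtain ⟨u, hu⟩ : ∃ u, u = g ^ e := ⟨_, rfl⟩
  have hub : u ^ (p ^ b) = 1 := by rw [hu]; exact E.pp_pow hg
  have hparts : u * g ^ e' = g := by rw [hu]; exact E.mul_parts hg
  obtain ⟨hn4, hnk⟩ := uni_nil E.hp hVd (U := φ u) (b := b) (by rw [← map_pow, hub, map_one])
  have triv : (φ u - 1) ^ p = 0 → χ (g ^ s) = χ g := by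
    intro h
    have h1 := hnk 1
    rw [pow_one, h, sub_eq_zero, ← map_pow, ← map_one φ] at h1
    have h2 := hφ h1
    rw [E.pow_s_eq hg]
    have := pow_modEq' h2 E.s_p
    rwa [pow_one, hu] at this
  by_cases h4 : 4 ≤ p
  · exact triv (pow_eq_zero_of_le h4 hn4)
  have hp3 : p = 3 := by
    have := E.hp.two_le
    have := E.hp2
    omega
  subst hp3
  by_cases h3 : (φ u - 1) ^ 3 = 0
  · exact triv h3
  obtain ⟨h, hω, hU, hs⟩ := uni3 hVd ω alt hn4 h3 ((hsp _).1 u.2)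
  obtain ⟨H, hH⟩ : ∃ H : Matrix.symplecticGroup (Fin 2) F, φ H = h := by
    have hm : ∀ v, (Matrix.toLinAlgEquiv'.symm h : Matrix (Fin 2 ⊕ Fin 2) (Fin 2 ⊕ Fin 2) F).mulVec v = h v := by
      intro v
      rw [← Matrix.toLinAlgEquiv'_apply, AlgEquiv.apply_symm_apply]
    refine ⟨⟨Matrix.toLinAlgEquiv'.symm h, (hsp _).2 ?_⟩, ?_⟩
    · intro v w; rw [hm, hm, hω]
    · show Matrix.toLinAlgEquiv' (Matrix.toLinAlgEquiv'.symm h) = h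
      exact AlgEquiv.apply_symm_apply _ _
  have hHu : H * u = u ^ 4 * H := by
    apply hφ
    rw [map_mul, map_mul, map_pow, hH, hU]
  have hb2 : 2 ≤ b := by
    by_contra hlt
    have hu3 : u ^ 3 = 1 := by
      have : b = 0 ∨ b = 1 := by omega
      rcases this with rfl | rfl
      · rw [pow_zero, pow_one] at hub; rw [hub, one_pow]
      · simpa using hub
    apply h3
    have h1 := hnk 1
    rw [pow_one, ← map_pow, hu3, map_one, sub_self] at h1
    exact h1.symm
  have h9 : (9 : ℕ) ∣ e' := dvd_trans (by rw [show 9 = 3 ^ 2 by norm_num]; exact pow_dvd_pow 3 hb2) E.he'0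
  have hu9 : u ^ 9 = 1 := by
    apply hφ
    have h1 := hnk 2
    rw [pow_eq_zero_of_le (show 4 ≤ 3 ^ 2 by norm_num) hn4, sub_eq_zero] at h1
    rw [map_pow, map_one]; simpa using h1
  have hz : Commute H (g ^ e') := by
    obtain ⟨k, hk⟩ := h9
    obtain ⟨c, hc⟩ := hs (φ g) (by
      show _ * _ = _ * _
      rw [← map_mul, ← map_mul, hu, ← pow_succ, ← pow_succ'])
    have : Commute H (g ^ 9) := by
      apply hφ
      rw [map_mul, map_mul, map_pow, hc]
      exact (Algebra.commutes c _).symm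
    rw [hk, pow_mul]
    exact this.pow_right k
  have c1 : ∀ n : ℕ, H * (u ^ n * g ^ e') * H⁻¹ = u ^ (4 * n) * g ^ e' := by
    intro n
    have k : H * u * H⁻¹ = u ^ 4 := by rw [hHu, mul_inv_cancel_right]
    have k2 : H * g ^ e' * H⁻¹ = g ^ e' := by rw [hz.eq, mul_inv_cancel_right]
    calc H * (u ^ n * g ^ e') * H⁻¹ = (H * u ^ n * H⁻¹) * (H * g ^ e' * H⁻¹) := by group
      _ = _ := by rw [← conj_pow, k, k2, pow_mul]
  have hc := irr_isChar hχ
  have d1 : χ (u ^ 4 * g ^ e') = χ g := by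
    rw [show 4 = 4 * 1 by norm_num, ← c1, hc.conj, pow_one, hparts]
  have d2 : χ (u ^ 16 * g ^ e') = χ g := by
    rw [show 16 = 4 * 4 by norm_num, ← c1, hc.conj, d1]
  rw [E.pow_s hg, ← hu]
  have hs3 : s % 3 = 1 := E.s_p
  have hs9 : s ≡ 1 [MOD 9] ∨ s ≡ 4 [MOD 9] ∨ s ≡ 16 [MOD 9] := by
    simp only [Nat.ModEq]; omega
  rcases hs9 with h' | h' | h'
  · rw [pow_modEq' hu9 h', pow_one, hparts]
  · rw [pow_modEq' hu9 h', d1]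
  · rw [pow_modEq' hu9 h', d2]

end CaseC2

theorem irr_of_simple {G : Type} [Group G] [Fintype G] (V : FDRep ℂ G) (hV : Simple V) : V.character ∈ irr G := by
  have hc : IsChar V.character := isChar_of_rep V.ρ
  haveI : Invertible (Fintype.card G : ℂ) := invertibleOfNonzero (by exact_mod_cast Fintype.card_ne_zero)
  haveI : Invertible (Nat.card G : ℂ) := invertibleOfNonzero (by exact_mod_cast Nat.card_pos.ne')
  refine irr_of_nsq hc ?_
  rw [← bil_eq_ip _ hc]
  have := FDRep.char_orthonormal V V
  rw [if_pos ⟨Iso.refl V⟩] at this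
  simpa [bil] using this

theorem stmt10_aux (F : Type) [Field F] [Fintype F] [DecidableEq F]
    (p : ℕ) (hp : p.Prime) (hodd : Odd p)
    (V : FDRep ℂ (Matrix.symplecticGroup (Fin 2) F)) (hV : Simple V) :
    Property13 V.character p := by
  classical
  haveI : Fintype (Matrix.symplecticGroup (Fin 2) F) := Fintype.ofFinite _
  have hp2 : p ≠ 2 := by rintro rfl; exact absurd hodd (by decide)
  have hχ := irr_of_simple V hV
  obtain ⟨b, m, hpm, hG⟩ := Nat.exists_eq_pow_mul_and_not_dvd (n := Fintype.card (Matrix.symplecticGroup (Fin 2) F)) Fintype.card_ne_zero p hp.ne_one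
  refine property13_of_main (irr_isChar hχ) hp hp2 hG hpm ?_
  intro s hs hpel' g
  obtain ⟨e, e', E⟩ := Ex.exists (b := b) hp hp2 hpm hs
  have hpel : ∀ t : Matrix.symplecticGroup (Fin 2) F, t ^ (p ^ b) = 1 → V.character (t ^ s) = V.character t := by
    intro t ht
    obtain ⟨j, -, hj⟩ := (Nat.dvd_prime_pow hp).1 (orderOf_dvd_of_pow_eq_one ht)
    exact hpel' t ⟨j, hj⟩
  by_cases hpF : (p : F) = 0
  · exact caseC E hG hpF hχ g
  by_cases h0 : ∀ Z : Matrix.SpecialLinearGroup (Fin 2) F, Z ^ p = 1 → Z = 1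
  · exact caseB E hG hpF h0 hχ hpel g
  push Not at h0
  obtain ⟨Z0, hZ, hne⟩ := h0
  refine caseA E hG hpF (Z0 := Z0) ?_ hne hχ hpel g
  rcases Nat.eq_zero_or_pos b with rfl | hb
  · exfalso
    have h1 : (spD F (Z0, 1)) ^ p = 1 := by
      rw [← map_pow, Prod.pow_mk, hZ, one_pow]; exact map_one _
    have h2 : orderOf (spD F (Z0, 1)) ∣ m := by
      have := orderOf_dvd_card (x := spD F (Z0, 1))
      rwa [hG, pow_zero, one_mul] at this
    have h3 := Nat.dvd_gcd (orderOf_dvd_of_pow_eq_one h1) h2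
    rw [((Nat.Prime.coprime_iff_not_dvd hp).2 hpm).gcd_eq_one, Nat.dvd_one, orderOf_eq_one_iff] at h3
    have h4 := sp_data.Dinj (h3.trans (map_one (spD F)).symm)
    exact hne (congrArg Prod.fst h4)
  · obtain ⟨k, rfl⟩ : ∃ k, b = k + 1 := ⟨b - 1, by omega⟩
    rw [pow_succ', pow_mul, hZ, one_pow]

/-- Property 1.3 holds for the symplectic group `Sp₄(F_q)` (`q ≥ 3` a prime
power), every odd prime `p` and every irreducible character of degree not divisible by `p`.
Here `Sp₄(F_q)` is realised as the group of `4 × 4` matrices (indexed by `Fin 2 ⊕ Fin 2`)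
preserving the standard nondegenerate alternating form `J`. -/
theorem stmt10 (F : Type) [Field F] [Fintype F] [DecidableEq F]
    (q : ℕ) (hq : Fintype.card F = q) (hq3 : 3 ≤ q)
    (p : ℕ) (hp : p.Prime) (hodd : Odd p)
    (V : FDRep ℂ (Matrix.symplecticGroup (Fin 2) F)) (hV : Simple V)
    (hdeg : ¬ p ∣ Module.finrank ℂ V) :
    Property13 V.character p := by
  exact stmt10_aux F p hp hodd V hV
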